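/- For every ε > 0 there is a constant C_ε such that for all X ≥ 1 and each choice of sign ±, one has |N_3^±(X) − C^±·X/(12·ζ(3))| ≤ C_ε·X^{7/8+ε}, where C^+ = 1 and C^- = 3. -/

import Mathlib

/-- A cubic field: a number field of degree 3 over `ℚ`. -/
structure CubicField where
  carrier : Type
  [field : Field carrier]
  [nf : NumberField carrier]
  deg : Module.finrank ℚ carrier = 3

attribute [instance] CubicField.field CubicField.nf

/-- Two cubic fields are identified if they are isomorphic. -/
instance CubicField.setoid : Setoid CubicField where
  r A B := Nonempty (A.carrier ≃+* B.carrier)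
  iseqv := ⟨fun _ => ⟨RingEquiv.refl _⟩, fun ⟨e⟩ => ⟨e.symm⟩, fun ⟨e⟩ ⟨f⟩ => ⟨e.trans f⟩⟩

/-- The number of isomorphism classes of cubic fields whose discriminant satisfies `P`. -/
noncomputable def countCubic (P : ℤ → Prop) : ℕ :=
  Nat.card {C : Quotient CubicField.setoid //
    ∃ K : CubicField, ⟦K⟧ = C ∧ P (NumberField.discr K.carrier)}

/-- An integral binary cubic form `a x³ + b x² y + c x y² + d y³`. -/
@[ext] structure BCF where
  a : ℤ
  b : ℤ
  c : ℤ
  d : ℤ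

/-- The discriminant of the binary cubic form with the given coefficients. -/
def cubicDisc {R : Type*} [CommRing R] (a b c d : R) : R :=
  b ^ 2 * c ^ 2 - 4 * a * c ^ 3 - 4 * b ^ 3 * d - 27 * a ^ 2 * d ^ 2 + 18 * a * b * c * d

namespace BCF

/-- The value of a form at an integral point. -/
def eval (f : BCF) (x y : ℤ) : ℤ := f.a * x ^ 3 + f.b * x ^ 2 * y + f.c * x * y ^ 2 + f.d * y ^ 3

/-- The partial derivative in the first variable. -/
def dx (f : BCF) (x y : ℤ) : ℤ := 3 * f.a * x ^ 2 + 2 * f.b * x * y + f.c * y ^ 2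

/-- The partial derivative in the second variable. -/
def dy (f : BCF) (x y : ℤ) : ℤ := f.b * x ^ 2 + 2 * f.c * x * y + 3 * f.d * y ^ 2

/-- The discriminant. -/
def disc (f : BCF) : ℤ := cubicDisc f.a f.b f.c f.d

/-- The form `f (p x + q y, r x + s y)`. -/
def comp (f : BCF) (p q r s : ℤ) : BCF where
  a := f.a * p ^ 3 + f.b * p ^ 2 * r + f.c * p * r ^ 2 + f.d * r ^ 3
  b := 3 * f.a * p ^ 2 * q + f.b * (p ^ 2 * s + 2 * p * q * r) + f.c * (2 * p * r * s + q * r ^ 2)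
    + 3 * f.d * r ^ 2 * s
  c := 3 * f.a * p * q ^ 2 + f.b * (2 * p * q * s + q ^ 2 * r) + f.c * (p * s ^ 2 + 2 * q * r * s)
    + 3 * f.d * r * s ^ 2
  d := f.a * q ^ 3 + f.b * q ^ 2 * s + f.c * q * s ^ 2 + f.d * s ^ 3

/-- The multiple of a form by an integer. -/
def smul (n : ℤ) (f : BCF) : BCF := ⟨n * f.a, n * f.b, n * f.c, n * f.d⟩

theorem eval_comp (f : BCF) (p q r s x y : ℤ) :
    (f.comp p q r s).eval x y = f.eval (p * x + q * y) (r * x + s * y) := by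
  simp only [eval, comp]; ring

theorem dx_comp (f : BCF) (p q r s x y : ℤ) :
    (f.comp p q r s).dx x y = p * f.dx (p * x + q * y) (r * x + s * y)
      + r * f.dy (p * x + q * y) (r * x + s * y) := by
  simp only [dx, dy, comp]; ring

theorem dy_comp (f : BCF) (p q r s x y : ℤ) :
    (f.comp p q r s).dy x y = q * f.dx (p * x + q * y) (r * x + s * y)
      + s * f.dy (p * x + q * y) (r * x + s * y) := by
  simp only [dx, dy, comp]; ring

theorem comp_comp (f : BCF) (p q r s p' q' r' s' : ℤ) :
    (f.comp p q r s).comp p' q' r' s' =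
      f.comp (p * p' + q * r') (p * q' + q * s') (r * p' + s * r') (r * q' + s * s') := by
  ext <;> simp only [comp] <;> ring

theorem comp_one (f : BCF) : f.comp 1 0 0 1 = f := by
  ext <;> simp [comp]

theorem disc_comp (f : BCF) (p q r s : ℤ) :
    (f.comp p q r s).disc = (p * s - q * r) ^ 6 * f.disc := by
  simp only [disc, cubicDisc, comp]; ring

theorem disc_smul (n : ℤ) (f : BCF) : (smul n f).disc = n ^ 4 * f.disc := by
  simp only [disc, cubicDisc, smul]; ring

theorem smul_comp (n : ℤ) (f : BCF) (p q r s : ℤ) :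
    (smul n f).comp p q r s = smul n (f.comp p q r s) := by
  ext <;> simp only [comp, smul] <;> ring

theorem eval_smul (n : ℤ) (f : BCF) (x y : ℤ) : (smul n f).eval x y = n * f.eval x y := by
  simp only [eval, smul]; ring

/-- `GL₂(ℤ)`-equivalence of forms. -/
def Equiv (f g : BCF) : Prop := ∃ p q r s : ℤ, (p * s - q * r) ^ 2 = 1 ∧ g = f.comp p q r s

theorem Equiv.refl (f : BCF) : f.Equiv f := ⟨1, 0, 0, 1, by norm_num, (comp_one f).symm⟩

theorem Equiv.trans {f g h : BCF} : f.Equiv g → g.Equiv h → f.Equiv h := by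
  rintro ⟨p, q, r, s, h1, rfl⟩ ⟨p', q', r', s', h2, rfl⟩
  refine ⟨_, _, _, _, ?_, comp_comp ..⟩
  have : (p * p' + q * r') * (r * q' + s * s') - (p * q' + q * s') * (r * p' + s * r')
    = (p * s - q * r) * (p' * s' - q' * r') := by ring
  rw [this, mul_pow, h1, h2, one_mul]

theorem Equiv.symm {f g : BCF} : f.Equiv g → g.Equiv f := by
  rintro ⟨p, q, r, s, h1, rfl⟩
  set e := p * s - q * r with he
  refine ⟨e * s, - e * q, - e * r, e * p, ?_, ?_⟩
  · have : e * s * (e * p) - -e * q * (-e * r) = e ^ 2 * e := by rw [he]; ring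
    rw [this, h1, one_mul, h1]
  · rw [comp_comp]
    have e1 : p * (e * s) + q * (-e * r) = 1 := by linear_combination h1 + e * he
    have e2 : p * (-e * q) + q * (e * p) = 0 := by ring
    have e3 : r * (e * s) + s * (-e * r) = 0 := by ring
    have e4 : r * (-e * q) + s * (e * p) = 1 := by linear_combination h1 + e * he
    rw [e1, e2, e3, e4, comp_one]

theorem Equiv.disc_eq {f g : BCF} : f.Equiv g → g.disc = f.disc := by
  rintro ⟨p, q, r, s, h1, rfl⟩
  rw [disc_comp]
  have : (p * s - q * r) ^ 6 = ((p * s - q * r) ^ 2) ^ 3 := by ring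
  rw [this, h1]; ring

/-- Irreducibility over `ℚ`, in the form: no nontrivial integral zero. -/
def Irr (f : BCF) : Prop := ∀ x y : ℤ, f.eval x y = 0 → x = 0 ∧ y = 0

theorem irr_comp {f : BCF} (hf : f.Irr) {p q r s : ℤ} (h : p * s - q * r ≠ 0) :
    (f.comp p q r s).Irr := by
  intro x y hxy
  rw [eval_comp] at hxy
  obtain ⟨h1, h2⟩ := hf _ _ hxy
  have e1 : (p * s - q * r) * x = 0 := by linear_combination s * h1 - q * h2
  have e2 : (p * s - q * r) * y = 0 := by linear_combination p * h2 - r * h1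
  exact ⟨(mul_eq_zero.mp e1).resolve_left h, (mul_eq_zero.mp e2).resolve_left h⟩

theorem ne_zero_of_sq_eq_one {e : ℤ} (h : e ^ 2 = 1) : e ≠ 0 := by rintro rfl; norm_num at h

theorem Equiv.irr {f g : BCF} (h : f.Equiv g) (hf : f.Irr) : g.Irr := by
  obtain ⟨p, q, r, s, h1, rfl⟩ := h
  exact irr_comp hf (ne_zero_of_sq_eq_one h1)

theorem irr_of_smul {n : ℤ} {f : BCF} (h : (smul n f).Irr) : f.Irr := by
  intro x y hxy
  exact h x y (by rw [eval_smul, hxy, mul_zero])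

theorem Irr.a_ne {f : BCF} (h : f.Irr) : f.a ≠ 0 := by
  intro ha
  have := h 1 0 (by simp [eval, ha])
  simp at this

theorem Irr.d_ne {f : BCF} (h : f.Irr) : f.d ≠ 0 := by
  intro ha
  have := h 0 1 (by simp [eval, ha])
  simp at this

/-- The form is a multiple of `p`. -/
def DvdAll (p : ℤ) (f : BCF) : Prop := p ∣ f.a ∧ p ∣ f.b ∧ p ∣ f.c ∧ p ∣ f.d

/-- The form has a double root modulo `p` at `(x : y)` witnessing non-maximality at `p`. -/
def BadAt (p : ℤ) (f : BCF) (x y : ℤ) : Prop :=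
  ¬ (p ∣ x ∧ p ∣ y) ∧ p ^ 2 ∣ f.eval x y ∧ p ∣ f.dx x y ∧ p ∣ f.dy x y

/-- The cubic ring attached to `f` is not maximal at `p`. -/
def NonMax (p : ℕ) (f : BCF) : Prop := DvdAll p f ∨ ∃ x y : ℤ, BadAt p f x y

theorem DvdAll.comp {p : ℤ} {f : BCF} (h : DvdAll p f) (x y z w : ℤ) :
    DvdAll p (f.comp x y z w) := by
  obtain ⟨⟨a, ha⟩, ⟨b, hb⟩, ⟨c, hc⟩, ⟨d, hd⟩⟩ := h
  refine ⟨?_, ?_, ?_, ?_⟩ <;> simp only [BCF.comp, ha, hb, hc, hd]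
  · exact ⟨a * x ^ 3 + b * x ^ 2 * z + c * x * z ^ 2 + d * z ^ 3, by ring⟩
  · exact ⟨3 * a * x ^ 2 * y + b * (x ^ 2 * w + 2 * x * y * z) + c * (2 * x * z * w + y * z ^ 2)
      + 3 * d * z ^ 2 * w, by ring⟩
  · exact ⟨3 * a * x * y ^ 2 + b * (2 * x * y * w + y ^ 2 * z) + c * (x * w ^ 2 + 2 * y * z * w)
      + 3 * d * z * w ^ 2, by ring⟩
  · exact ⟨a * y ^ 3 + b * y ^ 2 * w + c * y * w ^ 2 + d * w ^ 3, by ring⟩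

theorem badAt_of_comp {p : ℤ} {f : BCF} {x y z w u v e : ℤ}
    (hdet : (p) ∣ e * (x * w - y * z) - 1)
    (h : BadAt p (f.comp x y z w) u v) : BadAt p f (x * u + y * v) (z * u + w * v) := by
  obtain ⟨h0, h1, h2, h3⟩ := h
  rw [eval_comp] at h1
  rw [dx_comp] at h2
  rw [dy_comp] at h3
  set U := x * u + y * v with hU
  set V := z * u + w * v with hV
  obtain ⟨k, hk⟩ := hdet
  refine ⟨?_, h1, ?_, ?_⟩
  · rintro ⟨⟨i, hi⟩, ⟨j, hj⟩⟩
    refine h0 ⟨⟨e * (w * i - y * j) - k * u, ?_⟩, ⟨e * (x * j - z * i) - k * v, ?_⟩⟩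
    · linear_combination e * w * hi - e * y * hj - e * w * hU + e * y * hV - u * hk
    · linear_combination e * x * hj - e * z * hi - e * x * hV + e * z * hU - v * hk
  · obtain ⟨i, hi⟩ := h2
    obtain ⟨j, hj⟩ := h3
    exact ⟨e * (w * i - z * j) - k * f.dx U V, by
      linear_combination e * w * hi - e * z * hj - (f.dx U V) * hk⟩
  · obtain ⟨i, hi⟩ := h2
    obtain ⟨j, hj⟩ := h3
    exact ⟨e * (x * j - y * i) - k * f.dy U V, by
      linear_combination e * x * hj - e * y * hi - (f.dy U V) * hk⟩

/-- Non-maximality at `p` passes to `f` from any transform of determinant prime to `p`. -/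
theorem nonMax_of_comp {p : ℕ} {f : BCF} {x y z w e : ℤ}
    (hdet : (p : ℤ) ∣ e * (x * w - y * z) - 1) (h : NonMax p (f.comp x y z w)) : NonMax p f := by
  rcases h with h | ⟨u, v, h⟩
  · left
    have := DvdAll.comp h (e * w) (- e * y) (- e * z) (e * x)
    rw [comp_comp] at this
    set E := e * (x * w - y * z) with hE
    have e1 : x * (e * w) + y * (-e * z) = E := by rw [hE]; ring
    have e2 : x * (-e * y) + y * (e * x) = 0 := by ring
    have e3 : z * (e * w) + w * (-e * z) = 0 := by ring
    have e4 : z * (-e * y) + w * (e * x) = E := by rw [hE]; ring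
    rw [e1, e2, e3, e4] at this
    obtain ⟨h1, h2, h3, h4⟩ := this
    have hmod : E ^ 3 ≡ 1 [ZMOD p] := by
      have : E ≡ 1 [ZMOD p] := (Int.modEq_iff_dvd.mpr hdet).symm
      simpa using this.pow 3
    have key : ∀ t : ℤ, (p : ℤ) ∣ t * E ^ 3 → (p : ℤ) ∣ t := by
      intro t ht
      have := (hmod.mul_left t).dvd
      have h5 := dvd_add this ht
      simpa using h5
    refine ⟨key _ ?_, key _ ?_, key _ ?_, key _ ?_⟩
    · simpa [BCF.comp] using h1
    · convert h2 using 1; simp only [BCF.comp]; ring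
    · convert h3 using 1; simp only [BCF.comp]; ring
    · convert h4 using 1; simp only [BCF.comp]; ring
  · exact Or.inr ⟨_, _, badAt_of_comp hdet h⟩

theorem Equiv.nonMax {p : ℕ} {f g : BCF} (h : f.Equiv g) (hg : NonMax p g) : NonMax p f := by
  obtain ⟨x, y, z, w, h1, rfl⟩ := h
  refine nonMax_of_comp (e := x * w - y * z) ?_ hg
  rw [← sq, h1]; simp

theorem nonMax_of_smul {p : ℕ} {f : BCF} {n : ℤ} (hn : IsCoprime (p : ℤ) n)
    (h : NonMax p (smul n f)) : NonMax p f := by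
  rcases h with ⟨h1, h2, h3, h4⟩ | ⟨x, y, h0, h1, h2, h3⟩
  · exact Or.inl ⟨hn.dvd_of_dvd_mul_left h1, hn.dvd_of_dvd_mul_left h2,
      hn.dvd_of_dvd_mul_left h3, hn.dvd_of_dvd_mul_left h4⟩
  · refine Or.inr ⟨x, y, h0, ?_, ?_, ?_⟩
    · rw [eval_smul] at h1
      exact (hn.pow_left).dvd_of_dvd_mul_left h1
    · have : (smul n f).dx x y = n * f.dx x y := by simp only [dx, smul]; ring
      exact hn.dvd_of_dvd_mul_left (this ▸ h2)
    · have : (smul n f).dy x y = n * f.dy x y := by simp only [dy, smul]; ring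
      exact hn.dvd_of_dvd_mul_left (this ▸ h3)

end BCF

open Polynomial in
/-- An element of a cubic field that satisfies a nontrivial quadratic equation is rational. -/
theorem rational_of_quadratic {K : Type*} [Field K] [NumberField K]
    (hK : Module.finrank ℚ K = 3) {z : K} {u v w : ℚ} (h : (u : K) + v * z + w * z ^ 2 = 0)
    (hne : ¬ (u = 0 ∧ v = 0 ∧ w = 0)) : ∃ r : ℚ, z = r := by
  have hdvd := minpoly.degree_dvd (K := ℚ) (x := z) (Algebra.IsIntegral.isIntegral z)
  rw [hK] at hdvd
  have hP : (C u + C v * X + C w * X ^ 2 : ℚ[X]) ≠ 0 := by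
    intro h0
    apply hne
    have h1 := congrArg (fun P => coeff P 0) h0
    have h2 := congrArg (fun P => coeff P 1) h0
    have h3 := congrArg (fun P => coeff P 2) h0
    simp [coeff_X, coeff_C] at h1 h2 h3
    exact ⟨h1, h2, h3⟩
  have hdeg : (minpoly ℚ z).natDegree ≤ 2 := by
    have h1 := minpoly.degree_le_of_ne_zero ℚ z hP (by simpa using h)
    have h2 : (C u + C v * X + C w * X ^ 2 : ℚ[X]).degree ≤ 2 := by compute_degree
    exact natDegree_le_of_degree_le (h1.trans h2)
  have h1 : (minpoly ℚ z).natDegree = 1 := by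
    rcases (Nat.dvd_prime Nat.prime_three).mp hdvd with h | h
    · exact h
    · omega
  obtain ⟨r, hr⟩ := minpoly.natDegree_eq_one_iff.mp h1
  exact ⟨r, by rw [← hr]; simp⟩

theorem exists_integral_irrational {K : Type*} [Field K] [NumberField K]
    (hK : Module.finrank ℚ K = 3) : ∃ z : K, IsIntegral ℤ z ∧ ¬ ∃ r : ℚ, z = r := by
  by_contra! hcon
  have hall : ∀ z : K, ∃ r : ℚ, z = r := by
    intro z
    have halg : IsAlgebraic ℤ z :=
      (IsFractionRing.isAlgebraic_iff ℤ ℚ K).mpr (Algebra.IsAlgebraic.isAlgebraic z)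
    obtain ⟨y, hy0, hy⟩ := halg.exists_integral_multiple
    obtain ⟨r, hr⟩ := hcon _ hy
    refine ⟨r / y, ?_⟩
    have : (y : K) ≠ 0 := by exact_mod_cast hy0
    push_cast
    rw [← hr]
    field_simp
    simp [mul_comm]
  have hle : Module.finrank ℚ K ≤ 1 := by
    apply finrank_le_one (1 : K)
    intro z
    obtain ⟨r, hr⟩ := hall z
    exact ⟨r, by rw [hr, Algebra.smul_def]; simp⟩
  omega

namespace BCF

variable {K : Type*} [Field K]

/-- `θ` is a root of `f(x, 1)`. -/
def Root (f : BCF) (θ : K) : Prop := f.a * θ ^ 3 + f.b * θ ^ 2 + f.c * θ + f.d = 0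

/-- The lattice `ℤ + ℤ a θ + ℤ (a θ² + b θ + c)`. -/
def InLattice (f : BCF) (θ z : K) : Prop :=
  ∃ l m n : ℤ, z = l + m * (f.a * θ) + n * (f.a * θ ^ 2 + f.b * θ + f.c)

/-- The ring of integers of `K` is the cubic ring attached to `f`. -/
def RepBy (f : BCF) (K : Type*) [Field K] : Prop :=
  ∃ θ : K, f.a ≠ 0 ∧ f.Root θ ∧ ∀ z : K, IsIntegral ℤ z ↔ f.InLattice θ z

theorem RepBy.congr {f : BCF} {K L : Type*} [Field K] [Field L] (e : K ≃+* L) (h : f.RepBy K) :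
    f.RepBy L := by
  obtain ⟨θ, h0, h1, h2⟩ := h
  refine ⟨e θ, h0, ?_, ?_⟩
  · have := congrArg e h1
    simpa [Root] using this
  · intro z
    have hi : IsIntegral ℤ z ↔ IsIntegral ℤ (e.symm z) :=
      (isIntegral_algEquiv (A := L) (B := K) e.symm.toIntAlgEquiv).symm
    rw [hi, h2]
    constructor
    · rintro ⟨l, m, n, h⟩
      refine ⟨l, m, n, ?_⟩
      have := congrArg e h
      simpa using this
    · rintro ⟨l, m, n, h⟩
      refine ⟨l, m, n, ?_⟩
      rw [h]
      simp

theorem isIntegral_omega {f : BCF} {θ : K} (h : f.Root θ) : IsIntegral ℤ ((f.a : K) * θ) := by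
  refine ⟨Polynomial.X ^ 3 + (Polynomial.C f.b * Polynomial.X ^ 2
    + Polynomial.C (f.a * f.c) * Polynomial.X + Polynomial.C (f.a ^ 2 * f.d)), ?_, ?_⟩
  · exact Polynomial.monic_X_pow_add (n := 3) (by compute_degree!)
  · simp only [Polynomial.eval₂_add, Polynomial.eval₂_mul, Polynomial.eval₂_pow,
      Polynomial.eval₂_X, Polynomial.eval₂_C]
    unfold Root at h
    simp
    linear_combination (f.a : K) ^ 2 * h

theorem isIntegral_eta {f : BCF} {θ : K} (h : f.Root θ) :
    IsIntegral ℤ ((f.a : K) * θ ^ 2 + f.b * θ + f.c) := by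
  refine ⟨Polynomial.X ^ 3 + (Polynomial.C (-f.c) * Polynomial.X ^ 2
    + Polynomial.C (f.b * f.d) * Polynomial.X + Polynomial.C (-(f.a * f.d ^ 2))), ?_, ?_⟩
  · exact Polynomial.monic_X_pow_add (n := 3) (by compute_degree!)
  · simp only [Polynomial.eval₂_add, Polynomial.eval₂_mul, Polynomial.eval₂_pow,
      Polynomial.eval₂_X, Polynomial.eval₂_C]
    unfold Root at h
    simp
    linear_combination ((f.a : K) ^ 2 * θ ^ 3 + 2 * f.a * f.b * θ ^ 2 + f.a * f.c * θ
      + f.b ^ 2 * θ + f.b * f.c - f.a * f.d) * h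

theorem isIntegral_of_inLattice {f : BCF} {θ z : K} (h : f.Root θ) (hz : f.InLattice θ z) :
    IsIntegral ℤ z := by
  obtain ⟨l, m, n, rfl⟩ := hz
  have hi : ∀ k : ℤ, IsIntegral ℤ (k : K) := fun k => by
    simpa using isIntegral_algebraMap (R := ℤ) (A := K) (x := k)
  exact ((hi l).add ((hi m).mul (isIntegral_omega h))).add ((hi n).mul (isIntegral_eta h))

theorem root_comp {f : BCF} {θ : K} (h : f.Root θ) {p q r s : ℤ} (hne : (p : K) - r * θ ≠ 0) :
    (f.comp p q r s).Root ((s * θ - q) / (p - r * θ)) := by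
  unfold Root at *
  simp only [comp]
  push_cast
  field_simp
  linear_combination ((p : K) * s - q * r) ^ 3 * h

section Cubic

variable [NumberField K]

/-- For irrational `θ` the three generators of the lattice are independent. -/
theorem lattice_indep (hK : Module.finrank ℚ K = 3) {f : BCF} {θ : K} (ha : f.a ≠ 0)
    (hθ : ¬ ∃ r : ℚ, θ = r) {l m n : ℚ}
    (h : (l : K) + m * (f.a * θ) + n * (f.a * θ ^ 2 + f.b * θ + f.c) = 0) :
    l = 0 ∧ m = 0 ∧ n = 0 := by
  by_contra hne
  apply hθ
  apply rational_of_quadratic hK (u := l + n * f.c) (v := m * f.a + n * f.b) (w := n * f.a)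
  · push_cast
    linear_combination h
  · rintro ⟨h1, h2, h3⟩
    have ha' : (f.a : ℚ) ≠ 0 := by exact_mod_cast ha
    have hn : n = 0 := (mul_eq_zero.mp h3).resolve_right ha'
    subst hn
    simp [ha'] at h1 h2
    exact hne ⟨h1, h2, rfl⟩

theorem lattice_indep_int (hK : Module.finrank ℚ K = 3) {f : BCF} {θ : K} (ha : f.a ≠ 0)
    (hθ : ¬ ∃ r : ℚ, θ = r)
    {l m n l' m' n' : ℤ}
    (h : (l : K) + m * (f.a * θ) + n * (f.a * θ ^ 2 + f.b * θ + f.c)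
      = l' + m' * (f.a * θ) + n' * (f.a * θ ^ 2 + f.b * θ + f.c)) :
    l = l' ∧ m = m' ∧ n = n' := by
  have := lattice_indep hK ha hθ (l := l - l') (m := m - m') (n := n - n') (by
    push_cast; linear_combination h)
  simpa [sub_eq_zero] using this

theorem irrational_of_lattice (hK : Module.finrank ℚ K = 3) {f : BCF} {θ : K}
    (h : ∀ z : K, IsIntegral ℤ z ↔ f.InLattice θ z) : ¬ ∃ r : ℚ, θ = r := by
  rintro ⟨r, rfl⟩
  obtain ⟨z, hz, hz'⟩ := exists_integral_irrational hK
  obtain ⟨l, m, n, rfl⟩ := (h z).mp hz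
  exact hz' ⟨l + m * (f.a * r) + n * (f.a * r ^ 2 + f.b * r + f.c), by push_cast; ring⟩

theorem RepBy.comp (hK : Module.finrank ℚ K = 3) {f : BCF} (h : f.RepBy K) {p q r s : ℤ}
    (h1 : (p * s - q * r) ^ 2 = 1) :
    (f.comp p q r s).RepBy K := by
  obtain ⟨θ, h0, hr, h2⟩ := h
  have hθ := irrational_of_lattice hK h2
  have hdet := ne_zero_of_sq_eq_one h1
  have hne : ∀ x y : ℤ, ¬ (x = 0 ∧ y = 0) → (x : K) - y * θ ≠ 0 := by
    intro x y hxy h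
    by_cases hy : y = 0
    · subst hy
      simp at h
      exact hxy ⟨h, rfl⟩
    · apply hθ
      refine ⟨x / y, ?_⟩
      have : (y : K) ≠ 0 := by exact_mod_cast hy
      push_cast
      field_simp
      linear_combination -h
  have hpr : (p : K) - r * θ ≠ 0 := hne p r (by rintro ⟨rfl, rfl⟩; simp at hdet)
  have hqs : (q : K) - s * θ ≠ 0 := hne q s (by rintro ⟨rfl, rfl⟩; simp at hdet)
  have hω : ((f.comp p q r s).a : K) * ((s * θ - q) / (p - r * θ)) =
      -(s * (p * r * f.c + r ^ 2 * f.d) + q * (f.a * p ^ 2 + f.b * p * r))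
      + (p * s - q * r) * (p * (f.a * θ) + r * (f.a * θ ^ 2 + f.b * θ + f.c)) := by
    unfold Root at hr
    simp only [BCF.comp]
    push_cast
    field_simp
    linear_combination ((p * r ^ 2 * s : K) - q * r ^ 3) * hr
  have hη : ((f.comp p q r s).a : K) * ((s * θ - q) / (p - r * θ)) ^ 2
      + (f.comp p q r s).b * ((s * θ - q) / (p - r * θ)) + (f.comp p q r s).c =
      (p * (f.a * q ^ 2 + f.b * q * s) + r * (q * s * f.c + s ^ 2 * f.d))
      + (p * s - q * r) * (q * (f.a * θ) + s * (f.a * θ ^ 2 + f.b * θ + f.c)) := by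
    unfold Root at hr
    simp only [BCF.comp]
    push_cast
    field_simp
    linear_combination ((r : K) * (p * s - q * r) * ((p * s - q * r) + s * (p - r * θ))) * hr
  have hdetK : ((p : K) * s - q * r) ^ 2 = 1 := by exact_mod_cast congrArg (Int.cast (R := K)) h1
  refine ⟨(s * θ - q) / (p - r * θ), ?_, root_comp hr hpr, ?_⟩
  · intro ha
    have hq : (s : K) * θ - q ≠ 0 := by
      intro h; exact hqs (by linear_combination -h)
    rw [ha] at hω
    have := lattice_indep_int hK h0 hθ (l := 0) (m := 0) (n := 0)
      (l' := -(s * (p * r * f.c + r ^ 2 * f.d) + q * (f.a * p ^ 2 + f.b * p * r)))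
      (m' := (p * s - q * r) * p) (n' := (p * s - q * r) * r) (by
        push_cast
        push_cast at hω
        linear_combination hω)
    obtain ⟨-, hp, hr'⟩ := this
    have hp' := (mul_eq_zero.mp hp.symm).resolve_left hdet
    have hr'' := (mul_eq_zero.mp hr'.symm).resolve_left hdet
    exact hdet (by rw [hp', hr'']; ring)
  · intro z
    rw [h2]
    constructor
    · rintro ⟨l, m, n, rfl⟩
      refine ⟨l - (s * m - q * n) *
          (-(s * (p * r * f.c + r ^ 2 * f.d) + q * (f.a * p ^ 2 + f.b * p * r)))
        - (p * n - r * m) * (p * (f.a * q ^ 2 + f.b * q * s) + r * (q * s * f.c + s ^ 2 * f.d)),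
        s * m - q * n, p * n - r * m, ?_⟩
      rw [hω, hη]
      push_cast
      linear_combination (-((m : K) * (f.a * θ) + n * (f.a * θ ^ 2 + f.b * θ + f.c))) * hdetK
    · rintro ⟨l, m, n, rfl⟩
      rw [hω, hη]
      refine ⟨l + m * (-(s * (p * r * f.c + r ^ 2 * f.d) + q * (f.a * p ^ 2 + f.b * p * r)))
        + n * (p * (f.a * q ^ 2 + f.b * q * s) + r * (q * s * f.c + s ^ 2 * f.d)),
        (p * s - q * r) * (m * p + n * q), (p * s - q * r) * (m * r + n * s), ?_⟩
      push_cast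
      ring

end Cubic

end BCF

namespace BCF

variable {K : Type*} [Field K]

theorem Root.sq {f : BCF} {θ : K} (h : f.Root θ) (x y : ℤ) :
    ((x : K) * (f.a * θ) + y * (f.a * θ ^ 2 + f.b * θ + f.c)) ^ 2 =
      ((-(f.a * f.c) * x ^ 2 - 2 * f.a * f.d * x * y - f.b * f.d * y ^ 2 : ℤ) : K)
      + ((-f.b * x ^ 2 - f.d * y ^ 2 : ℤ) : K) * (f.a * θ)
      + ((f.a * x ^ 2 + f.c * y ^ 2 : ℤ) : K) * (f.a * θ ^ 2 + f.b * θ + f.c) := by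
  unfold Root at h
  push_cast
  linear_combination (2 * f.a * x * y + (f.a * θ + f.b) * y ^ 2 : K) * h

variable [NumberField K]

theorem index_form (hK : Module.finrank ℚ K = 3) {f : BCF} {θ : K} (ha : f.a ≠ 0)
    (hθ : ¬ ∃ r : ℚ, θ = r) (h : f.Root θ)
    {l x y l' x' y' : ℤ}
    (hsq : ((l : K) + x * (f.a * θ) + y * (f.a * θ ^ 2 + f.b * θ + f.c)) ^ 2 =
      l' + x' * (f.a * θ) + y' * (f.a * θ ^ 2 + f.b * θ + f.c)) :
    x * y' - y * x' = f.eval x y := by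
  have hs := h.sq x y
  obtain ⟨-, h1, h2⟩ := lattice_indep_int hK ha hθ
    (l := l ^ 2 + (-(f.a * f.c) * x ^ 2 - 2 * f.a * f.d * x * y - f.b * f.d * y ^ 2))
    (m := 2 * l * x + (-f.b * x ^ 2 - f.d * y ^ 2))
    (n := 2 * l * y + (f.a * x ^ 2 + f.c * y ^ 2)) (l' := l') (m' := x') (n' := y') (by
      push_cast
      push_cast at hs
      linear_combination hsq - hs)
  rw [← h1, ← h2]
  simp only [eval]
  ring

/-- Two forms with the same ring of integers are equivalent. -/
theorem RepBy.equiv (hK : Module.finrank ℚ K = 3) {f g : BCF} (hf : f.RepBy K) (hg : g.RepBy K) :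
    f.Equiv g := by
  obtain ⟨θ, ha, hr, hl⟩ := hf
  obtain ⟨φ, ha', hr', hl'⟩ := hg
  have hθ := irrational_of_lattice hK hl
  have hφ := irrational_of_lattice hK hl'
  obtain ⟨l1, p, r, e1⟩ := (hl _).mp (isIntegral_omega hr')
  obtain ⟨l2, q, s, e2⟩ := (hl _).mp (isIntegral_eta hr')
  obtain ⟨l3, p', r', e3⟩ := (hl' _).mp (isIntegral_omega hr)
  obtain ⟨l4, q', s', e4⟩ := (hl' _).mp (isIntegral_eta hr)
  obtain ⟨-, i1, i2⟩ := lattice_indep_int hK ha hθ (l := 0) (m := 1) (n := 0)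
    (l' := l3 + p' * l1 + r' * l2) (m' := p * p' + q * r') (n' := r * p' + s * r') (by
      push_cast; linear_combination e3 + (p' : K) * e1 + (r' : K) * e2)
  obtain ⟨-, i3, i4⟩ := lattice_indep_int hK ha hθ (l := 0) (m := 0) (n := 1)
    (l' := l4 + q' * l1 + s' * l2) (m' := p * q' + q * s') (n' := r * q' + s * s') (by
      push_cast; linear_combination e4 + (q' : K) * e1 + (s' : K) * e2)
  have hdet : (p * s - q * r) * (p' * s' - q' * r') = 1 := by
    linear_combination (-1 : ℤ) * i1 - (p * p' + q * r') * i4 + i3 * (r * p' + s * r')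
  have hsq : (p * s - q * r) ^ 2 = 1 := by
    rcases Int.isUnit_iff.mp (IsUnit.of_mul_eq_one _ hdet) with h | h <;> rw [h] <;> norm_num
  have key : ∀ x y : ℤ, f.eval (p * x + q * y) (r * x + s * y) = (p * s - q * r) * g.eval x y := by
    intro x y
    have hs := hr'.sq x y
    have := index_form hK ha hθ hr (l := x * l1 + y * l2) (x := p * x + q * y)
      (y := r * x + s * y)
      (l' := (-(g.a * g.c) * x ^ 2 - 2 * g.a * g.d * x * y - g.b * g.d * y ^ 2)
        + (-g.b * x ^ 2 - g.d * y ^ 2) * l1 + (g.a * x ^ 2 + g.c * y ^ 2) * l2)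
      (x' := p * (-g.b * x ^ 2 - g.d * y ^ 2) + q * (g.a * x ^ 2 + g.c * y ^ 2))
      (y' := r * (-g.b * x ^ 2 - g.d * y ^ 2) + s * (g.a * x ^ 2 + g.c * y ^ 2)) (by
        rw [e1, e2] at hs
        push_cast
        push_cast at hs
        linear_combination hs)
    rw [← this]
    simp only [eval]
    ring
  have hform : ∀ F G : BCF, (∀ x y, F.eval x y = G.eval x y) → F = G := by
    intro F G h
    have h1 := h 1 0
    have h2 := h 0 1
    have h3 := h 1 1
    have h4 := h 1 (-1)
    simp [eval] at h1 h2 h3 h4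
    ext <;> omega
  rcases Int.isUnit_iff.mp (IsUnit.of_mul_eq_one _ hdet) with h | h
  · refine ⟨p, q, r, s, hsq, hform _ _ fun x y => ?_⟩
    rw [eval_comp, key, h, one_mul]
  · refine ⟨-p, -q, -r, -s, by linear_combination hsq, hform _ _ fun x y => ?_⟩
    rw [eval_comp]
    have e : f.eval (-p * x + -q * y) (-r * x + -s * y)
      = - f.eval (p * x + q * y) (r * x + s * y) := by simp only [eval]; ring
    rw [e, key, h]; ring

end BCF

theorem trace_of_basis_three {R S : Type*} [CommRing R] [CommRing S] [Algebra R S]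
    (b : Module.Basis (Fin 3) R S) (x : S) (m : Fin 3 → Fin 3 → R)
    (h : ∀ j, x * b j = ∑ i, m j i • b i) :
    Algebra.trace R S x = m 0 0 + m 1 1 + m 2 2 := by
  rw [Algebra.trace_eq_matrix_trace b, Matrix.trace]
  have : ∀ j, (Algebra.leftMulMatrix b x).diag j = m j j := by
    intro j
    rw [Matrix.diag_apply, Algebra.leftMulMatrix_eq_repr_mul, h, map_sum]
    simp [Finsupp.single_apply]
  simp only [this, Fin.sum_univ_three]

namespace BCF

variable {K : Type*} [Field K]

open NumberField in
/-- The discriminant of a field is the discriminant of the attached form. -/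
theorem RepBy.discr_eq [NumberField K] (hK : Module.finrank ℚ K = 3) {f : BCF}
    (h : f.RepBy K) : discr K = f.disc := by
  obtain ⟨θ, ha, hr, hl⟩ := h
  have hθ := irrational_of_lattice hK hl
  let w : 𝓞 K := ⟨_, isIntegral_omega hr⟩
  let e : 𝓞 K := ⟨_, isIntegral_eta hr⟩
  have hw : algebraMap (𝓞 K) K w = f.a * θ := rfl
  have he : algebraMap (𝓞 K) K e = f.a * θ ^ 2 + f.b * θ + f.c := rfl
  have h1 : w * w = -(f.a * f.c : ℤ) - f.b * w + f.a * e := by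
    apply RingOfIntegers.ext
    simp only [map_mul, map_add, map_sub, map_neg, map_intCast, hw, he]
    push_cast
    ring
  have h2 : w * e = -(f.a * f.d : ℤ) := by
    apply RingOfIntegers.ext
    simp only [map_mul, map_neg, map_intCast, hw, he]
    push_cast
    unfold Root at hr
    linear_combination (f.a : K) * hr
  have h3 : e * e = -(f.b * f.d : ℤ) - f.d * w + f.c * e := by
    apply RingOfIntegers.ext
    simp only [map_mul, map_add, map_sub, map_neg, map_intCast, hw, he]
    push_cast
    unfold Root at hr
    linear_combination (f.a * θ + f.b : K) * hr
  have hli : LinearIndependent ℤ ![(1 : 𝓞 K), w, e] := by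
    rw [Fintype.linearIndependent_iff]
    intro g hg
    rw [Fin.sum_univ_three] at hg
    have := congrArg (algebraMap (𝓞 K) K) hg
    simp at this
    obtain ⟨i1, i2, i3⟩ := lattice_indep_int hK ha hθ (l := g 0) (m := g 1) (n := g 2)
      (l' := 0) (m' := 0) (n' := 0) (by push_cast; rw [← hw, ← he]; linear_combination this)
    intro i
    fin_cases i
    exacts [i1, i2, i3]
  have hsp : ⊤ ≤ Submodule.span ℤ (Set.range ![(1 : 𝓞 K), w, e]) := by
    rintro z -
    obtain ⟨l, m, n, hz⟩ := (hl z).mp z.2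
    have : z = l • (1 : 𝓞 K) + m • w + n • e := by
      apply RingOfIntegers.ext
      rw [hz]
      simp [hw, he]
    rw [this]
    refine add_mem (add_mem ?_ ?_) ?_ <;> refine Submodule.smul_mem _ _ (Submodule.subset_span ?_)
    exacts [⟨0, rfl⟩, ⟨1, rfl⟩, ⟨2, rfl⟩]
  let B : Module.Basis (Fin 3) ℤ (𝓞 K) := Module.Basis.mk hli hsp
  have hB : (B : Fin 3 → 𝓞 K) = ![1, w, e] := Module.Basis.coe_mk hli hsp
  have t1 : Algebra.trace ℤ (𝓞 K) 1 = 3 := by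
    rw [trace_of_basis_three B _ ![![1, 0, 0], ![0, 1, 0], ![0, 0, 1]]]
    · simp
    · rw [hB]
      intro j
      fin_cases j <;> simp [Fin.sum_univ_three]
  have tw : Algebra.trace ℤ (𝓞 K) w = -f.b := by
    rw [trace_of_basis_three B _ ![![0, 1, 0], ![-(f.a * f.c), -f.b, f.a], ![-(f.a * f.d), 0, 0]]]
    · simp
    · rw [hB]
      intro j
      fin_cases j
      · simp [Fin.sum_univ_three]
      · simp [Fin.sum_univ_three, h1, sub_eq_add_neg]
      · simp [Fin.sum_univ_three, h2]
  have te : Algebra.trace ℤ (𝓞 K) e = f.c := by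
    rw [trace_of_basis_three B _ ![![0, 0, 1], ![-(f.a * f.d), 0, 0], ![-(f.b * f.d), -f.d, f.c]]]
    · simp
    · rw [hB]
      intro j
      fin_cases j
      · simp [Fin.sum_univ_three]
      · simp [Fin.sum_univ_three, mul_comm e w, h2]
      · simp [Fin.sum_univ_three, h3, sub_eq_add_neg]
  have tz : ∀ n : ℤ, Algebra.trace ℤ (𝓞 K) (n : 𝓞 K) = n * 3 := by
    intro n
    have : ((n : ℤ) : 𝓞 K) = n • 1 := by simp
    rw [this, map_smul, t1]; simp
  have tm : ∀ (n : ℤ) (x : 𝓞 K), Algebra.trace ℤ (𝓞 K) (n * x) = n * Algebra.trace ℤ (𝓞 K) x := by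
    intro n x
    have : (n : 𝓞 K) * x = n • x := by simp
    rw [this, map_smul]; simp
  rw [← discr_eq_discr K B, Algebra.discr_def, Matrix.det_fin_three]
  simp only [Algebra.traceMatrix_apply, Algebra.traceForm_apply, hB]
  simp only [Matrix.cons_val_zero, Matrix.cons_val_one, Matrix.cons_val_two, Matrix.head_cons,
    Matrix.tail_cons, one_mul, mul_one, mul_comm e w, h1, h2, h3, map_add, map_sub,
    map_neg, tm, tz, t1, tw, te]
  simp only [disc, cubicDisc]
  ring

end BCF

/-- A primitive vector of a free abelian group of rank three extends to a basis. -/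
theorem exists_basis_of_primitive {M : Type*} [AddCommGroup M] [Module.Finite ℤ M]
    [Module.Free ℤ M] (hM : Module.finrank ℤ M = 3) (u : M) (hu : u ≠ 0)
    (hprim : ∀ (n m : ℤ) (z : M), n ≠ 0 → n • z = m • u → ∃ k : ℤ, z = k • u) :
    ∃ w e : M, (∀ z, ∃ l m n : ℤ, z = l • u + m • w + n • e) ∧
      ∀ l m n : ℤ, l • u + m • w + n • e = 0 → l = 0 ∧ m = 0 ∧ n = 0 := by
  set N : Submodule ℤ M := Submodule.span ℤ {u} with hN
  have hmem : ∀ z, N.mkQ z = 0 ↔ ∃ k : ℤ, z = k • u := by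
    intro z
    rw [Submodule.mkQ_apply, Submodule.Quotient.mk_eq_zero, hN, Submodule.mem_span_singleton]
    exact ⟨fun ⟨k, h⟩ => ⟨k, h.symm⟩, fun ⟨k, h⟩ => ⟨k, h.symm⟩⟩
  have htf : Module.IsTorsionFree ℤ (M ⧸ N) := by
    apply Module.IsTorsionFree.of_smul_eq_zero
    intro n x h
    by_cases hn : n = 0
    · exact Or.inl hn
    right
    obtain ⟨z, rfl⟩ := N.mkQ_surjective x
    rw [← map_smul, hmem] at h
    obtain ⟨m, hm⟩ := h
    exact (hmem z).mpr (hprim n m z hn hm)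
  have hfree : Module.Free ℤ (M ⧸ N) := Module.free_of_finite_type_torsion_free'
  have hrk : Module.finrank ℤ (M ⧸ N) = 2 := by
    have h1 := Submodule.finrank_quotient_add_finrank N
    have h2 : Module.finrank ℤ N = 1 := by
      rw [← (LinearEquiv.toSpanNonzeroSingleton ℤ M u hu).finrank_eq]
      exact Module.finrank_self ℤ
    rw [h2, hM] at h1
    omega
  let B := Module.finBasisOfFinrankEq ℤ (M ⧸ N) hrk
  obtain ⟨w, hw⟩ := N.mkQ_surjective (B 0)
  obtain ⟨e, he⟩ := N.mkQ_surjective (B 1)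
  refine ⟨w, e, ?_, ?_⟩
  · intro z
    have h1 := B.sum_repr (N.mkQ z)
    rw [Fin.sum_univ_two, ← hw, ← he, ← map_smul, ← map_smul, ← map_add, eq_comm,
      ← sub_eq_zero, ← map_sub, hmem] at h1
    obtain ⟨l, hl⟩ := h1
    exact ⟨l, _, _, by rw [add_assoc, ← hl, sub_add_cancel]⟩
  · intro l m n h
    have h1 := congrArg N.mkQ h
    have h2 : N.mkQ u = 0 := (hmem u).mpr ⟨1, by simp⟩
    rw [map_add, map_add, map_smul, map_smul, map_smul, h2, hw, he, smul_zero, zero_add,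
      (map_zero N.mkQ)] at h1
    have h3 := Fintype.linearIndependent_iff.mp B.linearIndependent ![m, n] (by
      simpa [Fin.sum_univ_two] using h1)
    have hm : m = 0 := h3 0
    have hn : n = 0 := h3 1
    subst hm hn
    simp at h
    exact ⟨h.resolve_right hu, rfl, rfl⟩

namespace BCF

open NumberField

variable {K : Type*} [Field K] [NumberField K]

theorem exists_integral_basis (hK : Module.finrank ℚ K = 3) :
    ∃ w e : K, IsIntegral ℤ w ∧ IsIntegral ℤ e ∧
      (∀ z : K, IsIntegral ℤ z → ∃ l m n : ℤ, z = l + m * w + n * e) ∧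
      ∀ l m n : ℤ, (l : K) + m * w + n * e = 0 → l = 0 ∧ m = 0 ∧ n = 0 := by
  obtain ⟨w, e, h1, h2⟩ := exists_basis_of_primitive (M := 𝓞 K)
    (by rw [RingOfIntegers.rank, hK]) 1 one_ne_zero (by
      intro n m z hn hm
      have h1 : (n : K) * z = m := by
        have := congrArg (algebraMap (𝓞 K) K) hm
        simpa using this
      have h2 : (z : K) = algebraMap ℚ K (m / n) := by
        have : (n : K) ≠ 0 := by exact_mod_cast hn
        rw [map_div₀]
        rw [map_intCast, map_intCast, eq_div_iff this, mul_comm]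
        exact h1
      have h3 : IsIntegral ℤ ((m : ℚ) / n) := by
        rw [← isIntegral_algebraMap_iff (B := K) (algebraMap ℚ K).injective, ← h2]
        exact z.2
      obtain ⟨k, hk⟩ := IsIntegrallyClosed.isIntegral_iff.mp h3
      refine ⟨k, RingOfIntegers.ext ?_⟩
      rw [h2, ← hk]
      simp)
  refine ⟨w, e, w.2, e.2, ?_, ?_⟩
  · intro z hz
    obtain ⟨l, m, n, h⟩ := h1 ⟨z, hz⟩
    refine ⟨l, m, n, ?_⟩
    have := congrArg (algebraMap (𝓞 K) K) h
    simp only [map_add, zsmul_eq_mul, map_mul, map_intCast, mul_one] at this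
    exact this
  · intro l m n h
    apply h2
    apply RingOfIntegers.ext
    simpa using h

/-- Every cubic field is attached to some form. -/
theorem exists_repBy (hK : Module.finrank ℚ K = 3) : ∃ f : BCF, f.RepBy K := by
  obtain ⟨w, e, hw, he, hsp, hind⟩ := exists_integral_basis hK
  obtain ⟨l0, m0, n0, h0⟩ := hsp _ (hw.mul he)
  obtain ⟨l1, b, a, h1⟩ := hsp _ (hw.mul hw)
  obtain ⟨l2, d, c, h2⟩ := hsp _ (he.mul he)
  set W : K := w - n0 with hW
  set E : K := e - m0 with hE
  have hind' : ∀ l m n : ℤ, (l : K) + m * W + n * E = 0 → l = 0 ∧ m = 0 ∧ n = 0 := by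
    intro l m n h
    obtain ⟨h1, h2, h3⟩ := hind (l - m * n0 - n * m0) m n (by
      push_cast; rw [hW, hE] at h; linear_combination h)
    subst h2 h3
    exact ⟨by simpa using h1, rfl, rfl⟩
  obtain ⟨k, hk⟩ : ∃ k : ℤ, W * E = k := ⟨l0 + m0 * n0, by
    push_cast; rw [hW, hE]; linear_combination h0⟩
  obtain ⟨L1, B, hL1⟩ : ∃ L1 B : ℤ, W ^ 2 = L1 - B * W + a * E := by
    refine ⟨l1 + b * n0 + a * m0 - n0 ^ 2, 2 * n0 - b, ?_⟩
    push_cast; rw [hW, hE]; linear_combination h1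
  obtain ⟨L2, C, hL2⟩ : ∃ L2 C : ℤ, E ^ 2 = L2 + d * W + C * E := by
    refine ⟨l2 + d * n0 + c * m0 - m0 ^ 2, c - 2 * m0, ?_⟩
    push_cast; rw [hW, hE]; linear_combination h2
  obtain ⟨-, i1, i2⟩ := hind' (-B * k + a * L2) (a * d - k) (L1 + a * C) (by
    push_cast; linear_combination (W + B) * hk - E * hL1 - a * hL2)
  obtain ⟨-, i3, -⟩ := hind' (d * L1 + C * k) (L2 - d * B) (d * a - k) (by
    push_cast; linear_combination (E - C) * hk - W * hL2 - d * hL1)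
  have ha : a ≠ 0 := by
    rintro rfl
    obtain ⟨r, hr⟩ := rational_of_quadratic hK (z := W) (u := -L1) (v := B) (w := 1) (by
      push_cast; push_cast at hL1; linear_combination hL1) (by simp)
    have hden : (r.den : K) ≠ 0 := by exact_mod_cast r.den_ne_zero
    obtain ⟨-, h, -⟩ := hind' (-r.num) r.den 0 (by
      rw [hr]
      push_cast
      have : ((r : ℚ) : K) = r.num / r.den := by
        exact_mod_cast congrArg (Rat.cast (K := K)) r.num_div_den.symm
      rw [this]; field_simp; ring)
    exact r.den_ne_zero (by exact_mod_cast h)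
  have haK : (a : K) ≠ 0 := by exact_mod_cast ha
  have j1 : (L1 : K) = -(a * C) := by
    have := congrArg (Int.cast (R := K)) i2
    push_cast at this; linear_combination this
  have j2 : (k : K) = a * d := by
    have := congrArg (Int.cast (R := K)) i1
    push_cast at this; linear_combination -this
  have hθw : ((a : K)) * (W / a) = W := by field_simp
  have hθe : ((a : K)) * (W / a) ^ 2 + B * (W / a) + C = E := by
    field_simp
    linear_combination hL1 + j1
  refine ⟨⟨a, B, C, -d⟩, W / a, ha, ?_, ?_⟩
  · unfold Root
    push_cast
    have : (a : K) * (W / a) ^ 3 + B * (W / a) ^ 2 + C * (W / a) + -d = (W / a) * E - d := by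
      rw [← hθe]; ring
    rw [this]
    field_simp
    linear_combination hk + j2
  · intro z
    constructor
    · intro hz
      obtain ⟨l, m, n, h⟩ := hsp z hz
      refine ⟨l + m * n0 + n * m0, m, n, ?_⟩
      simp only
      rw [hθw, hθe, h, hW, hE]
      push_cast; ring
    · rintro ⟨l, m, n, rfl⟩
      simp only
      rw [hθw, hθe]
      have hi : ∀ k : ℤ, IsIntegral ℤ (k : K) := fun k => by
        simpa using isIntegral_algebraMap (R := ℤ) (A := K) (x := k)
      exact ((hi l).add ((hi m).mul (hw.sub (hi _)))).add ((hi n).mul (he.sub (hi _)))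

end BCF

namespace BCF

/-- A primitive integral vector is the first column of a matrix of determinant one. -/
theorem exists_equiv_of_coprime (f : BCF) {x y : ℤ} (h : IsCoprime x y) :
    ∃ g : BCF, f.Equiv g ∧ g.a = f.eval x y ∧ ∃ q s : ℤ, x * s - q * y = 1 ∧
      g = f.comp x q y s ∧ g.b = q * f.dx x y + s * f.dy x y := by
  obtain ⟨u, v, huv⟩ := h
  have hdet : x * u - (-v) * y = 1 := by linear_combination huv
  refine ⟨f.comp x (-v) y u, ⟨x, -v, y, u, ?_, rfl⟩, ?_, -v, u, hdet, rfl, ?_⟩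
  · rw [hdet]; norm_num
  · simp only [comp, eval]
  · simp only [comp, dx, dy]; ring

theorem NonMax.normal_form {p : ℕ} (hp : p.Prime) {f : BCF} (h : NonMax p f) :
    DvdAll p f ∨ ∃ g : BCF, f.Equiv g ∧ (p : ℤ) ^ 2 ∣ g.a ∧ (p : ℤ) ∣ g.b := by
  refine h.imp_right ?_
  rintro ⟨x, y, h0, h1, h2, h3⟩
  have hp' : Prime (p : ℤ) := Nat.prime_iff_prime_int.mp hp
  have hne : x ≠ 0 ∨ y ≠ 0 := by
    by_contra! hcon
    rw [hcon.1, hcon.2] at h0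
    simp at h0
  obtain ⟨x', hx⟩ := Int.gcd_dvd_left x y
  obtain ⟨y', hy⟩ := Int.gcd_dvd_right x y
  set g : ℤ := ((Int.gcd x y : ℕ) : ℤ) with hg
  have hg0 : g ≠ 0 := by
    rw [hg]
    exact_mod_cast (Int.gcd_pos_iff.mpr hne).ne'
  have hpg : ¬ (p : ℤ) ∣ g := fun hdiv => h0 ⟨hx ▸ dvd_mul_of_dvd_left hdiv _,
    hy ▸ dvd_mul_of_dvd_left hdiv _⟩
  have hcop : IsCoprime (p : ℤ) g := (Prime.coprime_iff_not_dvd hp').mpr hpg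
  have hcop' : IsCoprime x' y' := by
    have := Int.gcd_eq_gcd_ab x y
    refine ⟨Int.gcdA x y, Int.gcdB x y, ?_⟩
    apply mul_left_cancel₀ hg0
    rw [← hg] at this
    linear_combination (-(Int.gcdA x y)) * hx - (Int.gcdB x y) * hy - this
  have e1 : f.eval x y = g ^ 3 * f.eval x' y' := by rw [hx, hy]; simp only [eval]; ring
  have e2 : f.dx x y = g ^ 2 * f.dx x' y' := by rw [hx, hy]; simp only [dx]; ring
  have e3 : f.dy x y = g ^ 2 * f.dy x' y' := by rw [hx, hy]; simp only [dy]; ring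
  rw [e1] at h1
  rw [e2] at h2
  rw [e3] at h3
  have h1' := (hcop.pow (m := 2) (n := 3)).dvd_of_dvd_mul_left h1
  have h2' := (hcop.pow_right (n := 2)).dvd_of_dvd_mul_left h2
  have h3' := (hcop.pow_right (n := 2)).dvd_of_dvd_mul_left h3
  obtain ⟨G, hG, ha, q, s, -, -, hb⟩ := exists_equiv_of_coprime f hcop'
  exact ⟨G, hG, ha ▸ h1', hb ▸ dvd_add (dvd_mul_of_dvd_right h2' _) (dvd_mul_of_dvd_right h3' _)⟩

variable {K : Type*} [Field K] [NumberField K]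

theorem RepBy.irr (hK : Module.finrank ℚ K = 3) {f : BCF} (h : f.RepBy K) : f.Irr := by
  obtain ⟨θ, ha, hr, hl⟩ := h
  have hθ := irrational_of_lattice hK hl
  intro x y hxy
  have haQ : (f.a : ℚ) ≠ 0 := by exact_mod_cast ha
  by_cases hy : y = 0
  · subst hy
    simp [eval, ha] at hxy
    exact ⟨hxy, rfl⟩
  exfalso
  apply hθ
  have hyK : (y : K) ≠ 0 := by exact_mod_cast hy
  have hxyK : (f.a * x ^ 3 + f.b * x ^ 2 * y + f.c * x * y ^ 2 + f.d * y ^ 3 : K) = 0 := by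
    exact_mod_cast congrArg (Int.cast (R := K)) hxy
  unfold Root at hr
  have hprod : (y * θ - x : K) * ((f.a * x ^ 2 + f.b * x * y + f.c * y ^ 2)
      + (f.a * x * y + f.b * y ^ 2) * θ + f.a * y ^ 2 * θ ^ 2) = 0 := by
    linear_combination (y : K) ^ 3 * hr - hxyK
  rcases mul_eq_zero.mp hprod with h | h
  · refine ⟨x / y, ?_⟩
    push_cast
    field_simp
    linear_combination h
  · apply rational_of_quadratic hK (u := f.a * x ^ 2 + f.b * x * y + f.c * y ^ 2)
      (v := f.a * x * y + f.b * y ^ 2) (w := f.a * y ^ 2)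
    · push_cast
      exact h
    · rintro ⟨-, -, h⟩
      have : (y : ℚ) ≠ 0 := by exact_mod_cast hy
      simp [haQ, this] at h

theorem RepBy.not_omega_div (hK : Module.finrank ℚ K = 3) {f : BCF} (h : f.RepBy K) {p : ℕ}
    (hp : p.Prime)
    (h1 : (p : ℤ) ∣ f.b) (h2 : (p : ℤ) ^ 2 ∣ f.a * f.c) (h3 : (p : ℤ) ^ 3 ∣ f.a ^ 2 * f.d) :
    False := by
  obtain ⟨θ, ha, hr, hl⟩ := h
  have hθ := irrational_of_lattice hK hl
  obtain ⟨b, hb⟩ := h1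
  obtain ⟨c, hc⟩ := h2
  obtain ⟨d, hd⟩ := h3
  have hpK : (p : K) ≠ 0 := by exact_mod_cast hp.ne_zero
  have h_int : IsIntegral ℤ ((f.a : K) * θ / p) := by
    refine ⟨Polynomial.X ^ 3 + (Polynomial.C b * Polynomial.X ^ 2
      + Polynomial.C c * Polynomial.X + Polynomial.C d), ?_, ?_⟩
    · exact Polynomial.monic_X_pow_add (n := 3) (by compute_degree!)
    · simp only [Polynomial.eval₂_add, Polynomial.eval₂_mul, Polynomial.eval₂_pow,
        Polynomial.eval₂_X, Polynomial.eval₂_C]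
      have hb' : (f.b : K) = p * b := by exact_mod_cast congrArg (Int.cast (R := K)) hb
      have hc' : (f.a * f.c : K) = p ^ 2 * c := by exact_mod_cast congrArg (Int.cast (R := K)) hc
      have hd' : (f.a ^ 2 * f.d : K) = p ^ 3 * d := by
        exact_mod_cast congrArg (Int.cast (R := K)) hd
      unfold Root at hr
      simp only [eq_intCast]
      field_simp
      linear_combination (f.a : K) ^ 2 * hr - f.a ^ 2 * θ ^ 2 * hb' - f.a * θ * hc' - hd'
  obtain ⟨l, m, n, h⟩ := (hl _).mp h_int
  obtain ⟨-, h5, -⟩ := lattice_indep_int hK ha hθ (l := 0) (m := 1) (n := 0)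
    (l' := p * l) (m' := p * m) (n' := p * n) (by
      push_cast
      have h' : (f.a : K) * θ = p * ((f.a : K) * θ / p) := by field_simp
      rw [h] at h'
      linear_combination h')
  have : (p : ℤ) ∣ 1 := ⟨m, h5⟩
  have := Int.natCast_dvd_natCast.mp (by simpa using this : (p : ℤ) ∣ ((1 : ℕ) : ℤ))
  exact hp.one_lt.ne' (Nat.dvd_one.mp this)

theorem RepBy.not_nonMax (hK : Module.finrank ℚ K = 3) {f : BCF} (h : f.RepBy K) {p : ℕ}
    (hp : p.Prime) : ¬ NonMax p f := by
  intro hn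
  rcases hn.normal_form hp with ⟨ha, hb, hc, hd⟩ | ⟨g, ⟨x, y, z, w, hdet, rfl⟩, ha, hb⟩
  · refine h.not_omega_div hK hp hb ?_ ?_
    · rw [sq]; exact mul_dvd_mul ha hc
    · have : (p : ℤ) ^ 3 = p ^ 2 * p := by ring
      rw [this]; exact mul_dvd_mul (pow_dvd_pow_of_dvd ha 2) hd
  · refine (h.comp hK hdet).not_omega_div hK hp hb (dvd_mul_of_dvd_left ha _) ?_
    refine dvd_mul_of_dvd_left (dvd_trans (pow_dvd_pow _ (by norm_num : 3 ≤ 4)) ?_) _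
    have : (p : ℤ) ^ 4 = (p ^ 2) ^ 2 := by ring
    rw [this]
    exact pow_dvd_pow_of_dvd ha 2

end BCF

namespace BCF

section

variable {K : Type*} [Field K] [NumberField K]

/-- An integer of a cubic field is a root of a monic integral cubic. -/
theorem exists_integral_cubic (hK : Module.finrank ℚ K = 3) {z : K} (hz : IsIntegral ℤ z)
    (hirr : ¬ ∃ r : ℚ, z = r) :
    ∃ u v w : ℤ, z ^ 3 + u * z ^ 2 + v * z + w = 0 := by
  have h1 := minpoly.isIntegrallyClosed_eq_field_fractions' ℚ hz
  have hdvd := minpoly.degree_dvd (K := ℚ) (x := z) (Algebra.IsIntegral.isIntegral z)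
  rw [hK, Nat.dvd_prime Nat.prime_three] at hdvd
  have hdeg : (minpoly ℚ z).natDegree = 3 := by
    refine hdvd.resolve_left fun h => hirr ?_
    obtain ⟨r, hr⟩ := minpoly.natDegree_eq_one_iff.mp h
    exact ⟨r, by rw [← hr]; simp⟩
  have hmon := minpoly.monic hz
  have hdeg' : (minpoly ℤ z).natDegree = 3 := by
    rw [← hdeg, h1, hmon.natDegree_map]
  have h0 := minpoly.aeval ℤ z
  rw [Polynomial.aeval_eq_sum_range, hdeg'] at h0
  have h3 : (minpoly ℤ z).coeff 3 = 1 := by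
    rw [← hdeg']; exact hmon
  refine ⟨(minpoly ℤ z).coeff 2, (minpoly ℤ z).coeff 1, (minpoly ℤ z).coeff 0, ?_⟩
  simp [Finset.sum_range_succ, h3] at h0
  linear_combination h0

theorem nonMax_of_integral_div (hK : Module.finrank ℚ K = 3) {f : BCF} {θ : K} (ha : f.a ≠ 0)
    (hθ : ¬ ∃ r : ℚ, θ = r)
    (hr : f.Root θ) {p : ℕ} (hp : p.Prime) {l : ℤ}
    (hz : IsIntegral ℤ (((l : K) + f.a * θ) / p)) : NonMax p f := by
  have hpK : (p : K) ≠ 0 := by exact_mod_cast hp.ne_zero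
  have hpQ : (p : ℚ) ≠ 0 := by exact_mod_cast hp.ne_zero
  have haQ : (f.a : ℚ) ≠ 0 := by exact_mod_cast ha
  have haK : (f.a : K) ≠ 0 := by exact_mod_cast ha
  set z := ((l : K) + f.a * θ) / p with hzdef
  have hzp : (f.a : K) * θ = p * z - l := by rw [hzdef]; field_simp; ring
  have hzirr : ¬ ∃ r : ℚ, z = r := by
    rintro ⟨r, h⟩
    apply hθ
    refine ⟨(p * r - l) / f.a, ?_⟩
    push_cast
    rw [← h, ← hzp]
    field_simp
  obtain ⟨u, v, w, huvw⟩ := exists_integral_cubic hK hz hzirr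
  have hF : (p : K) ^ 3 * z ^ 3 + p ^ 2 * (f.b - 3 * l) * z ^ 2
      + p * (3 * l ^ 2 - 2 * l * f.b + f.a * f.c) * z
      + (-l ^ 3 + f.b * l ^ 2 - f.a * f.c * l + f.a ^ 2 * f.d) = 0 := by
    have h1 : (f.a * θ : K) ^ 3 + f.b * (f.a * θ) ^ 2 + f.a * f.c * (f.a * θ) + f.a ^ 2 * f.d
        = 0 := by
      unfold Root at hr; linear_combination (f.a : K) ^ 2 * hr
    rw [hzp] at h1
    linear_combination h1
  have hquad : ¬ ¬ (((-l ^ 3 + f.b * l ^ 2 - f.a * f.c * l + f.a ^ 2 * f.d - p ^ 3 * w : ℤ) : ℚ) = 0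
      ∧ ((p * (3 * l ^ 2 - 2 * l * f.b + f.a * f.c) - p ^ 3 * v : ℤ) : ℚ) = 0
      ∧ ((p ^ 2 * (f.b - 3 * l) - p ^ 3 * u : ℤ) : ℚ) = 0) := by
    intro hne
    refine hzirr (rational_of_quadratic hK ?_ hne)
    push_cast
    linear_combination hF - (p : K) ^ 3 * huvw
  obtain ⟨q1, q2, q3⟩ := not_not.mp hquad
  have hp0 : (p : ℤ) ≠ 0 := by exact_mod_cast hp.ne_zero
  have d1 : (-l ^ 3 + f.b * l ^ 2 - f.a * f.c * l + f.a ^ 2 * f.d) = p ^ 3 * w := by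
    have : (-l ^ 3 + f.b * l ^ 2 - f.a * f.c * l + f.a ^ 2 * f.d - p ^ 3 * w : ℤ) = 0 := by
      exact_mod_cast q1
    linear_combination this
  have d2 : (3 * l ^ 2 - 2 * l * f.b + f.a * f.c) = p ^ 2 * v := by
    have : (p * (3 * l ^ 2 - 2 * l * f.b + f.a * f.c) - p ^ 3 * v : ℤ) = 0 := by exact_mod_cast q2
    apply mul_left_cancel₀ hp0
    linear_combination this
  have d3 : f.b - 3 * l = p * u := by
    have : (p ^ 2 * (f.b - 3 * l) - p ^ 3 * u : ℤ) = 0 := by exact_mod_cast q3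
    apply mul_left_cancel₀ (pow_ne_zero 2 hp0)
    linear_combination this
  have hp' : Prime (p : ℤ) := Nat.prime_iff_prime_int.mp hp
  by_cases hpa : (p : ℤ) ∣ f.a
  · obtain ⟨a', ha'⟩ := hpa
    have hpl : (p : ℤ) ∣ l := by
      apply hp'.dvd_of_dvd_pow (n := 3)
      refine ⟨-l * (2 * l * u + p * v - a' * f.c) - (p ^ 2 * w - u * l ^ 2 + a' * f.c * l
        - a' * f.a * f.d), ?_⟩
      have hb : f.b = 3 * l + p * u := by linear_combination d3
      rw [hb] at d1 d2
      linear_combination (-1 : ℤ) * d1 - l * d2 + (l * f.c - f.c * l + f.a * f.d) * ha'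
    obtain ⟨l', hl'⟩ := hpl
    have hb : f.b = p * (u + 3 * l') := by rw [hl'] at d3; linear_combination d3
    have hac : f.a * f.c = p ^ 2 * (v - 3 * l' ^ 2 + 2 * l' * (u + 3 * l')) := by
      rw [hl'] at d2; linear_combination d2 + 2 * p * l' * hb
    have hd : f.a ^ 2 * f.d = p ^ 3 * (w + l' ^ 3 - (u + 3 * l') * l' ^ 2
        + l' * (v - 3 * l' ^ 2 + 2 * l' * (u + 3 * l'))) := by
      rw [hl'] at d1; linear_combination d1 - p ^ 2 * l' ^ 2 * hb + p * l' * hac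
    by_cases hpa' : (p : ℤ) ∣ a'
    · right
      obtain ⟨a'', ha''⟩ := hpa'
      have hpa2 : f.a = p ^ 2 * a'' := by rw [ha', ha'']; ring
      refine ⟨1, 0, ?_, ?_, ?_, ?_⟩
      · rintro ⟨h, -⟩; exact hp'.not_dvd_one h
      · simp only [eval]; exact ⟨a'', by rw [hpa2]; ring⟩
      · simp only [dx]; exact ⟨3 * p * a'', by rw [hpa2]; ring⟩
      · simp only [dy]; exact ⟨u + 3 * l', by rw [hb]; ring⟩
    · left
      refine ⟨⟨a', ha'⟩, ⟨_, hb⟩, ?_, ?_⟩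
      · have : (p : ℤ) ∣ a' * f.c := by
          refine ⟨(v - 3 * l' ^ 2 + 2 * l' * (u + 3 * l')), ?_⟩
          apply mul_left_cancel₀ hp0
          rw [ha'] at hac
          linear_combination hac
        exact (hp'.dvd_or_dvd this).resolve_left hpa'
      · have : (p : ℤ) ∣ a' ^ 2 * f.d := by
          refine ⟨(w + l' ^ 3 - (u + 3 * l') * l' ^ 2
            + l' * (v - 3 * l' ^ 2 + 2 * l' * (u + 3 * l'))), ?_⟩
          apply mul_left_cancel₀ (pow_ne_zero 2 hp0)
          rw [ha'] at hd
          linear_combination hd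
        exact (hp'.dvd_or_dvd this).resolve_left fun h => hpa' (hp'.dvd_of_dvd_pow h)
  · right
    have hcop : IsCoprime (p : ℤ) f.a := (Prime.coprime_iff_not_dvd hp').mpr hpa
    obtain ⟨s, t, hst⟩ := hcop.pow_left (m := 3)
    set x := -l * t with hx
    have hax : f.a * x = -l + p ^ 3 * (s * l) := by rw [hx]; linear_combination (-l) * hst
    have h1 : (p : ℤ) ^ 2 ∣ f.eval x 1 := by
      have hc2 : IsCoprime ((p : ℤ) ^ 2) (f.a ^ 2) := hcop.pow
      apply hc2.dvd_of_dvd_mul_left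
      set k := s * l with hk
      refine ⟨p * w + p * k * (3 * l ^ 2 - 3 * l * p ^ 3 * k + p ^ 6 * k ^ 2
        + f.b * (-2 * l + p ^ 3 * k) + f.a * f.c), ?_⟩
      have : f.a ^ 2 * f.eval x 1 = (f.a * x) ^ 3 + f.b * (f.a * x) ^ 2 + f.a * f.c * (f.a * x)
          + f.a ^ 2 * f.d := by simp only [eval]; ring
      rw [this, hax]
      linear_combination d1
    have h2 : (p : ℤ) ∣ f.dx x 1 := by
      apply hcop.dvd_of_dvd_mul_left
      set k := s * l with hk
      refine ⟨p * v + p ^ 2 * k * (-6 * l + 3 * p ^ 3 * k + 2 * f.b), ?_⟩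
      have : f.a * f.dx x 1 = 3 * (f.a * x) ^ 2 + 2 * f.b * (f.a * x) + f.a * f.c := by
        simp only [dx]; ring
      rw [this, hax]
      linear_combination d2
    refine ⟨x, 1, ?_, h1, h2, ?_⟩
    · rintro ⟨-, h⟩; exact hp'.not_dvd_one h
    · have : f.dy x 1 = 3 * f.eval x 1 - x * f.dx x 1 := by simp only [dx, dy, eval]; ring
      rw [this]
      exact dvd_sub (dvd_mul_of_dvd_right (dvd_trans (dvd_pow_self _ two_ne_zero) h1) _)
        (dvd_mul_of_dvd_right h2 _)

end

end BCF

namespace BCF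

section

variable {K : Type*} [Field K] [NumberField K]

/-- If `f` is maximal at `p`, an integer with denominator `p` lies in the lattice. -/
theorem dvd_of_integral_div (hK : Module.finrank ℚ K = 3) {f : BCF} {θ : K} (hirr : f.Irr)
    (hθ : ¬ ∃ r : ℚ, θ = r)
    (hr : f.Root θ) {p : ℕ} (hp : p.Prime) (hmax : ¬ NonMax p f) {l m n : ℤ}
    (hz : IsIntegral ℤ (((l : K) + m * (f.a * θ) + n * (f.a * θ ^ 2 + f.b * θ + f.c)) / p)) :
    (p : ℤ) ∣ l ∧ (p : ℤ) ∣ m ∧ (p : ℤ) ∣ n := by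
  have hp' : Prime (p : ℤ) := Nat.prime_iff_prime_int.mp hp
  have hpK : (p : K) ≠ 0 := by exact_mod_cast hp.ne_zero
  have hi : ∀ k : ℤ, IsIntegral ℤ (k : K) := fun k => by
    simpa using isIntegral_algebraMap (R := ℤ) (A := K) (x := k)
  by_cases hmn : (p : ℤ) ∣ m ∧ (p : ℤ) ∣ n
  · refine ⟨?_, hmn⟩
    obtain ⟨⟨m', hm⟩, ⟨n', hn⟩⟩ := hmn
    have h1 : ((algebraMap ℚ K) ((l : ℚ) / p)) = ((l : K) + m * (f.a * θ)
        + n * (f.a * θ ^ 2 + f.b * θ + f.c)) / p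
        - (((0 : ℤ) : K) + m' * (f.a * θ) + n' * (f.a * θ ^ 2 + f.b * θ + f.c)) := by
      rw [hm, hn, map_div₀]
      push_cast
      simp only [map_intCast]
      field_simp
      ring
    have h2 : IsIntegral ℤ ((l : ℚ) / p) := by
      rw [← isIntegral_algebraMap_iff (B := K) (algebraMap ℚ K).injective, h1]
      exact hz.sub (isIntegral_of_inLattice hr ⟨0, m', n', rfl⟩)
    obtain ⟨k, hk⟩ := IsIntegrallyClosed.isIntegral_iff.mp h2
    refine ⟨k, ?_⟩
    have hpQ : (p : ℚ) ≠ 0 := by exact_mod_cast hp.ne_zero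
    rw [eq_div_iff hpQ] at hk
    have : ((k * p : ℤ) : ℚ) = (l : ℤ) := by push_cast; simpa using hk
    have := Int.cast_injective this
    linear_combination -this
  · exfalso
    apply hmax
    have hne : m ≠ 0 ∨ n ≠ 0 := by
      by_contra! hcon
      rw [hcon.1, hcon.2] at hmn
      simp at hmn
    obtain ⟨x, hx⟩ := Int.gcd_dvd_left m n
    obtain ⟨y, hy⟩ := Int.gcd_dvd_right m n
    have hab := Int.gcd_eq_gcd_ab m n
    set g : ℤ := ((Int.gcd m n : ℕ) : ℤ) with hg
    have hg0 : g ≠ 0 := by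
      rw [hg]
      exact_mod_cast (Int.gcd_pos_iff.mpr hne).ne'
    have hpg : ¬ (p : ℤ) ∣ g := fun hdiv => hmn ⟨hx ▸ dvd_mul_of_dvd_left hdiv _,
      hy ▸ dvd_mul_of_dvd_left hdiv _⟩
    obtain ⟨s, u, hsu⟩ := (Prime.coprime_iff_not_dvd hp').mpr hpg
    have hcop' : IsCoprime x y := by
      refine ⟨Int.gcdA m n, Int.gcdB m n, ?_⟩
      apply mul_left_cancel₀ hg0
      linear_combination (-(Int.gcdA m n)) * hx - (Int.gcdB m n) * hy - hab
    obtain ⟨F, hF, haF, q, t, hdet, hcomp, -⟩ := exists_equiv_of_coprime f hcop'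
    have hxy : ¬ (x = 0 ∧ y = 0) := by
      rintro ⟨rfl, rfl⟩; simp at hdet
    have haF0 : F.a ≠ 0 := by
      rw [haF]; exact fun h => hxy (hirr x y h)
    have hθx : (x : K) - y * θ ≠ 0 := by
      intro h
      by_cases hy0 : y = 0
      · subst hy0
        simp at h
        exact hxy ⟨h, rfl⟩
      · apply hθ
        refine ⟨x / y, ?_⟩
        have : (y : K) ≠ 0 := by exact_mod_cast hy0
        push_cast
        field_simp
        linear_combination -h
    have hdetK : (x : K) * t - q * y = 1 := by exact_mod_cast congrArg (Int.cast (R := K)) hdet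
    set θ' : K := (t * θ - q) / (x - y * θ) with hθ'
    have hr' : F.Root θ' := by rw [hcomp]; exact root_comp hr hθx
    set c0 : ℤ := -(t * (x * y * f.c + y ^ 2 * f.d) + q * (f.a * x ^ 2 + f.b * x * y)) with hc0
    have hω : (F.a : K) * θ' = c0 + (x * (f.a * θ) + y * (f.a * θ ^ 2 + f.b * θ + f.c)) := by
      rw [hcomp, hθ', hc0]
      unfold Root at hr
      simp only [BCF.comp]
      push_cast
      field_simp
      linear_combination ((x * y ^ 2 * t : K) - q * y ^ 3) * hr +
        (x - y * θ) * (x * (f.a * θ) + y * (f.a * θ ^ 2 + f.b * θ + f.c)) * hdetK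
    have hθirr : ¬ ∃ r : ℚ, θ' = r := by
      rintro ⟨r, h⟩
      rw [h] at hω
      have := lattice_indep hK hirr.a_ne hθ (l := c0 - F.a * r) (m := x) (n := y) (by
        push_cast; linear_combination -hω)
      exact hxy ⟨by exact_mod_cast this.2.1, by exact_mod_cast this.2.2⟩
    refine hF.nonMax (nonMax_of_integral_div hK haF0 hθirr hr' hp (l := u * l - c0) ?_)
    have : (((u * l - c0 : ℤ) : K) + F.a * θ') / p = u * (((l : K) + m * (f.a * θ)
        + n * (f.a * θ ^ 2 + f.b * θ + f.c)) / p)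
        + (((0 : ℤ) : K) + ((s * x : ℤ) : K) * (f.a * θ)
          + ((s * y : ℤ) : K) * (f.a * θ ^ 2 + f.b * θ + f.c)) := by
      have e : (s : K) * p + u * g = 1 := by exact_mod_cast congrArg (Int.cast (R := K)) hsu
      have hxK : (m : K) = g * x := by exact_mod_cast congrArg (Int.cast (R := K)) hx
      have hyK : (n : K) = g * y := by exact_mod_cast congrArg (Int.cast (R := K)) hy
      rw [hω, hxK, hyK]
      push_cast
      field_simp
      linear_combination (-(x * (f.a * θ) + y * (f.a * θ ^ 2 + f.b * θ + f.c)) : K) * e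
    rw [this]
    exact ((hi u).mul hz).add (isIntegral_of_inLattice hr ⟨0, _, _, rfl⟩)

theorem repBy_of_root (hK : Module.finrank ℚ K = 3) {f : BCF} {θ : K} (hirr : f.Irr)
    (hθ : ¬ ∃ r : ℚ, θ = r)
    (hr : f.Root θ) (hmax : ∀ p : ℕ, p.Prime → ¬ NonMax p f)
    (hsp : ∀ z : K, ∃ u v w : ℚ, z = u + v * θ + w * θ ^ 2) : f.RepBy K := by
  refine ⟨θ, hirr.a_ne, hr, fun z => ⟨fun hz => ?_, isIntegral_of_inLattice hr⟩⟩
  have key : ∀ N : ℕ, N ≠ 0 → ∀ z : K, IsIntegral ℤ z → f.InLattice θ (N * z) →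
      f.InLattice θ z := by
    intro N
    induction N using Nat.recOnMul with
    | zero => intro h; exact absurd rfl h
    | one => intro _ z _ h; simpa using h
    | prime p hp =>
      intro _ z hz h
      obtain ⟨l, m, n, h⟩ := h
      have hpK : (p : K) ≠ 0 := by exact_mod_cast hp.ne_zero
      have hz' : z = ((l : K) + m * (f.a * θ) + n * (f.a * θ ^ 2 + f.b * θ + f.c)) / p := by
        rw [← h]; field_simp
      obtain ⟨⟨l', rfl⟩, ⟨m', rfl⟩, ⟨n', rfl⟩⟩ :=
        dvd_of_integral_div hK hirr hθ hr hp (hmax p hp) (hz' ▸ hz)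
      refine ⟨l', m', n', ?_⟩
      rw [hz']
      push_cast
      field_simp
    | mul a b iha ihb =>
      intro hab z hz h
      have ha : a ≠ 0 := fun h => hab (by simp [h])
      have hb : b ≠ 0 := fun h => hab (by simp [h])
      have hbz : IsIntegral ℤ ((b : K) * z) :=
        (by simpa using isIntegral_algebraMap (R := ℤ) (A := K) (x := (b : ℤ)) :
          IsIntegral ℤ (b : K)).mul hz
      exact ihb hb z hz (iha ha _ hbz (by convert h using 1; push_cast; ring))
  obtain ⟨u, v, w, rfl⟩ := hsp z
  have ha0 : f.a.natAbs ≠ 0 := Int.natAbs_ne_zero.mpr hirr.a_ne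
  have haK : (f.a : K) ≠ 0 := by exact_mod_cast hirr.a_ne
  refine key (f.a.natAbs ^ 2 * (u.den * v.den * w.den)) ?_ _ hz ?_
  · have := u.den_ne_zero; have := v.den_ne_zero; have := w.den_ne_zero
    positivity
  · have hu : (u : K) = u.num / u.den := by
      exact_mod_cast congrArg (Rat.cast (K := K)) u.num_div_den.symm
    have hv : (v : K) = v.num / v.den := by
      exact_mod_cast congrArg (Rat.cast (K := K)) v.num_div_den.symm
    have hw : (w : K) = w.num / w.den := by
      exact_mod_cast congrArg (Rat.cast (K := K)) w.num_div_den.symm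
    have hu0 : (u.den : K) ≠ 0 := by exact_mod_cast u.den_ne_zero
    have hv0 : (v.den : K) ≠ 0 := by exact_mod_cast v.den_ne_zero
    have hw0 : (w.den : K) ≠ 0 := by exact_mod_cast w.den_ne_zero
    have habs : ((f.a.natAbs : ℕ) : K) ^ 2 = (f.a : K) ^ 2 := by
      have h : ((f.a.natAbs : ℤ)) ^ 2 = f.a ^ 2 := Int.natAbs_sq f.a
      have := congrArg (Int.cast (R := K)) h
      rwa [Int.cast_pow, Int.cast_pow, Int.cast_natCast] at this
    refine ⟨f.a ^ 2 * (u.num * v.den * w.den) - f.a * f.c * (w.num * u.den * v.den),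
      f.a * (v.num * u.den * w.den) - f.b * (w.num * u.den * v.den),
      f.a * (w.num * u.den * v.den), ?_⟩
    rw [hu, hv, hw]
    push_cast
    rw [habs]
    field_simp
    ring

end

open Polynomial in
/-- The dehomogenized form, over `ℚ`. -/
noncomputable def poly (f : BCF) : ℚ[X] :=
  C (f.a : ℚ) * X ^ 3 + C (f.b : ℚ) * X ^ 2 + C (f.c : ℚ) * X + C (f.d : ℚ)

theorem Irr.natDegree_poly {f : BCF} (hirr : f.Irr) : f.poly.natDegree = 3 :=
  Polynomial.natDegree_cubic (by exact_mod_cast hirr.a_ne)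

open Polynomial in
theorem Irr.irreducible_poly {f : BCF} (hirr : f.Irr) : Irreducible f.poly := by
  have hdeg := hirr.natDegree_poly
  apply irreducible_of_degree_le_three_of_not_isRoot
  · rw [hdeg]; decide
  · intro r h
    have h1 : (f.a : ℚ) * r ^ 3 + f.b * r ^ 2 + f.c * r + f.d = 0 := by
      simpa [poly, IsRoot] using h
    have hden : (r.den : ℚ) ≠ 0 := by exact_mod_cast r.den_ne_zero
    have hr : r = r.num / r.den := r.num_div_den.symm
    have h2 : f.eval r.num r.den = 0 := by
      rw [hr] at h1
      field_simp at h1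
      have : ((f.eval r.num r.den : ℤ) : ℚ) = 0 := by
        simp only [eval]
        push_cast
        linear_combination h1
      exact_mod_cast this
    have := (hirr _ _ h2).2
    exact r.den_ne_zero (by exact_mod_cast this)

open Polynomial in
/-- Every irreducible everywhere maximal form comes from a cubic field. -/
theorem exists_cubicField {f : BCF} (hirr : f.Irr) (hmax : ∀ p : ℕ, p.Prime → ¬ NonMax p f) :
    ∃ K : CubicField, f.RepBy K.carrier := by
  have haQ : (f.a : ℚ) ≠ 0 := by exact_mod_cast hirr.a_ne
  set P : ℚ[X] := C (f.a : ℚ) * X ^ 3 + C (f.b : ℚ) * X ^ 2 + C (f.c : ℚ) * X + C (f.d : ℚ)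
    with hP
  have hdeg : P.natDegree = 3 := natDegree_cubic haQ
  have hP0 : P ≠ 0 := by
    intro h; rw [h] at hdeg; simp at hdeg
  have hPirr : Irreducible P := hirr.irreducible_poly
  have : Fact (Irreducible P) := ⟨hPirr⟩
  let pb := AdjoinRoot.powerBasis hP0
  have : FiniteDimensional ℚ (AdjoinRoot P) := pb.finite
  have : CharZero (AdjoinRoot P) := charZero_of_injective_algebraMap (algebraMap ℚ _).injective
  have : NumberField (AdjoinRoot P) := { }
  have hfin : Module.finrank ℚ (AdjoinRoot P) = 3 := by
    rw [pb.finrank, AdjoinRoot.powerBasis_dim, hdeg]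
  refine ⟨⟨AdjoinRoot P, hfin⟩, ?_⟩
  have hspan : ∀ z : AdjoinRoot P, ∃ u v w : ℚ,
      z = u + v * AdjoinRoot.root P + w * AdjoinRoot.root P ^ 2 := by
    intro z
    obtain ⟨Q, rfl⟩ := AdjoinRoot.mk_surjective z
    have hmod : AdjoinRoot.mk P Q = AdjoinRoot.mk P (Q % P) := by
      conv_lhs => rw [← EuclideanDomain.div_add_mod Q P]
      simp
    have hlt : (Q % P).natDegree < 3 := by
      rw [← hdeg]
      exact natDegree_mod_lt Q (by rw [hdeg]; norm_num)
    have hcast : ∀ r : ℚ, AdjoinRoot.of P r = (r : AdjoinRoot P) := fun r =>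
      eq_ratCast (AdjoinRoot.of P) r
    rw [hmod, (Q % P).as_sum_range' 3 hlt]
    refine ⟨(Q % P).coeff 0, (Q % P).coeff 1, (Q % P).coeff 2, ?_⟩
    simp [Finset.sum_range_succ, ← C_mul_X_pow_eq_monomial, hcast]
  refine repBy_of_root (θ := AdjoinRoot.root P) hfin hirr ?_ ?_ hmax hspan
  · rintro ⟨r, hr⟩
    obtain ⟨z, hz, hzr⟩ := exists_integral_irrational hfin
    obtain ⟨u, v, w, rfl⟩ := hspan z
    exact hzr ⟨u + v * r + w * r ^ 2, by rw [hr]; push_cast; ring⟩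
  · have h0 : AdjoinRoot.mk P (C (f.a : ℚ) * X ^ 3 + C (f.b : ℚ) * X ^ 2 + C (f.c : ℚ) * X
        + C (f.d : ℚ)) = 0 := by
      rw [← hP]; exact AdjoinRoot.mk_self
    have hcast : ∀ r : ℚ, AdjoinRoot.of P r = (r : AdjoinRoot P) := fun r =>
      eq_ratCast (AdjoinRoot.of P) r
    simp only [map_add, map_mul, map_pow, AdjoinRoot.mk_X, AdjoinRoot.mk_C, hcast] at h0
    exact_mod_cast h0

end BCF

namespace BCF

/-- The setoid of equivalence of forms. -/
def equivSetoid : Setoid BCF := ⟨Equiv, Equiv.refl, Equiv.symm, Equiv.trans⟩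

/-- The class of a form. -/
def cls (f : BCF) : Quotient equivSetoid := Quotient.mk _ f

theorem cls_eq {f g : BCF} : cls f = cls g ↔ f.Equiv g := Quotient.eq (r := equivSetoid)

theorem equiv_out (f : BCF) : (cls f).out.Equiv f := Quotient.mk_out (s := equivSetoid) f

theorem cls_out (C : Quotient equivSetoid) : cls C.out = C := Quotient.out_eq C

/-- Irreducible forms with bounded discriminant of sign `ε`, not maximal at the primes in `s`. -/
def Fam (ε : ℤ) (s : Finset ℕ) (X : ℝ) : Set BCF :=
  {f | f.Irr ∧ 0 < ε * f.disc ∧ ((ε * f.disc : ℤ) : ℝ) < X ∧ ∀ p ∈ s, NonMax p f}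

theorem mem_fam_of_equiv {ε : ℤ} {s : Finset ℕ} {X : ℝ} {f g : BCF} (h : f.Equiv g)
    (hf : f ∈ Fam ε s X) : g ∈ Fam ε s X := by
  obtain ⟨h1, h2, h3, h4⟩ := hf
  refine ⟨h.irr h1, ?_, ?_, fun p hp => h.symm.nonMax (h4 p hp)⟩ <;> rwa [h.disc_eq]

theorem mem_fam_of_smul {ε : ℤ} {s : Finset ℕ} {X : ℝ} {p : ℕ} (hp : p.Prime)
    (hs : ∀ q ∈ s, q.Prime) (hps : p ∉ s) {g : BCF} (h : smul p g ∈ Fam ε s X) :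
    g ∈ Fam ε s (X / p ^ 4) := by
  obtain ⟨h1, h2, h3, h4⟩ := h
  have hp0 : (0 : ℝ) < p := by exact_mod_cast hp.pos
  have hpz : (0 : ℤ) < p := by exact_mod_cast hp.pos
  rw [disc_smul] at h2 h3
  refine ⟨irr_of_smul h1, ?_, ?_, ?_⟩
  · have : ε * (p ^ 4 * g.disc) = p ^ 4 * (ε * g.disc) := by ring
    rw [this] at h2
    exact pos_of_mul_pos_right h2 (by positivity)
  · rw [lt_div_iff₀ (by positivity)]
    calc _ = ((ε * ((p : ℤ) ^ 4 * g.disc) : ℤ) : ℝ) := by push_cast; ring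
      _ < X := h3
  · intro q hq
    refine nonMax_of_smul ?_ (h4 q hq)
    exact Nat.isCoprime_iff_coprime.mpr
      ((Nat.coprime_primes (hs q hq) hp).mpr fun h => hps (h ▸ hq))

theorem mem_fam_of_comp {ε : ℤ} {s : Finset ℕ} {X : ℝ} {p : ℕ} (hp : p.Prime)
    (hs : ∀ q ∈ s, q.Prime) (hps : p ∉ s) {f g : BCF} (h : f ∈ Fam ε s X)
    (hfg : smul p f = g.comp p 0 0 1) : g ∈ Fam ε s (X / p ^ 2) := by
  obtain ⟨h1, h2, h3, h4⟩ := h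
  have hp0 : (0 : ℝ) < p := by exact_mod_cast hp.pos
  have hpz : (0 : ℤ) < p := by exact_mod_cast hp.pos
  have hback : smul (p ^ 2) g = f.comp 1 0 0 p := by
    simp only [BCF.ext_iff, smul, comp] at hfg ⊢
    obtain ⟨e1, e2, e3, e4⟩ := hfg
    refine ⟨?_, ?_, ?_, ?_⟩
    · apply mul_left_cancel₀ hpz.ne'; linear_combination -e1
    · linear_combination -e2
    · linear_combination - p * e3
    · linear_combination - p ^ 2 * e4
  have hdisc : f.disc = p ^ 2 * g.disc := by
    have := congrArg disc hfg
    rw [disc_smul, disc_comp] at this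
    apply mul_left_cancel₀ (pow_ne_zero 4 hpz.ne')
    linear_combination this
  rw [hdisc] at h2 h3
  refine ⟨?_, ?_, ?_, ?_⟩
  · exact irr_of_smul (n := (p : ℤ) ^ 2) (hback ▸ irr_comp h1 (by simpa using hpz.ne'))
  · have : ε * (p ^ 2 * g.disc) = p ^ 2 * (ε * g.disc) := by ring
    rw [this] at h2
    exact pos_of_mul_pos_right h2 (by positivity)
  · rw [lt_div_iff₀ (by positivity)]
    calc _ = ((ε * ((p : ℤ) ^ 2 * g.disc) : ℤ) : ℝ) := by push_cast; ring
      _ < X := h3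
  · intro q hq
    have hcop : IsCoprime (q : ℤ) p := Nat.isCoprime_iff_coprime.mpr
      ((Nat.coprime_primes (hs q hq) hp).mpr fun h => hps (h ▸ hq))
    obtain ⟨u, v, huv⟩ := hcop
    refine nonMax_of_comp (x := p) (y := 0) (z := 0) (w := 1) (e := v)
      ⟨-u, by linear_combination huv⟩ ?_
    rw [← hfg]
    rcases h4 q hq with ⟨k1, k2, k3, k4⟩ | ⟨x, y, k0, k1, k2, k3⟩
    · exact Or.inl ⟨dvd_mul_of_dvd_right k1 _, dvd_mul_of_dvd_right k2 _,
        dvd_mul_of_dvd_right k3 _, dvd_mul_of_dvd_right k4 _⟩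
    · refine Or.inr ⟨x, y, k0, ?_, ?_, ?_⟩
      · rw [eval_smul]; exact dvd_mul_of_dvd_right k1 _
      · have : (smul p f).dx x y = p * f.dx x y := by simp only [dx, smul]; ring
        rw [this]; exact dvd_mul_of_dvd_right k2 _
      · have : (smul p f).dy x y = p * f.dy x y := by simp only [dy, smul]; ring
        rw [this]; exact dvd_mul_of_dvd_right k3 _

/-- Coefficientwise quotient. -/
def divc (n : ℤ) (f : BCF) : BCF := ⟨f.a / n, f.b / n, f.c / n, f.d / n⟩

theorem divc_smul {n : ℤ} (hn : n ≠ 0) (f : BCF) : divc n (smul n f) = f := by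
  ext <;> simp [divc, smul, hn]

theorem smul_divc {n : ℤ} {f : BCF} (h : DvdAll n f) : smul n (divc n f) = f := by
  obtain ⟨h1, h2, h3, h4⟩ := h
  ext <;> simp only [divc, smul] <;> exact Int.mul_ediv_cancel' (by assumption)

/-- The classes of forms obtained from `g` by passing to sublattices of index `p`. -/
noncomputable def under (p : ℕ) (g : BCF) : Finset (Quotient equivSetoid) := by
  classical
  exact insert (cls (divc p (g.comp 1 0 0 p)))
    (((Finset.range p).filter fun r : ℕ => (p : ℤ) ∣ g.eval r 1).image
      fun r : ℕ => cls (divc p (g.comp p r 0 1)))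

theorem card_under_le (p : ℕ) (g : BCF) : (under p g).card ≤ p + 1 := by
  classical
  unfold under
  refine (Finset.card_insert_le _ _).trans ?_
  gcongr
  refine Finset.card_image_le.trans ((Finset.card_filter_le _ _).trans ?_)
  simp

open Polynomial in
theorem card_under_le_four {p : ℕ} (hp : p.Prime) {g : BCF} (hg : ¬ DvdAll p g) :
    (under p g).card ≤ 4 := by
  classical
  unfold under
  refine (Finset.card_insert_le _ _).trans ?_
  suffices h : ((Finset.range p).filter fun r : ℕ => (p : ℤ) ∣ g.eval r 1).card ≤ 3 by
    have := Finset.card_image_le (s := (Finset.range p).filter fun r : ℕ => (p : ℤ) ∣ g.eval r 1)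
      (f := fun r : ℕ => cls (divc p (g.comp p r 0 1)))
    omega
  have : Fact p.Prime := ⟨hp⟩
  set P : (ZMod p)[X] := C (g.a : ZMod p) * X ^ 3 + C (g.b : ZMod p) * X ^ 2
    + C (g.c : ZMod p) * X + C (g.d : ZMod p) with hP
  have hP0 : P ≠ 0 := by
    intro h0
    apply hg
    have h1 := congrArg (fun P => coeff P 0) h0
    have h2 := congrArg (fun P => coeff P 1) h0
    have h3 := congrArg (fun P => coeff P 2) h0
    have h4 := congrArg (fun P => coeff P 3) h0
    simp only [hP, coeff_add, coeff_C_mul, coeff_X_pow, coeff_X, coeff_C, coeff_zero] at h1 h2 h3 h4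
    norm_num at h1 h2 h3 h4
    refine ⟨?_, ?_, ?_, ?_⟩ <;> rwa [← ZMod.intCast_zmod_eq_zero_iff_dvd]
  have hdeg : P.natDegree ≤ 3 := by rw [hP]; compute_degree
  have hinj : ((Finset.range p).filter fun r : ℕ => (p : ℤ) ∣ g.eval r 1).card
      ≤ P.roots.toFinset.card := by
    refine Finset.card_le_card_of_injOn (fun r => (r : ZMod p)) ?_ ?_
    · intro r hr
      simp only [Finset.coe_filter, Set.mem_ofPred_eq] at hr
      have h0 : ((g.eval r 1 : ℤ) : ZMod p) = 0 := by
        rw [ZMod.intCast_zmod_eq_zero_iff_dvd]; exact hr.2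
      simp only [eval] at h0
      push_cast at h0
      rw [Finset.mem_coe, Multiset.mem_toFinset, mem_roots hP0]
      simpa [hP, IsRoot] using h0
    · intro r hr r' hr' h
      simp only [Finset.coe_filter, Set.mem_ofPred_eq, Finset.mem_range] at hr hr'
      have := (ZMod.natCast_eq_natCast_iff' r r' p).mp h
      rwa [Nat.mod_eq_of_lt hr.1, Nat.mod_eq_of_lt hr'.1] at this
  exact hinj.trans ((Multiset.toFinset_card_le _).trans ((card_roots' _).trans hdeg))

theorem cls_mem_under {p : ℕ} (hp : p.Prime) {f g G : BCF} (hG : G.Equiv g)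
    (hfg : smul p f = g.comp p 0 0 1) : cls f ∈ under p G := by
  classical
  have hpz : (p : ℤ) ≠ 0 := by exact_mod_cast hp.ne_zero
  have hp' : Prime (p : ℤ) := Nat.prime_iff_prime_int.mp hp
  obtain ⟨m1, m2, m3, m4, hdet, rfl⟩ := hG
  rw [comp_comp] at hfg
  simp only [mul_zero, add_zero, mul_one, zero_add] at hfg
  have key : ∀ t1 t2 t3 t4 u1 u2 u3 u4 : ℤ, (u1 * u4 - u2 * u3) ^ 2 = 1 →
      smul p f = (G.comp t1 t2 t3 t4).comp u1 u2 u3 u4 →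
      DvdAll p (G.comp t1 t2 t3 t4) ∧ cls f = cls (divc p (G.comp t1 t2 t3 t4)) := by
    intro t1 t2 t3 t4 u1 u2 u3 u4 hu h
    have hE : (G.comp t1 t2 t3 t4).Equiv (smul p f) := ⟨u1, u2, u3, u4, hu, h⟩
    obtain ⟨v1, v2, v3, v4, hv, h'⟩ := hE.symm
    rw [smul_comp] at h'
    rw [h', divc_smul hpz]
    exact ⟨⟨Dvd.intro _ rfl, Dvd.intro _ rfl, Dvd.intro _ rfl, Dvd.intro _ rfl⟩,
      cls_eq.mpr ⟨v1, v2, v3, v4, hv, rfl⟩⟩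
  unfold under
  by_cases h4 : (p : ℤ) ∣ m4
  · obtain ⟨k, rfl⟩ := h4
    obtain ⟨-, h⟩ := key 1 0 0 p (m1 * p) m2 m3 k (by rw [← hdet]; ring) (by
      rw [hfg, comp_comp]; congr 1 <;> ring)
    rw [h]
    exact Finset.mem_insert_self _ _
  · obtain ⟨u, v, huv⟩ := (Prime.coprime_iff_not_dvd hp').mpr h4
    set r : ℕ := (m2 * v % p).toNat with hr
    have hr0 : (r : ℤ) = m2 * v % p := Int.toNat_of_nonneg (Int.emod_nonneg _ hpz)
    have hlt : r < p := by
      have := Int.emod_lt_of_pos (m2 * v) (by exact_mod_cast hp.pos : (0 : ℤ) < p)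
      omega
    obtain ⟨k, hk⟩ : (p : ℤ) ∣ m2 - r * m4 := by
      refine ⟨m2 * u + m4 * (m2 * v / p), ?_⟩
      have := Int.mul_ediv_add_emod (m2 * v) p
      rw [hr0]
      linear_combination (-m2) * huv + (- m4) * this
    obtain ⟨hd, h⟩ := key p r 0 1 (m1 - r * m3) k (p * m3) m4 (by
        rw [← hdet]; congr 1; linear_combination (m3) * hk) (by
      rw [hfg, comp_comp]; congr 1
      · ring
      · linear_combination hk
      · ring
      · ring)
    rw [h]
    refine Finset.mem_insert_of_mem (Finset.mem_image.mpr ⟨r, ?_, rfl⟩)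
    rw [Finset.mem_filter, Finset.mem_range]
    refine ⟨hlt, ?_⟩
    have := hd.2.2.2
    simpa [BCF.comp, eval] using this

/-- The number of classes of forms not maximal at the primes in `s`. -/
theorem ncard_cls_fam_le {ε : ℤ} {C : ℝ} (hC : ∀ X : ℝ, 0 < X →
      (cls '' Fam ε ∅ X).Finite ∧ ((cls '' Fam ε ∅ X).ncard : ℝ) ≤ C * X)
    (s : Finset ℕ) (hs : ∀ p ∈ s, p.Prime) (X : ℝ) (hX : 0 < X) :
    ((cls '' Fam ε s X).ncard : ℝ) ≤ C * X * ∏ p ∈ s, (5 / (p : ℝ) ^ 2) := by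
  classical
  have hC0 : 0 ≤ C := by
    have := (hC 1 one_pos).2
    exact (Nat.cast_nonneg _).trans (by simpa using this)
  have hfin : ∀ s : Finset ℕ, ∀ X : ℝ, 0 < X → (cls '' Fam ε s X).Finite := fun s X hX =>
    (hC X hX).1.subset (Set.image_mono fun f ⟨h1, h2, h3, _⟩ => ⟨h1, h2, h3, by simp⟩)
  induction s using Finset.induction_on generalizing X with
  | empty => simpa using (hC X hX).2
  | insert p s hps ih =>
    have hp : p.Prime := hs p (Finset.mem_insert_self _ _)
    have hs' : ∀ q ∈ s, q.Prime := fun q hq => hs q (Finset.mem_insert_of_mem hq)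
    have hpz : (p : ℤ) ≠ 0 := by exact_mod_cast hp.ne_zero
    have hpr : (0 : ℝ) < p := by exact_mod_cast hp.pos
    have ih' := fun X hX => ih hs' X hX
    have hX2 : 0 < X / p ^ 2 := by positivity
    have hX4 : 0 < X / p ^ 4 := by positivity
    have hX6 : 0 < X / p ^ 2 / p ^ 4 := by positivity
    set A := (hfin s _ hX4).toFinset with hA
    set B := (hfin s _ hX2).toFinset with hB
    set D := (hfin s _ hX6).toFinset with hD
    have cA : (A.card : ℝ) ≤ C * (X / p ^ 4) * ∏ p ∈ s, (5 / (p : ℝ) ^ 2) := by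
      rw [hA, ← Set.ncard_eq_toFinset_card _ (hfin s _ (by positivity))]; exact ih' _ hX4
    have cB : (B.card : ℝ) ≤ C * (X / p ^ 2) * ∏ p ∈ s, (5 / (p : ℝ) ^ 2) := by
      rw [hB, ← Set.ncard_eq_toFinset_card _ (hfin s _ (by positivity))]; exact ih' _ hX2
    have cD : (D.card : ℝ) ≤ C * (X / p ^ 2 / p ^ 4) * ∏ p ∈ s, (5 / (p : ℝ) ^ 2) := by
      rw [hD, ← Set.ncard_eq_toFinset_card _ (hfin s _ (by positivity))]; exact ih' _ hX6
    have hsub : cls '' Fam ε (insert p s) X ⊆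
        ((A.image fun c => cls (smul p c.out)) ∪ B.biUnion fun c => under p c.out :
          Finset (Quotient equivSetoid)) := by
      rintro _ ⟨f, hf, rfl⟩
      have hf' : f ∈ Fam ε s X :=
        ⟨hf.1, hf.2.1, hf.2.2.1, fun q hq => hf.2.2.2 q (Finset.mem_insert_of_mem hq)⟩
      rw [Finset.mem_coe, Finset.mem_union]
      rcases (hf.2.2.2 p (Finset.mem_insert_self _ _)).normal_form hp with h | ⟨F, hF, ha, hb⟩
      · left
        rw [← smul_divc h] at hf' ⊢
        refine Finset.mem_image.mpr ⟨cls (divc p f), ?_, ?_⟩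
        · rw [hA, Set.Finite.mem_toFinset]
          exact ⟨_, mem_fam_of_smul hp hs' hps hf', rfl⟩
        · obtain ⟨x, y, z, w, hdet, h'⟩ := equiv_out (divc p f)
          exact cls_eq.mpr ⟨x, y, z, w, hdet, by rw [smul_comp, ← h']⟩
      · right
        obtain ⟨a', ha'⟩ := ha
        obtain ⟨b', hb'⟩ := hb
        have hg : smul p F = (⟨a', b', F.c, p * F.d⟩ : BCF).comp p 0 0 1 := by
          ext <;> simp only [smul, BCF.comp, ha', hb'] <;> ring
        refine Finset.mem_biUnion.mpr ⟨cls ⟨a', b', F.c, p * F.d⟩, ?_, ?_⟩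
        · rw [hB, Set.Finite.mem_toFinset]
          exact ⟨_, mem_fam_of_comp hp hs' hps (mem_fam_of_equiv hF hf') hg, rfl⟩
        · rw [cls_eq.mpr hF]
          exact cls_mem_under hp (equiv_out _) hg
    set B' := B.filter fun c => DvdAll p c.out with hB'
    have hB'D : B'.card ≤ D.card := by
      refine Finset.card_le_card_of_injOn (fun c => cls (divc p c.out)) ?_ ?_
      · intro c hc
        simp only [hB', Finset.coe_filter, Set.mem_ofPred_eq, hB, Set.Finite.mem_toFinset] at hc
        obtain ⟨⟨f, hf, rfl⟩, hd⟩ := hc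
        simp only [hD, Set.Finite.coe_toFinset]
        refine ⟨_, mem_fam_of_smul hp hs' hps ?_, rfl⟩
        rw [smul_divc hd]
        exact mem_fam_of_equiv (equiv_out f).symm hf
      · intro c hc c' hc' h
        simp only [hB', Finset.coe_filter, Set.mem_ofPred_eq] at hc hc'
        obtain ⟨x, y, z, w, hdet, h'⟩ := cls_eq.mp h
        have := congrArg (smul p) h'
        rw [← smul_comp, smul_divc hc.2, smul_divc hc'.2] at this
        rw [← cls_out c, ← cls_out c']
        exact cls_eq.mpr ⟨x, y, z, w, hdet, this⟩
    have hcard : (B.biUnion fun c => under p c.out).card ≤ 4 * B.card + (p + 1) * D.card := by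
      refine Finset.card_biUnion_le.trans ?_
      have h1 : ∀ c ∈ B, (under p c.out).card ≤ 4 + if DvdAll p c.out then p + 1 else 0 := by
        intro c _
        split_ifs with h
        · have := card_under_le p c.out; omega
        · exact card_under_le_four hp h
      refine (Finset.sum_le_sum h1).trans ?_
      rw [Finset.sum_add_distrib, ← Finset.sum_filter, Finset.sum_const, Finset.sum_const,
        smul_eq_mul, smul_eq_mul, mul_comm B.card, mul_comm _ (p + 1)]
      gcongr
    have htot : (cls '' Fam ε (insert p s) X).ncard ≤ A.card + (4 * B.card + (p + 1) * D.card) := by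
      refine (Set.ncard_le_ncard hsub (Finset.finite_toSet _)).trans ?_
      rw [Set.ncard_coe_finset]
      refine (Finset.card_union_le _ _).trans (add_le_add Finset.card_image_le hcard)
    rw [Finset.prod_insert hps]
    set Z := ∏ p ∈ s, (5 / (p : ℝ) ^ 2) with hZ
    have hZ0 : 0 ≤ Z := Finset.prod_nonneg fun _ _ => by positivity
    have htot' : ((cls '' Fam ε (insert p s) X).ncard : ℝ) ≤
        A.card + (4 * B.card + (p + 1) * D.card) := by exact_mod_cast htot
    have hp2 : (2 : ℝ) ≤ p := by exact_mod_cast hp.two_le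
    calc _ ≤ _ := htot'
      _ ≤ C * (X / p ^ 4) * Z + (4 * (C * (X / p ^ 2) * Z)
          + (p + 1) * (C * (X / p ^ 2 / p ^ 4) * Z)) := by gcongr
      _ = C * X * Z * ((p ^ 2 + 4 * p ^ 4 + (p + 1)) / p ^ 6) := by field_simp; ring
      _ ≤ C * X * Z * (5 / p ^ 2) := by
          gcongr ?_ * ?_
          rw [div_le_div_iff₀ (by positivity) (by positivity)]
          have : (p : ℝ) ^ 2 + (p + 1) ≤ p ^ 4 := by
            nlinarith [sq_nonneg ((p : ℝ) - 2), sq_nonneg ((p : ℝ)^2 - 4)]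
          nlinarith [pow_pos hpr 2]
      _ = _ := by ring

end BCF

namespace BCF

open Polynomial in
theorem RepBy.nonempty_adjoinRoot_equiv {K : Type*} [Field K] [NumberField K]
    (hK : Module.finrank ℚ K = 3) {f : BCF} (h : f.RepBy K) :
    Nonempty (AdjoinRoot f.poly ≃+* K) := by
  have hirr := h.irr hK
  obtain ⟨θ, -, hr, -⟩ := h
  have hdeg := hirr.natDegree_poly
  have hP0 : f.poly ≠ 0 := by
    intro h; rw [h] at hdeg; simp at hdeg
  have : Fact (Irreducible f.poly) := ⟨hirr.irreducible_poly⟩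
  let pb := AdjoinRoot.powerBasis hP0
  have : FiniteDimensional ℚ (AdjoinRoot f.poly) := pb.finite
  have hfin : Module.finrank ℚ (AdjoinRoot f.poly) = Module.finrank ℚ K := by
    rw [hK, pb.finrank, AdjoinRoot.powerBasis_dim, hdeg]
  have h0 : f.poly.eval₂ (algebraMap ℚ K) θ = 0 := by
    simp only [poly, eval₂_add, eval₂_mul, eval₂_C, eval₂_X_pow, eval₂_X]
    simp only [map_intCast]
    exact hr
  let φ : AdjoinRoot f.poly →ₐ[ℚ] K := AdjoinRoot.liftAlgHom f.poly (Algebra.ofId ℚ K) θ h0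
  have hinj : Function.Injective φ := φ.toRingHom.injective
  have hsurj : Function.Surjective φ :=
    (LinearMap.injective_iff_surjective_of_finrank_eq_finrank hfin (f := φ.toLinearMap)).mp hinj
  exact ⟨(AlgEquiv.ofBijective φ ⟨hinj, hsurj⟩).toRingEquiv⟩

theorem RepBy.nonempty_ringEquiv {K L : Type*} [Field K] [NumberField K] [Field L] [NumberField L]
    (hK : Module.finrank ℚ K = 3) (hL : Module.finrank ℚ L = 3) {f : BCF} (h : f.RepBy K)
    (h' : f.RepBy L) : Nonempty (K ≃+* L) := by
  obtain ⟨e⟩ := h.nonempty_adjoinRoot_equiv hK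
  obtain ⟨e'⟩ := h'.nonempty_adjoinRoot_equiv hL
  exact ⟨e.symm.trans e'⟩

/-- Irreducible, everywhere maximal forms with bounded discriminant of sign `ε`. -/
def MaxFam (ε : ℤ) (X : ℝ) : Set BCF :=
  {f | f.Irr ∧ 0 < ε * f.disc ∧ ((ε * f.disc : ℤ) : ℝ) < X ∧ ∀ p : ℕ, p.Prime → ¬ NonMax p f}

/-- Cubic fields correspond to classes of irreducible maximal forms. -/
theorem countCubic_eq (ε : ℤ) (X : ℝ) :
    countCubic (fun d => 0 < ε * d ∧ ((ε * d : ℤ) : ℝ) < X) = (cls '' MaxFam ε X).ncard := by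
  rw [countCubic, ← Nat.card_coe_set_eq]
  symm
  choose F hF using fun K : CubicField => exists_repBy K.deg
  have hmax : ∀ {K : CubicField} {f : BCF}, f.RepBy K.carrier →
      0 < ε * NumberField.discr K.carrier → ((ε * NumberField.discr K.carrier : ℤ) : ℝ) < X →
      f ∈ MaxFam ε X := by
    intro K f h h1 h2
    rw [RepBy.discr_eq K.deg h] at h1 h2
    exact ⟨h.irr K.deg, h1, h2, fun p hp => h.not_nonMax K.deg hp⟩
  have hG : ∀ f : MaxFam ε X, ∃ K : CubicField, f.1.RepBy K.carrier := fun f =>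
    exists_cubicField f.2.1 f.2.2.2.2
  choose G hG using hG
  refine Nat.card_congr (Equiv.ofBijective (fun C : (cls '' MaxFam ε X) =>
    (⟨⟦G ⟨C.2.choose, C.2.choose_spec.1⟩⟧, G ⟨C.2.choose, C.2.choose_spec.1⟩, rfl, ?_⟩ :
      {C : Quotient CubicField.setoid // ∃ K : CubicField, ⟦K⟧ = C ∧
        (0 < ε * NumberField.discr K.carrier ∧
          ((ε * NumberField.discr K.carrier : ℤ) : ℝ) < X)})) ⟨?_, ?_⟩)
  · rw [RepBy.discr_eq (G _).deg (hG _)]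
    exact ⟨C.2.choose_spec.1.2.1, C.2.choose_spec.1.2.2.1⟩
  · intro C D h
    have h1 : (⟦G ⟨C.2.choose, C.2.choose_spec.1⟩⟧ : Quotient CubicField.setoid)
      = ⟦G ⟨D.2.choose, D.2.choose_spec.1⟩⟧ := congrArg Subtype.val h
    obtain ⟨e⟩ := Quotient.exact h1
    have h2 := ((hG ⟨C.2.choose, C.2.choose_spec.1⟩).congr e).equiv (G _).deg
      (hG ⟨D.2.choose, D.2.choose_spec.1⟩)
    apply Subtype.ext
    rw [← C.2.choose_spec.2, ← D.2.choose_spec.2]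
    exact cls_eq.mpr h2
  · rintro ⟨_, K, rfl, h1, h2⟩
    have hm := hmax (hF K) h1 h2
    refine ⟨⟨cls (F K), F K, hm, rfl⟩, ?_⟩
    apply Subtype.ext
    apply Quotient.sound
    have hex : ∃ f, f ∈ MaxFam ε X ∧ cls f = cls (F K) := ⟨F K, hm, rfl⟩
    have hE := cls_eq.mp hex.choose_spec.2
    obtain ⟨p, q, r, s, hdet, hpq⟩ := hE
    have h3 := (hG ⟨hex.choose, hex.choose_spec.1⟩).comp (G _).deg hdet
    rw [← hpq] at h3
    exact h3.nonempty_ringEquiv (G _).deg K.deg (hF K)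

end BCF

/-- Reduction of positive definite real binary quadratic forms. -/
theorem exists_reduced {A B C : ℝ} (hA : 0 < A) (hD : B ^ 2 < 4 * A * C) :
    ∃ p q r s : ℤ, p * s - q * r = 1 ∧
      |2 * A * p * q + B * (p * s + q * r) + 2 * C * r * s| ≤ A * p ^ 2 + B * p * r + C * r ^ 2 ∧
      A * p ^ 2 + B * p * r + C * r ^ 2 ≤ A * q ^ 2 + B * q * s + C * s ^ 2 := by
  set Q : ℤ × ℤ → ℝ := fun z => A * z.1 ^ 2 + B * z.1 * z.2 + C * z.2 ^ 2 with hQ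
  have hC : 0 < C := by nlinarith [sq_nonneg B]
  have hQsq : ∀ z : ℤ × ℤ, (4 * A * C - B ^ 2) * z.2 ^ 2 ≤ 4 * A * Q z := fun z => by
    simp only [hQ]; nlinarith [sq_nonneg (2 * A * z.1 + B * z.2)]
  have hQsq' : ∀ z : ℤ × ℤ, (4 * A * C - B ^ 2) * z.1 ^ 2 ≤ 4 * C * Q z := fun z => by
    simp only [hQ]; nlinarith [sq_nonneg (2 * C * z.2 + B * z.1)]
  have hQ0 : ∀ z : ℤ × ℤ, z ≠ 0 → 0 < Q z := by
    intro z hz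
    by_cases h : z.2 = 0
    · have h1 : z.1 ≠ 0 := fun h' => hz (Prod.ext h' h)
      have : (0 : ℝ) < (z.1 : ℝ) ^ 2 := by positivity
      have := hQsq' z
      nlinarith
    · have : (0 : ℝ) < (z.2 : ℝ) ^ 2 := by positivity
      have := hQsq z
      nlinarith
  obtain ⟨N, hN⟩ := exists_nat_gt ((4 * A * A + 4 * C * A) / (4 * A * C - B ^ 2))
  rw [div_lt_iff₀ (by linarith)] at hN
  set S : Finset (ℤ × ℤ) := (Finset.Icc (-(N + 1 : ℤ)) (N + 1)
      ×ˢ Finset.Icc (-(N + 1 : ℤ)) (N + 1)).erase 0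
  have hS : ((1, 0) : ℤ × ℤ) ∈ S := by
    simp only [S, Finset.mem_erase, Finset.mem_product, Finset.mem_Icc]
    refine ⟨by simp, ⟨by omega, by omega⟩, by omega, by omega⟩
  obtain ⟨z, hzS, hz⟩ := Finset.exists_min_image S Q ⟨_, hS⟩
  have hmin : ∀ y : ℤ × ℤ, y ≠ 0 → Q z ≤ Q y := by
    intro y hy
    by_cases hyS : y ∈ S
    · exact hz y hyS
    · have h1 : Q z ≤ A := (hz _ hS).trans (by simp [hQ])
      have hsq : ∀ n : ℤ, n ∉ Finset.Icc (-(N + 1 : ℤ)) (N + 1) → (N : ℝ) ≤ (n : ℝ) ^ 2 := by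
        intro n hn
        rw [Finset.mem_Icc, not_and_or, not_le, not_le] at hn
        have h : (N : ℤ) ≤ n ^ 2 := by rcases hn with h | h <;> nlinarith
        exact_mod_cast h
      have : y.1 ∉ Finset.Icc (-(N + 1 : ℤ)) (N + 1) ∨ y.2 ∉ Finset.Icc (-(N + 1 : ℤ)) (N + 1) := by
        by_contra! h
        exact hyS (Finset.mem_erase.mpr ⟨hy, Finset.mem_product.mpr h⟩)
      refine h1.trans ?_
      rcases this with h | h
      · have h2 := hsq _ h
        have h3 := hQsq' y
        have h4 : (4 * A * C - B ^ 2) * N ≤ (4 * A * C - B ^ 2) * (y.1 : ℝ) ^ 2 := by gcongr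
        have h5 : 4 * C * A ≤ 4 * C * Q y := by nlinarith
        exact le_of_mul_le_mul_left h5 (by linarith)
      · have h2 := hsq _ h
        have h3 := hQsq y
        have h4 : (4 * A * C - B ^ 2) * N ≤ (4 * A * C - B ^ 2) * (y.2 : ℝ) ^ 2 := by gcongr
        have h5 : 4 * A * A ≤ 4 * A * Q y := by nlinarith
        exact le_of_mul_le_mul_left h5 (by linarith)
  have hz0 : z ≠ 0 := (Finset.mem_erase.mp hzS).1
  obtain ⟨p, r⟩ := z
  have hcop : IsCoprime p r := by
    have hg : 0 < Int.gcd p r := by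
      rw [Nat.pos_iff_ne_zero, Ne, Int.gcd_eq_zero_iff]
      rintro ⟨rfl, rfl⟩; exact hz0 rfl
    obtain ⟨p', hp'⟩ := Int.gcd_dvd_left p r
    obtain ⟨r', hr'⟩ := Int.gcd_dvd_right p r
    rw [Int.isCoprime_iff_gcd_eq_one]
    by_contra hne
    have h2 : (2 : ℝ) ≤ Int.gcd p r := by
      have : 2 ≤ Int.gcd p r := by omega
      exact_mod_cast this
    have hy0 : ((p', r') : ℤ × ℤ) ≠ 0 := by
      intro h
      rw [Prod.mk_eq_zero] at h
      apply hz0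
      rw [Prod.mk_eq_zero]
      refine ⟨by rw [hp', h.1, mul_zero], by rw [hr', h.2, mul_zero]⟩
    have h3 := hmin _ hy0
    have h4 := hQ0 _ hy0
    have h5 : Q (p, r) = (Int.gcd p r : ℝ) ^ 2 * Q (p', r') := by
      have e1 : (p : ℝ) = Int.gcd p r * p' := by exact_mod_cast hp'
      have e2 : (r : ℝ) = Int.gcd p r * r' := by exact_mod_cast hr'
      simp only [hQ]
      generalize (Int.gcd p r : ℝ) = g at e1 e2
      rw [e1, e2]; ring
    rw [h5] at h3
    have h6 : (4 : ℝ) ≤ (Int.gcd p r : ℝ) ^ 2 := by nlinarith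
    nlinarith
  obtain ⟨s, q, hsq⟩ := hcop
  set n : ℤ := - round ((2 * A * p * (-q) + B * (p * s + (-q) * r) + 2 * C * r * s)
      / (2 * Q (p, r)))
    with hn
  have hQz := hQ0 _ hz0
  refine ⟨p, -q + n * p, r, s + n * r, by linear_combination hsq, ?_, ?_⟩
  · have h1 := abs_sub_round ((2 * A * p * (-q) + B * (p * s + (-q) * r) + 2 * C * r * s)
        / (2 * Q (p, r)))
    have h2 : 2 * A * p * ((-q + n * p : ℤ) : ℝ)
        + B * (p * ((s + n * r : ℤ) : ℝ) + ((-q + n * p : ℤ) : ℝ) * r)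
        + 2 * C * r * ((s + n * r : ℤ) : ℝ) = 2 * Q (p, r) *
        ((2 * A * p * (-q) + B * (p * s + (-q) * r) + 2 * C * r * s) / (2 * Q (p, r))
        - round ((2 * A * p * (-q) + B * (p * s + (-q) * r) + 2 * C * r * s)
          / (2 * Q (p, r)))) := by
      rw [mul_sub, mul_div_cancel₀ _ (by positivity)]
      have : (n : ℝ) = - (round ((2 * A * p * (-q) + B * (p * s + (-q) * r) + 2 * C * r * s)
        / (2 * Q (p, r))) : ℝ) := by rw [hn]; push_cast; ring
      push_cast
      rw [← neg_eq_iff_eq_neg] at this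
      rw [← this]
      simp only [hQ]
      ring
    rw [h2, abs_mul, abs_of_pos (by positivity)]
    have : Q (p, r) = A * p ^ 2 + B * p * r + C * r ^ 2 := rfl
    rw [← this]
    nlinarith
  · refine hmin (-q + n * p, s + n * r) ?_
    intro h
    rw [Prod.mk_eq_zero] at h
    have : p * (s + n * r) - (-q + n * p) * r = 1 := by linear_combination hsq
    rw [h.1, h.2] at this
    simp at this

theorem lt_of_reduced {A B C : ℝ} (h1 : |B| < A) (h2 : A < C) (x y : ℤ) (hy : y ≠ 0) :
    A < A * x ^ 2 + B * x * y + C * y ^ 2 := by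
  have hy1 : (1 : ℝ) ≤ |(y : ℝ)| := by exact_mod_cast Int.one_le_abs hy
  have hA : 0 < A := (abs_nonneg B).trans_lt h1
  have hB : -(A * (|(x : ℝ)| * |(y : ℝ)|)) ≤ B * x * y := by
    have : |B * x * y| ≤ A * (|(x : ℝ)| * |(y : ℝ)|) := by
      rw [abs_mul, abs_mul, mul_assoc]
      gcongr
    exact (abs_le.mp this).1
  have hx2 : (x : ℝ) ^ 2 = |(x : ℝ)| ^ 2 := (sq_abs _).symm
  have hy2 : (y : ℝ) ^ 2 = |(y : ℝ)| ^ 2 := (sq_abs _).symm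
  have hk : (1 : ℝ) ≤ |(x : ℝ)| ^ 2 - |(x : ℝ)| * |(y : ℝ)| + |(y : ℝ)| ^ 2 := by
    have h : 1 ≤ |x| ^ 2 - |x| * |y| + |y| ^ 2 := by
      have := Int.one_le_abs hy
      have h0 := abs_nonneg x
      by_contra! h
      nlinarith [sq_nonneg (2 * |x| - |y|), sq_nonneg (|x| - |y|), mul_nonneg h0 (abs_nonneg y)]
    exact_mod_cast h
  have hC : A * |(y : ℝ)| ^ 2 < C * |(y : ℝ)| ^ 2 := by gcongr
  rw [hx2, hy2]
  nlinarith

/-- Equivalences between strictly reduced forms are diagonal. -/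
theorem diag_of_reduced {A B C : ℝ} {p q r s : ℤ} (hdet : (p * s - q * r) ^ 2 = 1)
    (h1 : |B| < A) (h2 : A < C)
    (h3 : |2 * A * p * q + B * (p * s + q * r) + 2 * C * r * s| < A * p ^ 2 + B * p * r + C * r ^ 2)
    (h4 : A * p ^ 2 + B * p * r + C * r ^ 2 < A * q ^ 2 + B * q * s + C * s ^ 2) :
    q = 0 ∧ r = 0 := by
  have hdetR : ((p : ℝ) * s - q * r) ^ 2 = 1 := by exact_mod_cast hdet
  have hr : r = 0 := by
    by_contra hr
    have k1 := lt_of_reduced h1 h2 p r hr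
    have k2 := lt_of_reduced h3 h4 s (-r) (by simpa using hr)
    have : (A * p ^ 2 + B * p * r + C * r ^ 2) * s ^ 2
        + (2 * A * p * q + B * (p * s + q * r) + 2 * C * r * s) * s * ((-r : ℤ) : ℝ)
        + (A * q ^ 2 + B * q * s + C * s ^ 2) * ((-r : ℤ) : ℝ) ^ 2 = A * (p * s - q * r) ^ 2 := by
      push_cast; ring
    rw [this, hdetR] at k2
    linarith
  subst hr
  refine ⟨?_, rfl⟩
  by_contra hq
  have hps : (p * s) ^ 2 = 1 := by simpa using hdet
  have hp : p ^ 2 = 1 := by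
    rw [mul_pow] at hps
    exact (Int.eq_one_or_neg_one_of_mul_eq_one hps).resolve_right
      (by have := sq_nonneg p; omega)
  have hs : s ^ 2 = 1 := by rw [mul_pow, hp, one_mul] at hps; exact hps
  have hp' : |(p : ℝ)| = 1 := by
    have : (p : ℝ) ^ 2 = 1 := by exact_mod_cast hp
    rwa [← sq_abs, pow_eq_one_iff_of_nonneg (abs_nonneg _) two_ne_zero] at this
  have hs' : |(s : ℝ)| = 1 := by
    have : (s : ℝ) ^ 2 = 1 := by exact_mod_cast hs
    rwa [← sq_abs, pow_eq_one_iff_of_nonneg (abs_nonneg _) two_ne_zero] at this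
  have hq' : (1 : ℝ) ≤ |(q : ℝ)| := by exact_mod_cast Int.one_le_abs hq
  have hpR : (p : ℝ) ^ 2 = 1 := by exact_mod_cast hp
  simp only [Int.cast_zero, mul_zero, add_zero, zero_mul, zero_pow two_ne_zero, hpR, mul_one] at h3
  have hA : 0 < A := (abs_nonneg B).trans_lt h1
  have k1 : |2 * A * p * q| = 2 * A * |(q : ℝ)| := by
    rw [abs_mul, abs_mul, hp', abs_of_pos (by positivity)]; ring
  have k2 : |B * (p * s)| = |B| := by rw [abs_mul, abs_mul, hp', hs']; ring
  have k3 := abs_sub_abs_le_abs_sub (2 * A * p * q) (-(B * (p * s)))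
  rw [abs_neg, k1, k2, sub_neg_eq_add] at k3
  nlinarith

/-- Strictly reduced real cubic forms of positive discriminant: the Hessian is reduced. -/
def RPos (a b c d : ℝ) : Prop :=
  b * c - 9 * a * d < b ^ 2 - 3 * a * c ∧ -(b * c - 9 * a * d) < b ^ 2 - 3 * a * c ∧
    b ^ 2 - 3 * a * c < c ^ 2 - 3 * b * d

/-- Strictly reduced real cubic forms of negative discriminant: the definite factor is reduced. -/
def RNeg (a b c d : ℝ) : Prop :=
  0 < a * d - b * c + (a - b) ^ 2 + a * c ∧ 0 < (a + b) ^ 2 + a * c + b * c - a * d ∧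
    0 < d ^ 2 - a ^ 2 + a * c - b * d

/-- The closed version of `RPos`. -/
def RPosC (a b c d : ℝ) : Prop :=
  b * c - 9 * a * d ≤ b ^ 2 - 3 * a * c ∧ -(b * c - 9 * a * d) ≤ b ^ 2 - 3 * a * c ∧
    b ^ 2 - 3 * a * c ≤ c ^ 2 - 3 * b * d

/-- The closed version of `RNeg`. -/
def RNegC (a b c d : ℝ) : Prop :=
  0 ≤ a * d - b * c + (a - b) ^ 2 + a * c ∧ 0 ≤ (a + b) ^ 2 + a * c + b * c - a * d ∧
    0 ≤ d ^ 2 - a ^ 2 + a * c - b * d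

/-- Three times the discriminant is minus the discriminant of the Hessian. -/
theorem hessian_disc (a b c d : ℝ) : 4 * (b ^ 2 - 3 * a * c) * (c ^ 2 - 3 * b * d)
    - (b * c - 9 * a * d) ^ 2 = 3 * cubicDisc a b c d := by
  unfold cubicDisc; ring

theorem hessian_pos {a b c d : ℝ} (ha : a ≠ 0) (hD : 0 < cubicDisc a b c d) :
    0 < b ^ 2 - 3 * a * c := by
  have h : 4 * (b ^ 2 - 3 * a * c) ^ 3 = (2 * b ^ 3 - 9 * a * b * c + 27 * a ^ 2 * d) ^ 2
      + 27 * a ^ 2 * cubicDisc a b c d := by unfold cubicDisc; ring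
  have h1 : 0 < (b ^ 2 - 3 * a * c) ^ 3 := by
    have : 0 < a ^ 2 * cubicDisc a b c d := by positivity
    nlinarith [sq_nonneg (2 * b ^ 3 - 9 * a * b * c + 27 * a ^ 2 * d)]
  by_contra! h2
  have : (b ^ 2 - 3 * a * c) ^ 3 ≤ 0 := by
    have := mul_nonneg (neg_nonneg.mpr h2) (sq_nonneg (b ^ 2 - 3 * a * c))
    nlinarith
  linarith

/-- Coordinates adapted to the root of the Hessian. -/
theorem exists_param_pos {a b c d : ℝ} (ha : a ≠ 0) (hD : 0 < cubicDisc a b c d) :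
    ∃ w σ t : ℝ, 0 < t ∧ b = -3 * (a * σ - w * t) ∧
      c = 3 * (a * (σ ^ 2 - t ^ 2) - 2 * w * σ * t) ∧
      d = -(a * (σ ^ 3 - 3 * σ * t ^ 2) - w * (3 * σ ^ 2 * t - t ^ 3)) := by
  have hA := hessian_pos ha hD
  have hH := hessian_disc a b c d
  set A := b ^ 2 - 3 * a * c with hAdef
  set B := b * c - 9 * a * d with hBdef
  set C := c ^ 2 - 3 * b * d with hCdef
  set t := √(3 * cubicDisc a b c d) / (2 * A) with ht
  set σ := -B / (2 * A) with hσ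
  have ht0 : 0 < t := by positivity
  have hsum : σ ^ 2 + t ^ 2 = C / A := by
    rw [hσ, ht, div_pow, div_pow, Real.sq_sqrt (by linarith), ← hH]
    field_simp
    ring
  have hAC : A * (σ ^ 2 + t ^ 2) = C := by rw [hsum]; field_simp
  have hAB : A * σ = -B / 2 := by rw [hσ]; field_simp
  have e1 : c * A = b * B - 3 * a * C := by rw [hAdef, hBdef, hCdef]; ring
  have e2 : B * c - b * C = 3 * A * d := by rw [hAdef, hBdef, hCdef]; ring
  clear_value A B C t σ
  have hc : c = 3 * a * (σ ^ 2 - t ^ 2) - 2 * σ * (b + 3 * a * σ) := by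
    apply mul_left_cancel₀ hA.ne'
    linear_combination e1 + 3 * a * hAC + 2 * b * hAB
  have hd : d = 2 * a * σ * (σ ^ 2 + t ^ 2) + b * σ ^ 2 - b * t ^ 2 / 3 := by
    apply mul_left_cancel₀ (pow_ne_zero 2 hA.ne')
    linear_combination (-(A / 3)) * e2 + (B / 3) * e1 + (-2 * a * A * σ + b / 3 * A) * hAC
      - (2 * a * C + 4 / 3 * b * (A * σ - B / 2)) * hAB
  refine ⟨(b + 3 * a * σ) / (3 * t), σ, t, ht0, ?_, ?_, ?_⟩
  · field_simp; ring
  · field_simp; linear_combination hc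
  · field_simp; linear_combination 3 * hd

theorem exists_real_root {a : ℝ} (b c d : ℝ) (ha : a ≠ 0) :
    ∃ x : ℝ, a * x ^ 3 + b * x ^ 2 + c * x + d = 0 := by
  have ha' : 0 < |a| := abs_pos.mpr ha
  set S := |b| + |c| + |d| with hS
  set N := 1 + S / |a| with hN
  have hN1 : 1 ≤ N := le_add_of_nonneg_right (by positivity)
  have hNa : |a| * N = |a| + S := by rw [hN]; field_simp
  have hN2 : 1 ≤ N ^ 2 := one_le_pow₀ hN1
  have hNN : N ≤ N ^ 2 := by nlinarith
  have hB : ∀ s : ℝ, |s| = N → |b * s ^ 2 + c * s + d| ≤ S * N ^ 2 := by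
    intro s hs
    have h1 : |b * s ^ 2| = |b| * N ^ 2 := by rw [abs_mul, abs_pow, hs]
    have h2 : |c * s| = |c| * N := by rw [abs_mul, hs]
    have h3 := abs_add_three (b * s ^ 2) (c * s) d
    rw [h1, h2] at h3
    nlinarith [abs_nonneg c, abs_nonneg d]
  have hpos : 0 < a * (a * N ^ 3 + b * N ^ 2 + c * N + d) := by
    have h1 := hB N (abs_of_pos (by linarith))
    have h2 := neg_abs_le (a * (b * N ^ 2 + c * N + d))
    rw [abs_mul] at h2
    have h3 : a * (a * N ^ 3) = |a| * N ^ 2 * (|a| + S) := by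
      rw [← hNa, ← mul_assoc, ← sq, ← sq_abs a]; ring
    have h4 : 0 < |a| * N ^ 2 * |a| := by positivity
    nlinarith
  have hneg : a * (a * (-N) ^ 3 + b * (-N) ^ 2 + c * (-N) + d) < 0 := by
    have h1 := hB (-N) (by rw [abs_neg]; exact abs_of_pos (by linarith))
    have h2 := le_abs_self (a * (b * (-N) ^ 2 + c * (-N) + d))
    rw [abs_mul] at h2
    have h3 : a * (a * (-N) ^ 3) = -(|a| * N ^ 2 * (|a| + S)) := by
      rw [← hNa, ← mul_assoc, ← sq, ← sq_abs a]; ring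
    have h4 : 0 < |a| * N ^ 2 * |a| := by positivity
    nlinarith
  have hcont : ContinuousOn (fun x : ℝ => a * (a * x ^ 3 + b * x ^ 2 + c * x + d))
      (Set.Icc (-N) N) := by
    fun_prop
  obtain ⟨x, -, hx⟩ := intermediate_value_Icc (by linarith) hcont ⟨hneg.le, hpos.le⟩
  exact ⟨x, (mul_eq_zero.mp hx).resolve_left ha⟩

/-- Coordinates adapted to the complex root. -/
theorem exists_param_neg {a b c d : ℝ} (ha : a ≠ 0) (hD : cubicDisc a b c d < 0) :
    ∃ w σ t : ℝ, 0 < t ∧ b = -3 * a * σ + t * w ∧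
      c = a * (3 * σ ^ 2 + t ^ 2) - 2 * σ * t * w ∧
      d = (t * w - a * σ) * (σ ^ 2 + t ^ 2) := by
  obtain ⟨x, hx0⟩ := exists_real_root b c d ha
  set Q := (a * x + b) / a with hQ
  set R := (a * x ^ 2 + b * x + c) / a with hR
  have hb : b = a * Q - a * x := by rw [hQ]; field_simp; ring
  have hc : c = a * R - a * x * Q := by rw [hR, hQ]; field_simp; ring
  have hd : d = - a * x * R := by rw [hR]; field_simp; linear_combination hx0
  clear_value Q R
  subst hb hc hd
  have hdisc : cubicDisc a (a * Q - a * x) (a * R - a * x * Q) (- a * x * R)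
      = (Q ^ 2 - 4 * R) * (a ^ 2 * (x ^ 2 + Q * x + R)) ^ 2 := by unfold cubicDisc; ring
  rw [hdisc] at hD
  have hQR : Q ^ 2 - 4 * R < 0 := by
    by_contra! h
    have := mul_nonneg h (sq_nonneg (a ^ 2 * (x ^ 2 + Q * x + R)))
    linarith
  have hs : √(R - Q ^ 2 / 4) ^ 2 = R - Q ^ 2 / 4 := Real.sq_sqrt (by linarith)
  have ht : 0 < √(R - Q ^ 2 / 4) := Real.sqrt_pos.mpr (by linarith)
  set t := √(R - Q ^ 2 / 4)
  clear_value t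
  refine ⟨(-a * x - a * Q / 2) / t, -Q / 2, t, ht, ?_, ?_, ?_⟩
  · field_simp; ring
  · field_simp; linear_combination -4 * hs
  · field_simp; linear_combination (8 * x) * hs

/-- The conditions defining `RNeg` in terms of a factorization. -/
theorem neg_conditions (u v α β γ : ℝ) :
    (u * α) * (v * γ) - (u * β + v * α) * (u * γ + v * β) + (u * α - (u * β + v * α)) ^ 2
        + (u * α) * (u * γ + v * β)
      = (α - β) * (u ^ 2 * (γ + α - β) + u * v * (β - 2 * α) + v ^ 2 * α) ∧
    (u * α + (u * β + v * α)) ^ 2 + (u * α) * (u * γ + v * β)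
        + (u * β + v * α) * (u * γ + v * β) - (u * α) * (v * γ)
      = (α + β) * (u ^ 2 * (γ + α + β) + u * v * (β + 2 * α) + v ^ 2 * α) ∧
    (v * γ) ^ 2 - (u * α) ^ 2 + (u * α) * (u * γ + v * β) - (u * β + v * α) * (v * γ)
      = (γ - α) * (v ^ 2 * γ - u * v * β + u ^ 2 * α) :=
  ⟨by ring, by ring, by ring⟩

theorem neg_factors_pos {u v α β γ : ℝ} (huv : u ≠ 0 ∨ v ≠ 0) (hα : 0 < α)
    (h : β ^ 2 < 4 * α * γ) :
    0 < u ^ 2 * (γ + α - β) + u * v * (β - 2 * α) + v ^ 2 * α ∧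
    0 < u ^ 2 * (γ + α + β) + u * v * (β + 2 * α) + v ^ 2 * α ∧
    0 < v ^ 2 * γ - u * v * β + u ^ 2 * α := by
  have hγ : 0 < γ := by nlinarith [sq_nonneg β]
  have hd : 0 < 4 * α * γ - β ^ 2 := by linarith
  by_cases hu : u = 0
  · subst hu
    have hv : v ≠ 0 := huv.resolve_left (by simp)
    refine ⟨?_, ?_, ?_⟩ <;> ring_nf <;> positivity
  · have hu2 : 0 < u ^ 2 := by positivity
    have hu3 := mul_pos hd hu2
    refine ⟨?_, ?_, ?_⟩
    · have : 4 * α * (u ^ 2 * (γ + α - β) + u * v * (β - 2 * α) + v ^ 2 * α)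
        = (2 * α * v + u * (β - 2 * α)) ^ 2 + (4 * α * γ - β ^ 2) * u ^ 2 := by ring
      have h0 : 0 < 4 * α * (u ^ 2 * (γ + α - β) + u * v * (β - 2 * α) + v ^ 2 * α) := by
        rw [this]; positivity
      exact pos_of_mul_pos_right h0 (by positivity)
    · have : 4 * α * (u ^ 2 * (γ + α + β) + u * v * (β + 2 * α) + v ^ 2 * α)
        = (2 * α * v + u * (β + 2 * α)) ^ 2 + (4 * α * γ - β ^ 2) * u ^ 2 := by ring
      have h0 : 0 < 4 * α * (u ^ 2 * (γ + α + β) + u * v * (β + 2 * α) + v ^ 2 * α) := by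
        rw [this]; positivity
      exact pos_of_mul_pos_right h0 (by positivity)
    · have : 4 * γ * (v ^ 2 * γ - u * v * β + u ^ 2 * α)
        = (2 * γ * v - u * β) ^ 2 + (4 * α * γ - β ^ 2) * u ^ 2 := by ring
      have h0 : 0 < 4 * γ * (v ^ 2 * γ - u * v * β + u ^ 2 * α) := by
        rw [this]; positivity
      exact pos_of_mul_pos_right h0 (by positivity)

/-- A real cubic form of negative discriminant is the product of a linear and a definite form. -/
theorem exists_factor_neg {a b c d : ℝ} (ha : a ≠ 0) (hD : cubicDisc a b c d < 0) :
    ∃ v Q R : ℝ, Q ^ 2 < 4 * R ∧ b = a * Q + v ∧ c = a * R + v * Q ∧ d = v * R := by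
  obtain ⟨w, σ, t, ht, hb, hc, hd⟩ := exists_param_neg ha hD
  refine ⟨t * w - a * σ, -2 * σ, σ ^ 2 + t ^ 2, ?_, ?_, ?_, ?_⟩
  · nlinarith [pow_pos ht 2]
  · linear_combination hb
  · linear_combination hc
  · linear_combination hd

namespace BCF

theorem exists_equiv_rPosC {f : BCF} (hf : f.Irr) (hD : 0 < f.disc) :
    ∃ g : BCF, f.Equiv g ∧ RPosC g.a g.b g.c g.d := by
  have ha : (f.a : ℝ) ≠ 0 := by exact_mod_cast hf.a_ne
  have hDR : 0 < cubicDisc (f.a : ℝ) f.b f.c f.d := by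
    have : ((f.disc : ℤ) : ℝ) = cubicDisc (f.a : ℝ) f.b f.c f.d := by
      simp only [disc, cubicDisc]; push_cast; ring
    rw [← this]; exact_mod_cast hD
  have hA := hessian_pos ha hDR
  have hH := hessian_disc (f.a : ℝ) f.b f.c f.d
  obtain ⟨p, q, r, s, hdet, h1, h2⟩ := exists_reduced (B := (f.b : ℝ) * f.c - 9 * f.a * f.d)
    (C := (f.c : ℝ) ^ 2 - 3 * f.b * f.d) hA (by linarith)
  have hdR : (p : ℝ) * s - q * r = 1 := by exact_mod_cast hdet
  have hA' : ((f.comp p q r s).b : ℝ) ^ 2 - 3 * (f.comp p q r s).a * (f.comp p q r s).c =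
      ((p : ℝ) * s - q * r) ^ 2 * (((f.b : ℝ) ^ 2 - 3 * f.a * f.c) * p ^ 2
      + ((f.b : ℝ) * f.c - 9 * f.a * f.d) * p * r + ((f.c : ℝ) ^ 2 - 3 * f.b * f.d) * r ^ 2) := by
    simp only [comp]; push_cast; ring
  have hB' : ((f.comp p q r s).b : ℝ) * (f.comp p q r s).c - 9 * (f.comp p q r s).a
      * (f.comp p q r s).d =
      ((p : ℝ) * s - q * r) ^ 2 * (2 * ((f.b : ℝ) ^ 2 - 3 * f.a * f.c) * p * q
      + ((f.b : ℝ) * f.c - 9 * f.a * f.d) * (p * s + q * r)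
      + 2 * ((f.c : ℝ) ^ 2 - 3 * f.b * f.d) * r * s) := by
    simp only [comp]; push_cast; ring
  have hC' : ((f.comp p q r s).c : ℝ) ^ 2 - 3 * (f.comp p q r s).b * (f.comp p q r s).d =
      ((p : ℝ) * s - q * r) ^ 2 * (((f.b : ℝ) ^ 2 - 3 * f.a * f.c) * q ^ 2
      + ((f.b : ℝ) * f.c - 9 * f.a * f.d) * q * s + ((f.c : ℝ) ^ 2 - 3 * f.b * f.d) * s ^ 2) := by
    simp only [comp]; push_cast; ring
  rw [hdR, one_pow, one_mul] at hA' hB' hC'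
  refine ⟨f.comp p q r s, ⟨p, q, r, s, by rw [hdet]; norm_num, rfl⟩, ?_⟩
  unfold RPosC
  rw [hA', hB', hC']
  exact ⟨(abs_le.mp h1).2, neg_le.mp (abs_le.mp h1).1, h2⟩

theorem diag_of_rPos {f : BCF} {p q r s : ℤ} (hdet : (p * s - q * r) ^ 2 = 1)
    (h : RPos f.a f.b f.c f.d) (h' : RPos (f.comp p q r s).a (f.comp p q r s).b
      (f.comp p q r s).c (f.comp p q r s).d) : q = 0 ∧ r = 0 := by
  have hdR : ((p : ℝ) * s - q * r) ^ 2 = 1 := by exact_mod_cast hdet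
  have hA' : ((f.comp p q r s).b : ℝ) ^ 2 - 3 * (f.comp p q r s).a * (f.comp p q r s).c =
      ((p : ℝ) * s - q * r) ^ 2 * (((f.b : ℝ) ^ 2 - 3 * f.a * f.c) * p ^ 2
      + ((f.b : ℝ) * f.c - 9 * f.a * f.d) * p * r + ((f.c : ℝ) ^ 2 - 3 * f.b * f.d) * r ^ 2) := by
    simp only [comp]; push_cast; ring
  have hB' : ((f.comp p q r s).b : ℝ) * (f.comp p q r s).c - 9 * (f.comp p q r s).a
      * (f.comp p q r s).d =
      ((p : ℝ) * s - q * r) ^ 2 * (2 * ((f.b : ℝ) ^ 2 - 3 * f.a * f.c) * p * q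
      + ((f.b : ℝ) * f.c - 9 * f.a * f.d) * (p * s + q * r)
      + 2 * ((f.c : ℝ) ^ 2 - 3 * f.b * f.d) * r * s) := by
    simp only [comp]; push_cast; ring
  have hC' : ((f.comp p q r s).c : ℝ) ^ 2 - 3 * (f.comp p q r s).b * (f.comp p q r s).d =
      ((p : ℝ) * s - q * r) ^ 2 * (((f.b : ℝ) ^ 2 - 3 * f.a * f.c) * q ^ 2
      + ((f.b : ℝ) * f.c - 9 * f.a * f.d) * q * s + ((f.c : ℝ) ^ 2 - 3 * f.b * f.d) * s ^ 2) := by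
    simp only [comp]; push_cast; ring
  unfold RPos at h'
  rw [hdR, one_mul] at hA' hB' hC'
  rw [hA', hB', hC'] at h'
  obtain ⟨h1, h2, h3⟩ := h
  obtain ⟨h1', h2', h3'⟩ := h'
  exact diag_of_reduced hdet (abs_lt.mpr ⟨neg_lt.mp h2, h1⟩) h3
    (abs_lt.mpr ⟨neg_lt.mp h2', h1'⟩) h3'

/-- The action on a factored form. -/
theorem comp_factor {f : BCF} {v Q R : ℝ} (hb : (f.b : ℝ) = f.a * Q + v)
    (hc : (f.c : ℝ) = f.a * R + v * Q) (hd : (f.d : ℝ) = v * R) (p q r s : ℤ) :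
    ((f.comp p q r s).a : ℝ) = (f.a * p + v * r) * (1 * p ^ 2 + Q * p * r + R * r ^ 2) ∧
    ((f.comp p q r s).b : ℝ) =
        (f.a * p + v * r) * (2 * 1 * p * q + Q * (p * s + q * r) + 2 * R * r * s)
      + (f.a * q + v * s) * (1 * p ^ 2 + Q * p * r + R * r ^ 2) ∧
    ((f.comp p q r s).c : ℝ) = (f.a * p + v * r) * (1 * q ^ 2 + Q * q * s + R * s ^ 2)
      + (f.a * q + v * s) * (2 * 1 * p * q + Q * (p * s + q * r) + 2 * R * r * s) ∧
    ((f.comp p q r s).d : ℝ) = (f.a * q + v * s) * (1 * q ^ 2 + Q * q * s + R * s ^ 2) := by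
  simp only [comp]
  push_cast
  rw [hb, hc, hd]
  refine ⟨by ring, by ring, by ring, by ring⟩

theorem factor_ne_zero {u v : ℝ} (hu : u ≠ 0) {p q r s : ℤ} (hdet : (p * s - q * r) ^ 2 = 1) :
    u * p + v * r ≠ 0 ∨ u * q + v * s ≠ 0 := by
  by_contra! h
  have hdR : ((p : ℝ) * s - q * r) ^ 2 = 1 := by exact_mod_cast hdet
  have : u * ((p : ℝ) * s - q * r) = 0 := by linear_combination (s : ℝ) * h.1 - r * h.2
  rcases mul_eq_zero.mp this with h | h
  · exact hu h
  · rw [h] at hdR; norm_num at hdR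

theorem definite_comp {Q R : ℝ} (h : Q ^ 2 < 4 * R) {p q r s : ℤ}
    (hdet : (p * s - q * r) ^ 2 = 1) :
    0 < 1 * (p : ℝ) ^ 2 + Q * p * r + R * r ^ 2 ∧
    (2 * 1 * (p : ℝ) * q + Q * (p * s + q * r) + 2 * R * r * s) ^ 2
      < 4 * (1 * (p : ℝ) ^ 2 + Q * p * r + R * r ^ 2)
        * (1 * (q : ℝ) ^ 2 + Q * q * s + R * s ^ 2) := by
  have hdR : ((p : ℝ) * s - q * r) ^ 2 = 1 := by exact_mod_cast hdet
  constructor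
  · by_cases hr : r = 0
    · subst hr
      have : (p : ℝ) ≠ 0 := by
        rintro h; rw [h] at hdR; norm_num at hdR
      simp
      positivity
    · have : (0 : ℝ) < (r : ℝ) ^ 2 := by positivity
      nlinarith [sq_nonneg (2 * (p : ℝ) + Q * r)]
  · have : 4 * (1 * (p : ℝ) ^ 2 + Q * p * r + R * r ^ 2) * (1 * (q : ℝ) ^ 2 + Q * q * s + R * s ^ 2)
      - (2 * 1 * (p : ℝ) * q + Q * (p * s + q * r) + 2 * R * r * s) ^ 2
      = (4 * R - Q ^ 2) * ((p : ℝ) * s - q * r) ^ 2 := by ring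
    rw [hdR] at this
    linarith

theorem exists_equiv_rNegC {f : BCF} (hf : f.Irr) (hD : f.disc < 0) :
    ∃ g : BCF, f.Equiv g ∧ RNegC g.a g.b g.c g.d := by
  have ha : (f.a : ℝ) ≠ 0 := by exact_mod_cast hf.a_ne
  have hDR : cubicDisc (f.a : ℝ) f.b f.c f.d < 0 := by
    have : ((f.disc : ℤ) : ℝ) = cubicDisc (f.a : ℝ) f.b f.c f.d := by
      simp only [disc, cubicDisc]; push_cast; ring
    rw [← this]; exact_mod_cast hD
  obtain ⟨v, Q, R, hQR, hb, hc, hd⟩ := exists_factor_neg ha hDR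
  obtain ⟨p, q, r, s, hdet, h1, h2⟩ := exists_reduced (A := 1) (B := Q) (C := R) one_pos
    (by linarith)
  have hdet2 : (p * s - q * r) ^ 2 = 1 := by rw [hdet]; norm_num
  obtain ⟨e1, e2, e3, e4⟩ := comp_factor hb hc hd p q r s
  obtain ⟨n1, n2, n3⟩ := neg_conditions (f.a * p + v * r) (f.a * q + v * s)
    (1 * p ^ 2 + Q * p * r + R * r ^ 2) (2 * 1 * p * q + Q * (p * s + q * r) + 2 * R * r * s)
    (1 * q ^ 2 + Q * q * s + R * s ^ 2)
  obtain ⟨k1, k2⟩ := definite_comp hQR hdet2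
  obtain ⟨m1, m2, m3⟩ := neg_factors_pos (factor_ne_zero (v := v) ha hdet2) k1 k2
  refine ⟨f.comp p q r s, ⟨p, q, r, s, hdet2, rfl⟩, ?_⟩
  unfold RNegC
  rw [e1, e2, e3, e4, n1, n2, n3]
  have := abs_le.mp h1
  exact ⟨mul_nonneg (by linarith) m1.le, mul_nonneg (by linarith) m2.le,
    mul_nonneg (by linarith) m3.le⟩

theorem diag_of_rNeg {f : BCF} {p q r s : ℤ} (ha : f.a ≠ 0) (hD : f.disc < 0)
    (hdet : (p * s - q * r) ^ 2 = 1)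
    (h : RNeg f.a f.b f.c f.d) (h' : RNeg (f.comp p q r s).a (f.comp p q r s).b
      (f.comp p q r s).c (f.comp p q r s).d) : q = 0 ∧ r = 0 := by
  have key : ∀ p q r s : ℤ, (p * s - q * r) ^ 2 = 1 → ∀ v Q R : ℝ, Q ^ 2 < 4 * R →
      (f.b : ℝ) = f.a * Q + v → (f.c : ℝ) = f.a * R + v * Q → (f.d : ℝ) = v * R →
      RNeg (f.comp p q r s).a (f.comp p q r s).b (f.comp p q r s).c (f.comp p q r s).d →
      |2 * 1 * p * q + Q * (p * s + q * r) + 2 * R * r * s| < 1 * p ^ 2 + Q * p * r + R * r ^ 2 ∧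
      1 * p ^ 2 + Q * p * r + R * r ^ 2 < 1 * q ^ 2 + Q * q * s + R * s ^ 2 := by
    intro p q r s hdet v Q R hQR hb hc hd h
    obtain ⟨e1, e2, e3, e4⟩ := comp_factor hb hc hd p q r s
    obtain ⟨n1, n2, n3⟩ := neg_conditions (f.a * p + v * r) (f.a * q + v * s)
      (1 * p ^ 2 + Q * p * r + R * r ^ 2) (2 * 1 * p * q + Q * (p * s + q * r) + 2 * R * r * s)
      (1 * q ^ 2 + Q * q * s + R * s ^ 2)
    obtain ⟨k1, k2⟩ := definite_comp hQR hdet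
    obtain ⟨m1, m2, m3⟩ := neg_factors_pos
      (factor_ne_zero (v := v) (u := f.a) (by exact_mod_cast ha) hdet) k1 k2
    unfold RNeg at h
    rw [e1, e2, e3, e4, n1, n2, n3] at h
    obtain ⟨h1, h2, h3⟩ := h
    have h1 := pos_of_mul_pos_left h1 m1.le
    have h2 := pos_of_mul_pos_left h2 m2.le
    have h3 := pos_of_mul_pos_left h3 m3.le
    exact ⟨abs_lt.mpr ⟨by linarith, by linarith⟩, by linarith⟩
  have hDR : cubicDisc (f.a : ℝ) f.b f.c f.d < 0 := by
    have : ((f.disc : ℤ) : ℝ) = cubicDisc (f.a : ℝ) f.b f.c f.d := by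
      simp only [disc, cubicDisc]; push_cast; ring
    rw [← this]; exact_mod_cast hD
  obtain ⟨v, Q, R, hQR, hb, hc, hd⟩ := exists_factor_neg (by exact_mod_cast ha) hDR
  have h1 := key 1 0 0 1 (by norm_num) v Q R hQR hb hc hd (by rw [comp_one]; exact h)
  simp at h1
  obtain ⟨h2, h3⟩ := key p q r s hdet v Q R hQR hb hc hd h'
  exact diag_of_reduced hdet h1.1 h1.2 h2 h3

end BCF

section

open MeasureTheory

/-- Membership in `S` changes only at the points of a set of at most `N` elements. -/
def FewChanges (N : ℕ) (S : Set ℝ) : Prop :=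
  ∃ Z : Finset ℝ, Z.card ≤ N ∧ ∀ u v : ℝ, u ≤ v → (∀ z ∈ Z, z ∉ Set.Icc u v) → (u ∈ S ↔ v ∈ S)

theorem FewChanges.mono {N M : ℕ} {S : Set ℝ} (h : FewChanges N S) (hNM : N ≤ M) :
    FewChanges M S := by
  obtain ⟨Z, hZ, h⟩ := h
  exact ⟨Z, hZ.trans hNM, h⟩

theorem FewChanges.inter {N M : ℕ} {S T : Set ℝ} (hS : FewChanges N S) (hT : FewChanges M T) :
    FewChanges (N + M) (S ∩ T) := by
  classical
  obtain ⟨Z, hZ, hS⟩ := hS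
  obtain ⟨W, hW, hT⟩ := hT
  refine ⟨Z ∪ W, (Finset.card_union_le _ _).trans (by omega), fun u v huv h => ?_⟩
  have h1 := hS u v huv fun z hz => h z (Finset.mem_union_left _ hz)
  have h2 := hT u v huv fun z hz => h z (Finset.mem_union_right _ hz)
  simp only [Set.mem_inter_iff, h1, h2]

theorem fewChanges_pos (p : Polynomial ℝ) : FewChanges p.natDegree {x | 0 < p.eval x} := by
  classical
  by_cases hp : p = 0
  · exact ⟨∅, by simp, by simp [hp]⟩
  refine ⟨p.roots.toFinset, (Multiset.toFinset_card_le _).trans (Polynomial.card_roots' p),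
    fun u v huv h => ?_⟩
  have hroot : ∀ z ∈ Set.Icc u v, p.eval z ≠ 0 := fun z hz h0 =>
    h z (by simp [hp, Polynomial.IsRoot, h0]) hz
  have hc : ContinuousOn (fun x => p.eval x) (Set.Icc u v) := p.continuous.continuousOn
  simp only [Set.mem_ofPred_eq]
  constructor
  · intro h1
    by_contra! h2
    obtain ⟨z, hz, hz0⟩ := intermediate_value_Icc' huv hc ⟨h2, h1.le⟩
    exact hroot z hz hz0
  · intro h1
    by_contra! h2
    obtain ⟨z, hz, hz0⟩ := intermediate_value_Icc huv hc ⟨h2, h1.le⟩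
    exact hroot z hz hz0

theorem fewChanges_cubic {f : ℝ → ℝ} (c₀ c₁ c₂ c₃ : ℝ)
    (hf : ∀ x, f x = c₀ + c₁ * x + c₂ * x ^ 2 + c₃ * x ^ 3) : FewChanges 3 {x | 0 < f x} := by
  have h := fewChanges_pos (Polynomial.C c₃ * Polynomial.X ^ 3 + Polynomial.C c₂ * Polynomial.X ^ 2
    + Polynomial.C c₁ * Polynomial.X + Polynomial.C c₀)
  refine (FewChanges.mono h Polynomial.natDegree_cubic_le).mono le_rfl |> fun h => ?_
  convert h using 3 with x
  rw [hf]
  simp only [Polynomial.eval_add, Polynomial.eval_mul, Polynomial.eval_C, Polynomial.eval_pow,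
    Polynomial.eval_X]
  ring_nf

theorem fewChanges_Icc (u v : ℝ) : FewChanges 2 (Set.Icc u v) := by
  classical
  refine ⟨{u, v}, Finset.card_le_two, fun x y hxy h => ?_⟩
  have h1 := h u (by simp)
  have h2 := h v (by simp)
  simp only [Set.mem_Icc, not_and, not_le] at h1 h2 ⊢
  constructor
  · rintro ⟨h3, h4⟩
    exact ⟨by linarith, le_of_not_gt fun h5 => by have := h2 h4; linarith⟩
  · rintro ⟨h3, h4⟩
    refine ⟨le_of_not_gt fun h5 => by have := h1 h5.le; linarith, by linarith⟩

/-- The weight of the residue class of `r` modulo `m`. -/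
noncomputable def resw (m : ℕ) (r n : ℤ) : ℝ := by
  classical exact if (m : ℤ) ∣ n - r then 1 else 0

theorem resw_nonneg (m : ℕ) (r n : ℤ) : 0 ≤ resw m r n := by
  unfold resw; split_ifs <;> norm_num

/-- The number of points of a residue class in a bounded set with few changes. -/
theorem abs_sum_resw_sub_integral_le {N m : ℕ} (hm : 0 < m) {S : Set ℝ} (hS : FewChanges N S)
    (hmeas : MeasurableSet S) {M : ℤ} (hM : S ⊆ Set.Icc (-M : ℝ) M) (r : ℤ) :
    |∑ n ∈ Finset.Icc (-M) M, resw m r n * S.indicator 1 (n : ℝ) - 1 / m * ∫ x, S.indicator 1 x|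
      ≤ N := by
  classical
  obtain ⟨Z, hZ, hS⟩ := hS
  have hm' : (0 : ℝ) < m := by exact_mod_cast hm
  set χ : ℝ → ℝ := S.indicator 1 with hχ
  have hχ0 : ∀ x, 0 ≤ χ x := fun x => Set.indicator_nonneg (fun _ _ => zero_le_one) x
  have hχ1 : ∀ x, χ x ≤ 1 := fun x => Set.indicator_le_self' (fun _ _ => zero_le_one) x
  set F : Finset ℤ := (Finset.Icc (-M - m) M).filter fun n => (m : ℤ) ∣ n - r with hF
  set I : ℤ → Set ℝ := fun n => Set.Ico (n : ℝ) (n + m) with hI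
  have h_int : Integrable χ := by
    refine (integrable_indicator_iff hmeas).2 ?_
    refine IntegrableOn.mono_set ?_ hM
    exact continuousOn_const.integrableOn_compact isCompact_Icc
  have hsum : ∑ n ∈ Finset.Icc (-M) M, resw m r n * χ n = ∑ n ∈ F, χ n := by
    rw [hF, Finset.sum_filter]
    have : ∀ n ∈ Finset.Icc (-M - m) M, n ∉ Finset.Icc (-M) M →
        (if (m : ℤ) ∣ n - r then χ n else 0) = 0 := by
      intro n hn hn'
      have : (n : ℝ) ∉ S := fun h => hn' <| by
        have := hM h
        simp only [Set.mem_Icc] at this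
        exact Finset.mem_Icc.2 ⟨by exact_mod_cast this.1, by exact_mod_cast this.2⟩
      simp [hχ, this]
    rw [← Finset.sum_subset (Finset.Icc_subset_Icc (by omega) le_rfl) this]
    refine Finset.sum_congr rfl fun n _ => ?_
    unfold resw
    split_ifs <;> simp
  have huniq : ∀ n ∈ F, ∀ n' ∈ F, ∀ x, x ∈ I n → x ∈ I n' → n = n' := by
    intro n hn n' hn' x hx hx'
    simp only [hI, Set.mem_Ico] at hx hx'
    have h1 : n < n' + m := by
      have : (n : ℝ) < n' + m := by linarith
      exact_mod_cast this
    have h2 : n' < n + m := by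
      have : (n' : ℝ) < n + m := by linarith
      exact_mod_cast this
    obtain ⟨k, hk⟩ : (m : ℤ) ∣ n - n' := by
      have := dvd_sub (Finset.mem_filter.1 hn).2 (Finset.mem_filter.1 hn').2
      simpa using this
    have hmz : (0 : ℤ) < m := by exact_mod_cast hm
    have hk0 : k = 0 := by
      have h3 : k < 1 := by
        by_contra! h; nlinarith
      have h4 : -1 < k := by
        by_contra! h; nlinarith
      omega
    rw [hk0] at hk
    omega
  have hcov : ∀ x ∈ S, ∃ n ∈ F, x ∈ I n := by
    intro x hx
    have hxM := hM hx
    simp only [Set.mem_Icc] at hxM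
    set k := ⌊(x - r) / m⌋
    have hk1 : (k : ℝ) ≤ (x - r) / m := Int.floor_le _
    have hk2 : (x - r) / m < k + 1 := Int.lt_floor_add_one _
    rw [le_div_iff₀ hm'] at hk1
    rw [div_lt_iff₀ hm'] at hk2
    refine ⟨r + m * k, ?_, ?_⟩
    · rw [hF, Finset.mem_filter, Finset.mem_Icc]
      refine ⟨⟨?_, ?_⟩, ⟨k, by ring⟩⟩
      · have : ((-M - m : ℤ) : ℝ) ≤ ((r + m * k : ℤ) : ℝ) := by push_cast; nlinarith
        exact_mod_cast this
      · have : ((r + m * k : ℤ) : ℝ) ≤ (M : ℝ) := by push_cast; nlinarith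
        exact_mod_cast this
    · simp only [hI, Set.mem_Ico]
      push_cast
      constructor <;> nlinarith
  have hsplit : ∫ x, χ x = ∑ n ∈ F, ∫ x in I n, χ x := by
    rw [← integral_biUnion_finset F (fun n _ => measurableSet_Ico) ?_
      (fun n _ => h_int.integrableOn)]
    · refine (setIntegral_eq_integral_of_forall_compl_eq_zero fun x hx => ?_).symm
      refine Set.indicator_of_notMem (fun hxS => hx ?_) _
      obtain ⟨n, hn, hxn⟩ := hcov x hxS
      exact Set.mem_biUnion hn hxn
    · intro n hn n' hn' hne
      refine Set.disjoint_left.2 fun x hx hx' => hne (huniq n hn n' hn' x hx hx')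
  have hvol : ∀ n : ℤ, volume.real (I n) = m := fun n => by
    simp [hI, Measure.real]
  have hcell : ∀ n ∈ F, |m * χ n - ∫ x in I n, χ x| ≤
      m * ∑ z ∈ Z, if z ∈ I n then (1 : ℝ) else 0 := by
    intro n hn
    by_cases hbad : ∃ z ∈ Z, z ∈ I n
    · obtain ⟨z, hz, hzn⟩ := hbad
      have h1 : (1 : ℝ) ≤ ∑ z ∈ Z, if z ∈ I n then (1 : ℝ) else 0 := by
        refine le_trans (by simp [hzn]) (Finset.single_le_sum
          (f := fun z => if z ∈ I n then (1 : ℝ) else 0) (fun z _ => by split_ifs <;> norm_num) hz)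
      have h2 : 0 ≤ ∫ x in I n, χ x := integral_nonneg hχ0
      have h3 : ∫ x in I n, χ x ≤ m := by
        have : ∫ x in I n, χ x ≤ ∫ x in I n, (1 : ℝ) :=
          setIntegral_mono h_int.integrableOn (by simp [hI]) hχ1
        simpa [hvol] using this
      have h4 := hχ0 n
      have h5 := hχ1 n
      rw [abs_le]
      constructor <;> nlinarith
    · push Not at hbad
      have : ∫ x in I n, χ x = ∫ x in I n, χ n := by
        refine setIntegral_congr_fun measurableSet_Ico fun x hx => ?_
        simp only [hI, Set.mem_Ico] at hx
        have := hS n x hx.1 fun z hz hzz => hbad z hz ⟨hzz.1, hzz.2.trans_lt hx.2⟩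
        simp only [hχ, Set.indicator, this, Pi.one_apply]
      rw [this, setIntegral_const, hvol, smul_eq_mul, sub_self, abs_zero]
      exact mul_nonneg hm'.le (Finset.sum_nonneg fun z _ => by split_ifs <;> norm_num)
  have hmain : |∑ n ∈ F, (m * χ n - ∫ x in I n, χ x)| ≤ m * N := by
    refine (Finset.abs_sum_le_sum_abs _ _).trans ((Finset.sum_le_sum hcell).trans ?_)
    rw [← Finset.mul_sum, Finset.sum_comm]
    refine mul_le_mul_of_nonneg_left ?_ hm'.le
    calc ∑ z ∈ Z, ∑ n ∈ F, (if z ∈ I n then (1 : ℝ) else 0) ≤ ∑ z ∈ Z, 1 := by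
          refine Finset.sum_le_sum fun z _ => ?_
          rw [Finset.sum_boole]
          have : (F.filter fun n => z ∈ I n).card ≤ 1 := Finset.card_le_one.2 fun n hn n' hn' =>
            huniq n (Finset.mem_filter.1 hn).1 n' (Finset.mem_filter.1 hn').1 z
              (Finset.mem_filter.1 hn).2 (Finset.mem_filter.1 hn').2
          exact_mod_cast this
      _ ≤ N := by simpa using hZ
  rw [hsum, hsplit]
  rw [Finset.sum_sub_distrib, ← Finset.mul_sum] at hmain
  have : ∑ n ∈ F, χ n - 1 / m * ∑ n ∈ F, ∫ x in I n, χ x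
      = 1 / m * (m * ∑ n ∈ F, χ n - ∑ n ∈ F, ∫ x in I n, χ x) := by
    field_simp
  rw [this, abs_mul, abs_of_pos (by positivity : (0 : ℝ) < 1 / m)]
  calc 1 / m * |m * ∑ n ∈ F, χ n - ∑ n ∈ F, ∫ x in I n, χ x| ≤ 1 / m * (m * N) :=
        mul_le_mul_of_nonneg_left hmain (by positivity)
    _ = N := by field_simp

theorem sum_resw_Icc_le {m : ℕ} (hm : 0 < m) {β : ℝ} (hβ : 0 ≤ β) {M : ℤ} (hM : β ≤ M) (r : ℤ) :
    ∑ n ∈ Finset.Icc (-M) M, resw m r n * (Set.Icc (-β) β).indicator 1 (n : ℝ)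
      ≤ 2 * β / m + 2 := by
  have h := abs_sum_resw_sub_integral_le hm (fewChanges_Icc (-β) β) measurableSet_Icc
    (M := M) (Set.Icc_subset_Icc (by linarith) hM) r
  have : ∫ x, (Set.Icc (-β) β).indicator (1 : ℝ → ℝ) x = 2 * β := by
    rw [integral_indicator_one measurableSet_Icc]
    simp [Measure.real, ENNReal.toReal_ofReal (show (0 : ℝ) ≤ β + β by linarith)]
    ring
  rw [this] at h
  have := (abs_le.1 h).2
  push_cast at this
  have e : 2 * β / m = 1 / m * (2 * β) := by ring
  linarith

theorem abs_sum_resw_sub_integral_le_mul {N m : ℕ} (hm : 0 < m) {S : Set ℝ} (hS : FewChanges N S)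
    (hmeas : MeasurableSet S) {M : ℤ} (hM : S ⊆ Set.Icc (-M : ℝ) M) (r : ℤ) {e : ℝ} (he : 0 ≤ e)
    (he' : S.Nonempty → e = 1) :
    |∑ n ∈ Finset.Icc (-M) M, resw m r n * S.indicator 1 (n : ℝ) - 1 / m * ∫ x, S.indicator 1 x|
      ≤ N * e := by
  rcases S.eq_empty_or_nonempty with rfl | hne
  · simpa using mul_nonneg (Nat.cast_nonneg N) he
  · rw [he' hne, mul_one]
    exact abs_sum_resw_sub_integral_le hm hS hmeas hM r

theorem integrable_indicator_of_subset {E : Type*} [MeasureSpace E] [TopologicalSpace E]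
    [IsFiniteMeasureOnCompacts (volume : Measure E)] [OpensMeasurableSpace E] [T2Space E]
    {S K : Set E} (hS : MeasurableSet S) (hK : IsCompact K) (hSK : S ⊆ K) :
    Integrable (S.indicator (1 : E → ℝ)) := by
  refine (integrable_indicator_iff hS).2 ?_
  refine IntegrableOn.mono_set ?_ hSK
  exact integrableOn_const hK.measure_lt_top.ne

/-- Lattice points `(b, c, d)` of a bounded set with few changes, with `b`, `c`, `d` running
through residue classes. -/
theorem abs_sum_resw_sub_volume_le {N B C D : ℕ} (hB : 0 < B) (hC : 0 < C) (hD : 0 < D)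
    {T : Set ((ℝ × ℝ) × ℝ)} (hT : MeasurableSet T) {β γ δ : ℝ} (hβ : 0 ≤ β) (hγ : 0 ≤ γ)
    (hδ : 0 ≤ δ)
    (hbox : ∀ d c b, ((d, c), b) ∈ T → |d| ≤ δ ∧ |c| ≤ γ ∧ |b| ≤ β)
    (hTd : ∀ c b, FewChanges N {d | ((d, c), b) ∈ T})
    (hTc : ∀ d b, FewChanges N {c | ((d, c), b) ∈ T})
    (hTb : ∀ d c, FewChanges N {b | ((d, c), b) ∈ T})
    {M : ℤ} (hMβ : β ≤ M) (hMγ : γ ≤ M) (hMδ : δ ≤ M) (rb : ℤ) (rc : ℤ → ℤ) (rd : ℤ → ℤ → ℤ) :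
    |∑ b ∈ Finset.Icc (-M) M, resw B rb b * ∑ c ∈ Finset.Icc (-M) M, resw C (rc b) c *
      ∑ d ∈ Finset.Icc (-M) M, resw D (rd b c) d * T.indicator 1 (((d : ℝ), (c : ℝ)), (b : ℝ))
      - volume.real T / (B * C * D)|
      ≤ N * ((2 * β / B + 2) * (2 * γ / C + 2) + (2 * β / B + 2) * (2 * δ) / D
        + 2 * γ * (2 * δ) / (C * D)) := by
  set χ : (ℝ × ℝ) × ℝ → ℝ := T.indicator 1 with hχ
  set eβ : ℝ → ℝ := (Set.Icc (-β) β).indicator 1 with heβ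
  set eγ : ℝ → ℝ := (Set.Icc (-γ) γ).indicator 1 with heγ
  set eδ : ℝ → ℝ := (Set.Icc (-δ) δ).indicator 1 with heδ
  have e0 : ∀ (u x : ℝ), 0 ≤ (Set.Icc (-u) u).indicator (1 : ℝ → ℝ) x := fun u x =>
    Set.indicator_nonneg (fun _ _ => zero_le_one) x
  have e1 : ∀ (u x : ℝ), |x| ≤ u → (Set.Icc (-u) u).indicator (1 : ℝ → ℝ) x = 1 := fun u x h =>
    Set.indicator_of_mem (Set.mem_Icc.2 (abs_le.1 h)) _
  have eint : ∀ u : ℝ, 0 ≤ u → ∫ x, (Set.Icc (-u) u).indicator (1 : ℝ → ℝ) x = 2 * u := by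
    intro u hu
    rw [integral_indicator_one measurableSet_Icc]
    simp [Measure.real, ENNReal.toReal_ofReal (show (0 : ℝ) ≤ u + u by linarith)]
    ring
  have eintegrable : ∀ u : ℝ, Integrable ((Set.Icc (-u) u).indicator (1 : ℝ → ℝ)) := fun u =>
    integrable_indicator_of_subset measurableSet_Icc isCompact_Icc subset_rfl
  have hB' : (0 : ℝ) < B := by exact_mod_cast hB
  have hC' : (0 : ℝ) < C := by exact_mod_cast hC
  have hD' : (0 : ℝ) < D := by exact_mod_cast hD
  have hI3 : Integrable χ := by
    refine integrable_indicator_of_subset hT ((isCompact_Icc (a := -δ) (b := δ)).prod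
      (isCompact_Icc (a := -γ) (b := γ)) |>.prod (isCompact_Icc (a := -β) (b := β))) ?_
    rintro ⟨⟨d, c⟩, b⟩ h
    obtain ⟨h1, h2, h3⟩ := hbox d c b h
    exact ⟨⟨abs_le.1 h1, abs_le.1 h2⟩, abs_le.1 h3⟩
  have hmd : ∀ c b, MeasurableSet {d | ((d, c), b) ∈ T} := fun c b =>
    hT.preimage (by fun_prop : Measurable fun d : ℝ => ((d, c), b))
  have hmc : ∀ d b, MeasurableSet {c | ((d, c), b) ∈ T} := fun d b =>
    hT.preimage (by fun_prop : Measurable fun c : ℝ => ((d, c), b))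
  have hmb : ∀ d c, MeasurableSet {b | ((d, c), b) ∈ T} := fun d c =>
    hT.preimage (by fun_prop : Measurable fun b : ℝ => ((d, c), b))
  have hm2 : ∀ b, MeasurableSet {q : ℝ × ℝ | (q, b) ∈ T} := fun b =>
    hT.preimage (by fun_prop : Measurable fun q : ℝ × ℝ => (q, b))
  have hI2 : ∀ b, Integrable (fun q : ℝ × ℝ => χ (q, b)) := fun b => by
    refine integrable_indicator_of_subset (hm2 b) ((isCompact_Icc (a := -δ) (b := δ)).prod
      (isCompact_Icc (a := -γ) (b := γ))) ?_
    rintro ⟨d, c⟩ h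
    obtain ⟨h1, h2, h3⟩ := hbox d c b h
    exact ⟨abs_le.1 h1, abs_le.1 h2⟩
  have hI1 : ∀ c b, Integrable (fun d : ℝ => χ ((d, c), b)) := fun c b => by
    refine integrable_indicator_of_subset (hmd c b) (isCompact_Icc (a := -δ) (b := δ)) ?_
    intro d h
    exact abs_le.1 (hbox d c b h).1
  have hMd : ∀ c b, {d | ((d, c), b) ∈ T} ⊆ Set.Icc (-M : ℝ) M := fun c b d h =>
    abs_le.1 ((hbox d c b h).1.trans hMδ)
  have hMc : ∀ d b, {c | ((d, c), b) ∈ T} ⊆ Set.Icc (-M : ℝ) M := fun d b c h =>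
    abs_le.1 ((hbox d c b h).2.1.trans hMγ)
  have hMb : ∀ d c, {b | ((d, c), b) ∈ T} ⊆ Set.Icc (-M : ℝ) M := fun d c b h =>
    abs_le.1 ((hbox d c b h).2.2.trans hMβ)
  have h1 : ∀ b c : ℤ, |∑ d ∈ Finset.Icc (-M) M, resw D (rd b c) d * χ (((d : ℝ), (c : ℝ)), (b : ℝ))
      - 1 / D * ∫ y, χ ((y, c), b)| ≤ N * (eγ c * eβ b) := by
    intro b c
    refine abs_sum_resw_sub_integral_le_mul hD (hTd c b) (hmd c b) (hMd c b) _
      (mul_nonneg (e0 _ _) (e0 _ _)) ?_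
    rintro ⟨d, hd⟩
    obtain ⟨-, h2, h3⟩ := hbox d c b hd
    rw [heγ, heβ, e1 _ _ h2, e1 _ _ h3, one_mul]
  have h2 : ∀ (b : ℤ) (y : ℝ), |∑ c ∈ Finset.Icc (-M) M, resw C (rc b) c * χ ((y, (c : ℝ)), (b : ℝ))
      - 1 / C * ∫ z, χ ((y, z), b)| ≤ N * (eδ y * eβ b) := by
    intro b y
    refine abs_sum_resw_sub_integral_le_mul hC (hTc y b) (hmc y b) (hMc y b) _
      (mul_nonneg (e0 _ _) (e0 _ _)) ?_
    rintro ⟨c, hd⟩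
    obtain ⟨h2, -, h3⟩ := hbox y c b hd
    rw [heδ, heβ, e1 _ _ h2, e1 _ _ h3, one_mul]
  have h3 : ∀ q : ℝ × ℝ, |∑ b ∈ Finset.Icc (-M) M, resw B rb b * χ (q, (b : ℝ))
      - 1 / B * ∫ x, χ (q, x)| ≤ N * (eδ q.1 * eγ q.2) := by
    rintro ⟨y, z⟩
    refine abs_sum_resw_sub_integral_le_mul hB (hTb y z) (hmb y z) (hMb y z) _
      (mul_nonneg (e0 _ _) (e0 _ _)) ?_
    rintro ⟨b, hd⟩
    obtain ⟨h2, h3, -⟩ := hbox y z b hd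
    rw [heδ, heγ, e1 _ _ h2, e1 _ _ h3, one_mul]
  -- integrate the second estimate over `y`
  have h2' : ∀ b : ℤ, |∑ c ∈ Finset.Icc (-M) M, resw C (rc b) c * (∫ y, χ ((y, (c : ℝ)), (b : ℝ)))
      - 1 / C * ∫ q : ℝ × ℝ, χ (q, b)| ≤ N * (2 * δ * eβ b) := by
    intro b
    have e : ∑ c ∈ Finset.Icc (-M) M, resw C (rc b) c * (∫ y, χ ((y, (c : ℝ)), (b : ℝ)))
        - 1 / C * ∫ q : ℝ × ℝ, χ (q, b)
        = ∫ y, (∑ c ∈ Finset.Icc (-M) M, resw C (rc b) c * χ ((y, (c : ℝ)), (b : ℝ))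
          - 1 / C * ∫ z, χ ((y, z), b)) := by
      have hp : ∫ q : ℝ × ℝ, χ (q, b) = ∫ y, ∫ z, χ ((y, z), (b : ℝ)) :=
        integral_prod _ (hI2 b)
      have i1 : Integrable fun y => ∑ c ∈ Finset.Icc (-M) M,
          resw C (rc b) c * χ ((y, (c : ℝ)), (b : ℝ)) :=
        integrable_finsetSum _ fun c _ => (hI1 c b).const_mul _
      have i2 : Integrable fun y => 1 / (C : ℝ) * ∫ z, χ ((y, z), (b : ℝ)) :=
        Integrable.const_mul (Integrable.integral_prod_left (hI2 b)) _
      have i3 : ∀ c ∈ Finset.Icc (-M) M, Integrable fun y =>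
          resw C (rc b) c * χ ((y, (c : ℝ)), (b : ℝ)) := fun c _ => (hI1 c b).const_mul _
      rw [integral_sub i1 i2, integral_finsetSum _ i3, hp]
      simp only [integral_const_mul]
    rw [e, ← Real.norm_eq_abs]
    refine (norm_integral_le_of_norm_le
        ((Integrable.mul_const (eintegrable δ) (eβ b)).const_mul (N : ℝ))
      (Filter.Eventually.of_forall fun y => h2 b y)).trans ?_
    rw [integral_const_mul, integral_mul_const, eint δ hδ]
  have h3' : |∑ b ∈ Finset.Icc (-M) M, resw B rb b * (∫ q : ℝ × ℝ, χ (q, (b : ℝ)))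
      - 1 / B * volume.real T| ≤ N * (2 * δ * (2 * γ)) := by
    have e : ∑ b ∈ Finset.Icc (-M) M, resw B rb b * (∫ q : ℝ × ℝ, χ (q, (b : ℝ)))
        - 1 / B * volume.real T
        = ∫ q : ℝ × ℝ, (∑ b ∈ Finset.Icc (-M) M, resw B rb b * χ (q, (b : ℝ))
          - 1 / B * ∫ x, χ (q, x)) := by
      have hp : volume.real T = ∫ q : ℝ × ℝ, ∫ x, χ (q, x) := by
        rw [← integral_indicator_one hT]
        exact integral_prod _ hI3
      have i1 : Integrable fun q : ℝ × ℝ => ∑ b ∈ Finset.Icc (-M) M,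
          resw B rb b * χ (q, (b : ℝ)) :=
        integrable_finsetSum _ fun c _ => (hI2 c).const_mul _
      have i2 : Integrable fun q : ℝ × ℝ => 1 / (B : ℝ) * ∫ x, χ (q, x) :=
        Integrable.const_mul (Integrable.integral_prod_left hI3) _
      have i3 : ∀ b ∈ Finset.Icc (-M) M, Integrable fun q : ℝ × ℝ =>
          resw B rb b * χ (q, (b : ℝ)) := fun b _ => (hI2 b).const_mul _
      rw [integral_sub i1 i2, integral_finsetSum _ i3, hp]
      simp only [integral_const_mul]
    rw [e, ← Real.norm_eq_abs]
    have h_int : Integrable (fun q : ℝ × ℝ => eδ q.1 * eγ q.2) :=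
      Integrable.mul_prod (eintegrable δ) (eintegrable γ)
    refine (norm_integral_le_of_norm_le (h_int.const_mul (N : ℝ))
      (Filter.Eventually.of_forall h3)).trans ?_
    rw [integral_const_mul]
    have : ∫ q : ℝ × ℝ, eδ q.1 * eγ q.2 = (∫ x, eδ x) * ∫ x, eγ x := integral_prod_mul eδ eγ
    rw [this, eint δ hδ, eint γ hγ]
  -- assemble
  have sβ := sum_resw_Icc_le hB hβ hMβ rb
  have sγ := fun b => sum_resw_Icc_le hC hγ hMγ (rc b)
  set U := ∑ b ∈ Finset.Icc (-M) M, resw B rb b * ∑ c ∈ Finset.Icc (-M) M, resw C (rc b) c *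
      ∑ d ∈ Finset.Icc (-M) M, resw D (rd b c) d * χ (((d : ℝ), (c : ℝ)), (b : ℝ)) with hU
  set V := ∑ b ∈ Finset.Icc (-M) M, resw B rb b * ∑ c ∈ Finset.Icc (-M) M, resw C (rc b) c *
      ∫ y, χ ((y, (c : ℝ)), (b : ℝ)) with hV
  set W := ∑ b ∈ Finset.Icc (-M) M, resw B rb b * (∫ q : ℝ × ℝ, χ (q, (b : ℝ))) with hW
  have hN : (0 : ℝ) ≤ N := Nat.cast_nonneg N
  have k1 : |U - 1 / D * V| ≤ N * ((2 * β / B + 2) * (2 * γ / C + 2)) := by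
    have e : U - 1 / D * V = ∑ b ∈ Finset.Icc (-M) M, resw B rb b * ∑ c ∈ Finset.Icc (-M) M,
        resw C (rc b) c * (∑ d ∈ Finset.Icc (-M) M, resw D (rd b c) d *
          χ (((d : ℝ), (c : ℝ)), (b : ℝ)) - 1 / D * ∫ y, χ ((y, c), b)) := by
      simp only [hU, hV, mul_sub, Finset.sum_sub_distrib, Finset.mul_sum]
      congr 1
      refine Finset.sum_congr rfl fun b _ => Finset.sum_congr rfl fun c _ => by ring
    rw [e]
    calc _ ≤ ∑ b ∈ Finset.Icc (-M) M, resw B rb b * ∑ c ∈ Finset.Icc (-M) M,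
        resw C (rc b) c * (N * (eγ c * eβ b)) := by
          refine (Finset.abs_sum_le_sum_abs _ _).trans (Finset.sum_le_sum fun b _ => ?_)
          rw [abs_mul, abs_of_nonneg (resw_nonneg _ _ _)]
          refine mul_le_mul_of_nonneg_left ?_ (resw_nonneg _ _ _)
          refine (Finset.abs_sum_le_sum_abs _ _).trans (Finset.sum_le_sum fun c _ => ?_)
          rw [abs_mul, abs_of_nonneg (resw_nonneg _ _ _)]
          exact mul_le_mul_of_nonneg_left (h1 b c) (resw_nonneg _ _ _)
      _ = N * ∑ b ∈ Finset.Icc (-M) M, resw B rb b * eβ b * ∑ c ∈ Finset.Icc (-M) M,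
        resw C (rc b) c * eγ c := by
          simp only [Finset.mul_sum]
          refine Finset.sum_congr rfl fun b _ => Finset.sum_congr rfl fun c _ => by ring
      _ ≤ N * ∑ b ∈ Finset.Icc (-M) M, resw B rb b * eβ b * (2 * γ / C + 2) := by
          refine mul_le_mul_of_nonneg_left (Finset.sum_le_sum fun b _ => ?_) hN
          exact mul_le_mul_of_nonneg_left (sγ b) (mul_nonneg (resw_nonneg _ _ _) (e0 _ _))
      _ ≤ _ := by
          rw [← Finset.sum_mul]
          exact mul_le_mul_of_nonneg_left (mul_le_mul_of_nonneg_right sβ (by positivity)) hN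
  have k2 : |V - 1 / C * W| ≤ N * ((2 * β / B + 2) * (2 * δ)) := by
    have e : V - 1 / C * W = ∑ b ∈ Finset.Icc (-M) M, resw B rb b * (∑ c ∈ Finset.Icc (-M) M,
        resw C (rc b) c * (∫ y, χ ((y, (c : ℝ)), (b : ℝ))) - 1 / C * ∫ q : ℝ × ℝ, χ (q, b)) := by
      simp only [hV, hW, mul_sub, Finset.sum_sub_distrib]
      rw [Finset.mul_sum]
      congr 1
      refine Finset.sum_congr rfl fun b _ => by ring
    rw [e]
    calc _ ≤ ∑ b ∈ Finset.Icc (-M) M, resw B rb b * (N * (2 * δ * eβ b)) := by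
          refine (Finset.abs_sum_le_sum_abs _ _).trans (Finset.sum_le_sum fun b _ => ?_)
          rw [abs_mul, abs_of_nonneg (resw_nonneg _ _ _)]
          exact mul_le_mul_of_nonneg_left (h2' b) (resw_nonneg _ _ _)
      _ = N * ((∑ b ∈ Finset.Icc (-M) M, resw B rb b * eβ b) * (2 * δ)) := by
          simp only [Finset.mul_sum, Finset.sum_mul]
          refine Finset.sum_congr rfl fun b _ => by ring
      _ ≤ _ := mul_le_mul_of_nonneg_left (mul_le_mul_of_nonneg_right sβ (by positivity)) hN
  have e : U - volume.real T / (B * C * D) = (U - 1 / D * V) + 1 / D * (V - 1 / C * W)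
      + 1 / (C * D) * (W - 1 / B * volume.real T) := by
    field_simp
    ring
  rw [e]
  refine (abs_add_three _ _ _).trans ?_
  rw [abs_mul, abs_mul, abs_of_pos (by positivity : (0 : ℝ) < 1 / D),
    abs_of_pos (by positivity : (0 : ℝ) < 1 / (C * D))]
  have k2' := mul_le_mul_of_nonneg_left k2 (by positivity : (0 : ℝ) ≤ 1 / D)
  have k3' : 1 / (C * D) * |W - 1 / B * volume.real T| ≤ 1 / (C * D) * (N * (2 * δ * (2 * γ))) :=
    mul_le_mul_of_nonneg_left h3' (by positivity)
  refine (add_le_add (add_le_add k1 k2') k3').trans (le_of_eq ?_)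
  ring

/-- A reduction domain for real cubic forms whose discriminant has the sign of `ε`, with
coordinates `(w, σ, t)` on the forms of given leading coefficient. -/
structure IsReg (ε : ℤ) (R RC : ℝ → ℝ → ℝ → ℝ → Prop) (k α μ κ κ' : ℝ) : Prop where
  eps : ε = 1 ∨ ε = -1
  const : (k = 3 ∧ α = -3 ∧ μ = -1 ∧ κ = 36 ∧ κ' = 108) ∨
    (k = 1 ∧ α = 1 ∧ μ = 1 ∧ κ = 4 ∧ κ' = 4)
  exists_param : ∀ a b c d : ℝ, a ≠ 0 → 0 < ε * cubicDisc a b c d → ∃ w σ t : ℝ, 0 < t ∧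
    b = -3 * a * σ + k * w * t ∧ c = 3 * a * σ ^ 2 + α * a * t ^ 2 - 2 * k * w * σ * t ∧
    d = -a * σ ^ 3 - α * a * σ * t ^ 2 + k * w * σ ^ 2 * t + μ * w * t ^ 3
  disc_param : ∀ a w σ t : ℝ, ε * cubicDisc a (-3 * a * σ + k * w * t)
    (3 * a * σ ^ 2 + α * a * t ^ 2 - 2 * k * w * σ * t)
    (-a * σ ^ 3 - α * a * σ * t ^ 2 + k * w * σ ^ 2 * t + μ * w * t ^ 3)
    = κ' * t ^ 6 * (a ^ 2 + w ^ 2) ^ 2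
  mem_iff : ∀ a w σ t : ℝ, a ≠ 0 → 0 < t → (R a (-3 * a * σ + k * w * t)
    (3 * a * σ ^ 2 + α * a * t ^ 2 - 2 * k * w * σ * t)
    (-a * σ ^ 3 - α * a * σ * t ^ 2 + k * w * σ ^ 2 * t + μ * w * t ^ 3)
    ↔ |σ| < 1 / 2 ∧ 1 < σ ^ 2 + t ^ 2)
  memC_iff : ∀ a w σ t : ℝ, a ≠ 0 → 0 < t → (RC a (-3 * a * σ + k * w * t)
    (3 * a * σ ^ 2 + α * a * t ^ 2 - 2 * k * w * σ * t)
    (-a * σ ^ 3 - α * a * σ * t ^ 2 + k * w * σ ^ 2 * t + μ * w * t ^ 3)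
    ↔ |σ| ≤ 1 / 2 ∧ 1 ≤ σ ^ 2 + t ^ 2)
  few_b : ∀ a c d : ℝ, FewChanges 9 {b | R a b c d}
  few_c : ∀ a b d : ℝ, FewChanges 9 {c | R a b c d}
  few_d : ∀ a b c : ℝ, FewChanges 9 {d | R a b c d}
  meas : ∀ a : ℝ, MeasurableSet {p : (ℝ × ℝ) × ℝ | R a p.2 p.1.2 p.1.1}
  closed : ∀ a b c d : ℝ, R a b c d → RC a b c d
  neg_iff : ∀ a b c d : ℝ, R (-a) (-b) (-c) (-d) ↔ R a b c d
  alt_iff : ∀ a b c d : ℝ, R a (-b) c (-d) ↔ R a b c d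
  exists_equiv : ∀ f : BCF, f.Irr → 0 < ε * f.disc →
    ∃ g : BCF, f.Equiv g ∧ RC g.a g.b g.c g.d
  diag : ∀ (f : BCF) (p q r s : ℤ), f.Irr → 0 < ε * f.disc → (p * s - q * r) ^ 2 = 1 →
    R f.a f.b f.c f.d → R (f.comp p q r s).a (f.comp p q r s).b (f.comp p q r s).c
      (f.comp p q r s).d → q = 0 ∧ r = 0
  boundary : ∀ a b c : ℤ, a ≠ 0 → (b ≠ 0 ∨ (c ≠ 0 ∧ c ≠ -3 * a)) →
    ∃ Z : Finset ℤ, Z.card ≤ 4 ∧ ∀ d : ℤ, RC a b c d → ¬ R a b c d → d ∈ Z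

theorem reduced_iff {A : ℝ} (hA : 0 < A) (σ t : ℝ) :
    (-2 * σ * A < A ∧ -(-2 * σ * A) < A ∧ A < (σ ^ 2 + t ^ 2) * A) ↔
      |σ| < 1 / 2 ∧ 1 < σ ^ 2 + t ^ 2 := by
  rw [abs_lt, mul_lt_iff_lt_one_left hA, neg_mul_eq_neg_mul, mul_lt_iff_lt_one_left hA,
    lt_mul_iff_one_lt_left hA]
  constructor
  · rintro ⟨h1, h2, h3⟩
    exact ⟨⟨by linarith, by linarith⟩, h3⟩
  · rintro ⟨⟨h1, h2⟩, h3⟩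
    exact ⟨by linarith, by linarith, h3⟩

theorem reduced_iff' {A : ℝ} (hA : 0 < A) (σ t : ℝ) :
    (-2 * σ * A ≤ A ∧ -(-2 * σ * A) ≤ A ∧ A ≤ (σ ^ 2 + t ^ 2) * A) ↔
      |σ| ≤ 1 / 2 ∧ 1 ≤ σ ^ 2 + t ^ 2 := by
  rw [abs_le, mul_le_iff_le_one_left hA, neg_mul_eq_neg_mul, mul_le_iff_le_one_left hA,
    le_mul_iff_one_le_left hA]
  constructor
  · rintro ⟨h1, h2, h3⟩
    exact ⟨⟨by linarith, by linarith⟩, h3⟩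
  · rintro ⟨⟨h1, h2⟩, h3⟩
    exact ⟨by linarith, by linarith, h3⟩

theorem hessian_param (a w σ t : ℝ) :
    (-3 * a * σ + 3 * w * t) ^ 2 - 3 * a * (3 * a * σ ^ 2 + -3 * a * t ^ 2 - 2 * 3 * w * σ * t)
      = 9 * t ^ 2 * (a ^ 2 + w ^ 2) ∧
    (-3 * a * σ + 3 * w * t) * (3 * a * σ ^ 2 + -3 * a * t ^ 2 - 2 * 3 * w * σ * t)
      - 9 * a * (-a * σ ^ 3 - -3 * a * σ * t ^ 2 + 3 * w * σ ^ 2 * t + -1 * w * t ^ 3)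
      = -2 * σ * (9 * t ^ 2 * (a ^ 2 + w ^ 2)) ∧
    (3 * a * σ ^ 2 + -3 * a * t ^ 2 - 2 * 3 * w * σ * t) ^ 2 - 3 * (-3 * a * σ + 3 * w * t)
      * (-a * σ ^ 3 - -3 * a * σ * t ^ 2 + 3 * w * σ ^ 2 * t + -1 * w * t ^ 3)
      = (σ ^ 2 + t ^ 2) * (9 * t ^ 2 * (a ^ 2 + w ^ 2)) :=
  ⟨by ring, by ring, by ring⟩

theorem exists_finset_of_card_le_one {p : ℤ → Prop} (h : ∀ x y, p x → p y → x = y) :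
    ∃ Z : Finset ℤ, Z.card ≤ 1 ∧ ∀ x, p x → x ∈ Z := by
  by_cases hp : ∃ x, p x
  · obtain ⟨x, hx⟩ := hp
    exact ⟨{x}, by simp, fun y hy => by simp [h y x hy hx]⟩
  · exact ⟨∅, by simp, fun x hx => (hp ⟨x, hx⟩).elim⟩

theorem exists_finset_or {p q : ℤ → Prop} {m n : ℕ}
    (hp : ∃ Z : Finset ℤ, Z.card ≤ m ∧ ∀ x, p x → x ∈ Z)
    (hq : ∃ Z : Finset ℤ, Z.card ≤ n ∧ ∀ x, q x → x ∈ Z) :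
    ∃ Z : Finset ℤ, Z.card ≤ m + n ∧ ∀ x, p x ∨ q x → x ∈ Z := by
  obtain ⟨Z, hZ, h⟩ := hp
  obtain ⟨W, hW, h'⟩ := hq
  refine ⟨Z ∪ W, (Finset.card_union_le _ _).trans (add_le_add hZ hW), ?_⟩
  rintro x (hx | hx)
  · exact Finset.mem_union_left _ (h x hx)
  · exact Finset.mem_union_right _ (h' x hx)

theorem isReg_pos : IsReg 1 RPos RPosC 3 (-3) (-1) 36 108 where
  eps := Or.inl rfl
  const := Or.inl ⟨rfl, rfl, rfl, rfl, rfl⟩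
  exists_param a b c d ha hD := by
    obtain ⟨w, σ, t, ht, h1, h2, h3⟩ := exists_param_pos ha (by simpa using hD)
    refine ⟨w, σ, t, ht, ?_, ?_, ?_⟩
    · rw [h1]; ring
    · rw [h2]; ring
    · rw [h3]; ring
  disc_param a w σ t := by unfold cubicDisc; push_cast; ring
  mem_iff a w σ t ha ht := by
    obtain ⟨e1, e2, e3⟩ := hessian_param a w σ t
    unfold RPos
    rw [e1, e2, e3]
    exact reduced_iff (by positivity) σ t
  memC_iff a w σ t ha ht := by
    obtain ⟨e1, e2, e3⟩ := hessian_param a w σ t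
    unfold RPosC
    rw [e1, e2, e3]
    exact reduced_iff' (by positivity) σ t
  few_b a c d := by
    refine (((fewChanges_cubic (f := fun b => b ^ 2 - 3 * a * c - (b * c - 9 * a * d))
      (-3 * a * c + 9 * a * d) (-c) 1 0 (fun x => by ring)).inter
      (fewChanges_cubic (f := fun b => b ^ 2 - 3 * a * c + (b * c - 9 * a * d))
      (-3 * a * c - 9 * a * d) c 1 0 (fun x => by ring))).inter
      (fewChanges_cubic (f := fun b => c ^ 2 - 3 * b * d - (b ^ 2 - 3 * a * c))
      (c ^ 2 + 3 * a * c) (-3 * d) (-1) 0 (fun x => by ring))).mono le_rfl |> fun h => ?_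
    convert h using 1
    ext b
    simp only [RPos, Set.mem_inter_iff, Set.mem_ofPred_eq, sub_pos, neg_lt_iff_pos_add', and_assoc]
    rw [add_comm (b * c - _)]
  few_c a b d := by
    refine (((fewChanges_cubic (f := fun c => b ^ 2 - 3 * a * c - (b * c - 9 * a * d))
      (b ^ 2 + 9 * a * d) (-3 * a - b) 0 0 (fun x => by ring)).inter
      (fewChanges_cubic (f := fun c => b ^ 2 - 3 * a * c + (b * c - 9 * a * d))
      (b ^ 2 - 9 * a * d) (-3 * a + b) 0 0 (fun x => by ring))).inter
      (fewChanges_cubic (f := fun c => c ^ 2 - 3 * b * d - (b ^ 2 - 3 * a * c))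
      (-3 * b * d - b ^ 2) (3 * a) 1 0 (fun x => by ring))).mono le_rfl |> fun h => ?_
    convert h using 1
    ext c
    simp only [RPos, Set.mem_inter_iff, Set.mem_ofPred_eq, sub_pos, neg_lt_iff_pos_add', and_assoc]
    rw [add_comm (b * c - _)]
  few_d a b c := by
    refine (((fewChanges_cubic (f := fun d => b ^ 2 - 3 * a * c - (b * c - 9 * a * d))
      (b ^ 2 - 3 * a * c - b * c) (9 * a) 0 0 (fun x => by ring)).inter
      (fewChanges_cubic (f := fun d => b ^ 2 - 3 * a * c + (b * c - 9 * a * d))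
      (b ^ 2 - 3 * a * c + b * c) (-9 * a) 0 0 (fun x => by ring))).inter
      (fewChanges_cubic (f := fun d => c ^ 2 - 3 * b * d - (b ^ 2 - 3 * a * c))
      (c ^ 2 - b ^ 2 + 3 * a * c) (-3 * b) 0 0 (fun x => by ring))).mono le_rfl |> fun h => ?_
    convert h using 1
    ext d
    simp only [RPos, Set.mem_inter_iff, Set.mem_ofPred_eq, sub_pos, neg_lt_iff_pos_add', and_assoc]
    rw [add_comm (b * c - _)]
  meas a := by
    have h1 : MeasurableSet {p : (ℝ × ℝ) × ℝ | p.2 * p.1.2 - 9 * a * p.1.1 <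
        p.2 ^ 2 - 3 * a * p.1.2} :=
      measurableSet_lt (by fun_prop) (by fun_prop)
    have h2 : MeasurableSet {p : (ℝ × ℝ) × ℝ |
        -(p.2 * p.1.2 - 9 * a * p.1.1) < p.2 ^ 2 - 3 * a * p.1.2} :=
      measurableSet_lt (by fun_prop) (by fun_prop)
    have h3 : MeasurableSet {p : (ℝ × ℝ) × ℝ | p.2 ^ 2 - 3 * a * p.1.2 <
        p.1.2 ^ 2 - 3 * p.2 * p.1.1} :=
      measurableSet_lt (by fun_prop) (by fun_prop)
    exact h1.inter (h2.inter h3)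
  closed a b c d h := ⟨h.1.le, h.2.1.le, h.2.2.le⟩
  neg_iff a b c d := by unfold RPos; ring_nf
  alt_iff a b c d := by
    unfold RPos
    constructor
    · rintro ⟨h1, h2, h3⟩
      exact ⟨by linarith, by linarith, by linarith⟩
    · rintro ⟨h1, h2, h3⟩
      exact ⟨by linarith, by linarith, by linarith⟩
  exists_equiv f hf hD := BCF.exists_equiv_rPosC hf (by simpa using hD)
  diag f p q r s _ _ hdet h h' := BCF.diag_of_rPos hdet h h'
  boundary a b c ha hb := by
    obtain ⟨Z, hZ, h⟩ := exists_finset_or (exists_finset_or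
      (exists_finset_of_card_le_one (p := fun d => b * c - 9 * a * d = b ^ 2 - 3 * a * c)
        fun x y hx hy => by
          have : a * x = a * y := by linarith
          exact mul_left_cancel₀ ha this)
      (exists_finset_of_card_le_one (p := fun d => -(b * c - 9 * a * d) = b ^ 2 - 3 * a * c)
        fun x y hx hy => by
          have : a * x = a * y := by linarith
          exact mul_left_cancel₀ ha this))
      (exists_finset_of_card_le_one (p := fun d => b ≠ 0 ∧ b ^ 2 - 3 * a * c = c ^ 2 - 3 * b * d)
        fun x y hx hy => by
          have : b * x = b * y := by linarith [hx.2, hy.2]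
          exact mul_left_cancel₀ hx.1 this)
    refine ⟨Z, hZ.trans (by norm_num), fun d h1 h2 => h d ?_⟩
    obtain ⟨k1, k2, k3⟩ := h1
    by_contra! hne
    obtain ⟨⟨n1, n2⟩, n3⟩ := hne
    refine h2 ⟨lt_of_le_of_ne k1 ?_, lt_of_le_of_ne k2 ?_, lt_of_le_of_ne k3 ?_⟩
    · exact_mod_cast n1
    · exact_mod_cast n2
    · intro h3
      have h4 : b ^ 2 - 3 * a * c = c ^ 2 - 3 * b * d := by exact_mod_cast h3
      by_cases hb0 : b = 0
      · rcases hb with hb | ⟨hc, hc'⟩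
        · exact hb hb0
        · rw [hb0] at h4
          have : c * (c + 3 * a) = 0 := by linarith
          rcases mul_eq_zero.1 this with h5 | h5
          · exact hc h5
          · exact hc' (by linarith)
      · exact n3 hb0 h4

theorem exists_finset_of_quadratic (b e : ℤ) :
    ∃ Z : Finset ℤ, Z.card ≤ 2 ∧ ∀ x : ℤ, x ^ 2 - b * x = e → x ∈ Z := by
  by_cases hp : ∃ x : ℤ, x ^ 2 - b * x = e
  · obtain ⟨x, hx⟩ := hp
    refine ⟨{x, b - x}, Finset.card_le_two, fun y hy => ?_⟩
    have : (y - x) * (y - (b - x)) = 0 := by linear_combination hy - hx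
    rcases mul_eq_zero.1 this with h | h
    · simp [sub_eq_zero.1 h]
    · simp [sub_eq_zero.1 h]
  · exact ⟨∅, by simp, fun x hx => (hp ⟨x, hx⟩).elim⟩

theorem rNeg_param {a w σ t : ℝ} (ha : a ≠ 0) (ht : 0 < t) :
    ∃ A B C : ℝ, 0 < A ∧ 0 < B ∧ 0 < C ∧
    a * (-a * σ ^ 3 - 1 * a * σ * t ^ 2 + 1 * w * σ ^ 2 * t + 1 * w * t ^ 3)
      - (-3 * a * σ + 1 * w * t) * (3 * a * σ ^ 2 + 1 * a * t ^ 2 - 2 * 1 * w * σ * t)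
      + (a - (-3 * a * σ + 1 * w * t)) ^ 2
      + a * (3 * a * σ ^ 2 + 1 * a * t ^ 2 - 2 * 1 * w * σ * t) = (1 + 2 * σ) * A ∧
    (a + (-3 * a * σ + 1 * w * t)) ^ 2
      + a * (3 * a * σ ^ 2 + 1 * a * t ^ 2 - 2 * 1 * w * σ * t)
      + (-3 * a * σ + 1 * w * t) * (3 * a * σ ^ 2 + 1 * a * t ^ 2 - 2 * 1 * w * σ * t)
      - a * (-a * σ ^ 3 - 1 * a * σ * t ^ 2 + 1 * w * σ ^ 2 * t + 1 * w * t ^ 3)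
      = (1 - 2 * σ) * B ∧
    (-a * σ ^ 3 - 1 * a * σ * t ^ 2 + 1 * w * σ ^ 2 * t + 1 * w * t ^ 3) ^ 2 - a ^ 2
      + a * (3 * a * σ ^ 2 + 1 * a * t ^ 2 - 2 * 1 * w * σ * t)
      - (-3 * a * σ + 1 * w * t) *
        (-a * σ ^ 3 - 1 * a * σ * t ^ 2 + 1 * w * σ ^ 2 * t + 1 * w * t ^ 3)
      = (σ ^ 2 + t ^ 2 - 1) * C := by
  obtain ⟨m1, m2, m3⟩ := neg_factors_pos (u := a) (v := t * w - a * σ) (α := 1) (β := -2 * σ)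
    (γ := σ ^ 2 + t ^ 2) (Or.inl ha) one_pos (by nlinarith [pow_pos ht 2])
  exact ⟨_, _, _, m1, m2, m3, by ring, by ring, by ring⟩

theorem isReg_neg : IsReg (-1) RNeg RNegC 1 1 1 4 4 where
  eps := Or.inr rfl
  const := Or.inr ⟨rfl, rfl, rfl, rfl, rfl⟩
  exists_param a b c d ha hD := by
    obtain ⟨w, σ, t, ht, h1, h2, h3⟩ := exists_param_neg (a := a) (b := b) (c := c) (d := d) ha
      (by push_cast at hD; linarith)
    refine ⟨w, σ, t, ht, ?_, ?_, ?_⟩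
    · rw [h1]; ring
    · rw [h2]; ring
    · rw [h3]; ring
  disc_param a w σ t := by unfold cubicDisc; push_cast; ring
  mem_iff a w σ t ha ht := by
    obtain ⟨A, B, C, hA, hB, hC, e1, e2, e3⟩ := rNeg_param (w := w) (σ := σ) ha ht
    unfold RNeg
    rw [e1, e2, e3, mul_pos_iff_of_pos_right hA, mul_pos_iff_of_pos_right hB,
      mul_pos_iff_of_pos_right hC, abs_lt]
    constructor
    · rintro ⟨h1, h2, h3⟩
      exact ⟨⟨by linarith, by linarith⟩, by linarith⟩
    · rintro ⟨⟨h1, h2⟩, h3⟩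
      exact ⟨by linarith, by linarith, by linarith⟩
  memC_iff a w σ t ha ht := by
    obtain ⟨A, B, C, hA, hB, hC, e1, e2, e3⟩ := rNeg_param (w := w) (σ := σ) ha ht
    unfold RNegC
    rw [e1, e2, e3, mul_nonneg_iff_of_pos_right hA, mul_nonneg_iff_of_pos_right hB,
      mul_nonneg_iff_of_pos_right hC, abs_le]
    constructor
    · rintro ⟨h1, h2, h3⟩
      exact ⟨⟨by linarith, by linarith⟩, by linarith⟩
    · rintro ⟨⟨h1, h2⟩, h3⟩
      exact ⟨by linarith, by linarith, by linarith⟩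
  few_b a c d := by
    have h := ((fewChanges_cubic (f := fun b => a * d - b * c + (a - b) ^ 2 + a * c)
      (a * d + a ^ 2 + a * c) (-c - 2 * a) 1 0 (fun x => by ring)).inter
      (fewChanges_cubic (f := fun b => (a + b) ^ 2 + a * c + b * c - a * d)
      (a ^ 2 + a * c - a * d) (2 * a + c) 1 0 (fun x => by ring))).inter
      (fewChanges_cubic (f := fun b => d ^ 2 - a ^ 2 + a * c - b * d)
      (d ^ 2 - a ^ 2 + a * c) (-d) 0 0 (fun x => by ring))
    convert h using 1
    ext b
    simp only [RNeg, Set.mem_inter_iff, Set.mem_ofPred_eq, and_assoc]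
  few_c a b d := by
    have h := ((fewChanges_cubic (f := fun c => a * d - b * c + (a - b) ^ 2 + a * c)
      (a * d + (a - b) ^ 2) (a - b) 0 0 (fun x => by ring)).inter
      (fewChanges_cubic (f := fun c => (a + b) ^ 2 + a * c + b * c - a * d)
      ((a + b) ^ 2 - a * d) (a + b) 0 0 (fun x => by ring))).inter
      (fewChanges_cubic (f := fun c => d ^ 2 - a ^ 2 + a * c - b * d)
      (d ^ 2 - a ^ 2 - b * d) a 0 0 (fun x => by ring))
    convert h using 1
    ext c
    simp only [RNeg, Set.mem_inter_iff, Set.mem_ofPred_eq, and_assoc]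
  few_d a b c := by
    have h := ((fewChanges_cubic (f := fun d => a * d - b * c + (a - b) ^ 2 + a * c)
      (-b * c + (a - b) ^ 2 + a * c) a 0 0 (fun x => by ring)).inter
      (fewChanges_cubic (f := fun d => (a + b) ^ 2 + a * c + b * c - a * d)
      ((a + b) ^ 2 + a * c + b * c) (-a) 0 0 (fun x => by ring))).inter
      (fewChanges_cubic (f := fun d => d ^ 2 - a ^ 2 + a * c - b * d)
      (- a ^ 2 + a * c) (-b) 1 0 (fun x => by ring))
    convert h using 1
    ext d
    simp only [RNeg, Set.mem_inter_iff, Set.mem_ofPred_eq, and_assoc]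
  meas a := by
    have h1 : MeasurableSet {p : (ℝ × ℝ) × ℝ |
        0 < a * p.1.1 - p.2 * p.1.2 + (a - p.2) ^ 2 + a * p.1.2} :=
      measurableSet_lt (by fun_prop) (by fun_prop)
    have h2 : MeasurableSet {p : (ℝ × ℝ) × ℝ |
        0 < (a + p.2) ^ 2 + a * p.1.2 + p.2 * p.1.2 - a * p.1.1} :=
      measurableSet_lt (by fun_prop) (by fun_prop)
    have h3 : MeasurableSet {p : (ℝ × ℝ) × ℝ |
        0 < p.1.1 ^ 2 - a ^ 2 + a * p.1.2 - p.2 * p.1.1} :=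
      measurableSet_lt (by fun_prop) (by fun_prop)
    exact h1.inter (h2.inter h3)
  closed a b c d h := ⟨h.1.le, h.2.1.le, h.2.2.le⟩
  neg_iff a b c d := by unfold RNeg; ring_nf
  alt_iff a b c d := by
    unfold RNeg
    constructor
    · rintro ⟨h1, h2, h3⟩
      exact ⟨by linarith, by linarith, by linarith⟩
    · rintro ⟨h1, h2, h3⟩
      exact ⟨by linarith, by linarith, by linarith⟩
  exists_equiv f hf hD := BCF.exists_equiv_rNegC hf (by simpa using hD)
  diag f p q r s hf hD hdet h h' := BCF.diag_of_rNeg hf.a_ne (by simpa using hD) hdet h h'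
  boundary a b c ha _ := by
    obtain ⟨Z, hZ, h⟩ := exists_finset_or (exists_finset_or
      (exists_finset_of_card_le_one
        (p := fun d => 0 = a * d - b * c + (a - b) ^ 2 + a * c)
        fun x y hx hy => by
          have : a * x = a * y := by linarith
          exact mul_left_cancel₀ ha this)
      (exists_finset_of_card_le_one
        (p := fun d => 0 = (a + b) ^ 2 + a * c + b * c - a * d)
        fun x y hx hy => by
          have : a * x = a * y := by linarith
          exact mul_left_cancel₀ ha this))
      (exists_finset_of_quadratic b (a ^ 2 - a * c))
    refine ⟨Z, hZ.trans (by norm_num), fun d h1 h2 => h d ?_⟩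
    obtain ⟨k1, k2, k3⟩ := h1
    by_contra! hne
    obtain ⟨⟨n1, n2⟩, n3⟩ := hne
    refine h2 ⟨lt_of_le_of_ne k1 ?_, lt_of_le_of_ne k2 ?_, lt_of_le_of_ne k3 ?_⟩
    · exact_mod_cast n1
    · exact_mod_cast n2
    · intro h3
      have h4 : 0 = d ^ 2 - a ^ 2 + a * c - b * d := by exact_mod_cast h3
      exact n3 (by linarith)

namespace IsReg

variable {ε : ℤ} {R RC : ℝ → ℝ → ℝ → ℝ → Prop} {k α μ κ κ' : ℝ}

/-- The adapted coordinates of a cubic form are unique. -/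
theorem param_inj (h : IsReg ε R RC k α μ κ κ') {a w σ t w' σ' t' : ℝ} (ha : a ≠ 0) (ht : 0 < t)
    (ht' : 0 < t')
    (hb : -3 * a * σ + k * w * t = -3 * a * σ' + k * w' * t')
    (hc : 3 * a * σ ^ 2 + α * a * t ^ 2 - 2 * k * w * σ * t =
      3 * a * σ' ^ 2 + α * a * t' ^ 2 - 2 * k * w' * σ' * t')
    (hd : -a * σ ^ 3 - α * a * σ * t ^ 2 + k * w * σ ^ 2 * t + μ * w * t ^ 3 =
      -a * σ' ^ 3 - α * a * σ' * t' ^ 2 + k * w' * σ' ^ 2 * t' + μ * w' * t' ^ 3) :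
    w = w' ∧ σ = σ' ∧ t = t' := by
  have key : σ = σ' → t ^ 2 = t' ^ 2 → w = w' ∧ σ = σ' ∧ t = t' := by
    intro h1 h2
    have h3 : t = t' := (pow_left_inj₀ ht.le ht'.le two_ne_zero).1 h2
    subst h1 h3
    refine ⟨?_, rfl, rfl⟩
    have hk : k ≠ 0 := by rcases h.const with h | h <;> rw [h.1] <;> norm_num
    have : k * t * (w - w') = 0 := by linarith
    rcases mul_eq_zero.1 this with h4 | h4
    · exact ((mul_ne_zero hk ht.ne') h4).elim
    · linarith
  rcases h.const with ⟨rfl, rfl, rfl, -, -⟩ | ⟨rfl, rfl, rfl, -, -⟩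
  · obtain ⟨e1, e2, e3⟩ := hessian_param a w σ t
    obtain ⟨f1, f2, f3⟩ := hessian_param a w' σ' t'
    rw [hb, hc] at e1
    rw [hb, hc, hd] at e2 e3
    have hA : 0 < 9 * t ^ 2 * (a ^ 2 + w ^ 2) := by positivity
    have hAA : 9 * t ^ 2 * (a ^ 2 + w ^ 2) = 9 * t' ^ 2 * (a ^ 2 + w' ^ 2) := by rw [← e1, ← f1]
    rw [f2, ← hAA] at e2
    rw [f3, ← hAA] at e3
    have h1 : σ = σ' := by
      have := mul_right_cancel₀ hA.ne' e2
      linarith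
    subst h1
    exact key rfl (by have := mul_right_cancel₀ hA.ne' e3; linarith)
  · let z : ℂ := σ + t * Complex.I
    have hI := Complex.I_sq
    have e0 : (a * z + (t' * w' - a * σ')) * (z ^ 2 - 2 * σ' * z + (σ' ^ 2 + t' ^ 2)) = 0 := by
      have hb' : (-3 * a * σ + 1 * w * t : ℂ) = -3 * a * σ' + 1 * w' * t' := by exact_mod_cast hb
      have hc' : (3 * a * σ ^ 2 + 1 * a * t ^ 2 - 2 * 1 * w * σ * t : ℂ) =
        3 * a * σ' ^ 2 + 1 * a * t' ^ 2 - 2 * 1 * w' * σ' * t' := by exact_mod_cast hc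
      have hd' : (-a * σ ^ 3 - 1 * a * σ * t ^ 2 + 1 * w * σ ^ 2 * t + 1 * w * t ^ 3 : ℂ) =
        -a * σ' ^ 3 - 1 * a * σ' * t' ^ 2 + 1 * w' * σ' ^ 2 * t' + 1 * w' * t' ^ 3 := by
        exact_mod_cast hd
      have hz : z ^ 2 - 2 * σ * z + (σ ^ 2 + t ^ 2) = 0 := by
        simp only [z]
        linear_combination (t : ℂ) ^ 2 * hI
      linear_combination (a * z + (t * w - a * σ)) * hz - z ^ 2 * hb' - z * hc' - hd'
    rcases mul_eq_zero.1 e0 with h1 | h1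
    · have := congrArg Complex.im h1
      simp [z] at this
      exact (this.elim ha ht.ne').elim
    · have him := congrArg Complex.im h1
      have hre := congrArg Complex.re h1
      simp [z, sq] at him hre
      have h2 : t * (2 * (σ - σ')) = 0 := by linarith
      have h3 : σ = σ' := by
        have := (mul_eq_zero.1 h2).resolve_left ht.ne'
        linarith
      subst h3
      exact key rfl (by linarith)

theorem le_of_sq_le_sq {x y : ℝ} (hx : 0 ≤ x) (hy : 0 ≤ y) (h : x ^ 2 ≤ y ^ 2) : x ≤ y :=
  (pow_le_pow_iff_left₀ hx hy two_ne_zero).1 h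

theorem size_aux {m t l κ' : ℝ} (hm : 0 < m) (ht : 0 < t) (hl : 0 < l) (ht2 : 3 / 4 ≤ t ^ 2)
    (hκ : 4 ≤ κ') (h : κ' * t ^ 6 * (m ^ 2) ^ 2 < l ^ 4) :
    4 / 5 ≤ t ∧ m ^ 2 * t ^ 3 ≤ l ^ 2 / 2 ∧ m * t ≤ l := by
  have ht1 : 4 / 5 ≤ t := le_of_sq_le_sq (by norm_num) ht.le (by linarith)
  have h1 : 4 * (t ^ 6 * (m ^ 2) ^ 2) ≤ κ' * (t ^ 6 * (m ^ 2) ^ 2) :=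
    mul_le_mul_of_nonneg_right hκ (by positivity)
  have h2 : m ^ 2 * t ^ 3 ≤ l ^ 2 / 2 := by
    refine le_of_sq_le_sq (by positivity) (by positivity) ?_
    rw [show (m ^ 2 * t ^ 3) ^ 2 = t ^ 6 * (m ^ 2) ^ 2 by ring,
        show (l ^ 2 / 2) ^ 2 = l ^ 4 / 4 by ring]
    linarith
  refine ⟨ht1, h2, le_of_sq_le_sq (by positivity) hl.le ?_⟩
  have h3 : m ^ 2 * t ^ 2 * (4 / 5) ≤ m ^ 2 * t ^ 2 * t :=
    mul_le_mul_of_nonneg_left ht1 (by positivity)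
  have h4 : 0 < l ^ 2 := by positivity
  rw [mul_pow]
  linarith

theorem size_bounds {a b c d m t l : ℝ} (hm : 0 < m) (ht : 0 < t) (hl : 0 < l) (ht1 : 4 / 5 ≤ t)
    (hmt : m ^ 2 * t ^ 3 ≤ l ^ 2 / 2) (hmtl : m * t ≤ l) (ham : |a| ≤ m)
    (hb : |b| ≤ 3 * m * (1 / 2) + 3 * m * t)
    (hc : |c| ≤ 3 * m * (1 / 2) ^ 2 + 3 * m * t ^ 2 + 2 * 3 * m * (1 / 2) * t)
    (hd : |d| ≤ m * (1 / 2) ^ 3 + 3 * m * (1 / 2) * t ^ 2 + 3 * m * (1 / 2) ^ 2 * t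
      + 1 * m * t ^ 3) :
    |a| ≤ 2 * l ∧ |b| ≤ 10 * l ∧ |a| * c ^ 2 ≤ 100 * l ^ 3 ∧ |a * d| ≤ 10 * l ^ 2 := by
  have g1 : m * (4 / 5) ≤ m * t := mul_le_mul_of_nonneg_left ht1 hm.le
  have g2 : m * t * (4 / 5) ≤ m * t * t := mul_le_mul_of_nonneg_left ht1 (by positivity)
  have g3 : m * t ^ 2 * (4 / 5) ≤ m * t ^ 2 * t := mul_le_mul_of_nonneg_left ht1 (by positivity)
  have hc8 : |c| ≤ 8 * (m * t ^ 2) := by linarith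
  have hd8 : |d| ≤ 8 * (m * t ^ 3) := by linarith
  refine ⟨by linarith, by linarith, ?_, ?_⟩
  · have h4 : |a| * c ^ 2 ≤ 64 * (m ^ 3 * t ^ 4) := by
      rw [← sq_abs c]
      calc |a| * |c| ^ 2 ≤ m * (8 * (m * t ^ 2)) ^ 2 := by gcongr
        _ = _ := by ring
    have h5 : m ^ 3 * t ^ 4 = (m ^ 2 * t ^ 3) * (m * t) := by ring
    have h6 : (m ^ 2 * t ^ 3) * (m * t) ≤ l ^ 2 / 2 * l := by gcongr
    have h7 := pow_pos hl 3
    rw [h5] at h4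
    linarith
  · rw [abs_mul]
    have h4 : |a| * |d| ≤ m * (8 * (m * t ^ 3)) := by gcongr
    have h7 := pow_pos hl 2
    linarith

/-- Size bounds for reduced forms of bounded discriminant. -/
theorem bounds (h : IsReg ε R RC k α μ κ κ') {a b c d l : ℝ} (ha : a ≠ 0) (hl : 0 < l)
    (hR : RC a b c d) (h0 : 0 < ε * cubicDisc a b c d) (h1 : ε * cubicDisc a b c d < l ^ 4) :
    |a| ≤ 2 * l ∧ |b| ≤ 10 * l ∧ |a| * c ^ 2 ≤ 100 * l ^ 3 ∧ |a * d| ≤ 10 * l ^ 2 := by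
  obtain ⟨w, σ, t, ht, hb, hc, hd⟩ := h.exists_param a b c d ha h0
  have hdisc := h.disc_param a w σ t
  rw [← hb, ← hc, ← hd] at hdisc
  have hm := h.memC_iff a w σ t ha ht
  rw [← hb, ← hc, ← hd] at hm
  obtain ⟨hσ, hσt⟩ := hm.1 hR
  rw [hdisc] at h1
  have hσ2 : σ ^ 2 ≤ (1 / 2) ^ 2 := sq_le_sq.2 (by rwa [abs_of_pos (by norm_num : (0 : ℝ) < 1 / 2)])
  have hm2 : √(a ^ 2 + w ^ 2) ^ 2 = a ^ 2 + w ^ 2 := Real.sq_sqrt (by positivity)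
  have hm0 : 0 < √(a ^ 2 + w ^ 2) := Real.sqrt_pos.2 (by positivity)
  have ham : |a| ≤ √(a ^ 2 + w ^ 2) := Real.abs_le_sqrt (by linarith [sq_nonneg w])
  have hwm : |w| ≤ √(a ^ 2 + w ^ 2) := Real.abs_le_sqrt (by linarith [sq_nonneg a])
  rw [← hm2] at h1
  generalize √(a ^ 2 + w ^ 2) = m at *
  have hκ : 4 ≤ κ' := by rcases h.const with h | h <;> rw [h.2.2.2.2] <;> norm_num
  obtain ⟨ht1, hmt, hmtl⟩ := size_aux hm0 ht hl (by linarith) hκ h1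
  have hk : 0 ≤ k ∧ k ≤ 3 ∧ |α| ≤ 3 ∧ |μ| ≤ 1 := by
    rcases h.const with ⟨h1, h2, h3, -⟩ | ⟨h1, h2, h3, -⟩ <;> rw [h1, h2, h3] <;> norm_num
  obtain ⟨hk0, hk3, hα, hμ⟩ := hk
  refine size_bounds hm0 ht hl ht1 hmt hmtl ham ?_ ?_ ?_
  · rw [hb]
    refine (abs_add_le _ _).trans ?_
    rw [abs_mul, abs_mul, abs_mul, abs_mul, abs_of_nonneg hk0, abs_of_pos ht,
      show |(-3 : ℝ)| = 3 by norm_num]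
    gcongr
  · rw [hc]
    refine (abs_sub _ _).trans ((add_le_add_left (abs_add_le _ _) _).trans ?_)
    simp only [abs_mul, abs_pow, abs_of_nonneg hk0, abs_of_pos ht,
      show |(3 : ℝ)| = 3 by norm_num, show |(2 : ℝ)| = 2 by norm_num]
    gcongr
  · rw [hd]
    refine (abs_add_le _ _).trans ((add_le_add_left (abs_add_le _ _) _).trans ?_)
    refine (add_le_add_left (add_le_add_left (abs_sub _ _) _) _).trans ?_
    simp only [abs_mul, abs_pow, abs_of_nonneg hk0, abs_of_pos ht, abs_neg]
    have q1 : |a| * |σ| ^ 3 ≤ m * (1 / 2) ^ 3 := by gcongr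
    have q2 : |α| * |a| * |σ| * t ^ 2 ≤ 3 * m * (1 / 2) * t ^ 2 := by gcongr
    have q3 : k * |w| * |σ| ^ 2 * t ≤ 3 * m * (1 / 2) ^ 2 * t := by gcongr
    have q4 : |μ| * |w| * t ^ 3 ≤ 1 * m * t ^ 3 := by gcongr
    linarith

end IsReg

/-- The forms of leading coefficient `a` in the region `R` whose discriminant has the sign of `ε`
and size less than `X`. -/
def cutSet (ε : ℤ) (R : ℝ → ℝ → ℝ → ℝ → Prop) (X a : ℝ) : Set ((ℝ × ℝ) × ℝ) :=
  {p | R a p.2 p.1.2 p.1.1 ∧ 0 < ε * cubicDisc a p.2 p.1.2 p.1.1 ∧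
    ε * cubicDisc a p.2 p.1.2 p.1.1 < X}

/-- The parametrization of the forms of leading coefficient `a`. -/
def paramMap (k α μ a : ℝ) (p : (ℝ × ℝ) × ℝ) : (ℝ × ℝ) × ℝ :=
  ((-a * p.1.1 ^ 3 - α * a * p.1.1 * p.1.2 ^ 2 + k * p.2 * p.1.1 ^ 2 * p.1.2 + μ * p.2 * p.1.2 ^ 3,
    3 * a * p.1.1 ^ 2 + α * a * p.1.2 ^ 2 - 2 * k * p.2 * p.1.1 * p.1.2),
    -3 * a * p.1.1 + k * p.2 * p.1.2)

/-- Triples as functions on `Fin 3`. -/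
def tripleEquiv : (Fin 3 → ℝ) ≃ₗ[ℝ] (ℝ × ℝ) × ℝ where
  toFun v := ((v 0, v 1), v 2)
  invFun p := ![p.1.1, p.1.2, p.2]
  left_inv v := by ext i; fin_cases i <;> rfl
  right_inv p := rfl
  map_add' _ _ := rfl
  map_smul' _ _ := rfl

theorem tripleEquiv_apply (v : Fin 3 → ℝ) : tripleEquiv v = ((v 0, v 1), v 2) := rfl

theorem tripleEquiv_symm_apply (p : (ℝ × ℝ) × ℝ) : tripleEquiv.symm p = ![p.1.1, p.1.2, p.2] := rfl

/-- The derivative of `paramMap`. -/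
noncomputable def paramDeriv (k α μ a : ℝ) (p : (ℝ × ℝ) × ℝ) : ((ℝ × ℝ) × ℝ) →L[ℝ] (ℝ × ℝ) × ℝ :=
  LinearMap.toContinuousLinearMap (tripleEquiv.toLinearMap ∘ₗ (Matrix.toLin'
    !![-3 * a * p.1.1 ^ 2 - α * a * p.1.2 ^ 2 + 2 * k * p.2 * p.1.1 * p.1.2,
      -2 * α * a * p.1.1 * p.1.2 + k * p.2 * p.1.1 ^ 2 + 3 * μ * p.2 * p.1.2 ^ 2,
      k * p.1.1 ^ 2 * p.1.2 + μ * p.1.2 ^ 3;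
      6 * a * p.1.1 - 2 * k * p.2 * p.1.2, 2 * α * a * p.1.2 - 2 * k * p.2 * p.1.1,
      - 2 * k * p.1.1 * p.1.2;
      -3 * a, k * p.2, k * p.1.2]) ∘ₗ tripleEquiv.symm.toLinearMap)

theorem hasFDerivAt_paramMap (k α μ a : ℝ) (p : (ℝ × ℝ) × ℝ) :
    HasFDerivAt (paramMap k α μ a) (paramDeriv k α μ a p) p := by
  have h1 : HasFDerivAt (fun p : (ℝ × ℝ) × ℝ => p.1.1)
      (ContinuousLinearMap.fst ℝ ℝ ℝ ∘L ContinuousLinearMap.fst ℝ (ℝ × ℝ) ℝ) p :=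
    (ContinuousLinearMap.fst ℝ ℝ ℝ ∘L ContinuousLinearMap.fst ℝ (ℝ × ℝ) ℝ).hasFDerivAt
  have h2 : HasFDerivAt (fun p : (ℝ × ℝ) × ℝ => p.1.2)
      (ContinuousLinearMap.snd ℝ ℝ ℝ ∘L ContinuousLinearMap.fst ℝ (ℝ × ℝ) ℝ) p :=
    (ContinuousLinearMap.snd ℝ ℝ ℝ ∘L ContinuousLinearMap.fst ℝ (ℝ × ℝ) ℝ).hasFDerivAt
  have h3 : HasFDerivAt (fun p : (ℝ × ℝ) × ℝ => p.2) (ContinuousLinearMap.snd ℝ (ℝ × ℝ) ℝ) p :=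
    (ContinuousLinearMap.snd ℝ (ℝ × ℝ) ℝ).hasFDerivAt
  have hd := ((((h1.pow 3).const_mul (-a)).sub ((h1.const_mul (α * a)).mul (h2.pow 2))).add
    (((h3.const_mul k).mul (h1.pow 2)).mul h2)).add ((h3.const_mul μ).mul (h2.pow 3))
  have hc := (((h1.pow 2).const_mul (3 * a)).add ((h2.pow 2).const_mul (α * a))).sub
    (((h3.const_mul (2 * k)).mul h1).mul h2)
  have hb := (h1.const_mul (-3 * a)).add ((h3.const_mul k).mul h2)
  refine ((hd.prodMk hc).prodMk hb).congr_fderiv ?_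
  apply ContinuousLinearMap.ext
  rintro ⟨⟨x, y⟩, z⟩
  simp [paramDeriv, tripleEquiv_apply, tripleEquiv_symm_apply]
  refine ⟨⟨?_, ?_⟩, ?_⟩ <;> ring

theorem det_paramDeriv (k α μ a : ℝ) (p : (ℝ × ℝ) × ℝ) :
    (paramDeriv k α μ a p).det =
      p.1.2 ^ 4 * ((6 * α * μ - 2 * α ^ 2 * k) * a ^ 2 + 4 * k ^ 2 * μ * p.2 ^ 2) := by
  rw [ContinuousLinearMap.det, paramDeriv, LinearMap.coe_toContinuousLinearMap,
    LinearMap.det_conj, LinearMap.det_toLin', Matrix.det_fin_three]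
  simp
  ring

/-- The parameters of the forms of leading coefficient `a` in `cutSet`. -/
def paramSet (κ' X a : ℝ) : Set ((ℝ × ℝ) × ℝ) :=
  {p | (0 < p.1.2 ∧ |p.1.1| < 1 / 2 ∧ 1 < p.1.1 ^ 2 + p.1.2 ^ 2) ∧
    κ' * p.1.2 ^ 6 * (a ^ 2 + p.2 ^ 2) ^ 2 < X}

theorem measurableSet_paramSet (κ' X a : ℝ) : MeasurableSet (paramSet κ' X a) := by
  have h1 : MeasurableSet {p : (ℝ × ℝ) × ℝ | 0 < p.1.2} :=
    measurableSet_lt (by fun_prop) (by fun_prop)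
  have h2 : MeasurableSet {p : (ℝ × ℝ) × ℝ | |p.1.1| < 1 / 2} :=
    measurableSet_lt (by fun_prop) (by fun_prop)
  have h3 : MeasurableSet {p : (ℝ × ℝ) × ℝ | 1 < p.1.1 ^ 2 + p.1.2 ^ 2} :=
    measurableSet_lt (by fun_prop) (by fun_prop)
  have h4 : MeasurableSet {p : (ℝ × ℝ) × ℝ | κ' * p.1.2 ^ 6 * (a ^ 2 + p.2 ^ 2) ^ 2 < X} :=
    measurableSet_lt (by fun_prop) (by fun_prop)
  exact (h1.inter (h2.inter h3)).inter h4

namespace IsReg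

variable {ε : ℤ} {R RC : ℝ → ℝ → ℝ → ℝ → Prop} {k α μ κ κ' : ℝ}

theorem image_paramMap (h : IsReg ε R RC k α μ κ κ') (X : ℝ) {a : ℝ} (ha : a ≠ 0) :
    paramMap k α μ a '' paramSet κ' X a = cutSet ε R X a := by
  have hκ : 0 < κ' := by rcases h.const with h | h <;> rw [h.2.2.2.2] <;> norm_num
  ext ⟨⟨d, c⟩, b⟩
  constructor
  · rintro ⟨⟨⟨σ, t⟩, w⟩, ⟨⟨ht, hσ⟩, hX⟩, hp⟩
    simp only [paramMap, Prod.mk.injEq] at hp ht hσ hX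
    obtain ⟨⟨hd, hc⟩, hb⟩ := hp
    have hdisc := h.disc_param a w σ t
    have hm := h.mem_iff a w σ t ha ht
    rw [hb, hc, hd] at hdisc hm
    have : 0 < a ^ 2 := by positivity
    refine ⟨hm.2 hσ, ?_, ?_⟩
    · simp only [hdisc]
      positivity
    · simp only [hdisc]
      exact hX
  · rintro ⟨h1, h2, h3⟩
    simp only at h1 h2 h3
    obtain ⟨w, σ, t, ht, hb, hc, hd⟩ := h.exists_param a b c d ha h2
    have hdisc := h.disc_param a w σ t
    have hm := h.mem_iff a w σ t ha ht
    rw [← hb, ← hc, ← hd] at hdisc hm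
    refine ⟨((σ, t), w), ⟨⟨ht, hm.1 h1⟩, ?_⟩, ?_⟩
    · rw [hdisc] at h3
      exact h3
    · simp only [paramMap, ← hb, ← hc, ← hd]

theorem volume_cutSet (h : IsReg ε R RC k α μ κ κ') (X : ℝ) {a : ℝ} (ha : a ≠ 0) :
    volume (cutSet ε R X a) =
      ∫⁻ p in paramSet κ' X a, ENNReal.ofReal (κ * p.1.2 ^ 4 * (a ^ 2 + p.2 ^ 2)) := by
  have hinj : Set.InjOn (paramMap k α μ a) (paramSet κ' X a) := by
    rintro ⟨⟨σ, t⟩, w⟩ hp ⟨⟨σ', t'⟩, w'⟩ hp' heq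
    simp only [paramMap, Prod.mk.injEq] at heq
    obtain ⟨⟨hd, hc⟩, hb⟩ := heq
    obtain ⟨h1, h2, h3⟩ := h.param_inj ha hp.1.1 hp'.1.1 hb hc hd
    simp only at h3
    simp only [h1, h2, h3]
  have : (volume : Measure ((ℝ × ℝ) × ℝ)).IsAddHaarMeasure :=
    haveI : (volume : Measure (ℝ × ℝ)).IsAddHaarMeasure :=
      inferInstanceAs ((volume : Measure ℝ).prod volume).IsAddHaarMeasure
    inferInstanceAs ((volume : Measure (ℝ × ℝ)).prod (volume : Measure ℝ)).IsAddHaarMeasure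
  have := lintegral_image_eq_lintegral_abs_det_fderiv_mul volume (measurableSet_paramSet κ' X a)
    (fun p _ => (hasFDerivAt_paramMap k α μ a p).hasFDerivWithinAt) hinj (fun _ => 1)
  rw [h.image_paramMap X ha, setLIntegral_one] at this
  rw [this]
  refine lintegral_congr fun p => ?_
  rw [mul_one, det_paramDeriv, abs_mul, abs_of_nonneg (by positivity : (0 : ℝ) ≤ p.1.2 ^ 4)]
  congr 1
  have h0 : 0 ≤ a ^ 2 + p.2 ^ 2 := by positivity
  rcases h.const with ⟨rfl, rfl, rfl, rfl, -⟩ | ⟨rfl, rfl, rfl, rfl, -⟩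
  · rw [show ((6 * (-3) * (-1) - 2 * (-3) ^ 2 * 3) * a ^ 2 + 4 * 3 ^ 2 * (-1) * p.2 ^ 2 : ℝ)
      = -(36 * (a ^ 2 + p.2 ^ 2)) by ring, abs_neg, abs_of_nonneg (by positivity)]
    ring
  · rw [show ((6 * 1 * 1 - 2 * 1 ^ 2 * 1) * a ^ 2 + 4 * 1 ^ 2 * 1 * p.2 ^ 2 : ℝ)
      = 4 * (a ^ 2 + p.2 ^ 2) by ring, abs_of_nonneg (by positivity)]
    ring

end IsReg

/-- The upper half of the fundamental domain of `GL₂(ℤ)`-type, in the coordinates `(σ, t)`. -/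
def modDomain : Set (ℝ × ℝ) := {q | 0 < q.2 ∧ |q.1| < 1 / 2 ∧ 1 < q.1 ^ 2 + q.2 ^ 2}

theorem measurableSet_modDomain : MeasurableSet modDomain := by
  have h1 : MeasurableSet {p : ℝ × ℝ | 0 < p.2} := measurableSet_lt (by fun_prop) (by fun_prop)
  have h2 : MeasurableSet {p : ℝ × ℝ | |p.1| < 1 / 2} :=
    measurableSet_lt (by fun_prop) (by fun_prop)
  have h3 : MeasurableSet {p : ℝ × ℝ | 1 < p.1 ^ 2 + p.2 ^ 2} :=
    measurableSet_lt (by fun_prop) (by fun_prop)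
  exact h1.inter (h2.inter h3)

/-- The integral of `a ^ 2 + w ^ 2` over the `w` with `a ^ 2 + w ^ 2 < M`. -/
noncomputable def chordMass (a M : ℝ) : ℝ := 2 / 3 * √(M - a ^ 2) * (2 * a ^ 2 + M)

theorem sq_add_sq_lt_iff (a M w : ℝ) :
    a ^ 2 + w ^ 2 < M ↔ w ∈ Set.Ioo (-√(M - a ^ 2)) √(M - a ^ 2) := by
  rw [Set.mem_Ioo, ← abs_lt, ← Real.sqrt_sq_eq_abs, Real.sqrt_lt_sqrt_iff (sq_nonneg w)]
  constructor <;> intro h <;> linarith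

theorem lintegral_chord (a M c : ℝ) (hc : 0 ≤ c) :
    ∫⁻ w in {w : ℝ | a ^ 2 + w ^ 2 < M}, ENNReal.ofReal (c * (a ^ 2 + w ^ 2))
      = ENNReal.ofReal (c * chordMass a M) := by
  by_cases h : a ^ 2 < M
  · have hset : {w : ℝ | a ^ 2 + w ^ 2 < M} = Set.Ioo (-√(M - a ^ 2)) √(M - a ^ 2) := by
      ext w; exact sq_add_sq_lt_iff a M w
    set r := √(M - a ^ 2) with hr
    have hr0 : 0 ≤ r := Real.sqrt_nonneg _
    have hr2 : r ^ 2 = M - a ^ 2 := Real.sq_sqrt (by linarith)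
    rw [hset, setLIntegral_congr Ioo_ae_eq_Ioc, ← ofReal_integral_eq_lintegral_ofReal,
      ← intervalIntegral.integral_of_le (by linarith)]
    · congr 1
      simp only [intervalIntegral.integral_const_mul]
      rw [intervalIntegral.integral_add (Continuous.intervalIntegrable (by fun_prop) _ _)
        (Continuous.intervalIntegrable (by fun_prop) _ _)]
      simp only [intervalIntegral.integral_const, integral_pow, chordMass, ← hr, smul_eq_mul]
      have hM : M = r ^ 2 + a ^ 2 := by linarith
      rw [hM]; push_cast; ring
    · exact (Continuous.integrableOn_Ioc (by fun_prop))
    · exact Filter.Eventually.of_forall fun w => by positivity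
  · have hset : {w : ℝ | a ^ 2 + w ^ 2 < M} = ∅ := by
      ext w
      simp only [Set.mem_ofPred_eq, Set.mem_empty_iff_false, iff_false, not_lt]
      nlinarith [sq_nonneg w]
    rw [hset, setLIntegral_empty, chordMass, Real.sqrt_eq_zero'.2 (by linarith)]
    simp

theorem chordMass_nonneg {a M : ℝ} (hM : 0 ≤ M) : 0 ≤ chordMass a M := by
  unfold chordMass; positivity

theorem chordMass_neg (a M : ℝ) : chordMass (-a) M = chordMass a M := by
  simp [chordMass]

theorem chordMass_eq_zero {a M : ℝ} (h : M ≤ a ^ 2) : chordMass a M = 0 := by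
  rw [chordMass, Real.sqrt_eq_zero'.2 (by linarith)]; simp

namespace IsReg

variable {ε : ℤ} {R RC : ℝ → ℝ → ℝ → ℝ → Prop} {k α μ κ κ' : ℝ}

theorem volume_cutSet_eq (h : IsReg ε R RC k α μ κ κ') {l a : ℝ} (hl : 0 < l) (ha : a ≠ 0) :
    volume (cutSet ε R (l ^ 4) a) = ∫⁻ q in modDomain,
      ENNReal.ofReal (κ * q.2 ^ 4 * chordMass a (l ^ 2 / (√κ' * q.2 ^ 3))) := by
  have hκ' : 0 < κ' := by rcases h.const with h | h <;> rw [h.2.2.2.2] <;> norm_num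
  have hκ : 0 < κ := by rcases h.const with h | h <;> rw [h.2.2.2.1] <;> norm_num
  have hs : √κ' ^ 2 = κ' := Real.sq_sqrt hκ'.le
  have hs0 : 0 < √κ' := Real.sqrt_pos.2 hκ'
  rw [h.volume_cutSet _ ha, ← lintegral_indicator (measurableSet_paramSet _ _ _),
    ← lintegral_indicator measurableSet_modDomain, Measure.volume_eq_prod, lintegral_prod]
  · refine lintegral_congr fun q => ?_
    by_cases hq : q ∈ modDomain
    · rw [Set.indicator_of_mem hq, ← lintegral_chord _ _ _ (by positivity),
        ← lintegral_indicator (measurableSet_lt (by fun_prop) (by fun_prop))]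
      refine lintegral_congr fun w => ?_
      have ht : 0 < q.2 := hq.1
      have hiff : (q, w) ∈ paramSet κ' (l ^ 4) a ↔
          w ∈ {w : ℝ | a ^ 2 + w ^ 2 < l ^ 2 / (√κ' * q.2 ^ 3)} := by
        have h1 : (q, w) ∈ paramSet κ' (l ^ 4) a ↔ κ' * q.2 ^ 6 * (a ^ 2 + w ^ 2) ^ 2 < l ^ 4 :=
          ⟨fun h => h.2, fun h => ⟨hq, h⟩⟩
        have h2 : κ' * q.2 ^ 6 * (a ^ 2 + w ^ 2) ^ 2 =
            ((a ^ 2 + w ^ 2) * (√κ' * q.2 ^ 3)) ^ 2 := by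
          rw [mul_pow, mul_pow, hs]; ring
        rw [h1, Set.mem_ofPred_eq, lt_div_iff₀ (by positivity), h2,
          show l ^ 4 = (l ^ 2) ^ 2 by ring,
          pow_lt_pow_iff_left₀ (by positivity) (by positivity) two_ne_zero]
      by_cases hw : (q, w) ∈ paramSet κ' (l ^ 4) a
      · rw [Set.indicator_of_mem hw, Set.indicator_of_mem (hiff.1 hw)]
      · rw [Set.indicator_of_notMem hw, Set.indicator_of_notMem fun h => hw (hiff.2 h)]
    · rw [Set.indicator_of_notMem hq]
      have : ∀ w, (paramSet κ' (l ^ 4) a).indicator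
          (fun p => ENNReal.ofReal (κ * p.1.2 ^ 4 * (a ^ 2 + p.2 ^ 2))) (q, w) = 0 :=
        fun w => Set.indicator_of_notMem (fun hw => hq hw.1) _
      simp [this]
  · exact ((by fun_prop : Measurable fun p : (ℝ × ℝ) × ℝ =>
      ENNReal.ofReal (κ * p.1.2 ^ 4 * (a ^ 2 + p.2 ^ 2))).indicator
        (measurableSet_paramSet _ _ _)).aemeasurable

end IsReg

theorem sum_sq_aux (A u : ℝ) (m : ℕ) : A * ∑ n ∈ Finset.Icc 1 m, ((A * n) ^ 2 + u)
    = (A * m) ^ 3 / 3 + (A * m) ^ 2 * A / 2 + (A * m) * A ^ 2 / 6 + u * (A * m) := by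
  induction m with
  | zero => simp
  | succ m ih =>
    rw [Finset.sum_Icc_succ_top (by omega), mul_add, ih]
    push_cast; ring

/-- A Riemann sum estimate for `x ^ 2 + u` on a bounded interval. -/
theorem abs_sum_sq_sub_le {A r u : ℝ} (hA : 1 ≤ A) (hr : 0 < r) (hu : 0 ≤ u) {N : ℕ}
    (hN : r ≤ A * N) :
    |∑ n ∈ Finset.Icc 1 N, (if (A * n) ^ 2 + u < r ^ 2 + u then (A * n) ^ 2 + u else 0)
      - r * (r ^ 2 / 3 + u) / A| ≤ (r ^ 2 + u) ^ (5 / 4 : ℝ) := by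
  have hA0 : 0 < A := by linarith
  have hM : 0 < r ^ 2 + u := by positivity
  obtain ⟨m, hm1, hm2⟩ : ∃ m : ℕ, A * m < r ∧ r ≤ A * (m + 1) := by
    have h1 : 0 < ⌈r / A⌉₊ := Nat.ceil_pos.2 (by positivity)
    obtain ⟨m, hm⟩ := Nat.exists_eq_succ_of_ne_zero h1.ne'
    refine ⟨m, ?_, ?_⟩
    · have : m < ⌈r / A⌉₊ := by omega
      rw [Nat.lt_ceil, lt_div_iff₀ hA0] at this
      linarith
    · have := Nat.le_ceil (r / A)
      rw [hm, div_le_iff₀ hA0] at this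
      push_cast at this
      linarith
  have hmN : m ≤ N := by
    have : A * m < A * N := hm1.trans_le hN
    exact_mod_cast (lt_of_mul_lt_mul_left this hA0.le).le
  have hsum : ∑ n ∈ Finset.Icc 1 N, (if (A * n) ^ 2 + u < r ^ 2 + u then (A * n) ^ 2 + u else 0)
      = ∑ n ∈ Finset.Icc 1 m, ((A * n) ^ 2 + u) := by
    rw [← Finset.sum_filter]
    congr 1
    ext n
    simp only [Finset.mem_filter, Finset.mem_Icc, add_lt_add_iff_right]
    rw [pow_lt_pow_iff_left₀ (by positivity) hr.le two_ne_zero]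
    constructor
    · rintro ⟨⟨h1, -⟩, h3⟩
      have : A * n < A * (m + 1) := h3.trans_le hm2
      have : (n : ℝ) < m + 1 := lt_of_mul_lt_mul_left this hA0.le
      exact ⟨h1, by exact_mod_cast Nat.lt_succ_iff.1 (by exact_mod_cast this)⟩
    · rintro ⟨h1, h2⟩
      refine ⟨⟨h1, h2.trans hmN⟩, lt_of_le_of_lt ?_ hm1⟩
      have : (n : ℝ) ≤ m := by exact_mod_cast h2
      gcongr
  rw [hsum]
  have key := sum_sq_aux A u m
  set S := ∑ n ∈ Finset.Icc 1 m, ((A * n) ^ 2 + u)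
  have hSA : S - r * (r ^ 2 / 3 + u) / A = (A * S - r * (r ^ 2 / 3 + u)) / A := by field_simp
  rw [hSA, key, abs_div, abs_of_pos hA0, div_le_iff₀ hA0]
  rcases Nat.eq_zero_or_pos m with h0 | h0
  · subst h0
    simp only [Nat.cast_zero, mul_zero, zero_add, mul_one] at hm2 ⊢
    rw [show (0 : ℝ) ^ 3 / 3 + 0 ^ 2 * A / 2 + 0 * A ^ 2 / 6 + 0 - r * (r ^ 2 / 3 + u)
      = -(r * (r ^ 2 / 3 + u)) by ring, abs_neg, abs_of_nonneg (by positivity)]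
    have h1 : r * (r ^ 2 / 3 + u) ≤ r * (r ^ 2 + u) := by
      gcongr; linarith [sq_nonneg r]
    refine h1.trans ?_
    rcases le_total 1 (r ^ 2 + u) with hM1 | hM1
    · have h2 : r ^ 2 + u ≤ (r ^ 2 + u) ^ (5 / 4 : ℝ) := by
        conv_lhs => rw [← Real.rpow_one (r ^ 2 + u)]
        exact Real.rpow_le_rpow_of_exponent_le hM1 (by norm_num)
      rw [mul_comm]
      gcongr
    · have h2 : (r ^ 2 + u) ^ (3 / 2 : ℝ) ≤ (r ^ 2 + u) ^ (5 / 4 : ℝ) :=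
        Real.rpow_le_rpow_of_exponent_ge hM hM1 (by norm_num)
      have h3 : r ≤ √(r ^ 2 + u) := Real.le_sqrt_of_sq_le (by linarith)
      have h4 : (r ^ 2 + u) ^ (3 / 2 : ℝ) = √(r ^ 2 + u) * (r ^ 2 + u) := by
        rw [Real.sqrt_eq_rpow, show (3 / 2 : ℝ) = 1 / 2 + 1 by norm_num, Real.rpow_add hM,
          Real.rpow_one]
      calc r * (r ^ 2 + u) ≤ √(r ^ 2 + u) * (r ^ 2 + u) := by gcongr
        _ ≤ (r ^ 2 + u) ^ (5 / 4 : ℝ) := h4 ▸ h2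
        _ ≤ (r ^ 2 + u) ^ (5 / 4 : ℝ) * A := le_mul_of_one_le_right (by positivity) hA
  · have hx : A ≤ A * m := le_mul_of_one_le_right hA0.le (by exact_mod_cast h0)
    have hM1 : 1 ≤ r ^ 2 + u := by nlinarith
    have h2 : r ^ 2 + u ≤ (r ^ 2 + u) ^ (5 / 4 : ℝ) := by
      conv_lhs => rw [← Real.rpow_one (r ^ 2 + u)]
      exact Real.rpow_le_rpow_of_exponent_le hM1 (by norm_num)
    have h3 : (r ^ 2 + u) * A ≤ (r ^ 2 + u) ^ (5 / 4 : ℝ) * A := by gcongr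
    refine le_trans ?_ h3
    have hm2' : r ≤ A * m + A := by linarith
    generalize A * (m : ℝ) = x at *
    have hx0 : 0 < x := by linarith
    have e1 : x ^ 2 ≤ r ^ 2 := by gcongr
    have e2 : x * A ≤ r ^ 2 := by nlinarith
    have e3 : x ^ 2 * A ≤ r ^ 2 * A := by gcongr
    have e4 : x * A * A ≤ r ^ 2 * A := by gcongr
    have e5 : u * x ≤ u * r := by gcongr
    have e6 : u * (r - x) ≤ u * A := by gcongr; linarith
    have e7 : x ^ 3 ≤ r ^ 3 := by gcongr
    have e8 : r ^ 3 - x ^ 3 ≤ 3 * (r ^ 2 * A) := by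
      have : r ^ 2 + r * x + x ^ 2 ≤ 3 * r ^ 2 := by nlinarith
      calc r ^ 3 - x ^ 3 = (r - x) * (r ^ 2 + r * x + x ^ 2) := by ring
        _ ≤ A * (3 * r ^ 2) := by
          apply mul_le_mul (by linarith) this (by positivity) hA0.le
        _ = _ := by ring
    have e9 : 0 ≤ x ^ 2 * A := by positivity
    have e10 : 0 ≤ x * A * A := by positivity
    have e11 : 0 ≤ u * A := by positivity
    have e12 : 0 ≤ r ^ 2 * A := by positivity
    rw [abs_le]
    constructor
    · linarith
    · linarith

theorem integral_semicircle_moment :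
    ∫ x in (-1 : ℝ)..1, √(1 - x ^ 2) * ((1 - x ^ 2) / 3 + x ^ 2) = Real.pi / 4 := by
  have h1 : ∫ x in (-1 : ℝ)..1, √(1 - x ^ 2) * (1 - 4 * x ^ 2) = 0 := by
    rw [intervalIntegral.integral_eq_sub_of_hasDerivAt_of_le (by norm_num)
      (f := fun x => x * (1 - x ^ 2) * √(1 - x ^ 2)) (by fun_prop)]
    · norm_num
    · intro x hx
      have hx1 : 0 < 1 - x ^ 2 := by nlinarith [hx.1, hx.2]
      have hx2 : √(1 - x ^ 2) ^ 2 = 1 - x ^ 2 := Real.sq_sqrt hx1.le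
      have hx3 : √(1 - x ^ 2) ≠ 0 := (Real.sqrt_pos.2 hx1).ne'
      have d1 : HasDerivAt (fun x : ℝ => 1 - x ^ 2) (-(2 * x)) x := by
        simpa using ((hasDerivAt_pow 2 x).const_sub 1)
      have d2 := ((hasDerivAt_id x).mul d1).mul (d1.sqrt hx1.ne')
      refine d2.congr_deriv ?_
      simp only [id, Pi.mul_apply]
      field_simp
      rw [hx2]
      ring
    · exact Continuous.intervalIntegrable (by fun_prop) _ _
  have h2 : ∀ x : ℝ, √(1 - x ^ 2) * ((1 - x ^ 2) / 3 + x ^ 2) =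
      1 / 2 * √(1 - x ^ 2) - 1 / 6 * (√(1 - x ^ 2) * (1 - 4 * x ^ 2)) := fun x => by ring
  simp only [h2]
  rw [intervalIntegral.integral_sub (Continuous.intervalIntegrable (by fun_prop) _ _)
    (Continuous.intervalIntegrable (by fun_prop) _ _), intervalIntegral.integral_const_mul,
    intervalIntegral.integral_const_mul, h1, integral_sqrt_one_sub_sq]
  ring

theorem integral_chord_main {M : ℝ} (hM : 0 < M) :
    ∫ w in Set.Ioo (-√M) √M, √(M - w ^ 2) * ((M - w ^ 2) / 3 + w ^ 2) = Real.pi * M ^ 2 / 4 := by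
  have hs : 0 < √M := Real.sqrt_pos.2 hM
  have hs2 : √M ^ 2 = M := Real.sq_sqrt hM.le
  rw [setIntegral_congr_set Ioo_ae_eq_Ioc, ← intervalIntegral.integral_of_le (by linarith)]
  have h1 := intervalIntegral.integral_comp_mul_left (a := -1) (b := 1)
    (fun w => √(M - w ^ 2) * ((M - w ^ 2) / 3 + w ^ 2)) hs.ne'
  rw [mul_one, mul_neg, mul_one] at h1
  have h2 : ∀ x : ℝ, √(M - (√M * x) ^ 2) * ((M - (√M * x) ^ 2) / 3 + (√M * x) ^ 2)
      = √M * M * (√(1 - x ^ 2) * ((1 - x ^ 2) / 3 + x ^ 2)) := by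
    intro x
    have : M - (√M * x) ^ 2 = M * (1 - x ^ 2) := by rw [mul_pow, hs2]; ring
    rw [this, Real.sqrt_mul hM.le, mul_pow, hs2]
    ring
  simp only [h2] at h1
  rw [intervalIntegral.integral_const_mul, integral_semicircle_moment, smul_eq_mul] at h1
  have h3 : √M * (√M * M * (Real.pi / 4)) = ∫ w in -√M..√M,
      √(M - w ^ 2) * ((M - w ^ 2) / 3 + w ^ 2) := by
    rw [h1, mul_inv_cancel_left₀ hs.ne']
  rw [← h3]
  linear_combination (M * Real.pi / 4) * hs2

theorem chord_integrable (a M : ℝ) :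
    IntegrableOn (fun w => if a ^ 2 + w ^ 2 < M then a ^ 2 + w ^ 2 else 0)
      (Set.Ioo (-√M) √M) := by
  refine Measure.integrableOn_of_bounded (M := |M|) (by simp)
    (Measurable.aestronglyMeasurable ?_) (Filter.Eventually.of_forall fun w => ?_)
  · exact Measurable.ite (measurableSet_lt (by fun_prop) (by fun_prop)) (by fun_prop) (by fun_prop)
  · rw [Real.norm_eq_abs]
    split_ifs with h
    · rw [abs_of_nonneg (by positivity)]
      exact h.le.trans (le_abs_self M)
    · simp

theorem integral_chord {a M : ℝ} (hM : 0 < M) :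
    ∫ w in Set.Ioo (-√M) √M, (if a ^ 2 + w ^ 2 < M then a ^ 2 + w ^ 2 else 0)
      = chordMass a M := by
  have hms : MeasurableSet {w : ℝ | a ^ 2 + w ^ 2 < M} :=
    measurableSet_lt (by fun_prop) (by fun_prop)
  have h1 : (fun w : ℝ => if a ^ 2 + w ^ 2 < M then a ^ 2 + w ^ 2 else 0) =
      Set.indicator {w : ℝ | a ^ 2 + w ^ 2 < M} (fun w => a ^ 2 + w ^ 2) := by
    ext w; simp [Set.indicator_apply]
  have hsub : {w : ℝ | a ^ 2 + w ^ 2 < M} ⊆ Set.Ioo (-√M) √M := by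
    intro w hw
    rw [Set.mem_ofPred_eq] at hw
    have : w ^ 2 < M := by nlinarith [sq_nonneg a]
    rw [Set.mem_Ioo, ← abs_lt]
    exact Real.lt_sqrt_of_sq_lt (by rwa [sq_abs])
  rw [h1, setIntegral_indicator hms, Set.inter_eq_self_of_subset_right hsub,
    integral_eq_lintegral_of_nonneg_ae (Filter.Eventually.of_forall fun w => by positivity)
      (by fun_prop)]
  have := lintegral_chord a M 1 zero_le_one
  simp only [one_mul] at this
  rw [this, ENNReal.toReal_ofReal (chordMass_nonneg hM.le)]

/-- Summing the chord masses over the multiples of `A`. -/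
theorem abs_sum_chordMass_sub_le {A M : ℝ} (hA : 1 ≤ A) (hM : 0 < M) {N : ℕ} (hN : √M ≤ A * N) :
    |∑ n ∈ Finset.Icc 1 N, chordMass (A * n) M - Real.pi * M ^ 2 / (4 * A)|
      ≤ 2 * M ^ (7 / 4 : ℝ) := by
  have hA0 : 0 < A := by linarith
  have hs : 0 < √M := Real.sqrt_pos.2 hM
  have h1 : ∑ n ∈ Finset.Icc 1 N, chordMass (A * n) M - Real.pi * M ^ 2 / (4 * A)
      = ∫ w in Set.Ioo (-√M) √M, (∑ n ∈ Finset.Icc 1 N,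
          (if (A * n) ^ 2 + w ^ 2 < M then (A * n) ^ 2 + w ^ 2 else 0)
          - √(M - w ^ 2) * ((M - w ^ 2) / 3 + w ^ 2) / A) := by
    rw [integral_sub, integral_finsetSum, integral_div, integral_chord_main hM]
    · simp only [integral_chord hM]
      field_simp
    · exact fun n _ => chord_integrable _ _
    · exact integrable_finsetSum _ fun n _ => chord_integrable _ _
    · exact (Continuous.integrableOn_Icc (by fun_prop)).mono_set Set.Ioo_subset_Icc_self
  rw [h1, ← Real.norm_eq_abs]
  refine (norm_setIntegral_le_of_norm_le_const (C := M ^ (5 / 4 : ℝ)) (by simp)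
    fun w hw => ?_).trans ?_
  · have hw2 : w ^ 2 < M := by
      rw [Set.mem_Ioo, ← abs_lt] at hw
      rw [← sq_abs, ← Real.sq_sqrt hM.le]
      gcongr
    have hr : 0 < √(M - w ^ 2) := Real.sqrt_pos.2 (by linarith)
    have hr2 : √(M - w ^ 2) ^ 2 = M - w ^ 2 := Real.sq_sqrt (by linarith)
    have := abs_sum_sq_sub_le hA hr (sq_nonneg w) (N := N)
      ((Real.sqrt_le_sqrt (by linarith [sq_nonneg w])).trans hN)
    rw [hr2, sub_add_cancel] at this
    exact this
  · simp only [measureReal_def, Real.volume_Ioo]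
    rw [ENNReal.toReal_ofReal (by linarith), show (7 / 4 : ℝ) = 5 / 4 + 1 / 2 by norm_num,
      Real.rpow_add hM, ← Real.sqrt_eq_rpow]
    apply le_of_eq; ring

theorem three_fourths_lt_of_mem {q : ℝ × ℝ} (hq : q ∈ modDomain) : 3 / 4 < q.2 := by
  obtain ⟨h1, h2, h3⟩ := hq
  rw [abs_lt] at h2
  by_contra! h
  nlinarith

theorem integrableOn_rpow_modDomain {s : ℝ} (hs : s < -1) :
    IntegrableOn (fun q : ℝ × ℝ => q.2 ^ s) modDomain := by
  have h1 : IntegrableOn (fun q : ℝ × ℝ => q.2 ^ s)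
      (Set.Ioo (-1 / 2) (1 / 2) ×ˢ Set.Ioi (1 / 2 : ℝ)) := by
    rw [IntegrableOn, Measure.volume_eq_prod, ← Measure.prod_restrict]
    have ha : Integrable (fun _ : ℝ => (1 : ℝ)) (volume.restrict (Set.Ioo (-1 / 2 : ℝ) (1 / 2))) :=
      integrable_const _
    have hb : Integrable (fun t : ℝ => t ^ s) (volume.restrict (Set.Ioi (1 / 2 : ℝ))) :=
      integrableOn_Ioi_rpow_of_lt hs (by norm_num)
    simpa using ha.mul_prod hb
  refine h1.mono_set fun q hq => ⟨?_, ?_⟩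
  · have := abs_lt.1 hq.2.1
    exact ⟨by linarith [this.1], this.2⟩
  · exact lt_trans (by norm_num) (three_fourths_lt_of_mem hq)

theorem integral_one_div_sqrt :
    ∫ x in (-1 / 2 : ℝ)..(1 / 2), (√(1 - x ^ 2))⁻¹ = Real.pi / 3 := by
  have hpos : ∀ x ∈ Set.uIcc (-1 / 2 : ℝ) (1 / 2), 0 < 1 - x ^ 2 := by
    intro x hx
    rw [Set.uIcc_of_le (by norm_num)] at hx
    nlinarith [hx.1, hx.2]
  have hasin : Real.arcsin (1 / 2) = Real.pi / 6 := by
    rw [← Real.sin_pi_div_six]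
    exact Real.arcsin_sin (by linarith [Real.pi_pos]) (by linarith [Real.pi_pos])
  rw [intervalIntegral.integral_eq_sub_of_hasDerivAt (f := Real.arcsin)]
  · rw [show (-1 / 2 : ℝ) = -(1 / 2) by norm_num, Real.arcsin_neg, hasin]; ring
  · intro x hx
    have := hpos x hx
    rw [← one_div]
    exact Real.hasDerivAt_arcsin (by nlinarith) (by nlinarith)
  · refine ContinuousOn.intervalIntegrable (ContinuousOn.inv₀ (by fun_prop) fun x hx => ?_)
    exact (Real.sqrt_pos.2 (hpos x hx)).ne'

theorem integral_modDomain : ∫ q in modDomain, q.2 ^ (-2 : ℝ) = Real.pi / 3 := by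
  have h_int := integrableOn_rpow_modDomain (s := -2) (by norm_num)
  rw [← integral_indicator measurableSet_modDomain, Measure.volume_eq_prod, integral_prod]
  · have h1 : ∀ σ : ℝ, ∫ t : ℝ, modDomain.indicator (fun q : ℝ × ℝ => q.2 ^ (-2 : ℝ)) (σ, t)
        = (Set.Ioo (-1 / 2 : ℝ) (1 / 2)).indicator (fun σ => (√(1 - σ ^ 2))⁻¹) σ := by
      intro σ
      by_cases hσ : σ ∈ Set.Ioo (-1 / 2 : ℝ) (1 / 2)
      · have hσ2 : 0 < 1 - σ ^ 2 := by nlinarith [hσ.1, hσ.2]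
        have hr : 0 < √(1 - σ ^ 2) := Real.sqrt_pos.2 hσ2
        rw [Set.indicator_of_mem hσ]
        have h2 : ∀ t : ℝ, modDomain.indicator (fun q : ℝ × ℝ => q.2 ^ (-2 : ℝ)) (σ, t)
            = (Set.Ioi √(1 - σ ^ 2)).indicator (fun t => t ^ (-2 : ℝ)) t := by
          intro t
          have hiff : (σ, t) ∈ modDomain ↔ t ∈ Set.Ioi √(1 - σ ^ 2) := by
            constructor
            · rintro ⟨h1, -, h3⟩
              exact (Real.sqrt_lt' h1).2 (by simp only at h3; linarith)
            · intro ht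
              have ht0 : 0 < t := hr.trans ht
              refine ⟨ht0, ?_, ?_⟩
              · rw [abs_lt]; exact ⟨by linarith [hσ.1], hσ.2⟩
              · have := (Real.sqrt_lt' ht0).1 ht
                simp only; linarith
          by_cases ht : (σ, t) ∈ modDomain
          · rw [Set.indicator_of_mem ht, Set.indicator_of_mem (hiff.1 ht)]
          · rw [Set.indicator_of_notMem ht, Set.indicator_of_notMem fun h => ht (hiff.2 h)]
        simp only [h2]
        rw [integral_indicator measurableSet_Ioi, integral_Ioi_rpow_of_lt (by norm_num) hr]
        norm_num
        rw [Real.rpow_neg_one]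
      · rw [Set.indicator_of_notMem hσ]
        have h2 : ∀ t : ℝ, modDomain.indicator (fun q : ℝ × ℝ => q.2 ^ (-2 : ℝ)) (σ, t) = 0 := by
          intro t
          refine Set.indicator_of_notMem (fun h => hσ ?_) _
          have := abs_lt.1 h.2.1
          exact ⟨by linarith [this.1], this.2⟩
        simp only [h2]
        exact integral_zero _ _
    simp only [h1]
    rw [integral_indicator measurableSet_Ioo, setIntegral_congr_set Ioo_ae_eq_Ioc,
      ← intervalIntegral.integral_of_le (by norm_num), integral_one_div_sqrt]
  · rw [← Measure.volume_eq_prod]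
    exact h_int.integrable_indicator measurableSet_modDomain

theorem chordMass_le {a M : ℝ} (ha : a ≠ 0) (hM : 0 ≤ M) : chordMass a M ≤ 2 * M ^ 2 / |a| := by
  by_cases h : M ≤ a ^ 2
  · rw [chordMass_eq_zero h]; positivity
  · push Not at h
    have ha' : 0 < |a| := abs_pos.2 ha
    have h1 : √(M - a ^ 2) ≤ √M := Real.sqrt_le_sqrt (by nlinarith [sq_nonneg a])
    have h2 : |a| ≤ √M := Real.abs_le_sqrt h.le
    have h3 : √M ^ 2 = M := Real.sq_sqrt hM
    have h4 : √M ≤ M / |a| := by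
      rw [le_div_iff₀ ha']; nlinarith [Real.sqrt_nonneg M]
    calc chordMass a M = 2 / 3 * √(M - a ^ 2) * (2 * a ^ 2 + M) := rfl
      _ ≤ 2 / 3 * (M / |a|) * (2 * M + M) := by
        gcongr
        exact h1.trans h4
      _ = 2 * M ^ 2 / |a| := by ring

namespace IsReg

variable {ε : ℤ} {R RC : ℝ → ℝ → ℝ → ℝ → Prop} {k α μ κ κ' : ℝ}

theorem one_le_κ' (h : IsReg ε R RC k α μ κ κ') : 4 ≤ κ' := by
  rcases h.const with h | h <;> rw [h.2.2.2.2] <;> norm_num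

theorem κ_pos (h : IsReg ε R RC k α μ κ κ') : 0 < κ := by
  rcases h.const with h | h <;> rw [h.2.2.2.1] <;> norm_num

theorem mass_sq (h : IsReg ε R RC k α μ κ κ') {l t : ℝ} (ht : 0 < t) :
    t ^ 4 * (l ^ 2 / (√κ' * t ^ 3)) ^ 2 = l ^ 4 / κ' * t ^ (-2 : ℝ) := by
  have h4 := h.one_le_κ'
  have hs : √κ' ^ 2 = κ' := Real.sq_sqrt (by linarith)
  rw [Real.rpow_neg ht.le, div_pow, mul_pow, hs, show (2 : ℝ) = ((2 : ℕ) : ℝ) by norm_num,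
    Real.rpow_natCast]
  field_simp

theorem mass_rpow_le (h : IsReg ε R RC k α μ κ κ') {l t : ℝ} (hl : 0 < l) (ht : 0 < t) :
    t ^ 4 * (l ^ 2 / (√κ' * t ^ 3)) ^ (7 / 4 : ℝ) ≤ l ^ (7 / 2 : ℝ) * t ^ (-5 / 4 : ℝ) := by
  have h4 := h.one_le_κ'
  have hs : 1 ≤ √κ' := Real.one_le_sqrt.2 (by linarith)
  have h1 : (l ^ 2 / (√κ' * t ^ 3)) ^ (7 / 4 : ℝ) ≤ (l ^ 2 / t ^ 3) ^ (7 / 4 : ℝ) := by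
    apply Real.rpow_le_rpow (by positivity) _ (by norm_num)
    apply div_le_div_of_nonneg_left (by positivity) (by positivity)
    exact le_mul_of_one_le_left (by positivity) hs
  refine (mul_le_mul_of_nonneg_left h1 (by positivity)).trans (le_of_eq ?_)
  rw [Real.div_rpow (by positivity) (by positivity), ← Real.rpow_natCast l, ← Real.rpow_natCast t,
    ← Real.rpow_natCast t, ← Real.rpow_mul hl.le, ← Real.rpow_mul ht.le, mul_div_assoc',
    mul_comm, mul_div_assoc, ← Real.rpow_sub ht]
  norm_num

theorem integrableOn_mass (h : IsReg ε R RC k α μ κ κ') (l : ℝ) {a : ℝ} (ha : a ≠ 0) :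
    IntegrableOn (fun q : ℝ × ℝ => κ * q.2 ^ 4 * chordMass a (l ^ 2 / (√κ' * q.2 ^ 3)))
      modDomain := by
  have hκ := h.κ_pos
  refine Integrable.mono' ((integrableOn_rpow_modDomain (s := -2) (by norm_num)).const_mul
    (κ * (2 / |a|) * (l ^ 4 / κ'))) ?_ ?_
  · refine Measurable.aestronglyMeasurable ?_
    unfold chordMass
    fun_prop
  · refine (ae_restrict_mem measurableSet_modDomain).mono fun q hq => ?_
    have hq0 : 0 < q.2 := hq.1
    have hM : 0 ≤ l ^ 2 / (√κ' * q.2 ^ 3) := by positivity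
    rw [Real.norm_of_nonneg (mul_nonneg (by positivity) (chordMass_nonneg hM)), mul_assoc,
      mul_assoc, mul_assoc, ← h.mass_sq hq0]
    calc κ * (q.2 ^ 4 * chordMass a (l ^ 2 / (√κ' * q.2 ^ 3)))
        ≤ κ * (q.2 ^ 4 * (2 * (l ^ 2 / (√κ' * q.2 ^ 3)) ^ 2 / |a|)) := by
          gcongr; exact chordMass_le ha hM
      _ = _ := by ring

theorem volume_real_cutSet (h : IsReg ε R RC k α μ κ κ') {l a : ℝ} (hl : 0 < l) (ha : a ≠ 0) :
    volume.real (cutSet ε R (l ^ 4) a) = ∫ q in modDomain,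
      κ * q.2 ^ 4 * chordMass a (l ^ 2 / (√κ' * q.2 ^ 3)) := by
  rw [measureReal_def, h.volume_cutSet_eq hl ha, integral_eq_lintegral_of_nonneg_ae]
  · refine (ae_restrict_mem measurableSet_modDomain).mono fun q hq => ?_
    have hq0 : 0 < q.2 := hq.1
    have hκ := h.κ_pos
    exact mul_nonneg (by positivity) (chordMass_nonneg (by positivity))
  · exact (h.integrableOn_mass l ha).1

theorem volume_real_cutSet_neg (h : IsReg ε R RC k α μ κ κ') {l a : ℝ} (hl : 0 < l) (ha : a ≠ 0) :
    volume.real (cutSet ε R (l ^ 4) (-a)) = volume.real (cutSet ε R (l ^ 4) a) := by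
  simp only [h.volume_real_cutSet hl ha, h.volume_real_cutSet hl (neg_ne_zero.2 ha), chordMass_neg]

/-- Summing the volumes of the slices over the multiples of `A`. -/
theorem exists_abs_sum_volume_sub_le (h : IsReg ε R RC k α μ κ κ') :
    ∃ K : ℝ, 0 ≤ K ∧ ∀ (l A : ℝ) (N : ℕ), 0 < l → 1 ≤ A → 2 * l ≤ A * N →
      |∑ n ∈ Finset.Icc 1 N, volume.real (cutSet ε R (l ^ 4) (A * n))
        - κ * Real.pi ^ 2 / (12 * κ') * l ^ 4 / A| ≤ K * l ^ (7 / 2 : ℝ) := by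
  have hκ := h.κ_pos
  have hκ' := h.one_le_κ'
  have hi2 := integrableOn_rpow_modDomain (s := -2) (by norm_num)
  have hi5 := integrableOn_rpow_modDomain (s := -5 / 4) (by norm_num)
  refine ⟨2 * κ * ∫ q in modDomain, q.2 ^ (-5 / 4 : ℝ), ?_, ?_⟩
  · refine mul_nonneg (by positivity) (setIntegral_nonneg measurableSet_modDomain fun q hq => ?_)
    exact (Real.rpow_pos_of_pos hq.1 _).le
  intro l A N hl hA hN
  have hA0 : 0 < A := by linarith
  have hterm : ∀ n ∈ Finset.Icc 1 N, A * (n : ℝ) ≠ 0 := by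
    intro n hn
    have : 0 < (n : ℝ) := by exact_mod_cast (Finset.mem_Icc.1 hn).1
    positivity
  have hmain : κ * Real.pi ^ 2 / (12 * κ') * l ^ 4 / A
      = ∫ q in modDomain, κ * Real.pi / (4 * A) * (l ^ 4 / κ') * q.2 ^ (-2 : ℝ) := by
    rw [integral_const_mul, integral_modDomain]
    field_simp
    ring
  rw [Finset.sum_congr rfl fun n hn => h.volume_real_cutSet hl (hterm n hn), hmain,
    ← integral_finsetSum _ fun n hn => h.integrableOn_mass l (hterm n hn), ← integral_sub
      (integrable_finsetSum _ fun n hn => h.integrableOn_mass l (hterm n hn)) (hi2.const_mul _),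
    ← Real.norm_eq_abs, mul_right_comm, ← integral_const_mul]
  refine norm_integral_le_of_norm_le (hi5.const_mul _) ?_
  refine (ae_restrict_mem measurableSet_modDomain).mono fun q hq => ?_
  have hq0 : 0 < q.2 := hq.1
  have hs2 : 2 ≤ √κ' := Real.le_sqrt_of_sq_le (by linarith)
  have hM : 0 < l ^ 2 / (√κ' * q.2 ^ 3) := by positivity
  have hMN : √(l ^ 2 / (√κ' * q.2 ^ 3)) ≤ A * N := by
    refine le_trans (Real.sqrt_le_iff.2 ⟨by positivity, ?_⟩) hN
    rw [div_le_iff₀ (by positivity)]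
    have h34 := three_fourths_lt_of_mem hq
    have h3 : (3 / 4 : ℝ) ^ 3 ≤ q.2 ^ 3 := by gcongr
    have : (1 : ℝ) ≤ 4 * (√κ' * q.2 ^ 3) := by nlinarith
    nlinarith [sq_nonneg l]
  have hb := abs_sum_chordMass_sub_le hA hM hMN
  have hr := h.mass_rpow_le hl hq0
  rw [Real.norm_eq_abs, ← Finset.mul_sum]
  have heq : κ * q.2 ^ 4 * ∑ n ∈ Finset.Icc 1 N, chordMass (A * n) (l ^ 2 / (√κ' * q.2 ^ 3))
      - κ * Real.pi / (4 * A) * (l ^ 4 / κ') * q.2 ^ (-2 : ℝ)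
      = κ * q.2 ^ 4 * (∑ n ∈ Finset.Icc 1 N, chordMass (A * n) (l ^ 2 / (√κ' * q.2 ^ 3))
        - Real.pi * (l ^ 2 / (√κ' * q.2 ^ 3)) ^ 2 / (4 * A)) := by
    rw [mul_assoc (κ * Real.pi / (4 * A)), ← h.mass_sq hq0]
    ring
  rw [heq, abs_mul, abs_of_pos (by positivity)]
  refine (mul_le_mul_of_nonneg_left hb (by positivity)).trans ?_
  calc _ = 2 * κ * (q.2 ^ 4 * (l ^ 2 / (√κ' * q.2 ^ 3)) ^ (7 / 4 : ℝ)) := by ring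
    _ ≤ 2 * κ * (l ^ (7 / 2 : ℝ) * q.2 ^ (-5 / 4 : ℝ)) := by gcongr
    _ = _ := by ring

end IsReg

namespace IsReg

variable {ε : ℤ} {R RC : ℝ → ℝ → ℝ → ℝ → Prop} {k α μ κ κ' : ℝ}

theorem measurableSet_cutSet (h : IsReg ε R RC k α μ κ κ') (X a : ℝ) :
    MeasurableSet (cutSet ε R X a) := by
  have hm : Measurable fun p : (ℝ × ℝ) × ℝ => ε * cubicDisc a p.2 p.1.2 p.1.1 := by
    unfold cubicDisc; fun_prop
  exact (h.meas a).inter ((measurableSet_lt measurable_const hm).inter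
    (measurableSet_lt hm measurable_const))

theorem fewChanges_slice {S : Set ℝ} (hS : FewChanges 9 S) {F : ℝ → ℝ} (e X : ℝ)
    (c₀ c₁ c₂ c₃ : ℝ) (hF : ∀ x, F x = c₀ + c₁ * x + c₂ * x ^ 2 + c₃ * x ^ 3) :
    FewChanges 15 {x | x ∈ S ∧ 0 < e * F x ∧ e * F x < X} := by
  have h1 : FewChanges 3 {x | 0 < e * F x} :=
    fewChanges_cubic (e * c₀) (e * c₁) (e * c₂) (e * c₃) fun x => by rw [hF]; ring
  have h2 : FewChanges 3 {x | 0 < X - e * F x} :=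
    fewChanges_cubic (X - e * c₀) (-(e * c₁)) (-(e * c₂)) (-(e * c₃)) fun x => by rw [hF]; ring
  have h3 := hS.inter (h1.inter h2)
  convert h3 using 2
  ext x
  simp only [Set.mem_ofPred_eq, Set.mem_inter_iff, sub_pos]

theorem fewChanges_cutSet_d (h : IsReg ε R RC k α μ κ κ') (X a c b : ℝ) :
    FewChanges 15 {d | ((d, c), b) ∈ cutSet ε R X a} :=
  fewChanges_slice (h.few_d a b c) (F := fun d => cubicDisc a b c d) ε X
    (b ^ 2 * c ^ 2 - 4 * a * c ^ 3) (-4 * b ^ 3 + 18 * a * b * c) (-27 * a ^ 2) 0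
    fun x => by unfold cubicDisc; ring

theorem fewChanges_cutSet_c (h : IsReg ε R RC k α μ κ κ') (X a d b : ℝ) :
    FewChanges 15 {c | ((d, c), b) ∈ cutSet ε R X a} :=
  fewChanges_slice (h.few_c a b d) (F := fun c => cubicDisc a b c d) ε X
    (-4 * b ^ 3 * d - 27 * a ^ 2 * d ^ 2) (18 * a * b * d) (b ^ 2) (-4 * a)
    fun x => by unfold cubicDisc; ring

theorem fewChanges_cutSet_b (h : IsReg ε R RC k α μ κ κ') (X a d c : ℝ) :
    FewChanges 15 {b | ((d, c), b) ∈ cutSet ε R X a} :=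
  fewChanges_slice (h.few_b a c d) (F := fun b => cubicDisc a b c d) ε X
    (-4 * a * c ^ 3 - 27 * a ^ 2 * d ^ 2) (18 * a * c * d) (c ^ 2) (-4 * d)
    fun x => by unfold cubicDisc; ring

end IsReg

theorem slice_error_le {l s a B C D : ℝ} (hl : 1 ≤ l) (hs : 1 ≤ s) (ha : a = s ^ 2) (hB : 1 ≤ B)
    (hC : 1 ≤ C) (hD : 1 ≤ D) :
    15 * ((2 * (10 * l) / B + 2) * (2 * (10 * l * √l / s) / C + 2)
      + (2 * (10 * l) / B + 2) * (2 * (10 * l ^ 2 / a)) / D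
      + 2 * (10 * l * √l / s) * (2 * (10 * l ^ 2 / a)) / (C * D))
    ≤ 6600 * (l ^ 2 * √l / (s * C) + l + l ^ 3 / (a * D) + l ^ 3 * √l / (a * s * C * D)) := by
  subst ha
  have h1 : 2 * (10 * l) / B + 2 ≤ 22 * l := by
    have : 2 * (10 * l) / B ≤ 2 * (10 * l) := div_le_self (by linarith) hB
    linarith
  have h0 : 0 ≤ √l := Real.sqrt_nonneg l
  calc _ ≤ 15 * ((22 * l) * (2 * (10 * l * √l / s) / C + 2)
      + (22 * l) * (2 * (10 * l ^ 2 / s ^ 2)) / D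
      + 2 * (10 * l * √l / s) * (2 * (10 * l ^ 2 / s ^ 2)) / (C * D)) := by gcongr
    _ = 6600 * (l ^ 2 * √l / (s * C)) + 660 * l + 6600 * (l ^ 3 / (s ^ 2 * D))
      + 6000 * (l ^ 3 * √l / (s ^ 2 * s * C * D)) := by field_simp; ring
    _ ≤ _ := by
      have : 0 ≤ l ^ 3 * √l / (s ^ 2 * s * C * D) := by positivity
      linarith

namespace IsReg

variable {ε : ℤ} {R RC : ℝ → ℝ → ℝ → ℝ → Prop} {k α μ κ κ' : ℝ}

/-- The box containing the forms of leading coefficient `a`. -/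
theorem box (h : IsReg ε R RC k α μ κ κ') {a b c d l : ℝ} (ha : 1 ≤ |a|) (hl : 0 < l)
    (hR : RC a b c d) (h0 : 0 < ε * cubicDisc a b c d) (h1 : ε * cubicDisc a b c d < l ^ 4) :
    |d| ≤ 10 * l ^ 2 / |a| ∧ |c| ≤ 10 * l * √l / √|a| ∧ |b| ≤ 10 * l := by
  have ha0 : a ≠ 0 := abs_pos.1 (by linarith)
  obtain ⟨-, hb, hc, hd⟩ := h.bounds ha0 hl hR h0 h1
  refine ⟨?_, ?_, hb⟩
  · rw [le_div_iff₀ (by linarith), mul_comm, ← abs_mul]; exact hd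
  · rw [le_div_iff₀ (Real.sqrt_pos.2 (by linarith))]
    refine abs_le_of_sq_le_sq' ?_ (by positivity) |>.2
    have e1 : √|a| ^ 2 = |a| := Real.sq_sqrt (abs_nonneg a)
    have e2 : √l ^ 2 = l := Real.sq_sqrt hl.le
    rw [mul_pow, mul_pow, e1, e2, sq_abs]
    linarith

/-- Counting the forms of given leading coefficient in residue classes. -/
theorem abs_slice_sub_le (h : IsReg ε R RC k α μ κ κ') {l : ℝ} (hl : 1 ≤ l) {a : ℤ} (ha : a ≠ 0)
    {B C D : ℕ} (hB : 0 < B) (hC : 0 < C) (hD : 0 < D) {M : ℤ} (hM : 10 * l ^ 2 ≤ M)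
    (rb : ℤ) (rc : ℤ → ℤ) (rd : ℤ → ℤ → ℤ) :
    |∑ b ∈ Finset.Icc (-M) M, resw B rb b * ∑ c ∈ Finset.Icc (-M) M, resw C (rc b) c *
      ∑ d ∈ Finset.Icc (-M) M, resw D (rd b c) d *
        (cutSet ε R (l ^ 4) a).indicator 1 (((d : ℝ), (c : ℝ)), (b : ℝ))
      - volume.real (cutSet ε R (l ^ 4) a) / (B * C * D)|
      ≤ 6600 * (l ^ 2 * √l / (√|(a : ℝ)| * C) + l + l ^ 3 / (|(a : ℝ)| * D)
        + l ^ 3 * √l / (|(a : ℝ)| * √|(a : ℝ)| * C * D)) := by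
  have ha1 : (1 : ℝ) ≤ |(a : ℝ)| := by exact_mod_cast Int.one_le_abs ha
  have hs1 : 1 ≤ √|(a : ℝ)| := Real.one_le_sqrt.2 ha1
  have hl0 : 0 < l := by linarith
  have hsl : √l ≤ l := Real.sqrt_le_iff.2 ⟨hl0.le, by nlinarith⟩
  refine le_trans (abs_sum_resw_sub_volume_le (N := 15) (β := 10 * l)
    (γ := 10 * l * √l / √|(a : ℝ)|) (δ := 10 * l ^ 2 / |(a : ℝ)|) hB hC hD
    (h.measurableSet_cutSet _ _) (by positivity) (by positivity) (by positivity) ?_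
    (fun c b => h.fewChanges_cutSet_d _ _ c b) (fun d b => h.fewChanges_cutSet_c _ _ d b)
    (fun d c => h.fewChanges_cutSet_b _ _ d c) ?_ ?_ ?_ rb rc rd) ?_
  · rintro d c b ⟨hR, h0, h1⟩
    exact h.box ha1 hl0 (h.closed _ _ _ _ hR) h0 h1
  · nlinarith
  · refine (div_le_self (by positivity) hs1).trans (le_trans ?_ hM)
    nlinarith [Real.sqrt_nonneg l]
  · exact (div_le_self (by positivity) ha1).trans hM
  · exact slice_error_le hl hs1 (Real.sq_sqrt (abs_nonneg _)).symm (by exact_mod_cast hB)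
      (by exact_mod_cast hC) (by exact_mod_cast hD)

end IsReg

theorem sum_inv_sqrt_le (N : ℕ) : ∑ n ∈ Finset.Icc 1 N, 1 / √(n : ℝ) ≤ 2 * √N := by
  induction N with
  | zero => simp
  | succ n ih =>
    rw [Finset.sum_Icc_succ_top (by omega)]
    have h1 : √(n : ℝ) ^ 2 = n := Real.sq_sqrt (by positivity)
    have h2 : √((n + 1 : ℕ) : ℝ) ^ 2 = n + 1 := by rw [Real.sq_sqrt (by positivity)]; push_cast; rfl
    have h3 : 0 < √((n + 1 : ℕ) : ℝ) := Real.sqrt_pos.2 (by positivity)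
    have h4 : 1 / √((n + 1 : ℕ) : ℝ) ≤ 2 * √((n + 1 : ℕ) : ℝ) - 2 * √(n : ℝ) := by
      rw [div_le_iff₀ h3]; nlinarith [sq_nonneg (√((n + 1 : ℕ) : ℝ) - √(n : ℝ))]
    linarith

theorem sum_inv_mul_sqrt_le (N : ℕ) :
    ∑ n ∈ Finset.Icc 1 N, 1 / ((n : ℝ) * √(n : ℝ)) ≤ 3 := by
  rcases Nat.eq_zero_or_pos N with rfl | hN
  · simp
  suffices h : ∑ n ∈ Finset.Icc 1 N, 1 / ((n : ℝ) * √(n : ℝ)) ≤ 3 - 2 / √(N : ℝ) by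
    have : 0 ≤ 2 / √(N : ℝ) := by positivity
    linarith
  induction N, hN using Nat.le_induction with
  | base => norm_num
  | succ n hn ih =>
    rw [Finset.sum_Icc_succ_top (by omega)]
    have hn0 : (0 : ℝ) < n := by exact_mod_cast hn
    have h1 : √(n : ℝ) ^ 2 = n := Real.sq_sqrt (by positivity)
    have h2 : √((n + 1 : ℕ) : ℝ) ^ 2 = n + 1 := by rw [Real.sq_sqrt (by positivity)]; push_cast; rfl
    have h3 : 0 < √(n : ℝ) := Real.sqrt_pos.2 hn0
    have h4 : √(n : ℝ) ≤ √((n + 1 : ℕ) : ℝ) := Real.sqrt_le_sqrt (by push_cast; linarith)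
    have h5 : ((n + 1 : ℕ) : ℝ) = √((n + 1 : ℕ) : ℝ) ^ 2 := by rw [h2]; push_cast; rfl
    have h6 : 1 / (((n + 1 : ℕ) : ℝ) * √((n + 1 : ℕ) : ℝ))
        ≤ 2 / √(n : ℝ) - 2 / √((n + 1 : ℕ) : ℝ) := by
      set u := √(n : ℝ)
      set v := √((n + 1 : ℕ) : ℝ)
      have hv : 0 < v := h3.trans_le h4
      rw [h5, div_sub_div _ _ h3.ne' hv.ne', div_le_div_iff₀ (by positivity) (by positivity)]
      have h7 : (v - u) * (v + u) = 1 := by nlinarith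
      have h8 : 1 ≤ (v - u) * (2 * v) := by
        rw [← h7]; exact mul_le_mul_of_nonneg_left (by linarith) (by linarith)
      nlinarith [mul_le_mul_of_nonneg_right h8 (by positivity : 0 ≤ v ^ 2),
        mul_le_mul_of_nonneg_right h4 hv.le]
    linarith

theorem sum_inv_le (N : ℕ) {l : ℝ} (hl : 1 ≤ l) (hN : N ≤ 3 * l) :
    ∑ n ∈ Finset.Icc 1 N, 1 / (n : ℝ) ≤ 3 + Real.log l := by
  have h1 : ∑ n ∈ Finset.Icc 1 N, 1 / (n : ℝ) = (harmonic N : ℝ) := by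
    rw [harmonic_eq_sum_Icc]; push_cast; simp
  rw [h1]
  refine (harmonic_le_one_add_log N).trans ?_
  rcases Nat.eq_zero_or_pos N with rfl | hN0
  · have := Real.log_nonneg hl
    simp; linarith
  have h2 : Real.log N ≤ Real.log (3 * l) :=
    Real.log_le_log (by exact_mod_cast hN0) hN
  rw [Real.log_mul (by norm_num) (by linarith)] at h2
  have h3 : Real.log 3 ≤ 3 - 1 := Real.log_le_sub_one_of_pos (by norm_num)
  linarith

/-- A sum over the nonzero multiples of `A`. -/
theorem sum_resw_eq {A N : ℕ} (hA : 0 < A) {M : ℤ} {g : ℤ → ℝ} (h0 : g 0 = 0)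
    (hM : ∀ a, g a ≠ 0 → |a| ≤ M ∧ |a| ≤ A * N) :
    ∑ a ∈ Finset.Icc (-M) M, resw A 0 a * g a =
        ∑ n ∈ Finset.Icc 1 N, (g (A * n) + g (-(A * n))) := by
  classical
  set U := (Finset.Icc 1 N).image fun n : ℕ => (A * n : ℤ) with hU
  set V := (Finset.Icc 1 N).image fun n : ℕ => -(A * n : ℤ) with hV
  have hA' : (A : ℤ) ≠ 0 := by exact_mod_cast hA.ne'
  have hdis : Disjoint U V := by
    rw [Finset.disjoint_left]
    intro x hx hy
    obtain ⟨n, hn, rfl⟩ := Finset.mem_image.1 hx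
    obtain ⟨m, hm, hm'⟩ := Finset.mem_image.1 hy
    have h1 : 0 < (A : ℤ) * n := by have := (Finset.mem_Icc.1 hn).1; positivity
    have h2 : 0 < (A : ℤ) * m := by have := (Finset.mem_Icc.1 hm).1; positivity
    linarith
  have e1 : ∑ a ∈ Finset.Icc (-M) M, resw A 0 a * g a
      = ∑ a ∈ Finset.Icc (-M) M ∪ (U ∪ V), resw A 0 a * g a := by
    refine Finset.sum_subset Finset.subset_union_left fun x _ hx => ?_
    by_contra hne
    exact hx (Finset.mem_Icc.2 (abs_le.1 (hM x (right_ne_zero_of_mul hne)).1))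
  have e2 : ∑ a ∈ U ∪ V, resw A 0 a * g a
      = ∑ a ∈ Finset.Icc (-M) M ∪ (U ∪ V), resw A 0 a * g a := by
    refine Finset.sum_subset Finset.subset_union_right fun x _ hx => ?_
    by_contra hne
    have hg := right_ne_zero_of_mul hne
    have hr := left_ne_zero_of_mul hne
    have hdvd : (A : ℤ) ∣ x := by
      by_contra hnd
      exact hr (by rw [resw, if_neg]; simpa using hnd)
    obtain ⟨n, rfl⟩ := hdvd
    have hn0 : n ≠ 0 := by rintro rfl; exact hg (by simpa using h0)
    have hnN := (hM _ hg).2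
    rw [abs_mul, Nat.abs_cast] at hnN
    have hnN' : |n| ≤ N := le_of_mul_le_mul_left hnN (by positivity)
    have hmem : n.natAbs ∈ Finset.Icc 1 N := by
      rw [Finset.mem_Icc]
      exact ⟨Int.natAbs_pos.2 hn0, by zify; exact hnN'⟩
    refine hx (Finset.mem_union.2 ?_)
    rcases le_total 0 n with h | h
    · exact Or.inl (Finset.mem_image.2 ⟨n.natAbs, hmem, by
        rw [Int.natCast_natAbs, abs_of_nonneg h]⟩)
    · exact Or.inr (Finset.mem_image.2 ⟨n.natAbs, hmem, by
        rw [Int.natCast_natAbs, abs_of_nonpos h]; ring⟩)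
  have hr1 : ∀ n : ℕ, resw A 0 (A * n) = 1 := fun n => by
    rw [resw, if_pos]; simp
  have hr2 : ∀ n : ℕ, resw A 0 (-(A * n)) = 1 := fun n => by
    rw [resw, if_pos]; simp
  rw [e1, ← e2, Finset.sum_union hdis, Finset.sum_image, Finset.sum_image, ← Finset.sum_add_distrib]
  · exact Finset.sum_congr rfl fun n _ => by rw [hr1, hr2, one_mul, one_mul]
  · intro x _ y _ hxy
    simp only [neg_inj] at hxy
    exact_mod_cast mul_left_cancel₀ hA' hxy
  · intro x _ y _ hxy
    exact_mod_cast mul_left_cancel₀ hA' hxy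

/-- The forms in the region `R` with nonzero leading coefficient and bounded discriminant. -/
def regForms (ε : ℤ) (R : ℝ → ℝ → ℝ → ℝ → Prop) (X : ℝ) : Set BCF :=
  {f | f.a ≠ 0 ∧ R f.a f.b f.c f.d ∧ 0 < ε * f.disc ∧ ((ε * f.disc : ℤ) : ℝ) < X}

namespace IsReg

variable {ε : ℤ} {R RC : ℝ → ℝ → ℝ → ℝ → Prop} {k α μ κ κ' : ℝ}

theorem mem_regForms_iff {X : ℝ} {f : BCF} : f ∈ regForms ε R X ↔
    f.a ≠ 0 ∧ (((f.d : ℝ), (f.c : ℝ)), (f.b : ℝ)) ∈ cutSet ε R X f.a := by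
  have h1 : ((ε * f.disc : ℤ) : ℝ) = ε * cubicDisc (f.a : ℝ) f.b f.c f.d := by
    simp only [BCF.disc, cubicDisc]; push_cast; rfl
  have h2 : 0 < ε * f.disc ↔ (0 : ℝ) < ε * cubicDisc (f.a : ℝ) f.b f.c f.d := by
    rw [← h1]; exact Int.cast_pos.symm
  rw [regForms, Set.mem_ofPred_eq, h1, h2]
  rfl

theorem abs_le_of_mem (h : IsReg ε R RC k α μ κ κ') {l : ℝ} (hl : 1 ≤ l) {a b c d : ℤ}
    (ha : a ≠ 0) (hf : (((d : ℝ), (c : ℝ)), (b : ℝ)) ∈ cutSet ε R (l ^ 4) a) {M : ℤ}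
    (hM : 10 * l ^ 2 ≤ M) : |a| ≤ M ∧ |b| ≤ M ∧ |c| ≤ M ∧ |d| ≤ M := by
  have ha1 : (1 : ℝ) ≤ |(a : ℝ)| := by exact_mod_cast Int.one_le_abs ha
  have hs1 : 1 ≤ √|(a : ℝ)| := Real.one_le_sqrt.2 ha1
  have hl0 : 0 < l := by linarith
  have hsl : √l ≤ l := Real.sqrt_le_iff.2 ⟨hl0.le, by nlinarith⟩
  obtain ⟨hR, h0, h1⟩ := hf
  have hb := h.bounds (by exact_mod_cast ha) hl0 (h.closed _ _ _ _ hR) h0 h1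
  obtain ⟨h2, h3, h4⟩ := h.box ha1 hl0 (h.closed _ _ _ _ hR) h0 h1
  have e2 : |(d : ℝ)| ≤ M := h2.trans ((div_le_self (by positivity) ha1).trans hM)
  have e3 : |(c : ℝ)| ≤ M := by
    refine h3.trans ((div_le_self (by positivity) hs1).trans (le_trans ?_ hM))
    nlinarith [Real.sqrt_nonneg l]
  have e4 : |(b : ℝ)| ≤ M := by nlinarith
  have e1 : |(a : ℝ)| ≤ M := by nlinarith [hb.1]
  exact ⟨by exact_mod_cast e1, by exact_mod_cast e4, by exact_mod_cast e3, by exact_mod_cast e2⟩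

theorem sum_regForms (h : IsReg ε R RC k α μ κ κ') {l : ℝ} (hl : 1 ≤ l) {F : Finset BCF}
    (hF : ∀ f, f ∈ F ↔ f ∈ regForms ε R (l ^ 4)) {M : ℤ} (hM : 10 * l ^ 2 ≤ M)
    (w : ℤ → ℤ → ℤ → ℤ → ℝ) :
    ∑ f ∈ F, w f.a f.b f.c f.d = ∑ a ∈ Finset.Icc (-M) M, ∑ b ∈ Finset.Icc (-M) M,
      ∑ c ∈ Finset.Icc (-M) M, ∑ d ∈ Finset.Icc (-M) M, if a = 0 then 0 else w a b c d *
        (cutSet ε R (l ^ 4) a).indicator 1 (((d : ℝ), (c : ℝ)), (b : ℝ)) := by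
  classical
  set I := Finset.Icc (-M) M
  have e1 : ∑ f ∈ F, w f.a f.b f.c f.d = ∑ x ∈ I ×ˢ I ×ˢ I ×ˢ I, if x.1 = 0 then 0 else
      w x.1 x.2.1 x.2.2.1 x.2.2.2 * (cutSet ε R (l ^ 4) x.1).indicator 1
        (((x.2.2.2 : ℝ), (x.2.2.1 : ℝ)), (x.2.1 : ℝ)) := by
    refine Finset.sum_of_injOn (fun f => (f.a, f.b, f.c, f.d)) ?_ ?_ ?_ ?_
    · intro f _ g _ hfg
      simp only [Prod.mk.injEq] at hfg
      exact BCF.ext hfg.1 hfg.2.1 hfg.2.2.1 hfg.2.2.2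
    · intro f hf
      obtain ⟨h1, h2⟩ := mem_regForms_iff.1 ((hF f).1 hf)
      obtain ⟨i1, i2, i3, i4⟩ := h.abs_le_of_mem hl h1 h2 hM
      simp only [Finset.coe_product, Set.mem_prod, Finset.mem_coe, I, Finset.mem_Icc]
      exact ⟨abs_le.1 i1, abs_le.1 i2, abs_le.1 i3, abs_le.1 i4⟩
    · intro x _ hx
      split_ifs with h0
      · rfl
      · rw [Set.indicator_of_notMem, mul_zero]
        intro hmem
        exact hx ⟨⟨x.1, x.2.1, x.2.2.1, x.2.2.2⟩,
          Finset.mem_coe.2 ((hF _).2 (mem_regForms_iff.2 ⟨h0, hmem⟩)), rfl⟩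
    · intro f hf
      obtain ⟨h1, h2⟩ := mem_regForms_iff.1 ((hF f).1 hf)
      simp only [if_neg h1]
      rw [Set.indicator_of_mem h2, Pi.one_apply, mul_one]
  rw [e1]
  simp only [Finset.sum_product]

end IsReg

theorem rpow_seven_halves {l : ℝ} (hl : 0 < l) : l ^ (7 / 2 : ℝ) = l ^ 3 * √l := by
  rw [Real.sqrt_eq_rpow, ← Real.rpow_natCast, ← Real.rpow_add hl]; norm_num

theorem sum_slice_error_le {l : ℝ} (hl : 1 ≤ l) {A C D : ℝ} (hA : 1 ≤ A) (hC : 1 ≤ C) (hD : 1 ≤ D)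
    {N : ℕ} (hN : N ≤ 3 * l) :
    ∑ n ∈ Finset.Icc 1 N, (l ^ 2 * √l / (√(A * n) * C) + l + l ^ 3 / (A * n * D)
        + l ^ 3 * √l / (A * n * √(A * n) * C * D))
      ≤ 4 * (l ^ 3 * (3 + Real.log l) / C) + 3 * l ^ 2 + l ^ 3 * (3 + Real.log l) / D
        + 3 * (l ^ 3 * √l / (A * C * D)) := by
  have hl0 : 0 < l := by linarith
  have hA0 : 0 < A := by linarith
  have hC0 : 0 < C := by linarith
  have hD0 : 0 < D := by linarith
  have hlog := Real.log_nonneg hl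
  have hsl : √l ^ 2 = l := Real.sq_sqrt hl0.le
  have h1 : ∀ n ∈ Finset.Icc 1 N, l ^ 2 * √l / (√(A * n) * C) + l + l ^ 3 / (A * n * D)
        + l ^ 3 * √l / (A * n * √(A * n) * C * D) ≤ l ^ 2 * √l / C * (1 / √(n : ℝ)) + l
        + l ^ 3 / D * (1 / (n : ℝ)) + l ^ 3 * √l / (A * C * D) * (1 / ((n : ℝ) * √(n : ℝ))) := by
    intro n hn
    have hn0 : (0 : ℝ) < n := by exact_mod_cast (Finset.mem_Icc.1 hn).1
    have h2 : (n : ℝ) ≤ A * n := le_mul_of_one_le_left hn0.le hA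
    have h3 : √(n : ℝ) ≤ √(A * n) := Real.sqrt_le_sqrt h2
    have h4 : 0 < √(n : ℝ) := Real.sqrt_pos.2 hn0
    have h5 : l ^ 2 * √l / (√(A * n) * C) ≤ l ^ 2 * √l / C * (1 / √(n : ℝ)) := by
      calc _ ≤ l ^ 2 * √l / (√(n : ℝ) * C) := by gcongr
        _ = _ := by field_simp
    have h6 : l ^ 3 / (A * n * D) ≤ l ^ 3 / D * (1 / (n : ℝ)) := by
      calc _ ≤ l ^ 3 / (n * D) := by gcongr
        _ = _ := by field_simp
    have h7 : l ^ 3 * √l / (A * n * √(A * n) * C * D)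
        ≤ l ^ 3 * √l / (A * C * D) * (1 / ((n : ℝ) * √(n : ℝ))) := by
      calc _ ≤ l ^ 3 * √l / (A * n * √(n : ℝ) * C * D) := by gcongr
        _ = _ := by field_simp
    linarith
  refine (Finset.sum_le_sum h1).trans ?_
  rw [Finset.sum_add_distrib, Finset.sum_add_distrib, Finset.sum_add_distrib, ← Finset.mul_sum,
    ← Finset.mul_sum, ← Finset.mul_sum]
  have s1 : ∑ n ∈ Finset.Icc 1 N, 1 / √(n : ℝ) ≤ 4 * √l := by
    refine (sum_inv_sqrt_le N).trans ?_
    have : √(N : ℝ) ≤ 2 * √l := by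
      refine Real.sqrt_le_iff.2 ⟨by positivity, ?_⟩
      rw [mul_pow, hsl]; linarith
    linarith
  have s2 := sum_inv_le N hl hN
  have s3 := sum_inv_mul_sqrt_le N
  have s4 : ∑ n ∈ Finset.Icc 1 N, l ≤ 3 * l ^ 2 := by
    simp only [Finset.sum_const, Nat.card_Icc, Nat.add_sub_cancel, nsmul_eq_mul]; nlinarith
  have t1 : l ^ 2 * √l / C * ∑ n ∈ Finset.Icc 1 N, 1 / √(n : ℝ)
      ≤ 4 * (l ^ 3 * (3 + Real.log l) / C) := by
    calc _ ≤ l ^ 2 * √l / C * (4 * √l) := by gcongr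
      _ = 4 * (l ^ 2 * √l ^ 2 * 1 / C) := by ring
      _ = 4 * (l ^ 3 * 1 / C) := by rw [hsl]; ring
      _ ≤ _ := by gcongr; linarith
  have t2 : l ^ 3 / D * ∑ n ∈ Finset.Icc 1 N, 1 / (n : ℝ) ≤ l ^ 3 * (3 + Real.log l) / D := by
    calc _ ≤ l ^ 3 / D * (3 + Real.log l) := by gcongr
      _ = _ := by ring
  have t3 : l ^ 3 * √l / (A * C * D) * ∑ n ∈ Finset.Icc 1 N, 1 / ((n : ℝ) * √(n : ℝ))
      ≤ 3 * (l ^ 3 * √l / (A * C * D)) := by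
    calc _ ≤ l ^ 3 * √l / (A * C * D) * 3 := by gcongr
      _ = _ := by ring
  linarith

namespace IsReg

variable {ε : ℤ} {R RC : ℝ → ℝ → ℝ → ℝ → Prop} {k α μ κ κ' : ℝ}

/-- The weighted number of forms of given leading coefficient. -/
noncomputable def sliceSum (ε : ℤ) (R : ℝ → ℝ → ℝ → ℝ → Prop) (l : ℝ) (M : ℤ) (B C D : ℕ)
    (rb : ℤ → ℤ) (rc : ℤ → ℤ → ℤ) (rd : ℤ → ℤ → ℤ → ℤ) (a : ℤ) : ℝ :=
  if a = 0 then 0 else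
    ∑ b ∈ Finset.Icc (-M) M, resw B (rb a) b * ∑ c ∈ Finset.Icc (-M) M, resw C (rc a b) c *
      ∑ d ∈ Finset.Icc (-M) M, resw D (rd a b c) d *
        (cutSet ε R (l ^ 4) a).indicator 1 (((d : ℝ), (c : ℝ)), (b : ℝ))

theorem sliceSum_bound (h : IsReg ε R RC k α μ κ κ') {l : ℝ} (hl : 1 ≤ l) {M : ℤ}
    (hM : 10 * l ^ 2 ≤ M) {B C D : ℕ} {rb : ℤ → ℤ} {rc : ℤ → ℤ → ℤ} {rd : ℤ → ℤ → ℤ → ℤ} {a : ℤ}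
    (ha : sliceSum ε R l M B C D rb rc rd a ≠ 0) : |a| ≤ M ∧ (|a| : ℝ) ≤ 2 * l := by
  unfold sliceSum at ha
  split_ifs at ha with h0
  · exact (ha rfl).elim
  obtain ⟨b, -, hb⟩ := Finset.exists_ne_zero_of_sum_ne_zero ha
  obtain ⟨c, -, hc⟩ := Finset.exists_ne_zero_of_sum_ne_zero (right_ne_zero_of_mul hb)
  obtain ⟨d, -, hd⟩ := Finset.exists_ne_zero_of_sum_ne_zero (right_ne_zero_of_mul hc)
  have hmem := Set.mem_of_indicator_ne_zero (right_ne_zero_of_mul hd)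
  refine ⟨(h.abs_le_of_mem hl h0 hmem hM).1, ?_⟩
  obtain ⟨hR, h1, h2⟩ := hmem
  exact (h.bounds (by exact_mod_cast h0) (by linarith) (h.closed _ _ _ _ hR) h1 h2).1

/-- Counting the reduced forms with coefficients in residue classes. -/
theorem exists_abs_sum_sub_le (h : IsReg ε R RC k α μ κ κ') : ∃ K : ℝ, 0 ≤ K ∧
    ∀ (l : ℝ) (F : Finset BCF) (A B C D : ℕ) (rb : ℤ → ℤ) (rc : ℤ → ℤ → ℤ) (rd : ℤ → ℤ → ℤ → ℤ),
      1 ≤ l → (∀ f, f ∈ F ↔ f ∈ regForms ε R (l ^ 4)) → 0 < A → 0 < B → 0 < C → 0 < D →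
      |∑ f ∈ F, resw A 0 f.a * resw B (rb f.a) f.b * resw C (rc f.a f.b) f.c
          * resw D (rd f.a f.b f.c) f.d - κ * Real.pi ^ 2 / (6 * κ') * l ^ 4 / (A * B * C * D)|
        ≤ K * (l ^ 3 * (3 + Real.log l) * (1 / C + 1 / D) + l ^ 2
          + l ^ 3 * √l * (1 / (A * C * D) + 1 / (B * C * D))) := by
  obtain ⟨K, hK, hvol⟩ := h.exists_abs_sum_volume_sub_le
  refine ⟨13200 * 4 + 2 * K, by positivity, ?_⟩
  intro l F A B C D rb rc rd hl hF hA hB hC hD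
  have hl0 : 0 < l := by linarith
  have hA1 : (1 : ℝ) ≤ A := by exact_mod_cast hA
  have hB1 : (1 : ℝ) ≤ B := by exact_mod_cast hB
  have hC1 : (1 : ℝ) ≤ C := by exact_mod_cast hC
  have hD1 : (1 : ℝ) ≤ D := by exact_mod_cast hD
  obtain ⟨M, hM⟩ : ∃ M : ℤ, 10 * l ^ 2 ≤ M := ⟨⌈10 * l ^ 2⌉, Int.le_ceil _⟩
  set N := ⌈2 * l⌉₊ with hN
  have hN1 : 2 * l ≤ N := Nat.le_ceil _
  have hN2 : (N : ℝ) ≤ 3 * l := by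
    have := Nat.ceil_lt_add_one (a := 2 * l) (by linarith)
    linarith
  have hAN : 2 * l ≤ A * N := hN1.trans (le_mul_of_one_le_left (by positivity) hA1)
  set g := sliceSum ε R l M B C D rb rc rd with hg
  have e1 : ∑ f ∈ F, resw A 0 f.a * resw B (rb f.a) f.b * resw C (rc f.a f.b) f.c
      * resw D (rd f.a f.b f.c) f.d = ∑ n ∈ Finset.Icc 1 N, (g (A * n) + g (-(A * n))) := by
    rw [h.sum_regForms hl hF hM (fun a b c d => resw A 0 a * resw B (rb a) b * resw C (rc a b) c
      * resw D (rd a b c) d), ← sum_resw_eq (M := M) hA (by simp [hg, sliceSum])]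
    · refine Finset.sum_congr rfl fun a _ => ?_
      rw [hg, sliceSum]
      split_ifs with h0
      · simp
      · simp only [Finset.mul_sum]
        refine Finset.sum_congr rfl fun b _ => Finset.sum_congr rfl fun c _ =>
          Finset.sum_congr rfl fun d _ => by ring
    · intro a ha
      obtain ⟨h1, h2⟩ := h.sliceSum_bound hl hM ha
      refine ⟨h1, ?_⟩
      have := h2.trans hAN
      exact_mod_cast this
  set V : ℕ → ℝ := fun n => volume.real (cutSet ε R (l ^ 4) (A * n)) with hV
  set E : ℕ → ℝ := fun n => l ^ 2 * √l / (√(A * n) * C) + l + l ^ 3 / (A * n * D)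
        + l ^ 3 * √l / (A * n * √(A * n) * C * D) with hE
  have hterm : ∀ n ∈ Finset.Icc 1 N, |g (A * n) + g (-(A * n)) - 2 * V n / (B * C * D)|
      ≤ 13200 * E n := by
    intro n hn
    have hn0 : 0 < n := (Finset.mem_Icc.1 hn).1
    have ha : (A * n : ℤ) ≠ 0 := by positivity
    have h1 := h.abs_slice_sub_le hl ha hB hC hD hM (rb (A * n)) (rc (A * n)) (rd (A * n))
    have h2 := h.abs_slice_sub_le hl (neg_ne_zero.2 ha) hB hC hD hM (rb (-(A * n)))
      (rc (-(A * n))) (rd (-(A * n)))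
    have hg1 : g (A * n) = _ := if_neg ha
    have hg2 : g (-(A * n)) = _ := if_neg (neg_ne_zero.2 ha)
    rw [← hg1] at h1
    rw [← hg2] at h2
    have hc1 : (((A * n : ℤ)) : ℝ) = A * n := by push_cast; rfl
    have hc2 : (((-(A * n : ℤ) : ℤ)) : ℝ) = -(A * n) := by push_cast; rfl
    have hpos : 0 ≤ (A : ℝ) * n := by positivity
    rw [hc1, abs_of_nonneg hpos] at h1
    rw [hc2, h.volume_real_cutSet_neg hl0 (by positivity), abs_neg, abs_of_nonneg hpos] at h2
    have h3 : g (A * n) + g (-(A * n)) - 2 * V n / (B * C * D)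
        = (g (A * n) - V n / (B * C * D)) + (g (-(A * n)) - V n / (B * C * D)) := by ring
    rw [h3]
    refine (abs_add_le _ _).trans ((add_le_add h1 h2).trans (le_of_eq ?_))
    simp only [hE]
    ring
  have hv := hvol l A N hl0 hA1 hAN
  rw [rpow_seven_halves hl0] at hv
  have hsum := Finset.abs_sum_le_sum_abs (fun n : ℕ => g (A * n) + g (-(A * n))
    - 2 * V n / (B * C * D)) (Finset.Icc 1 N)
  have hsum2 := hsum.trans (Finset.sum_le_sum hterm)
  rw [← Finset.mul_sum, Finset.sum_sub_distrib] at hsum2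
  have hEs := sum_slice_error_le hl hA1 hC1 hD1 hN2
  have hVs : ∑ n ∈ Finset.Icc 1 N, 2 * V n / (B * C * D : ℝ)
      = 2 / (B * C * D) * ∑ n ∈ Finset.Icc 1 N, V n := by
    rw [Finset.mul_sum]; exact Finset.sum_congr rfl fun n _ => by ring
  have hmain : κ * Real.pi ^ 2 / (6 * κ') * l ^ 4 / (A * B * C * D)
      = 2 / (B * C * D) * (κ * Real.pi ^ 2 / (12 * κ') * l ^ 4 / A) := by
    have := h.one_le_κ'
    field_simp; ring
  have hv2 : |2 / (B * C * D : ℝ) * ∑ n ∈ Finset.Icc 1 N, V n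
      - 2 / (B * C * D) * (κ * Real.pi ^ 2 / (12 * κ') * l ^ 4 / A)|
      ≤ 2 * K * (l ^ 3 * √l * (1 / (B * C * D))) := by
    rw [← mul_sub, abs_mul, abs_of_nonneg (by positivity)]
    refine (mul_le_mul_of_nonneg_left hv (by positivity)).trans (le_of_eq (by ring))
  rw [e1, hmain]
  rw [hVs] at hsum2
  refine (abs_sub_le _ _ _).trans ((add_le_add hsum2 hv2).trans ?_)
  have hlog := Real.log_nonneg hl
  have p1 : 0 ≤ l ^ 3 * (3 + Real.log l) * (1 / C) := by positivity
  have p2 : 0 ≤ l ^ 3 * (3 + Real.log l) * (1 / D) := by positivity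
  have p3 : 0 ≤ l ^ 3 * √l * (1 / (A * C * D)) := by positivity
  have p4 : 0 ≤ l ^ 3 * √l * (1 / (B * C * D)) := by positivity
  have p5 : 0 ≤ l ^ 2 := by positivity
  have hEs' : ∑ n ∈ Finset.Icc 1 N, E n ≤ 4 * (l ^ 3 * (3 + Real.log l) * (1 / C)) + 3 * l ^ 2
      + l ^ 3 * (3 + Real.log l) * (1 / D) + 3 * (l ^ 3 * √l * (1 / (A * C * D))) := by
    refine hEs.trans (le_of_eq (by ring))
  have q1 := mul_nonneg hK p1
  have q2 := mul_nonneg hK p2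
  have q3 := mul_nonneg hK p3
  have q5 := mul_nonneg hK p5
  linarith

end IsReg

/-- A signed condition on the coefficients of a form: each coefficient lies in a residue class
determined by the preceding ones. -/
structure ResCond where
  sgn : ℝ
  A : ℕ
  B : ℕ
  C : ℕ
  D : ℕ
  rb : ℤ → ℤ
  rc : ℤ → ℤ → ℤ
  rd : ℤ → ℤ → ℤ → ℤ

namespace ResCond

/-- The indicator function of the condition. -/
noncomputable def ind (τ : ResCond) (f : BCF) : ℝ :=
  resw τ.A 0 f.a * resw τ.B (τ.rb f.a) f.b * resw τ.C (τ.rc f.a f.b) f.c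
    * resw τ.D (τ.rd f.a f.b f.c) f.d

/-- An integer congruent to `r` modulo `m` and to `s` modulo `n`. -/
def crt (m n : ℕ) (r s : ℤ) : ℤ := r * (n * Nat.gcdB m n) + s * (m * Nat.gcdA m n)

theorem resw_mul_resw {m n : ℕ} (h : m.Coprime n) (r s x : ℤ) :
    resw m r x * resw n s x = resw (m * n) (crt m n r s) x := by
  have hb : (1 : ℤ) = m * Nat.gcdA m n + n * Nat.gcdB m n := by
    have := Nat.gcd_eq_gcd_ab m n
    rw [h] at this; exact_mod_cast this
  have h1 : (m : ℤ) ∣ x - crt m n r s ↔ (m : ℤ) ∣ x - r := by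
    have e : x - crt m n r s = x - r + m * ((r - s) * Nat.gcdA m n) := by
      unfold crt; linear_combination r * hb
    rw [e, Int.dvd_add_left (dvd_mul_right _ _)]
  have h2 : (n : ℤ) ∣ x - crt m n r s ↔ (n : ℤ) ∣ x - s := by
    have e : x - crt m n r s = x - s + n * ((s - r) * Nat.gcdB m n) := by
      unfold crt; linear_combination s * hb
    rw [e, Int.dvd_add_left (dvd_mul_right _ _)]
  have h3 : ((m * n : ℕ) : ℤ) ∣ x - crt m n r s ↔ (m : ℤ) ∣ x - r ∧ (n : ℤ) ∣ x - s := by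
    rw [← h1, ← h2]
    push_cast
    refine ⟨fun h => ⟨(dvd_mul_right _ _).trans h, (dvd_mul_left _ _).trans h⟩, fun h' => ?_⟩
    exact (Nat.isCoprime_iff_coprime.2 h).mul_dvd h'.1 h'.2
  unfold resw
  simp only [h3]
  by_cases ha : (m : ℤ) ∣ x - r <;> by_cases hb : (n : ℤ) ∣ x - s <;> simp [ha, hb]

/-- The conjunction of two conditions. -/
def and (σ τ : ResCond) : ResCond where
  sgn := σ.sgn * τ.sgn
  A := σ.A * τ.A
  B := σ.B * τ.B
  C := σ.C * τ.C
  D := σ.D * τ.D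
  rb a := crt σ.B τ.B (σ.rb a) (τ.rb a)
  rc a b := crt σ.C τ.C (σ.rc a b) (τ.rc a b)
  rd a b c := crt σ.D τ.D (σ.rd a b c) (τ.rd a b c)

/-- All moduli are positive and have prime factors in `s`. -/
def On (s : Finset ℕ) (τ : ResCond) : Prop :=
  (0 < τ.A ∧ 0 < τ.B ∧ 0 < τ.C ∧ 0 < τ.D) ∧
  ∀ p : ℕ, p.Prime → p ∣ τ.A ∨ p ∣ τ.B ∨ p ∣ τ.C ∨ p ∣ τ.D → p ∈ s

theorem ind_and {s t : Finset ℕ} (hst : Disjoint s t) {σ τ : ResCond} (hσ : σ.On s) (hτ : τ.On t)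
    (f : BCF) : (σ.and τ).ind f = σ.ind f * τ.ind f := by
  have hA : σ.A.Coprime τ.A := Nat.Coprime.symm (Nat.coprime_of_dvd fun p hp h1 h2 =>
    Finset.disjoint_left.1 hst (hσ.2 p hp (Or.inl h2)) (hτ.2 p hp (Or.inl h1)))
  have hB : σ.B.Coprime τ.B := Nat.Coprime.symm (Nat.coprime_of_dvd fun p hp h1 h2 =>
    Finset.disjoint_left.1 hst (hσ.2 p hp (by tauto)) (hτ.2 p hp (by tauto)))
  have hC : σ.C.Coprime τ.C := Nat.Coprime.symm (Nat.coprime_of_dvd fun p hp h1 h2 =>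
    Finset.disjoint_left.1 hst (hσ.2 p hp (by tauto)) (hτ.2 p hp (by tauto)))
  have hD : σ.D.Coprime τ.D := Nat.Coprime.symm (Nat.coprime_of_dvd fun p hp h1 h2 =>
    Finset.disjoint_left.1 hst (hσ.2 p hp (by tauto)) (hτ.2 p hp (by tauto)))
  have h0 : crt σ.A τ.A 0 0 = 0 := by simp [crt]
  have hAA := resw_mul_resw hA 0 0 f.a
  rw [h0] at hAA
  simp only [ind, and]
  rw [← hAA, ← resw_mul_resw hB, ← resw_mul_resw hC, ← resw_mul_resw hD]
  ring

theorem On.and {s t : Finset ℕ} {σ τ : ResCond} (hσ : σ.On s) (hτ : τ.On t) :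
    (σ.and τ).On (s ∪ t) := by
  obtain ⟨⟨h1, h2, h3, h4⟩, h5⟩ := hσ
  obtain ⟨⟨k1, k2, k3, k4⟩, k5⟩ := hτ
  refine ⟨⟨Nat.mul_pos h1 k1, Nat.mul_pos h2 k2, Nat.mul_pos h3 k3, Nat.mul_pos h4 k4⟩, ?_⟩
  intro p hp h
  simp only [ResCond.and, hp.dvd_mul] at h
  have a1 := h5 p hp
  have a2 := k5 p hp
  rw [Finset.mem_union]
  tauto

end ResCond

namespace ResCond

/-- The conditions `τ` with their signs detect the forms that are not maximal at all `p ∈ s`. -/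
structure Covers (s : Finset ℕ) {ι : Type} [Fintype ι] (τ : ι → ResCond) : Prop where
  on : ∀ i, (τ i).On s
  abs_sgn : ∀ i, |(τ i).sgn| = 1
  ind_of : ∀ f : BCF, (∀ p ∈ s, BCF.NonMax p f) → ∑ i, (τ i).sgn * (τ i).ind f = 1
  ind_of_not : ∀ f : BCF, (¬ ∀ p ∈ s, BCF.NonMax p f) → ∑ i, (τ i).sgn * (τ i).ind f = 0
  density : ∑ i, (τ i).sgn / ((τ i).A * (τ i).B * (τ i).C * (τ i).D)
    = ∏ p ∈ s, (1 - (1 - 1 / (p : ℝ) ^ 2) * (1 - 1 / (p : ℝ) ^ 3))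
  card : ∑ _i : ι, (1 : ℝ) ≤ ∏ p ∈ s, 5 * (p : ℝ)
  sum_C : ∑ i, 1 / ((τ i).C : ℝ) ≤ ∏ _p ∈ s, 5
  sum_D : ∑ i, 1 / ((τ i).D : ℝ) ≤ ∏ _p ∈ s, 5
  sum_ACD : ∑ i, 1 / ((τ i).A * (τ i).C * (τ i).D : ℝ) ≤ ∏ p ∈ s, 5 / (p : ℝ)
  sum_BCD : ∑ i, 1 / ((τ i).B * (τ i).C * (τ i).D : ℝ) ≤ ∏ p ∈ s, 5 / (p : ℝ)

theorem sum_and {ι κ : Type} [Fintype ι] [Fintype κ] (σ : ι → ResCond) (τ : κ → ResCond)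
    {h : ResCond → ℝ} (hh : ∀ i j, h ((σ i).and (τ j)) = h (σ i) * h (τ j)) :
    ∑ x : ι × κ, h ((σ x.1).and (τ x.2)) = (∑ i, h (σ i)) * ∑ j, h (τ j) := by
  rw [Fintype.sum_prod_type, Finset.sum_mul_sum]
  simp only [hh]

theorem Covers.and {s t : Finset ℕ} (hst : Disjoint s t) {ι κ : Type} [Fintype ι] [Fintype κ]
    {σ : ι → ResCond} {τ : κ → ResCond} (hσ : Covers s σ) (hτ : Covers t τ) :
    Covers (s ∪ t) fun x : ι × κ => (σ x.1).and (τ x.2) := by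
  classical
  have hind : ∀ f : BCF, ∑ x : ι × κ, ((σ x.1).and (τ x.2)).sgn * ((σ x.1).and (τ x.2)).ind f
      = (∑ i, (σ i).sgn * (σ i).ind f) * ∑ j, (τ j).sgn * (τ j).ind f := fun f =>
    sum_and σ τ (h := fun ρ => ρ.sgn * ρ.ind f) fun i j => by
      rw [ind_and hst (hσ.on i) (hτ.on j)]; simp only [ResCond.and]; ring
  refine ⟨fun x => (hσ.on _).and (hτ.on _), fun x => ?_, fun f hf => ?_, fun f hf => ?_,
    ?_, ?_, ?_, ?_, ?_, ?_⟩
  · simp only [ResCond.and, abs_mul, hσ.abs_sgn, hτ.abs_sgn, mul_one]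
  · rw [hind, hσ.ind_of f fun p hp => hf p (Finset.mem_union_left _ hp),
      hτ.ind_of f fun p hp => hf p (Finset.mem_union_right _ hp), mul_one]
  · rw [hind]
    by_cases h1 : ∀ p ∈ s, BCF.NonMax p f
    · rw [hτ.ind_of_not f, mul_zero]
      intro h2
      refine hf fun p hp => ?_
      rcases Finset.mem_union.1 hp with h | h
      · exact h1 p h
      · exact h2 p h
    · rw [hσ.ind_of_not f h1, zero_mul]
  · rw [sum_and σ τ (h := fun ρ => ρ.sgn / (ρ.A * ρ.B * ρ.C * ρ.D)), hσ.density, hτ.density,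
      Finset.prod_union hst]
    intro i j
    simp only [ResCond.and]
    push_cast
    rw [div_mul_div_comm]
    congr 1
    ring
  · rw [sum_and σ τ (h := fun _ => 1) (by simp), Finset.prod_union hst]
    exact mul_le_mul hσ.card hτ.card (by positivity) (by positivity)
  · rw [sum_and σ τ (h := fun ρ => 1 / (ρ.C : ℝ)), Finset.prod_union hst]
    · exact mul_le_mul hσ.sum_C hτ.sum_C (by positivity) (by positivity)
    · intro i j; simp only [ResCond.and]; push_cast; rw [div_mul_div_comm, one_mul]
  · rw [sum_and σ τ (h := fun ρ => 1 / (ρ.D : ℝ)), Finset.prod_union hst]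
    · exact mul_le_mul hσ.sum_D hτ.sum_D (by positivity) (by positivity)
    · intro i j; simp only [ResCond.and]; push_cast; rw [div_mul_div_comm, one_mul]
  · rw [sum_and σ τ (h := fun ρ => 1 / (ρ.A * ρ.C * ρ.D : ℝ)), Finset.prod_union hst]
    · exact mul_le_mul hσ.sum_ACD hτ.sum_ACD (by positivity) (by positivity)
    · intro i j
      simp only [ResCond.and]; push_cast; rw [div_mul_div_comm, one_mul]
      congr 1
      ring
  · rw [sum_and σ τ (h := fun ρ => 1 / (ρ.B * ρ.C * ρ.D : ℝ)), Finset.prod_union hst]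
    · exact mul_le_mul hσ.sum_BCD hτ.sum_BCD (by positivity) (by positivity)
    · intro i j
      simp only [ResCond.and]; push_cast; rw [div_mul_div_comm, one_mul]
      congr 1
      ring

/-- The condition with moduli `(A, B, C, D)` and root `x`. -/
def ofRoot (e : ℝ) (A B C D : ℕ) (x : ℤ) : ResCond where
  sgn := e
  A := A
  B := B
  C := C
  D := D
  rb _ := 0
  rc a b := -(3 * a * x ^ 2 + 2 * b * x)
  rd a b c := -(a * x ^ 3 + b * x ^ 2 + c * x)

theorem ind_ofRoot (e : ℝ) (A B C D : ℕ) (x : ℤ) (f : BCF) [Decidable ((A : ℤ) ∣ f.a ∧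
    (B : ℤ) ∣ f.b ∧ (C : ℤ) ∣ f.dx x 1 ∧ (D : ℤ) ∣ f.eval x 1)] :
    (ofRoot e A B C D x).ind f = if ((A : ℤ) ∣ f.a ∧ (B : ℤ) ∣ f.b ∧ (C : ℤ) ∣ f.dx x 1 ∧
      (D : ℤ) ∣ f.eval x 1) then 1 else 0 := by
  have h1 : f.c - (ofRoot e A B C D x).rc f.a f.b = f.dx x 1 := by
    simp only [ofRoot, BCF.dx]; ring
  have h2 : f.d - (ofRoot e A B C D x).rd f.a f.b f.c = f.eval x 1 := by
    simp only [ofRoot, BCF.eval]; ring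
  have h3 : f.b - (ofRoot e A B C D x).rb f.a = f.b := by
    simp only [ofRoot]; ring
  unfold ind resw
  rw [h1, h2, h3, sub_zero]
  simp only [ofRoot]
  by_cases k1 : (A : ℤ) ∣ f.a <;> by_cases k2 : (B : ℤ) ∣ f.b <;>
    by_cases k3 : (C : ℤ) ∣ f.dx x 1 <;> by_cases k4 : (D : ℤ) ∣ f.eval x 1 <;>
    simp [k1, k2, k3, k4]

end ResCond

namespace BCF

theorem root_unique {p : ℤ} (hp : Prime p) {f : BCF} (hf : ¬ DvdAll p f) {x y : ℤ}
    (h1 : p ∣ f.dx x 1) (h2 : p ∣ f.eval x 1) (h3 : p ∣ f.dx y 1) (h4 : p ∣ f.eval y 1) :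
    p ∣ y - x := by
  by_contra hxy
  have hcan : ∀ z, p ∣ (y - x) * z → p ∣ z := fun z hz => (hp.dvd_or_dvd hz).resolve_left hxy
  have e1 : p ∣ (y - x) * (2 * (3 * f.a * x + f.b) + 3 * f.a * (y - x)) := by
    have := dvd_sub h3 h1
    exact this.trans (dvd_of_eq (by simp only [dx]; ring))
  have e2 : p ∣ (y - x) * ((y - x) * ((3 * f.a * x + f.b) + f.a * (y - x))) := by
    have := dvd_sub (dvd_sub h4 h2) (h1.mul_right (y - x))
    exact this.trans (dvd_of_eq (by simp only [dx, eval]; ring))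
  have e3 := hcan _ e1
  have e4 := hcan _ (hcan _ e2)
  have ha : p ∣ f.a := by
    refine hcan _ ?_
    have := dvd_sub e3 (e4.mul_left 2)
    exact this.trans (dvd_of_eq (by ring))
  have hb : p ∣ f.b := by
    have := dvd_sub e4 (ha.mul_right (3 * x + (y - x)))
    exact this.trans (dvd_of_eq (by ring))
  have hc : p ∣ f.c := by
    have := dvd_sub h1 ((ha.mul_right (3 * x ^ 2)).add (hb.mul_right (2 * x)))
    exact this.trans (dvd_of_eq (by simp only [dx]; ring))
  have hd : p ∣ f.d := by
    have := dvd_sub h2 (((ha.mul_right (x ^ 3)).add (hb.mul_right (x ^ 2))).add (hc.mul_right x))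
    exact this.trans (dvd_of_eq (by simp only [eval]; ring))
  exact hf ⟨ha, hb, hc, hd⟩

theorem root_infty {p : ℤ} {f : BCF} (ha : p ∣ f.a) (hb : p ∣ f.b) {x : ℤ}
    (h1 : p ∣ f.dx x 1) (h2 : p ∣ f.eval x 1) : DvdAll p f := by
  have hc : p ∣ f.c := by
    have := dvd_sub h1 ((ha.mul_right (3 * x ^ 2)).add (hb.mul_right (2 * x)))
    exact this.trans (dvd_of_eq (by simp only [dx]; ring))
  have hd : p ∣ f.d := by
    have := dvd_sub h2 (((ha.mul_right (x ^ 3)).add (hb.mul_right (x ^ 2))).add (hc.mul_right x))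
    exact this.trans (dvd_of_eq (by simp only [eval]; ring))
  exact ⟨ha, hb, hc, hd⟩

theorem root_congr {p : ℤ} {f : BCF} {x y : ℤ} (h : p ∣ y - x) (h1 : p ∣ f.dx x 1)
    (h2 : p ^ 2 ∣ f.eval x 1) : p ∣ f.dx y 1 ∧ p ^ 2 ∣ f.eval y 1 := by
  obtain ⟨k, hk⟩ := h
  obtain rfl : y = x + p * k := by linarith
  obtain ⟨u, hu⟩ := h1
  obtain ⟨v, hv⟩ := h2
  refine ⟨⟨u + (3 * f.a * (2 * x * k + p * k ^ 2) + 2 * f.b * k), ?_⟩,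
    ⟨v + u * k + (3 * f.a * x + f.b) * k ^ 2 + f.a * p * k ^ 3, ?_⟩⟩
  · simp only [dx] at hu ⊢; linear_combination hu
  · simp only [eval, dx] at hv hu ⊢; linear_combination hv + p * k * hu

theorem nonMax_iff_root {p : ℕ} (hp : p.Prime) {f : BCF} (hf : ¬ DvdAll p f) :
    NonMax p f ↔ (∃ x : Fin p, (p : ℤ) ∣ f.dx (x : ℕ) 1 ∧ (p : ℤ) ^ 2 ∣ f.eval (x : ℕ) 1) ∨
      ((p : ℤ) ^ 2 ∣ f.a ∧ (p : ℤ) ∣ f.b) := by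
  have hp' : Prime (p : ℤ) := Nat.prime_iff_prime_int.1 hp
  constructor
  · rintro (h | ⟨x, y, hxy, h1, h2, h3⟩)
    · exact (hf h).elim
    by_cases hy : (p : ℤ) ∣ y
    · have hx : ¬ (p : ℤ) ∣ x := fun h => hxy ⟨h, hy⟩
      right
      obtain ⟨k, rfl⟩ := hy
      have hb : (p : ℤ) ∣ f.b := by
        have : (p : ℤ) ∣ f.b * x ^ 2 := by
          have := dvd_sub h3 (dvd_mul_right (p : ℤ) (2 * f.c * x * k + 3 * f.d * p * k ^ 2))
          exact this.trans (dvd_of_eq (by simp only [dy]; ring))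
        exact (hp'.dvd_or_dvd this).resolve_right fun h => hx (hp'.dvd_of_dvd_pow h)
      refine ⟨?_, hb⟩
      have : (p : ℤ) ^ 2 ∣ f.a * x ^ 3 := by
        obtain ⟨m, hm⟩ := hb
        have := dvd_sub h1 (dvd_mul_right ((p : ℤ) ^ 2)
          (m * x ^ 2 * k + f.c * x * k ^ 2 + f.d * p * k ^ 3))
        exact this.trans (dvd_of_eq (by simp only [eval, hm]; ring))
      exact (IsCoprime.pow ((hp'.coprime_iff_not_dvd).2 hx)).dvd_of_dvd_mul_right this
    · left
      obtain ⟨u, v, huv⟩ : IsCoprime (y) ((p : ℤ) ^ 2) :=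
        (IsCoprime.pow_left (m := 2) ((hp'.coprime_iff_not_dvd).2 hy)).symm
      have k1 : (p : ℤ) ∣ f.dx (x * u) 1 := by
        have : f.dx (x * u) 1 = u ^ 2 * f.dx x y
            + (p : ℤ) * (p * v * (2 * f.b * x * u + f.c * (1 + u * y))) := by
          simp only [dx]
          linear_combination -(2 * f.b * x * u + f.c * (1 + u * y)) * huv
        rw [this]; exact dvd_add (h2.mul_left _) (dvd_mul_right _ _)
      have k2 : (p : ℤ) ^ 2 ∣ f.eval (x * u) 1 := by
        have : f.eval (x * u) 1 = u ^ 3 * f.eval x y + (p : ℤ) ^ 2 * (v * (f.b * (x * u) ^ 2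
            + f.c * (x * u) * (1 + u * y) + f.d * (1 + u * y + (u * y) ^ 2))) := by
          simp only [eval]
          linear_combination -(f.b * (x * u) ^ 2
            + f.c * (x * u) * (1 + u * y) + f.d * (1 + u * y + (u * y) ^ 2)) * huv
        rw [this]; exact dvd_add (h1.mul_left _) (dvd_mul_right _ _)
      have hp0 : (p : ℤ) ≠ 0 := by exact_mod_cast hp.ne_zero
      have hpp : (0 : ℤ) < p := by exact_mod_cast hp.pos
      have hr0 := Int.emod_nonneg (x * u) hp0
      have hr1 := Int.emod_lt_of_pos (x * u) hpp
      refine ⟨⟨(x * u % p).toNat, by omega⟩, ?_⟩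
      simp only [Int.toNat_of_nonneg hr0]
      refine root_congr ?_ k1 k2
      exact ⟨-(x * u / p), by have := Int.emod_add_mul_ediv (x * u) p; linarith⟩
  · have h1p : ¬ (p : ℤ) ∣ 1 := hp'.not_dvd_one
    rintro (⟨x, h1, h2⟩ | ⟨h1, h2⟩)
    · refine Or.inr ⟨(x : ℕ), 1, fun h => h1p h.2, h2, h1, ?_⟩
      have h3 : f.dy (x : ℕ) 1 = 3 * f.eval (x : ℕ) 1 - (x : ℕ) * f.dx (x : ℕ) 1 := by
        simp only [dy, dx, eval]; ring
      rw [h3]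
      exact dvd_sub (((dvd_pow_self _ two_ne_zero).trans h2).mul_left _) (h1.mul_left _)
    · refine Or.inr ⟨1, 0, fun h => h1p h.1, ?_, ?_, ?_⟩
      · simpa [eval] using h1
      · simpa [dx] using ((dvd_pow_self _ two_ne_zero).trans h1).mul_left 3
      · simpa [dy] using h2

end BCF

namespace ResCond

/-- The conditions detecting non-maximality at `p`. -/
def primeCover (p : ℕ) : (Fin p ⊕ Unit) ⊕ (Fin p ⊕ Unit) ⊕ Unit → ResCond :=
  Sum.elim (Sum.elim (fun x => ofRoot 1 1 1 p (p ^ 2) (x : ℕ))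
    (fun _ => ofRoot 1 (p ^ 2) p 1 1 0))
  (Sum.elim (Sum.elim (fun x => ofRoot (-1) p p p (p ^ 2) (x : ℕ))
    (fun _ => ofRoot (-1) (p ^ 2) p p p 0)) (fun _ => ofRoot 1 p p p p 0))

open Classical in
theorem sum_primeCover (p : ℕ) (f : BCF) :
    ∑ i, (primeCover p i).sgn * (primeCover p i).ind f =
      ((∑ x : Fin p, if (p : ℤ) ∣ f.dx (x : ℕ) 1 ∧ (p : ℤ) ^ 2 ∣ f.eval (x : ℕ) 1 then (1 : ℝ)
          else 0) + (if (p : ℤ) ^ 2 ∣ f.a ∧ (p : ℤ) ∣ f.b then 1 else 0)) +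
      ((-(∑ x : Fin p, if (p : ℤ) ∣ f.a ∧ (p : ℤ) ∣ f.b ∧ (p : ℤ) ∣ f.dx (x : ℕ) 1 ∧
          (p : ℤ) ^ 2 ∣ f.eval (x : ℕ) 1 then (1 : ℝ) else 0)
        - (if (p : ℤ) ^ 2 ∣ f.a ∧ (p : ℤ) ∣ f.b ∧ (p : ℤ) ∣ f.c ∧ (p : ℤ) ∣ f.d then 1 else 0))
        + (if BCF.DvdAll p f then 1 else 0)) := by
  have e1 : f.dx 0 1 = f.c := by simp [BCF.dx]
  have e2 : f.eval 0 1 = f.d := by simp [BCF.eval]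
  have s1 : ∀ e A B C D x, (ofRoot e A B C D x).sgn = e := fun _ _ _ _ _ _ => rfl
  simp only [Fintype.sum_sum_type, primeCover, Sum.elim_inl, Sum.elim_inr, ind_ofRoot, s1,
    Finset.univ_unique, Finset.sum_singleton, e1, e2, Nat.cast_one, isUnit_one, IsUnit.dvd,
    true_and, and_true, one_mul, Nat.cast_pow, neg_mul, Finset.sum_neg_distrib, ← sub_eq_add_neg,
    BCF.DvdAll]
  congr!
  funext a b
  split_ifs with h
  · exact (if_pos h).symm
  · exact (if_neg h).symm

theorem covers_primeCover {p : ℕ} (hp : p.Prime) : Covers {p} (primeCover p) := by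
  classical
  have hp' : Prime (p : ℤ) := Nat.prime_iff_prime_int.1 hp
  have h2 : (2 : ℝ) ≤ p := by exact_mod_cast hp.two_le
  have hp0 : (0 : ℝ) < p := by linarith
  have hpos := hp.pos
  have sq : (p : ℤ) ∣ (p : ℤ) ^ 2 := dvd_pow_self _ two_ne_zero
  have key : ∀ f : BCF, ∑ i, (primeCover p i).sgn * (primeCover p i).ind f
      = if BCF.NonMax p f then 1 else 0 := by
    intro f
    rw [sum_primeCover]
    by_cases hf : BCF.DvdAll p f
    · have hN : BCF.NonMax p f := Or.inl hf
      obtain ⟨ha, hb, hc, hd⟩ := id hf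
      simp only [hf, hN, ha, hb, hc, hd, true_and, and_true, if_true]
      ring
    · have z3 : ∀ x : Fin p, ¬ ((p : ℤ) ∣ f.a ∧ (p : ℤ) ∣ f.b ∧ (p : ℤ) ∣ f.dx (x : ℕ) 1 ∧
          (p : ℤ) ^ 2 ∣ f.eval (x : ℕ) 1) := fun x h =>
        hf (BCF.root_infty h.1 h.2.1 h.2.2.1 (sq.trans h.2.2.2))
      have z4 : ¬ ((p : ℤ) ^ 2 ∣ f.a ∧ (p : ℤ) ∣ f.b ∧ (p : ℤ) ∣ f.c ∧ (p : ℤ) ∣ f.d) := fun h =>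
        hf ⟨sq.trans h.1, h.2⟩
      simp only [z3, z4, hf, if_false, Finset.sum_const_zero, neg_zero, sub_zero, add_zero]
      by_cases hN : BCF.NonMax p f
      · rw [if_pos hN]
        rcases (BCF.nonMax_iff_root hp hf).1 hN with ⟨x, hx⟩ | h
        · rw [if_neg fun h => hf (BCF.root_infty (sq.trans h.1) h.2 hx.1 (sq.trans hx.2)),
            Finset.sum_eq_single x, if_pos hx, add_zero]
          · intro y _ hy
            refine if_neg fun h => hy ?_
            have := BCF.root_unique hp' hf hx.1 (sq.trans hx.2) h.1 (sq.trans h.2)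
            obtain ⟨k, hk⟩ := this
            have l1 := x.2
            have l2 := y.2
            have : k = 0 := by
              by_contra hk0
              rcases lt_or_gt_of_ne hk0 with h | h
              · nlinarith
              · nlinarith
            rw [this] at hk
            exact Fin.ext (by omega)
          · simp
        · rw [if_pos h, Finset.sum_eq_zero, zero_add]
          intro x _
          exact if_neg fun hx => hf (BCF.root_infty (sq.trans h.1) h.2 hx.1 (sq.trans hx.2))
      · have := (BCF.nonMax_iff_root hp hf).not.1 hN
        push Not at this
        rw [if_neg hN, if_neg fun h => this.2 h.1 h.2, Finset.sum_eq_zero, add_zero]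
        exact fun x _ => if_neg fun h => this.1 x h.1 h.2
  refine ⟨?_, ?_, ?_, ?_, ?_, ?_, ?_, ?_, ?_, ?_⟩
  · have hq : ∀ q : ℕ, q.Prime → q ∣ p ^ 2 → q = p := fun q hq h =>
      (Nat.prime_dvd_prime_iff_eq hq hp).1 (hq.dvd_of_dvd_pow h)
    have hq' : ∀ q : ℕ, q.Prime → q ∣ p → q = p := fun q hq h =>
      (Nat.prime_dvd_prime_iff_eq hq hp).1 h
    have hq1 : ∀ q : ℕ, q.Prime → ¬ q ∣ 1 := fun q hq h => hq.one_lt.ne' (Nat.dvd_one.1 h)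
    rintro ((x | _) | (x | _) | _) <;>
    · refine ⟨?_, ?_⟩
      · simp only [primeCover, Sum.elim_inl, Sum.elim_inr, ofRoot]
        refine ⟨?_, ?_, ?_, ?_⟩ <;> positivity
      · intro q hqq
        have a1 := hq q hqq
        have a2 := hq' q hqq
        have a3 := hq1 q hqq
        simp only [primeCover, Sum.elim_inl, Sum.elim_inr, ofRoot, Finset.mem_singleton]
        tauto
  · rintro ((x | _) | (x | _) | _) <;> simp [primeCover, ofRoot]
  · intro f hf
    rw [key, if_pos (hf p (Finset.mem_singleton_self p))]
  · intro f hf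
    rw [key, if_neg]
    simpa using hf
  · simp [primeCover, ofRoot]
    field_simp
    ring
  · simp
    linarith
  all_goals
    simp only [Fintype.sum_sum_type, primeCover, Sum.elim_inl, Sum.elim_inr, ofRoot,
      Finset.univ_unique, Finset.sum_const, Finset.card_univ, Finset.card_singleton,
      Fintype.card_fin, nsmul_eq_mul, one_mul, Finset.prod_singleton, Nat.cast_one, Nat.cast_pow]
  · have : 1 / (p : ℝ) ≤ 1 := by rw [div_le_one hp0]; linarith
    have e : (p : ℝ) * (1 / p) = 1 := by field_simp
    linarith
  · have i1 : 1 / (p : ℝ) ≤ 1 := by rw [div_le_one hp0]; linarith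
    have i0 : 0 ≤ 1 / (p : ℝ) := by positivity
    have e : (p : ℝ) * (1 / p ^ 2) = 1 / p := by field_simp
    linarith
  · have i1 : 1 / (p : ℝ) ≤ 1 := by rw [div_le_one hp0]; linarith
    have i0 : 0 ≤ 1 / (p : ℝ) := by positivity
    set u := 1 / (p : ℝ) with hu
    have e : 5 / (p : ℝ) = 5 * u := by rw [hu]; ring
    have e1 : (p : ℝ) * (1 / (p * p ^ 2)) = u ^ 2 := by rw [hu]; field_simp
    have e2 : 1 / ((p : ℝ) ^ 2 * 1 * 1) = u ^ 2 := by rw [hu]; field_simp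
    have e3 : (p : ℝ) * (1 / (p * p * p ^ 2)) = u ^ 3 := by rw [hu]; field_simp
    have e4 : 1 / ((p : ℝ) ^ 2 * p * p) = u ^ 4 := by rw [hu]; field_simp
    have e5 : 1 / ((p : ℝ) * p * p) = u ^ 3 := by rw [hu]; field_simp
    rw [e, e1, e2, e3, e4, e5]
    have j2 : u ^ 2 ≤ u := pow_le_of_le_one i0 i1 two_ne_zero
    have j3 : u ^ 3 ≤ u := pow_le_of_le_one i0 i1 three_ne_zero
    have j4 : u ^ 4 ≤ u := pow_le_of_le_one i0 i1 four_ne_zero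
    linarith
  · have i1 : 1 / (p : ℝ) ≤ 1 := by rw [div_le_one hp0]; linarith
    have i0 : 0 ≤ 1 / (p : ℝ) := by positivity
    set u := 1 / (p : ℝ) with hu
    have e : 5 / (p : ℝ) = 5 * u := by rw [hu]; ring
    have e1 : (p : ℝ) * (1 / (p * p ^ 2)) = u ^ 2 := by rw [hu]; field_simp
    have e2 : 1 / ((p : ℝ) * 1 * 1) = u := by rw [hu]; field_simp
    have e3 : (p : ℝ) * (1 / (p * p * p ^ 2)) = u ^ 3 := by rw [hu]; field_simp
    have e5 : 1 / ((p : ℝ) * p * p) = u ^ 3 := by rw [hu]; field_simp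
    rw [e, e1, e2, e3, e5]
    have j2 : u ^ 2 ≤ u := pow_le_of_le_one i0 i1 two_ne_zero
    have j3 : u ^ 3 ≤ u := pow_le_of_le_one i0 i1 three_ne_zero
    linarith

theorem exists_covers (s : Finset ℕ) (hs : ∀ p ∈ s, p.Prime) :
    ∃ (ι : Type) (_ : Fintype ι) (τ : ι → ResCond), Covers s τ := by
  classical
  induction s using Finset.induction_on with
  | empty =>
    refine ⟨Unit, inferInstance, fun _ => ofRoot 1 1 1 1 1 0, ?_⟩
    have key : ∀ f : BCF, (ofRoot 1 1 1 1 1 0).ind f = 1 := fun f => by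
      rw [ind_ofRoot, if_pos]; simp
    refine ⟨fun _ => ⟨by simp [ofRoot], fun q hq h => ?_⟩, ?_, ?_, ?_, ?_, ?_, ?_, ?_, ?_, ?_⟩
    · simp [ofRoot, hq.ne_one] at h
    · simp [ofRoot]
    · intro f _; simp only [key]; simp [ofRoot]
    · intro f hf; exact (hf (by simp)).elim
    all_goals simp [ofRoot]
  | insert p s hps ih =>
    obtain ⟨ι, _, τ, hτ⟩ := ih fun q hq => hs q (Finset.mem_insert_of_mem hq)
    have := (covers_primeCover (hs p (Finset.mem_insert_self p s))).and
      (Finset.disjoint_singleton_left.2 hps) hτ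
    rw [← Finset.insert_eq] at this
    exact ⟨_, _, _, this⟩

end ResCond

namespace IsReg

variable {ε : ℤ} {R RC : ℝ → ℝ → ℝ → ℝ → Prop} {k α μ κ κ' : ℝ}

/-- The number of integral forms of bounded discriminant in the region that are not maximal at
the primes in `s`. -/
theorem exists_abs_card_nonMax_sub_le (h : IsReg ε R RC k α μ κ κ') : ∃ K : ℝ, 0 ≤ K ∧
    ∀ (l : ℝ) (F G : Finset BCF) (s : Finset ℕ), 1 ≤ l →
      (∀ f, f ∈ F ↔ f ∈ regForms ε R (l ^ 4)) → (∀ p ∈ s, p.Prime) →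
      (∀ f, f ∈ G ↔ f ∈ F ∧ ∀ p ∈ s, BCF.NonMax p f) →
      |(G.card : ℝ) - κ * Real.pi ^ 2 / (6 * κ') * l ^ 4
          * ∏ p ∈ s, (1 - (1 - 1 / (p : ℝ) ^ 2) * (1 - 1 / (p : ℝ) ^ 3))|
        ≤ K * (l ^ 3 * (3 + Real.log l) * (2 * ∏ _p ∈ s, (5 : ℝ)) + l ^ 2 * ∏ p ∈ s, (5 * (p : ℝ))
          + l ^ 3 * √l * (2 * ∏ p ∈ s, (5 / (p : ℝ)))) := by
  classical
  obtain ⟨K, hK, hb⟩ := h.exists_abs_sum_sub_le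
  refine ⟨K, hK, ?_⟩
  intro l F G s hl hF hs hG
  obtain ⟨ι, _, τ, hτ⟩ := ResCond.exists_covers s hs
  set v := κ * Real.pi ^ 2 / (6 * κ') with hv
  have hlog := Real.log_nonneg hl
  have hl0 : 0 < l := by linarith
  have e1 : (G.card : ℝ) = ∑ i, (τ i).sgn * ∑ f ∈ F, (τ i).ind f := by
    have hG' : G = F.filter fun f => ∀ p ∈ s, BCF.NonMax p f := by
      ext f; rw [hG, Finset.mem_filter]
    rw [hG', Finset.card_filter]
    push_cast
    simp only [Finset.mul_sum]
    rw [Finset.sum_comm]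
    refine Finset.sum_congr rfl fun f _ => ?_
    split_ifs with hf
    · exact (hτ.ind_of f hf).symm
    · exact (hτ.ind_of_not f hf).symm
  have e2 : v * l ^ 4 * ∏ p ∈ s, (1 - (1 - 1 / (p : ℝ) ^ 2) * (1 - 1 / (p : ℝ) ^ 3))
      = ∑ i, (τ i).sgn * (v * l ^ 4 / ((τ i).A * (τ i).B * (τ i).C * (τ i).D)) := by
    rw [← hτ.density, Finset.mul_sum]
    exact Finset.sum_congr rfl fun i _ => by ring
  rw [e1, e2, ← Finset.sum_sub_distrib]
  refine (Finset.abs_sum_le_sum_abs _ _).trans ?_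
  have e3 : ∀ i, |(τ i).sgn * ∑ f ∈ F, (τ i).ind f
      - (τ i).sgn * (v * l ^ 4 / ((τ i).A * (τ i).B * (τ i).C * (τ i).D))|
      ≤ K * (l ^ 3 * (3 + Real.log l) * (1 / (τ i).C + 1 / (τ i).D) + l ^ 2 * 1
          + l ^ 3 * √l * (1 / ((τ i).A * (τ i).C * (τ i).D)
            + 1 / ((τ i).B * (τ i).C * (τ i).D))) := by
    intro i
    rw [← mul_sub, abs_mul, hτ.abs_sgn, one_mul, mul_one]
    obtain ⟨⟨h1, h2, h3, h4⟩, -⟩ := hτ.on i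
    exact hb l F _ _ _ _ (τ i).rb (τ i).rc (τ i).rd hl hF h1 h2 h3 h4
  refine (Finset.sum_le_sum fun i _ => e3 i).trans ?_
  rw [← Finset.mul_sum, Finset.sum_add_distrib, Finset.sum_add_distrib, ← Finset.mul_sum,
    ← Finset.mul_sum, ← Finset.mul_sum, Finset.sum_add_distrib, Finset.sum_add_distrib]
  have a1 := hτ.sum_C
  have a2 := hτ.sum_D
  have a3 := hτ.sum_ACD
  have a4 := hτ.sum_BCD
  have a5 := hτ.card
  have b1 : 0 ≤ l ^ 3 * (3 + Real.log l) := by positivity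
  gcongr
  · linarith
  · linarith

end IsReg

/-- The nonzero integers of absolute value at most `N`. -/
noncomputable def nz (N : ℕ) : Finset ℤ := (Finset.Icc (-(N : ℤ)) N).erase 0

theorem mem_nz {N : ℕ} {n : ℤ} : n ∈ nz N ↔ n ≠ 0 ∧ |n| ≤ N := by
  rw [nz, Finset.mem_erase, Finset.mem_Icc, abs_le]

theorem mem_nz_floor {y : ℝ} {n : ℤ} (hn : n ≠ 0) (h : |(n : ℝ)| ≤ y) : n ∈ nz ⌊y⌋₊ := by
  refine mem_nz.2 ⟨hn, ?_⟩
  rw [Int.abs_eq_natAbs]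
  have : n.natAbs ≤ ⌊y⌋₊ := Nat.le_floor (by rwa [Nat.cast_natAbs, Int.cast_abs])
  exact_mod_cast this

theorem sum_nz (N : ℕ) (g : ℝ → ℝ) :
    ∑ n ∈ nz N, g |(n : ℝ)| = 2 * ∑ n ∈ Finset.Icc 1 N, g n := by
  classical
  have h := sum_resw_eq one_pos (N := N) (M := N)
    (g := fun n : ℤ => if n ∈ nz N then g |(n : ℝ)| else 0) (by simp [nz]) (fun a ha => by
      have : a ∈ nz N := by
        by_contra h
        simp [h] at ha
      have := (mem_nz.1 this).2
      exact ⟨this, by simpa using this⟩)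
  have e : ∀ n : ℤ, resw 1 0 n = 1 := fun n => by unfold resw; rw [if_pos]; simp
  simp only [e, one_mul] at h
  rw [← Finset.sum_filter] at h
  have e2 : (Finset.Icc (-(N : ℤ)) N).filter (fun n => n ∈ nz N) = nz N := by
    ext n; rw [Finset.mem_filter, mem_nz, Finset.mem_Icc, abs_le]; tauto
  rw [e2] at h
  rw [h, Finset.mul_sum]
  refine Finset.sum_congr rfl fun n hn => ?_
  rw [Finset.mem_Icc] at hn
  have k1 : ((1 : ℕ) * (n : ℤ)) ∈ nz N := mem_nz.2 ⟨by simp; omega, by simp; exact hn.2⟩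
  have k2 : -((1 : ℕ) * (n : ℤ)) ∈ nz N := mem_nz.2 ⟨by simp; omega, by simp; exact hn.2⟩
  rw [if_pos k1, if_pos k2]
  simp
  ring

theorem sum_inv_nz_le (N : ℕ) : ∑ n ∈ nz N, 1 / |(n : ℝ)| ≤ 2 * (1 + Real.log N) := by
  rw [sum_nz N fun x => 1 / x]
  have h1 : ∑ n ∈ Finset.Icc 1 N, 1 / (n : ℝ) = (harmonic N : ℝ) := by
    rw [harmonic_eq_sum_Icc]; push_cast; simp
  rw [h1]
  linarith [harmonic_le_one_add_log N]

theorem card_le_of_forall_abs_le {S : Finset ℤ} {y : ℝ} (h : ∀ n ∈ S, |(n : ℝ)| ≤ y)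
    (hy : 0 ≤ y) : (S.card : ℝ) ≤ 2 * y + 1 := by
  have hsub : S ⊆ insert 0 (nz ⌊y⌋₊) := by
    intro n hn
    rw [Finset.mem_insert]
    by_cases h0 : n = 0
    · exact Or.inl h0
    · exact Or.inr (mem_nz_floor h0 (h n hn))
  have h1 := (Finset.card_le_card hsub).trans (Finset.card_insert_le _ _)
  have h2 : ((nz ⌊y⌋₊).card : ℝ) = 2 * ⌊y⌋₊ := by
    have := sum_nz ⌊y⌋₊ fun _ => 1
    simpa using this
  have h3 := Nat.floor_le hy
  have h4 : (S.card : ℝ) ≤ (nz ⌊y⌋₊).card + 1 := by exact_mod_cast h1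
  linarith

theorem card_le_of_forall_abs_le' {S : Finset ℤ} {y : ℝ} (h : ∀ n ∈ S, n ≠ 0 ∧ |(n : ℝ)| ≤ y)
    (hy : 0 ≤ y) : (S.card : ℝ) ≤ 2 * y := by
  have hsub : S ⊆ nz ⌊y⌋₊ := fun n hn => mem_nz_floor (h n hn).1 (h n hn).2
  have h2 : ((nz ⌊y⌋₊).card : ℝ) = 2 * ⌊y⌋₊ := by
    have := sum_nz ⌊y⌋₊ fun _ => 1
    simpa using this
  have h3 := Nat.floor_le hy
  have h4 : (S.card : ℝ) ≤ (nz ⌊y⌋₊).card := by exact_mod_cast Finset.card_le_card hsub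
  linarith

/-- The number of quadruples of nonzero integers of bounded product. -/
theorem card_quadruples_le (N : ℕ) {S : Finset ((ℤ × ℤ × ℤ) × ℤ)}
    (hS : ∀ x ∈ S, x.1.1 ≠ 0 ∧ x.1.2.1 ≠ 0 ∧ x.1.2.2 ≠ 0 ∧ x.2 ≠ 0 ∧
      |x.1.1 * x.1.2.1 * x.1.2.2 * x.2| ≤ N) :
    (S.card : ℝ) ≤ 2 * N * (2 * (1 + Real.log N)) ^ 3 := by
  classical
  have h1 : ∀ x ∈ S, x.1 ∈ nz N ×ˢ nz N ×ˢ nz N := by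
    intro x hx
    obtain ⟨h1, h2, h3, h4, h5⟩ := hS x hx
    have a1 := Int.one_le_abs h1
    have a2 := Int.one_le_abs h2
    have a3 := Int.one_le_abs h3
    have a4 := Int.one_le_abs h4
    rw [abs_mul, abs_mul, abs_mul] at h5
    simp only [Finset.mem_product, mem_nz]
    have b1 := one_le_mul_of_one_le_of_one_le a1 a2
    have b2 := one_le_mul_of_one_le_of_one_le b1 a3
    have c1 := le_mul_of_one_le_right (by positivity : 0 ≤ |x.1.1| * |x.1.2.1| * |x.1.2.2|) a4
    have c2 := le_mul_of_one_le_right (by positivity : 0 ≤ |x.1.1| * |x.1.2.1|) a3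
    have c3 := le_mul_of_one_le_right (abs_nonneg x.1.1) a2
    have c4 := le_mul_of_one_le_left (abs_nonneg x.1.2.1) a1
    have c5 := le_mul_of_one_le_left (abs_nonneg x.1.2.2) b1
    exact ⟨⟨h1, by linarith⟩, ⟨h2, by linarith⟩, ⟨h3, by linarith⟩⟩
  rw [Finset.card_eq_sum_card_fiberwise h1]
  push_cast
  have h2 : ∀ y ∈ nz N ×ˢ nz N ×ˢ nz N, ((S.filter fun x => x.1 = y).card : ℝ) ≤
      2 * N * ((1 / |(y.1 : ℝ)|) * ((1 / |(y.2.1 : ℝ)|) * (1 / |(y.2.2 : ℝ)|))) := by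
    intro y hy
    simp only [Finset.mem_product, mem_nz] at hy
    obtain ⟨⟨h1, -⟩, ⟨h2, -⟩, ⟨h3, -⟩⟩ := hy
    have p1 : 0 < |(y.1 : ℝ)| := abs_pos.2 (by exact_mod_cast h1)
    have p2 : 0 < |(y.2.1 : ℝ)| := abs_pos.2 (by exact_mod_cast h2)
    have p3 : 0 < |(y.2.2 : ℝ)| := abs_pos.2 (by exact_mod_cast h3)
    have e : 2 * (N : ℝ) * ((1 / |(y.1 : ℝ)|) * ((1 / |(y.2.1 : ℝ)|) * (1 / |(y.2.2 : ℝ)|)))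
        = 2 * (N / (|(y.1 : ℝ)| * |(y.2.1 : ℝ)| * |(y.2.2 : ℝ)|)) := by
      field_simp
    have hinj : Set.InjOn (fun x : (ℤ × ℤ × ℤ) × ℤ => x.2)
        ((S.filter fun x => x.1 = y : Finset _) : Set ((ℤ × ℤ × ℤ) × ℤ)) := by
      intro x hx z hz hxz
      simp only [Finset.coe_filter, Set.mem_ofPred_eq] at hx hz
      exact Prod.ext (hx.2.trans hz.2.symm) hxz
    rw [e, ← Finset.card_image_of_injOn hinj]
    refine card_le_of_forall_abs_le' ?_ (by positivity)
    intro n hn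
    rw [Finset.mem_image] at hn
    obtain ⟨x, hx, rfl⟩ := hn
    rw [Finset.mem_filter] at hx
    obtain ⟨hxS, rfl⟩ := hx
    obtain ⟨-, -, -, h4, h5⟩ := hS x hxS
    refine ⟨h4, ?_⟩
    rw [le_div_iff₀ (by positivity)]
    have h5' : |(x.1.1 * x.1.2.1 * x.1.2.2 * x.2 : ℝ)| ≤ N := by exact_mod_cast h5
    rw [abs_mul, abs_mul, abs_mul] at h5'
    linarith
  refine (Finset.sum_le_sum h2).trans ?_
  rw [← Finset.mul_sum, Finset.sum_product]
  simp only [← Finset.mul_sum]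
  rw [Finset.sum_product]
  simp only [← Finset.mul_sum, ← Finset.sum_mul]
  have h3 := sum_inv_nz_le N
  have h4 : 0 ≤ ∑ n ∈ nz N, 1 / |(n : ℝ)| := by positivity
  have h5 : (∑ n ∈ nz N, 1 / |(n : ℝ)|) * ((∑ n ∈ nz N, 1 / |(n : ℝ)|) *
      (∑ n ∈ nz N, 1 / |(n : ℝ)|)) = (∑ n ∈ nz N, 1 / |(n : ℝ)|) ^ 3 := by ring
  rw [h5]
  gcongr

/-- The number of possible triples of first three coefficients. -/
theorem card_triples_le {l : ℝ} (hl : 1 ≤ l) {S : Finset (ℤ × ℤ × ℤ)}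
    (hS : ∀ x ∈ S, x.1 ≠ 0 ∧ |(x.1 : ℝ)| ≤ 2 * l ∧ |(x.2.1 : ℝ)| ≤ 10 * l ∧
      |(x.2.2 : ℝ)| ≤ 10 * l * √l / √|(x.1 : ℝ)|) :
    (S.card : ℝ) ≤ 3500 * l ^ 3 := by
  classical
  have hl0 : 0 < l := by linarith
  have h1 : ∀ x ∈ S, x.1 ∈ nz ⌊2 * l⌋₊ := fun x hx => mem_nz_floor (hS x hx).1 (hS x hx).2.1
  rw [Finset.card_eq_sum_card_fiberwise h1]
  push_cast
  have h2 : ∀ a ∈ nz ⌊2 * l⌋₊, ((S.filter fun x => x.1 = a).card : ℝ) ≤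
      21 * l * (20 * l * √l * (1 / √|(a : ℝ)|) + 1) := by
    intro a ha
    set T := S.filter fun x => x.1 = a with hT
    have hmem : ∀ x ∈ T, x.2 ∈ (T.image fun x => x.2.1) ×ˢ (T.image fun x => x.2.2) := by
      intro x hx
      exact Finset.mem_product.2 ⟨Finset.mem_image_of_mem _ hx, Finset.mem_image_of_mem _ hx⟩
    have hcard : T.card ≤ (T.image fun x => x.2.1).card * (T.image fun x => x.2.2).card := by
      rw [← Finset.card_product]
      refine Finset.card_le_card_of_injOn (fun x => x.2) hmem ?_
      intro x hx z hz hxz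
      rw [Finset.mem_coe, hT, Finset.mem_filter] at hx hz
      exact Prod.ext (hx.2.trans hz.2.symm) hxz
    have k1 : ((T.image fun x => x.2.1).card : ℝ) ≤ 2 * (10 * l) + 1 := by
      refine card_le_of_forall_abs_le ?_ (by positivity)
      intro n hn
      obtain ⟨x, hx, rfl⟩ := Finset.mem_image.1 hn
      exact (hS x (Finset.mem_filter.1 hx).1).2.2.1
    have k2 : ((T.image fun x => x.2.2).card : ℝ) ≤ 2 * (10 * l * √l / √|(a : ℝ)|) + 1 := by
      refine card_le_of_forall_abs_le ?_ (by positivity)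
      intro n hn
      obtain ⟨x, hx, rfl⟩ := Finset.mem_image.1 hn
      obtain ⟨hxS, rfl⟩ := Finset.mem_filter.1 hx
      exact (hS x hxS).2.2.2
    calc (T.card : ℝ) ≤ (T.image fun x => x.2.1).card * (T.image fun x => x.2.2).card := by
          exact_mod_cast hcard
      _ ≤ (2 * (10 * l) + 1) * (2 * (10 * l * √l / √|(a : ℝ)|) + 1) := by gcongr
      _ ≤ (21 * l) * (2 * (10 * l * √l / √|(a : ℝ)|) + 1) := by gcongr; linarith
      _ = _ := by ring
  refine (Finset.sum_le_sum h2).trans ?_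
  rw [← Finset.mul_sum, Finset.sum_add_distrib, ← Finset.mul_sum, sum_nz _ fun x => 1 / √x,
    sum_nz _ fun _ => (1 : ℝ)]
  have k3 := sum_inv_sqrt_le ⌊2 * l⌋₊
  have k4 : (⌊2 * l⌋₊ : ℝ) ≤ 2 * l := Nat.floor_le (by positivity)
  have k5 : √(⌊2 * l⌋₊ : ℝ) ≤ 2 * √l := by
    rw [Real.sqrt_le_left (by positivity), mul_pow, Real.sq_sqrt hl0.le]
    linarith
  have k6 : √l * √l = l := Real.mul_self_sqrt hl0.le
  simp only [Finset.sum_const, Nat.card_Icc, nsmul_eq_mul, mul_one, Nat.add_sub_cancel]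
  have k7 : 20 * l * √l * (2 * ∑ n ∈ Finset.Icc 1 ⌊2 * l⌋₊, 1 / √(n : ℝ)) ≤ 80 * 2 * l ^ 2 := by
    calc _ ≤ 20 * l * √l * (2 * (2 * (2 * √l))) := by gcongr; linarith
      _ = 80 * 2 * l * (√l * √l) := by ring
      _ = 80 * 2 * l ^ 2 := by rw [k6]; ring
  have hl2 : l ≤ l ^ 2 := by nlinarith
  calc _ ≤ 21 * l * (80 * 2 * l ^ 2 + 2 * (2 * l)) := by gcongr
    _ ≤ 21 * l * (80 * 2 * l ^ 2 + 2 * (2 * l ^ 2)) := by gcongr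
    _ = 3444 * l ^ 3 := by ring
    _ ≤ 3500 * l ^ 3 := by gcongr; norm_num

theorem BCF.exists_factor {f : BCF} (ha : f.a ≠ 0) (hd : f.d ≠ 0) (h : ¬ f.Irr) :
    ∃ s α r δ : ℤ, f.a = s * α ∧ f.d = r * δ ∧ f.eval r s = 0 ∧ s ≠ 0 ∧ r ≠ 0 := by
  simp only [BCF.Irr, not_forall] at h
  obtain ⟨x, y, hxy, h0⟩ := h
  have hg : Int.gcd x y ≠ 0 := fun h => h0 (Int.gcd_eq_zero_iff.1 h)
  obtain ⟨r, s, hrs, hx, hy⟩ := Int.exists_gcd_one (Nat.pos_of_ne_zero hg)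
  obtain ⟨g, hgd⟩ : ∃ g : ℤ, g = (Int.gcd x y : ℤ) := ⟨_, rfl⟩
  rw [← hgd] at hx hy
  have hg' : g ≠ 0 := by rw [hgd]; exact_mod_cast hg
  have he : f.eval r s = 0 := by
    have e : f.eval x y = g ^ 3 * f.eval r s := by
      rw [hx, hy]; simp only [BCF.eval]; ring
    rw [e] at hxy
    exact (mul_eq_zero.1 hxy).resolve_left (pow_ne_zero _ hg')
  have hco : IsCoprime r s := Int.isCoprime_iff_gcd_eq_one.2 hrs
  have hsa : s ∣ f.a := by
    have : s ∣ f.a * r ^ 3 := by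
      refine ⟨-(f.b * r ^ 2 + f.c * r * s + f.d * s ^ 2), ?_⟩
      simp only [BCF.eval] at he
      linear_combination he
    exact (IsCoprime.pow_right hco.symm).dvd_of_dvd_mul_right this
  have hrd : r ∣ f.d := by
    have : r ∣ f.d * s ^ 3 := by
      refine ⟨-(f.c * s ^ 2 + f.b * r * s + f.a * r ^ 2), ?_⟩
      simp only [BCF.eval] at he
      linear_combination he
    exact (IsCoprime.pow_right hco).dvd_of_dvd_mul_right this
  obtain ⟨α, hα⟩ := hsa
  obtain ⟨δ, hδ⟩ := hrd
  refine ⟨s, α, r, δ, hα, hδ, he, ?_, ?_⟩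
  · rintro rfl; exact ha (by rw [hα, zero_mul])
  · rintro rfl; exact hd (by rw [hδ, zero_mul])

theorem log_le_six_mul {l : ℝ} (hl : 1 ≤ l) :
    ∃ u : ℝ, 1 ≤ u ∧ u ^ 3 = √l ∧ Real.log l ≤ 6 * u := by
  have hl0 : 0 < l := by linarith
  refine ⟨l ^ (1 / 6 : ℝ), Real.one_le_rpow hl (by norm_num), ?_, ?_⟩
  · rw [← Real.rpow_natCast, ← Real.rpow_mul hl0.le, Real.sqrt_eq_rpow]; norm_num
  · have := Real.log_le_rpow_div hl0.le (ε := 1 / 6) (by norm_num)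
    linarith

namespace IsReg

variable {ε : ℤ} {R RC : ℝ → ℝ → ℝ → ℝ → Prop} {k α μ κ κ' : ℝ}

theorem closed_mem_box (h : IsReg ε R RC k α μ κ κ') {l : ℝ} (hl : 1 ≤ l) {f : BCF}
    (hf : f ∈ regForms ε RC (l ^ 4)) : f.a ≠ 0 ∧ |(f.a : ℝ)| ≤ 2 * l ∧ |(f.b : ℝ)| ≤ 10 * l ∧
      |(f.c : ℝ)| ≤ 10 * l * √l / √|(f.a : ℝ)| ∧ |(f.a * f.d : ℝ)| ≤ 10 * l ^ 2 ∧
      |(f.d : ℝ)| ≤ 10 * l ^ 2 / |(f.a : ℝ)| := by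
  obtain ⟨h0, hR, h1, h2⟩ := mem_regForms_iff.1 hf
  have hl0 : 0 < l := by linarith
  have ha1 : (1 : ℝ) ≤ |(f.a : ℝ)| := by exact_mod_cast Int.one_le_abs h0
  obtain ⟨b1, -, -, b4⟩ := h.bounds (by exact_mod_cast h0) hl0 hR h1 h2
  obtain ⟨c1, c2, c3⟩ := h.box ha1 hl0 hR h1 h2
  exact ⟨h0, b1, c3, c2, b4, c1⟩

theorem finite_regForms (h : IsReg ε R RC k α μ κ κ') {l : ℝ} (hl : 1 ≤ l) :
    (regForms ε RC (l ^ 4)).Finite := by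
  classical
  have hl0 : 0 < l := by linarith
  set N := ⌊10 * l ^ 2⌋₊
  set I := insert 0 (nz N) with hI
  have hmem : ∀ n : ℤ, |(n : ℝ)| ≤ 10 * l ^ 2 → n ∈ I := by
    intro n hn
    rw [hI, Finset.mem_insert]
    by_cases h0 : n = 0
    · exact Or.inl h0
    · exact Or.inr (mem_nz_floor h0 hn)
  refine Set.Finite.subset (Finset.finite_toSet ((I ×ˢ I ×ˢ I ×ˢ I).image fun x : ℤ × ℤ × ℤ × ℤ =>
    (⟨x.1, x.2.1, x.2.2.1, x.2.2.2⟩ : BCF))) ?_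
  intro f hf
  obtain ⟨h0, h1, h2, h3, -, h5⟩ := h.closed_mem_box hl hf
  have ha1 : (1 : ℝ) ≤ |(f.a : ℝ)| := by exact_mod_cast Int.one_le_abs h0
  have hs1 : 1 ≤ √|(f.a : ℝ)| := Real.one_le_sqrt.2 ha1
  have hsl : √l ≤ l := Real.sqrt_le_iff.2 ⟨hl0.le, by nlinarith⟩
  rw [Finset.coe_image, Set.mem_image]
  refine ⟨(f.a, f.b, f.c, f.d), ?_, rfl⟩
  simp only [Finset.coe_product, Set.mem_prod, Finset.mem_coe]
  refine ⟨hmem _ (by nlinarith), hmem _ (by nlinarith), hmem _ ?_, hmem _ ?_⟩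
  · refine h3.trans ((div_le_self (by positivity) hs1).trans ?_)
    have := mul_le_mul_of_nonneg_left hsl (by positivity : 0 ≤ 10 * l)
    linarith
  · exact h5.trans (div_le_self (by positivity) ha1)

/-- There are few reducible forms with nonzero leading coefficient. -/
theorem card_reducible_le (h : IsReg ε R RC k α μ κ κ') {l : ℝ} (hl : 1 ≤ l) {G : Finset BCF}
    (hG : ∀ f ∈ G, f ∈ regForms ε RC (l ^ 4) ∧ ¬ f.Irr) :
    (G.card : ℝ) ≤ 20000000 * (l ^ 3 * √l) := by
  classical
  have hl0 : 0 < l := by linarith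
  have hs1 : 1 ≤ √l := Real.one_le_sqrt.2 hl
  have h0 : ((G.filter fun f => f.d = 0).card : ℝ) ≤ 3500 * l ^ 3 := by
    have hinj : Set.InjOn (fun f : BCF => (f.a, f.b, f.c))
        ((G.filter fun f => f.d = 0 : Finset BCF) : Set BCF) := by
      intro f hf g hg hfg
      rw [Finset.mem_coe, Finset.mem_filter] at hf hg
      simp only [Prod.mk.injEq] at hfg
      exact BCF.ext hfg.1 hfg.2.1 hfg.2.2 (hf.2.trans hg.2.symm)
    rw [← Finset.card_image_of_injOn hinj]
    refine card_triples_le hl fun x hx => ?_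
    obtain ⟨f, hf, rfl⟩ := Finset.mem_image.1 hx
    obtain ⟨b0, b1, b2, b3, -⟩ := h.closed_mem_box hl (hG f (Finset.mem_filter.1 hf).1).1
    exact ⟨b0, b1, b2, b3⟩
  have hex : ∀ f : BCF, f.a ≠ 0 ∧ f.d ≠ 0 ∧ ¬ f.Irr → ∃ t : (ℤ × ℤ × ℤ) × ℤ,
      f.a = t.1.1 * t.1.2.1 ∧ f.d = t.1.2.2 * t.2 ∧ f.eval t.1.2.2 t.1.1 = 0 ∧ t.1.1 ≠ 0 ∧
        t.1.2.2 ≠ 0 := by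
    rintro f ⟨h1, h2, h3⟩
    obtain ⟨s, α, r, δ, hh⟩ := BCF.exists_factor h1 h2 h3
    exact ⟨((s, α, r), δ), hh⟩
  choose! t ht using hex
  set H := G.filter fun f => ¬ f.d = 0 with hH
  have hHm : ∀ f ∈ H, f ∈ regForms ε RC (l ^ 4) ∧ f.a ≠ 0 ∧ f.d ≠ 0 ∧ ¬ f.Irr := by
    intro f hf
    obtain ⟨h1, h2⟩ := Finset.mem_filter.1 hf
    obtain ⟨h3, h4⟩ := hG f h1
    exact ⟨h3, h3.1, h2, h4⟩
  have hcard : H.card ≤ (H.image fun f => f.b).card * (H.image t).card := by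
    rw [← Finset.card_product]
    refine Finset.card_le_card_of_injOn (fun f => (f.b, t f)) (fun f hf => ?_) ?_
    · exact Finset.mem_product.2 ⟨Finset.mem_image_of_mem _ hf, Finset.mem_image_of_mem _ hf⟩
    · intro f hf g hg hfg
      simp only [Prod.mk.injEq] at hfg
      obtain ⟨f1, f2, f3, f4, f5⟩ := ht f (hHm f hf).2
      obtain ⟨g1, g2, g3, g4, g5⟩ := ht g (hHm g hg).2
      rw [← hfg.2] at g1 g2 g3
      have ea := f1.trans g1.symm
      have ed := f2.trans g2.symm
      refine BCF.ext ea hfg.1 ?_ ed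
      simp only [BCF.eval] at f3 g3
      have : (f.c - g.c) * ((t f).1.2.2 * (t f).1.1 ^ 2) = 0 := by
        rw [ea, hfg.1, ed] at f3
        linear_combination f3 - g3
      have := (mul_eq_zero.1 this).resolve_right (mul_ne_zero f5 (pow_ne_zero _ f4))
      linarith
  have k1 : ((H.image fun f => f.b).card : ℝ) ≤ 2 * (10 * l) + 1 := by
    refine card_le_of_forall_abs_le ?_ (by positivity)
    intro n hn
    obtain ⟨f, hf, rfl⟩ := Finset.mem_image.1 hn
    exact (h.closed_mem_box hl (hHm f hf).1).2.2.1
  set N := ⌊10 * l ^ 2⌋₊ with hN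
  have hN1 : (N : ℝ) ≤ 10 * l ^ 2 := Nat.floor_le (by positivity)
  have hN0 : (1 : ℝ) ≤ N := by
    have : 1 ≤ N := Nat.le_floor (by push_cast; nlinarith)
    exact_mod_cast this
  have k2 : ((H.image t).card : ℝ) ≤ 2 * N * (2 * (1 + Real.log N)) ^ 3 := by
    refine card_quadruples_le N fun x hx => ?_
    obtain ⟨f, hf, rfl⟩ := Finset.mem_image.1 hx
    obtain ⟨f1, f2, f3, f4, f5⟩ := ht f (hHm f hf).2
    refine ⟨f4, fun h0 => ?_, f5, fun h0 => ?_, ?_⟩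
    · exact (hHm f hf).2.1 (by rw [f1, h0, mul_zero])
    · exact (hHm f hf).2.2.1 (by rw [f2, h0, mul_zero])
    · have e : (t f).1.1 * (t f).1.2.1 * (t f).1.2.2 * (t f).2 = f.a * f.d := by
        rw [f1, f2]; ring
      rw [e]
      have b := (h.closed_mem_box hl (hHm f hf).1).2.2.2.2.1
      rw [Int.abs_eq_natAbs]
      have : (f.a * f.d).natAbs ≤ N := Nat.le_floor (by
        rw [Nat.cast_natAbs, Int.cast_abs]; push_cast; exact b)
      exact_mod_cast this
  obtain ⟨u, hu1, hu3, hul⟩ := log_le_six_mul hl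
  have hlogN : Real.log N ≤ 3 + 2 * Real.log l := by
    have h1 : Real.log N ≤ Real.log (10 * l ^ 2) := Real.log_le_log (by linarith) hN1
    rw [Real.log_mul (by norm_num) (by positivity), Real.log_pow] at h1
    have h2 : Real.log 10 ≤ 3 := by
      rw [Real.log_le_iff_le_exp (by norm_num)]
      have := Real.add_one_le_exp (1 : ℝ)
      have e : Real.exp 3 = Real.exp 1 ^ 3 := by rw [← Real.exp_nat_mul]; norm_num
      have h27 := Real.exp_one_gt_d9
      rw [e]
      calc (10 : ℝ) ≤ 2.7 ^ 3 := by norm_num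
        _ ≤ _ := by gcongr; linarith
    push_cast at h1
    linarith
  have hlN0 := Real.log_nonneg hN0
  have hu : 2 * (1 + Real.log N) ≤ 32 * u := by linarith
  have k3 : (H.card : ℝ) ≤ 420 * 32768 * (l ^ 3 * √l) := by
    calc (H.card : ℝ) ≤ (H.image fun f => f.b).card * (H.image t).card := by exact_mod_cast hcard
      _ ≤ (2 * (10 * l) + 1) * (2 * N * (2 * (1 + Real.log N)) ^ 3) := by gcongr
      _ ≤ (21 * l) * (2 * (10 * l ^ 2) * (32 * u) ^ 3) := by
          gcongr
          linarith
      _ = 420 * 32768 * (l ^ 3 * u ^ 3) := by ring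
      _ = _ := by rw [hu3]
  have k4 : (G.card : ℝ) = (G.filter fun f => f.d = 0).card + H.card := by
    rw [hH]
    exact_mod_cast (Finset.card_filter_add_card_filter_not (s := G) fun f => f.d = 0).symm
  have k5 : l ^ 3 * 1 ≤ l ^ 3 * √l := by gcongr
  have k6 : 0 ≤ l ^ 3 * √l := by positivity
  rw [k4]
  linarith

end IsReg

namespace IsReg

variable {ε : ℤ} {R RC : ℝ → ℝ → ℝ → ℝ → Prop} {k α μ κ κ' : ℝ}

theorem card_boundary_le (h : IsReg ε R RC k α μ κ κ') {l : ℝ} (hl : 1 ≤ l) {G : Finset BCF}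
    (hG : ∀ f ∈ G, f ∈ regForms ε RC (l ^ 4) ∧ ¬ R f.a f.b f.c f.d) :
    (G.card : ℝ) ≤ 15000 * l ^ 3 := by
  classical
  have hl0 : 0 < l := by linarith
  set P : BCF → Prop := fun f => f.b ≠ 0 ∨ (f.c ≠ 0 ∧ f.c ≠ -3 * f.a) with hP
  have h1 : ((G.filter P).card : ℝ) ≤ 4 * (3500 * l ^ 3) := by
    set t : BCF → ℤ × ℤ × ℤ := fun f => (f.a, f.b, f.c) with ht
    have hcard : (G.filter P).card ≤ 4 * ((G.filter P).image t).card := by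
      refine Finset.card_le_mul_card_image _ _ fun x hx => ?_
      obtain ⟨g, hg, rfl⟩ := Finset.mem_image.1 hx
      obtain ⟨hgG, hgP⟩ := Finset.mem_filter.1 hg
      obtain ⟨Z, hZ, hZm⟩ := h.boundary g.a g.b g.c (hG g hgG).1.1 hgP
      refine le_trans (Finset.card_le_card_of_injOn (fun f => f.d) (fun f hf => ?_) ?_) hZ
      · rw [Finset.mem_coe, Finset.mem_filter] at hf
        obtain ⟨hf1, hf2⟩ := hf
        simp only [ht, Prod.mk.injEq] at hf2
        obtain ⟨k1, k2⟩ := hG f (Finset.mem_filter.1 hf1).1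
        have k3 := k1.2.1
        rw [hf2.1, hf2.2.1, hf2.2.2] at k2 k3
        exact hZm _ k3 k2
      · intro f hf f' hf' hd
        rw [Finset.mem_coe, Finset.mem_filter] at hf hf'
        have e := hf.2.trans hf'.2.symm
        simp only [ht, Prod.mk.injEq] at e
        exact BCF.ext e.1 e.2.1 e.2.2 hd
    have := card_triples_le hl (S := (G.filter P).image t) fun x hx => by
      obtain ⟨f, hf, rfl⟩ := Finset.mem_image.1 hx
      obtain ⟨b0, b1, b2, b3, -⟩ := h.closed_mem_box hl (hG f (Finset.mem_filter.1 hf).1).1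
      exact ⟨b0, b1, b2, b3⟩
    calc ((G.filter P).card : ℝ) ≤ 4 * ((G.filter P).image t).card := by exact_mod_cast hcard
      _ ≤ _ := by gcongr
  have h2 : ((G.filter fun f => ¬ P f).card : ℝ) ≤ 2 * ((2 * (2 * l)) * (21 * l ^ 2)) := by
    set H := G.filter fun f => ¬ P f with hH
    have hHG : ∀ f ∈ H, f ∈ G ∧ f.b = 0 ∧ (f.c = 0 ∨ f.c = -3 * f.a) := by
      intro f hf
      obtain ⟨h1, h2⟩ := Finset.mem_filter.1 hf
      refine ⟨h1, ?_⟩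
      simp only [hP] at h2
      tauto
    have hcard : H.card ≤ 2 * (H.image fun f => (f.a, f.d)).card := by
      refine Finset.card_le_mul_card_image _ _ fun x hx => ?_
      obtain ⟨g, hg, rfl⟩ := Finset.mem_image.1 hx
      refine le_trans (Finset.card_le_card (t := {⟨g.a, 0, 0, g.d⟩, ⟨g.a, 0, -3 * g.a, g.d⟩})
        fun f hf => ?_) Finset.card_le_two
      obtain ⟨hf1, hf2⟩ := Finset.mem_filter.1 hf
      simp only [Prod.mk.injEq] at hf2
      obtain ⟨-, hb, hc⟩ := hHG f hf1
      rw [Finset.mem_insert, Finset.mem_singleton]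
      rcases hc with hc | hc
      · exact Or.inl (BCF.ext hf2.1 hb hc hf2.2)
      · exact Or.inr (BCF.ext hf2.1 hb (by rw [hc, hf2.1]) hf2.2)
    have hcard2 : (H.image fun f => (f.a, f.d)).card ≤
        (H.image fun f => f.a).card * (H.image fun f => f.d).card := by
      rw [← Finset.card_product]
      refine Finset.card_le_card fun x hx => ?_
      obtain ⟨f, hf, rfl⟩ := Finset.mem_image.1 hx
      exact Finset.mem_product.2 ⟨Finset.mem_image_of_mem _ hf, Finset.mem_image_of_mem _ hf⟩
    have k1 : ((H.image fun f => f.a).card : ℝ) ≤ 2 * (2 * l) := by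
      refine card_le_of_forall_abs_le' (fun n hn => ?_) (by positivity)
      obtain ⟨f, hf, rfl⟩ := Finset.mem_image.1 hn
      obtain ⟨b0, b1, -⟩ := h.closed_mem_box hl (hG f (hHG f hf).1).1
      exact ⟨b0, b1⟩
    have k2 : ((H.image fun f => f.d).card : ℝ) ≤ 2 * (10 * l ^ 2) + 1 := by
      refine card_le_of_forall_abs_le (fun n hn => ?_) (by positivity)
      obtain ⟨f, hf, rfl⟩ := Finset.mem_image.1 hn
      obtain ⟨b0, -, -, -, -, b5⟩ := h.closed_mem_box hl (hG f (hHG f hf).1).1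
      exact b5.trans (div_le_self (by positivity) (by exact_mod_cast Int.one_le_abs b0))
    calc (H.card : ℝ) ≤ 2 * (H.image fun f => (f.a, f.d)).card := by exact_mod_cast hcard
      _ ≤ 2 * ((H.image fun f => f.a).card * (H.image fun f => f.d).card) := by
          gcongr; exact_mod_cast hcard2
      _ ≤ 2 * ((2 * (2 * l)) * (2 * (10 * l ^ 2) + 1)) := by gcongr
      _ ≤ _ := by gcongr; nlinarith
  have h3 : (G.card : ℝ) = (G.filter P).card + (G.filter fun f => ¬ P f).card := by
    exact_mod_cast (Finset.card_filter_add_card_filter_not (s := G) P).symm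
  have h4 : 0 ≤ l ^ 3 := by positivity
  rw [h3]
  nlinarith

theorem regForms_subset (h : IsReg ε R RC k α μ κ κ') (X : ℝ) :
    regForms ε R X ⊆ regForms ε RC X := fun _ hf =>
  ⟨hf.1, h.closed _ _ _ _ hf.2.1, hf.2.2⟩

/-- A crude upper bound for the number of reduced forms. -/
theorem exists_ncard_regForms_le (h : IsReg ε R RC k α μ κ κ') : ∃ C : ℝ, 0 ≤ C ∧ ∀ l : ℝ, 1 ≤ l →
    ((regForms ε RC (l ^ 4)).ncard : ℝ) ≤ C * l ^ 4 := by
  classical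
  obtain ⟨K, hK, hb⟩ := h.exists_abs_card_nonMax_sub_le
  refine ⟨|κ * Real.pi ^ 2 / (6 * κ')| + 11 * K + 15000, by positivity, fun l hl => ?_⟩
  have hl0 : 0 < l := by linarith
  have hfin := h.finite_regForms hl
  have hfinR := hfin.subset (h.regForms_subset _)
  have h1 := hb l hfinR.toFinset hfinR.toFinset ∅ hl (by simp) (by simp) (by simp)
  simp only [Finset.prod_empty, mul_one] at h1
  have h2 : (((hfin.toFinset.filter fun f => ¬ R f.a f.b f.c f.d).card : ℕ) : ℝ) ≤
      15000 * l ^ 3 := h.card_boundary_le hl fun f hf => by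
    obtain ⟨k1, k2⟩ := Finset.mem_filter.1 hf
    exact ⟨hfin.mem_toFinset.1 k1, k2⟩
  have h3 : (regForms ε RC (l ^ 4)).ncard ≤ hfinR.toFinset.card
      + (hfin.toFinset.filter fun f => ¬ R f.a f.b f.c f.d).card := by
    rw [Set.ncard_eq_toFinset_card _ hfin]
    refine (Finset.card_le_card fun f hf => ?_).trans (Finset.card_union_le _ _)
    rw [Finset.mem_union, Finset.mem_filter, hfinR.mem_toFinset]
    by_cases hR : R f.a f.b f.c f.d
    · have := hfin.mem_toFinset.1 hf
      exact Or.inl ⟨this.1, hR, this.2.2⟩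
    · exact Or.inr ⟨hf, hR⟩
  have h3' : ((regForms ε RC (l ^ 4)).ncard : ℝ) ≤ hfinR.toFinset.card
      + (hfin.toFinset.filter fun f => ¬ R f.a f.b f.c f.d).card := by exact_mod_cast h3
  have hlog : Real.log l ≤ l - 1 := Real.log_le_sub_one_of_pos hl0
  have hlog0 := Real.log_nonneg hl
  have hsl : √l ≤ l := Real.sqrt_le_iff.2 ⟨hl0.le, by nlinarith⟩
  have e1 : l ^ 3 * (3 + Real.log l) * 2 + l ^ 2 + l ^ 3 * √l * 2 ≤ 11 * l ^ 4 := by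
    have i1 : l ^ 3 * (3 + Real.log l) * 2 ≤ l ^ 3 * (4 * l) * 2 := by gcongr; linarith
    have i2 : l ^ 2 * 1 ≤ l ^ 2 * l ^ 2 := by gcongr; nlinarith
    have i3 : l ^ 3 * √l * 2 ≤ l ^ 3 * l * 2 := by gcongr
    nlinarith
  have e2 := mul_le_mul_of_nonneg_left e1 hK
  have e3 := (abs_le.1 h1).2
  have e4 : κ * Real.pi ^ 2 / (6 * κ') * l ^ 4 ≤ |κ * Real.pi ^ 2 / (6 * κ')| * l ^ 4 := by
    gcongr; exact le_abs_self _
  have e5 : l ^ 3 * 1 ≤ l ^ 3 * l := by gcongr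
  nlinarith

theorem cls_fam_subset (h : IsReg ε R RC k α μ κ κ') (X : ℝ) :
    BCF.cls '' BCF.Fam ε ∅ X ⊆ BCF.cls '' regForms ε RC X := by
  rintro _ ⟨f, hf, rfl⟩
  obtain ⟨g, hfg, hg⟩ := h.exists_equiv f hf.1 hf.2.1
  refine ⟨g, ⟨(hfg.irr hf.1).a_ne, hg, ?_, ?_⟩, (BCF.cls_eq.2 hfg).symm⟩
  · rw [hfg.disc_eq]; exact hf.2.1
  · rw [hfg.disc_eq]; exact hf.2.2.1

/-- The number of classes of irreducible forms is at most proportional to the discriminant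
bound. -/
theorem exists_ncard_cls_fam_le (h : IsReg ε R RC k α μ κ κ') : ∃ C : ℝ, ∀ X : ℝ, 0 < X →
    (BCF.cls '' BCF.Fam ε ∅ X).Finite ∧ ((BCF.cls '' BCF.Fam ε ∅ X).ncard : ℝ) ≤ C * X := by
  obtain ⟨C, hC0, hC⟩ := h.exists_ncard_regForms_le
  refine ⟨C, fun X hX => ?_⟩
  rcases lt_or_ge X 1 with h1 | h1
  · have : BCF.Fam ε ∅ X = ∅ := by
      rw [Set.eq_empty_iff_forall_notMem]
      rintro f ⟨-, h2, h3, -⟩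
      have : (1 : ℝ) ≤ ((ε * f.disc : ℤ) : ℝ) := by exact_mod_cast h2
      linarith
    rw [this]
    simp
    positivity
  · set l := X ^ (1 / 4 : ℝ) with hl
    have hl1 : 1 ≤ l := Real.one_le_rpow h1 (by norm_num)
    have hlX : l ^ 4 = X := by
      rw [hl, ← Real.rpow_natCast, ← Real.rpow_mul hX.le]; norm_num
    have hfin := h.finite_regForms hl1
    rw [hlX] at hfin
    have hsub := h.cls_fam_subset X
    have hfi := hfin.image BCF.cls
    refine ⟨hfi.subset hsub, ?_⟩
    have := hC l hl1
    rw [hlX] at this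
    refine le_trans ?_ this
    exact_mod_cast (Set.ncard_le_ncard hsub hfi).trans (Set.ncard_image_le hfin)

end IsReg

namespace BCF

/-- The form composed with `diag (-1, -1)`. -/
def neg (f : BCF) : BCF := ⟨-f.a, -f.b, -f.c, -f.d⟩

/-- The form composed with `diag (1, -1)`. -/
def flipSign (f : BCF) : BCF := ⟨f.a, -f.b, f.c, -f.d⟩

theorem equiv_neg (f : BCF) : f.Equiv f.neg :=
  ⟨-1, 0, 0, -1, by norm_num, by simp only [comp, neg]; ext <;> ring⟩

theorem equiv_flipSign (f : BCF) : f.Equiv f.flipSign :=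
  ⟨1, 0, 0, -1, by norm_num, by simp only [comp, flipSign]; ext <;> ring⟩

open Classical in
/-- The forms obtained by changing signs of the variables. -/
noncomputable def signs (f : BCF) : Finset BCF := {f, f.neg, f.flipSign, f.flipSign.neg}

theorem card_signs_le (f : BCF) : f.signs.card ≤ 4 := by
  classical exact Finset.card_le_four

theorem card_signs {f : BCF} (ha : f.a ≠ 0) (hd : f.d ≠ 0) : f.signs.card = 4 := by
  classical
  have h1 : ∀ g h : BCF, g.a ≠ h.a ∨ g.d ≠ h.d → g ≠ h := by
    rintro g h hh rfl; simp at hh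
  rw [signs, Finset.card_insert_of_notMem, Finset.card_insert_of_notMem,
    Finset.card_insert_of_notMem, Finset.card_singleton]
  all_goals
    simp only [Finset.mem_insert, Finset.mem_singleton, not_or]
  · exact h1 _ _ (by simp only [neg, flipSign]; omega)
  · exact ⟨h1 _ _ (by simp only [neg, flipSign]; omega),
        h1 _ _ (by simp only [neg, flipSign]; omega)⟩
  · exact ⟨h1 _ _ (by simp only [neg]; omega), h1 _ _ (by simp only [flipSign]; omega),
      h1 _ _ (by simp only [neg, flipSign]; omega)⟩

theorem mem_signs {f : BCF} {p s : ℤ} (h : (p * s) ^ 2 = 1) : f.comp p 0 0 s ∈ f.signs := by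
  classical
  have h1 : IsUnit p := by
    refine isUnit_of_dvd_one ⟨p * s ^ 2, by linear_combination -h⟩
  have h2 : IsUnit s := by
    refine isUnit_of_dvd_one ⟨p ^ 2 * s, by linear_combination -h⟩
  simp only [signs, Finset.mem_insert, Finset.mem_singleton]
  rcases Int.isUnit_iff.1 h1 with rfl | rfl <;> rcases Int.isUnit_iff.1 h2 with rfl | rfl
  · left; simp only [comp]; ext <;> ring
  · right; right; left; simp only [comp, flipSign]; ext <;> ring
  · right; right; right; simp only [comp, flipSign, neg]; ext <;> ring
  · right; left; simp only [comp, neg]; ext <;> ring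

theorem equiv_of_mem_signs {f g : BCF} (h : g ∈ f.signs) : f.Equiv g := by
  classical
  simp only [signs, Finset.mem_insert, Finset.mem_singleton] at h
  rcases h with rfl | rfl | rfl | rfl
  · exact Equiv.refl _
  · exact equiv_neg _
  · exact equiv_flipSign _
  · exact (equiv_flipSign _).trans (equiv_neg _)

end BCF

namespace IsReg

open BCF

variable {ε : ℤ} {R RC : ℝ → ℝ → ℝ → ℝ → Prop} {k α μ κ κ' : ℝ}

theorem mem_signs_of_equiv (h : IsReg ε R RC k α μ κ κ') {X : ℝ} {f g : BCF} (hfg : f.Equiv g)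
    (hf : f ∈ regForms ε R X) (hg : g ∈ regForms ε R X) (hi : f.Irr) : g ∈ f.signs := by
  obtain ⟨p, q, r, s, h1, rfl⟩ := hfg
  obtain ⟨rfl, rfl⟩ := h.diag f p q r s hi hf.2.2.1 h1 hf.2.1 hg.2.1
  exact mem_signs (by simpa using h1)

theorem signs_subset (h : IsReg ε R RC k α μ κ κ') {X : ℝ} {f g : BCF} (hg : g ∈ f.signs)
    (hf : f ∈ regForms ε R X) : g ∈ regForms ε R X := by
  classical
  have hd := (equiv_of_mem_signs hg).disc_eq
  refine ⟨?_, ?_, by rw [hd]; exact hf.2.2.1, by rw [hd]; exact hf.2.2.2⟩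
  · simp only [signs, Finset.mem_insert, Finset.mem_singleton] at hg
    have := hf.1
    rcases hg with rfl | rfl | rfl | rfl <;> simpa [neg, flipSign] using this
  · simp only [signs, Finset.mem_insert, Finset.mem_singleton] at hg
    have h1 := hf.2.1
    rcases hg with rfl | rfl | rfl | rfl
    · exact h1
    · simp only [neg]; push_cast; exact (h.neg_iff _ _ _ _).2 h1
    · simp only [flipSign]; push_cast; exact (h.alt_iff _ _ _ _).2 h1
    · simp only [flipSign, neg]; push_cast
      exact (h.neg_iff _ _ _ _).2 ((h.alt_iff _ _ _ _).2 h1)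

theorem card_le_four_mul (h : IsReg ε R RC k α μ κ κ') {X : ℝ} {W : Finset BCF}
    (hW : ∀ f ∈ W, f ∈ regForms ε R X ∧ f.Irr) : W.card ≤ 4 * (cls '' (W : Set BCF)).ncard := by
  classical
  rw [← Finset.coe_image, Set.ncard_coe_finset]
  refine Finset.card_le_mul_card_image _ _ fun x hx => ?_
  obtain ⟨f, hf, rfl⟩ := Finset.mem_image.1 hx
  refine (Finset.card_le_card fun g hg => ?_).trans (card_signs_le f)
  obtain ⟨h1, h2⟩ := Finset.mem_filter.1 hg
  exact h.mem_signs_of_equiv (cls_eq.1 h2.symm) (hW f hf).1 (hW g h1).1 (hW f hf).2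

theorem card_eq_four_mul (h : IsReg ε R RC k α μ κ κ') {X : ℝ} {W : Finset BCF} {P : BCF → Prop}
    (hP : ∀ f g : BCF, f.Equiv g → P f → P g)
    (hW : ∀ f, f ∈ W ↔ f ∈ regForms ε R X ∧ f.Irr ∧ P f) :
    W.card = 4 * (cls '' (W : Set BCF)).ncard := by
  classical
  rw [← Finset.coe_image, Set.ncard_coe_finset, Finset.card_eq_sum_card_image cls W,
    Finset.sum_const_nat (m := 4), mul_comm]
  intro x hx
  obtain ⟨f, hf, rfl⟩ := Finset.mem_image.1 hx
  have hf' := (hW f).1 hf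
  rw [← card_signs hf'.2.1.a_ne hf'.2.1.d_ne]
  congr 1
  ext g
  rw [Finset.mem_filter]
  constructor
  · rintro ⟨h1, h2⟩
    exact h.mem_signs_of_equiv (cls_eq.1 h2.symm) hf'.1 ((hW g).1 h1).1 hf'.2.1
  · intro hg
    have he := equiv_of_mem_signs hg
    exact ⟨(hW g).2 ⟨h.signs_subset hg hf'.1, he.irr hf'.2.1, hP f g he hf'.2.2⟩,
      (cls_eq.2 he).symm⟩

/-- Cubic fields are counted by reduced irreducible maximal forms, up to a boundary term. -/
theorem abs_ncard_maxFam_sub_le (h : IsReg ε R RC k α μ κ κ') {l : ℝ} (hl : 1 ≤ l)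
    {W : Finset BCF} (hW : ∀ f, f ∈ W ↔ f ∈ regForms ε R (l ^ 4) ∧ f.Irr ∧
      ∀ p : ℕ, p.Prime → ¬ NonMax p f) :
    |((cls '' MaxFam ε (l ^ 4)).ncard : ℝ) - W.card / 4| ≤ 15000 * l ^ 3 := by
  classical
  have h4 := h.card_eq_four_mul (P := fun f => ∀ p : ℕ, p.Prime → ¬ NonMax p f)
    (fun f g hfg hf p hp hg => hf p hp (hfg.nonMax hg)) hW
  have hfin := h.finite_regForms hl
  set B := hfin.toFinset.filter fun f => ¬ R f.a f.b f.c f.d with hB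
  have hBc : (B.card : ℝ) ≤ 15000 * l ^ 3 := h.card_boundary_le hl fun f hf => by
    obtain ⟨k1, k2⟩ := Finset.mem_filter.1 hf
    exact ⟨hfin.mem_toFinset.1 k1, k2⟩
  have hsub1 : cls '' (W : Set BCF) ⊆ cls '' MaxFam ε (l ^ 4) := by
    refine Set.image_mono fun f hf => ?_
    obtain ⟨h1, h2, h3⟩ := (hW f).1 hf
    exact ⟨h2, h1.2.2.1, h1.2.2.2, h3⟩
  have hsub2 : cls '' MaxFam ε (l ^ 4) ⊆ cls '' (W : Set BCF) ∪ cls '' (B : Set BCF) := by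
    rintro _ ⟨f, ⟨f1, f2, f3, f4⟩, rfl⟩
    obtain ⟨g, hfg, hg⟩ := h.exists_equiv f f1 f2
    have hgr : g ∈ regForms ε RC (l ^ 4) :=
      ⟨(hfg.irr f1).a_ne, hg, by rw [hfg.disc_eq]; exact f2, by rw [hfg.disc_eq]; exact f3⟩
    rw [cls_eq.2 hfg]
    by_cases hR : R g.a g.b g.c g.d
    · exact Or.inl (Set.mem_image_of_mem _ ((hW g).2 ⟨⟨hgr.1, hR, hgr.2.2⟩, hfg.irr f1,
        fun p hp hn => f4 p hp (hfg.nonMax hn)⟩))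
    · exact Or.inr (Set.mem_image_of_mem _ (Finset.mem_filter.2 ⟨hfin.mem_toFinset.2 hgr, hR⟩))
  have hfu : (cls '' (W : Set BCF) ∪ cls '' (B : Set BCF)).Finite :=
    (W.finite_toSet.image _).union (B.finite_toSet.image _)
  have c1 := Set.ncard_le_ncard hsub1 (hfu.subset hsub2)
  have c2 := (Set.ncard_le_ncard hsub2 hfu).trans (Set.ncard_union_le _ _)
  have c3 := Set.ncard_image_le (f := cls) B.finite_toSet
  rw [Set.ncard_coe_finset] at c3
  have c1' : ((cls '' (W : Set BCF)).ncard : ℝ) ≤ (cls '' MaxFam ε (l ^ 4)).ncard := by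
    exact_mod_cast c1
  have c2' : ((cls '' MaxFam ε (l ^ 4)).ncard : ℝ) ≤ (cls '' (W : Set BCF)).ncard + B.card := by
    exact_mod_cast c2.trans (Nat.add_le_add_left c3 _)
  have h4' : (W.card : ℝ) = 4 * (cls '' (W : Set BCF)).ncard := by exact_mod_cast h4
  rw [h4', abs_le]
  constructor <;> [have : 0 ≤ l ^ 3 := (by positivity); skip] <;> linarith

end IsReg

end

theorem exists_pow_card_le_mul_rpow {A : ℝ} (hA : 1 ≤ A) {δ : ℝ} (hδ : 0 < δ) :
    ∃ C : ℝ, 1 ≤ C ∧ ∀ s : Finset ℕ, (∀ p ∈ s, p.Prime) →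
      A ^ s.card ≤ C * (∏ p ∈ s, (p : ℝ)) ^ δ := by
  classical
  obtain ⟨N, hN⟩ := exists_nat_ge (A ^ (1 / δ))
  have hN' : A ≤ (N : ℝ) ^ δ := by
    have := Real.rpow_le_rpow (by positivity) hN hδ.le
    rwa [← Real.rpow_mul (by linarith), one_div_mul_cancel hδ.ne', Real.rpow_one] at this
  refine ⟨A ^ N, one_le_pow₀ hA, fun s hs => ?_⟩
  have h1 : ∀ p ∈ s, A ≤ (if p < N then A else 1) * (p : ℝ) ^ δ := fun p hp => by
    have hp1 : (1 : ℝ) ≤ p := by exact_mod_cast (hs p hp).one_le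
    split_ifs with h
    · exact le_mul_of_one_le_right (by linarith) (Real.one_le_rpow hp1 hδ.le)
    · rw [one_mul]
      exact hN'.trans (Real.rpow_le_rpow (by positivity) (by exact_mod_cast not_lt.1 h) hδ.le)
  have h2 := Finset.prod_le_prod (fun _ _ => by linarith) h1
  rw [Finset.prod_const, Finset.prod_mul_distrib, Real.finsetProd_rpow _ _ (by simp)] at h2
  refine h2.trans (mul_le_mul_of_nonneg_right ?_ (by positivity))
  rw [Finset.prod_ite, Finset.prod_const, Finset.prod_const_one, mul_one]
  refine pow_le_pow_right₀ hA ?_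
  have : (s.filter fun p => p < N) ⊆ Finset.range N := fun p hp =>
    Finset.mem_range.2 (Finset.mem_filter.1 hp).2
  simpa using Finset.card_le_card this

theorem exists_sum_prod_rpow_le {δ : ℝ} (hδ : 0 < δ) :
    ∃ Z : ℝ, 0 ≤ Z ∧ ∀ T : Finset (Finset ℕ), (∀ s ∈ T, ∀ p ∈ s, p.Prime) →
      ∑ s ∈ T, (∏ p ∈ s, (p : ℝ)) ^ (-1 - δ) ≤ Z := by
  classical
  have hsum : Summable fun n : ℕ => (n : ℝ) ^ (-1 - δ) :=
    Real.summable_nat_rpow.2 (by linarith)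
  refine ⟨∑' n : ℕ, (n : ℝ) ^ (-1 - δ), tsum_nonneg fun n => by positivity, fun T hT => ?_⟩
  have hinj : Set.InjOn (fun s : Finset ℕ => ∏ p ∈ s, p) T := fun s hs t ht hst => by
    rw [← Nat.primeFactors_prod (hT s hs), ← Nat.primeFactors_prod (hT t ht)]
    exact congrArg _ hst
  have h1 := hsum.sum_le_tsum (T.image fun s => ∏ p ∈ s, p) fun n _ => by positivity
  rw [Finset.sum_image hinj] at h1
  simpa using h1

theorem sieve_error_le_of_le {l m a C δ : ℝ} (hl : 1 ≤ l) (hm : 1 ≤ m) (hC : 0 ≤ C)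
    (hδ : 0 < δ) (ha : a ≤ C * m ^ δ) (hml : m ≤ √l) :
    l ^ 3 * (3 + Real.log l) * (2 * a) + l ^ 2 * (a * m) + l ^ 3 * √l * (2 * (a / m)) ≤
      C * (9 + 2 / δ) * l ^ (7 / 2 + 2 * δ) * m ^ (-1 - δ) := by
  have hl0 : 0 < l := by linarith
  have hm0 : 0 < m := by linarith
  have key : ∀ t : ℝ, 0 ≤ t → m ^ t ≤ l ^ (t / 2) := fun t ht => by
    have := Real.rpow_le_rpow hm0.le hml ht
    rwa [Real.sqrt_eq_rpow, ← Real.rpow_mul hl0.le, one_div_mul_eq_div] at this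
  set w := m ^ (-1 - δ) with hw
  have hw0 : 0 < w := by positivity
  have e1 : a ≤ C * l ^ (1 / 2 + δ) * w := by
    have h1 := key (1 + 2 * δ) (by linarith)
    rw [show (1 + 2 * δ) / 2 = 1 / 2 + δ by ring] at h1
    have h2 : m ^ δ = m ^ (1 + 2 * δ) * w := by rw [hw, ← Real.rpow_add hm0]; ring_nf
    calc a ≤ _ := ha
      _ = C * m ^ (1 + 2 * δ) * w := by rw [h2]; ring
      _ ≤ _ := by gcongr
  have e2 : a * m ≤ C * l ^ (1 + δ) * w := by
    have h1 := key (2 + 2 * δ) (by linarith)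
    rw [show (2 + 2 * δ) / 2 = 1 + δ by ring] at h1
    have h2 : m ^ δ * m = m ^ (2 + 2 * δ) * w := by
      rw [hw, ← Real.rpow_add hm0, ← Real.rpow_add_one hm0.ne']; ring_nf
    calc a * m ≤ C * m ^ δ * m := by gcongr
      _ = C * m ^ (2 + 2 * δ) * w := by rw [mul_assoc, h2]; ring
      _ ≤ _ := by gcongr
  have e3 : a / m ≤ C * l ^ δ * w := by
    have h1 := key (2 * δ) (by linarith)
    rw [show 2 * δ / 2 = δ by ring] at h1
    have h2 : m ^ δ / m = m ^ (2 * δ) * w := by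
      rw [hw, ← Real.rpow_add hm0, ← Real.rpow_sub_one hm0.ne']; ring_nf
    calc a / m ≤ C * m ^ δ / m := by gcongr
      _ = C * m ^ (2 * δ) * w := by rw [mul_div_assoc, h2]; ring
      _ ≤ _ := by gcongr
  have hlog : 3 + Real.log l ≤ (3 + 1 / δ) * l ^ δ := by
    have h1 := Real.log_le_rpow_div hl0.le hδ
    have h2 := Real.one_le_rpow hl hδ.le
    calc 3 + Real.log l ≤ 3 * l ^ δ + l ^ δ / δ := by linarith
      _ = _ := by ring
  have hlog0 : 0 ≤ 3 + Real.log l := by linarith [Real.log_nonneg hl]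
  have hL : ∀ t : ℝ, t ≤ 7 / 2 + 2 * δ → l ^ t ≤ l ^ (7 / 2 + 2 * δ) := fun t ht =>
    Real.rpow_le_rpow_of_exponent_le hl ht
  set L := l ^ (7 / 2 + 2 * δ) with hLdef
  have n3 : l ^ 3 = l ^ (3 : ℝ) := by norm_cast
  have n2 : l ^ 2 = l ^ (2 : ℝ) := by norm_cast
  have t1 : l ^ 3 * (3 + Real.log l) * (2 * a) ≤ 2 * (3 + 1 / δ) * C * L * w := by
    calc l ^ 3 * (3 + Real.log l) * (2 * a)
        ≤ l ^ 3 * ((3 + 1 / δ) * l ^ δ) * (2 * (C * l ^ (1 / 2 + δ) * w)) := by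
          have : 0 ≤ C * l ^ (1 / 2 + δ) * w := by positivity
          refine (mul_le_mul_of_nonneg_left
            (mul_le_mul_of_nonneg_left e1 zero_le_two) (by positivity)).trans ?_
          gcongr
      _ = 2 * (3 + 1 / δ) * C * (l ^ 3 * l ^ δ * l ^ (1 / 2 + δ)) * w := by ring
      _ = _ := by
          rw [n3, ← Real.rpow_add hl0, ← Real.rpow_add hl0, hLdef]; ring_nf
  have t2 : l ^ 2 * (a * m) ≤ C * L * w := by
    calc l ^ 2 * (a * m) ≤ l ^ 2 * (C * l ^ (1 + δ) * w) := by gcongr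
      _ = C * (l ^ 2 * l ^ (1 + δ)) * w := by ring
      _ ≤ _ := by
          rw [n2, ← Real.rpow_add hl0]
          have := hL (2 + (1 + δ)) (by linarith)
          gcongr
  have t3 : l ^ 3 * √l * (2 * (a / m)) ≤ 2 * C * L * w := by
    calc l ^ 3 * √l * (2 * (a / m)) ≤ l ^ 3 * √l * (2 * (C * l ^ δ * w)) := by gcongr
      _ = 2 * C * (l ^ 3 * √l * l ^ δ) * w := by ring
      _ ≤ _ := by
          rw [n3, Real.sqrt_eq_rpow, ← Real.rpow_add hl0, ← Real.rpow_add hl0]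
          have := hL (3 + 1 / 2 + δ) (by linarith)
          gcongr
  calc _ ≤ 2 * (3 + 1 / δ) * C * L * w + C * L * w + 2 * C * L * w := by linarith
    _ = _ := by ring

theorem sieve_error_le_of_ge {l m a C δ : ℝ} (hl : 1 ≤ l) (hC : 0 ≤ C)
    (hδ : 0 < δ) (hδ' : δ ≤ 1 / 2) (ha : a ≤ C * m ^ δ) (hml : √l ≤ m) :
    l ^ 4 * (a / m ^ 2) ≤ C * l ^ (7 / 2 + 2 * δ) * m ^ (-1 - δ) := by
  have hl0 : 0 < l := by linarith
  have hs0 : 0 < √l := Real.sqrt_pos.2 hl0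
  have hm0 : 0 < m := by linarith
  have key := Real.rpow_le_rpow_of_nonpos hs0 hml (show -1 + 2 * δ ≤ 0 by linarith)
  rw [Real.sqrt_eq_rpow, ← Real.rpow_mul hl0.le] at key
  have h2 : m ^ δ / m ^ 2 = m ^ (-1 + 2 * δ) * m ^ (-1 - δ) := by
    rw [← Real.rpow_add hm0, ← Real.rpow_natCast m 2, ← Real.rpow_sub hm0]
    congr 1; push_cast; ring
  have n4 : l ^ 4 = l ^ (4 : ℝ) := by norm_cast
  calc l ^ 4 * (a / m ^ 2) ≤ l ^ 4 * (C * m ^ δ / m ^ 2) := by gcongr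
    _ = l ^ 4 * C * (m ^ (-1 + 2 * δ) * m ^ (-1 - δ)) := by rw [← h2]; ring
    _ ≤ l ^ 4 * C * (l ^ (1 / 2 * (-1 + 2 * δ)) * m ^ (-1 - δ)) := by gcongr
    _ = C * (l ^ 4 * l ^ (1 / 2 * (-1 + 2 * δ))) * m ^ (-1 - δ) := by ring
    _ ≤ _ := by
        rw [n4, ← Real.rpow_add hl0]
        have : l ^ (4 + 1 / 2 * (-1 + 2 * δ)) ≤ l ^ (7 / 2 + 2 * δ) :=
          Real.rpow_le_rpow_of_exponent_le hl (by linarith)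
        gcongr

theorem sum_powerset_mul_card_filter {α β : Type*} [DecidableEq α] [DecidableEq β]
    (F : Finset α) (P : Finset β) (N : β → α → Prop) [∀ b a, Decidable (N b a)]
    (g : Finset β → ℝ) :
    ∑ s ∈ P.powerset, g s * ((F.filter fun f => ∀ p ∈ s, N p f).card : ℝ)
      = ∑ f ∈ F, ∑ s ∈ (P.filter fun p => N p f).powerset, g s := by
  simp_rw [← Finset.sum_boole, Finset.mul_sum, mul_ite, mul_one, mul_zero]
  rw [Finset.sum_comm]
  refine Finset.sum_congr rfl fun f _ => ?_
  rw [← Finset.sum_filter]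
  refine Finset.sum_congr ?_ fun _ _ => rfl
  ext s
  simp only [Finset.mem_filter, Finset.mem_powerset, Finset.subset_iff]
  exact ⟨fun h p hp => ⟨h.1 hp, h.2 p hp⟩, fun h => ⟨fun p hp => (h hp).1, fun p hp => (h hp).2⟩⟩

theorem sum_powerset_neg_one_pow_mul_card_filter {α β : Type*} [DecidableEq α] [DecidableEq β]
    (F : Finset α) (P : Finset β) (N : β → α → Prop) [∀ b a, Decidable (N b a)] :
    ∑ s ∈ P.powerset, (-1 : ℝ) ^ s.card * ((F.filter fun f => ∀ p ∈ s, N p f).card : ℝ)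
      = (F.filter fun f => ∀ p ∈ P, ¬ N p f).card := by
  rw [sum_powerset_mul_card_filter, ← Finset.sum_boole]
  refine Finset.sum_congr rfl fun f _ => ?_
  have h := Finset.sum_powerset_neg_one_pow_card (x := P.filter fun p => N p f)
  simp only [Finset.filter_eq_empty_iff] at h
  exact_mod_cast h

theorem density_nonneg_and_le {p : ℕ} (hp : p.Prime) :
    0 ≤ 1 - (1 - 1 / (p : ℝ) ^ 2) * (1 - 1 / (p : ℝ) ^ 3) ∧
      1 - (1 - 1 / (p : ℝ) ^ 2) * (1 - 1 / (p : ℝ) ^ 3) ≤ 5 / (p : ℝ) ^ 2 := by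
  have hp1 : (1 : ℝ) ≤ p := by exact_mod_cast hp.one_le
  have h1 : 1 / (p : ℝ) ^ 3 ≤ 1 / (p : ℝ) ^ 2 := by
    have := pow_le_pow_right₀ hp1 (show 2 ≤ 3 by norm_num)
    gcongr
  have h2 : 1 / (p : ℝ) ^ 2 ≤ 1 := by
    rw [div_le_one (by positivity)]; exact one_le_pow₀ hp1
  have h3 : 0 ≤ 1 / (p : ℝ) ^ 3 := by positivity
  rw [← mul_one_div 5]
  constructor <;> nlinarith

namespace BCF

theorem NonMax.sq_dvd_disc {p : ℕ} (hp : p.Prime) {f : BCF} (h : NonMax p f) :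
    (p : ℤ) ^ 2 ∣ f.disc := by
  rcases NonMax.normal_form hp h with ⟨⟨a, ha⟩, ⟨b, hb⟩, ⟨c, hc⟩, ⟨d, hd⟩⟩ |
      ⟨g, hfg, ⟨a, ha⟩, ⟨b, hb⟩⟩
  · rw [disc, ha, hb, hc, hd]
    exact ⟨p ^ 2 * cubicDisc a b c d, by simp only [cubicDisc]; ring⟩
  · rw [← hfg.disc_eq, disc, ha, hb]
    refine ⟨b ^ 2 * g.c ^ 2 - 4 * a * g.c ^ 3 - 4 * p * b ^ 3 * g.d - 27 * p ^ 2 * a ^ 2 * g.d ^ 2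
      + 18 * p * a * b * g.c * g.d, ?_⟩
    simp only [cubicDisc]; ring

theorem prod_le_sq_of_nonMax {ε : ℤ} {l : ℝ} {f : BCF} (h0 : 0 < ε * f.disc)
    (h1 : ((ε * f.disc : ℤ) : ℝ) < l ^ 4) {s : Finset ℕ} (hs : ∀ p ∈ s, p.Prime ∧ NonMax p f) :
    ∏ p ∈ s, (p : ℝ) ≤ l ^ 2 := by
  have h2 : ∏ p ∈ s, (p : ℤ) ^ 2 ∣ f.disc := by
    refine Finset.prod_dvd_of_coprime (fun p hp q hq hpq => ?_) fun p hp =>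
      NonMax.sq_dvd_disc (hs p hp).1 (hs p hp).2
    exact (Nat.isCoprime_iff_coprime.2
      ((Nat.coprime_primes (hs p hp).1 (hs q hq).1).2 hpq)).pow
  have h3 := Int.le_of_dvd h0 (h2.mul_left ε)
  have h4 : (∏ p ∈ s, (p : ℝ)) ^ 2 ≤ ((ε * f.disc : ℤ) : ℝ) := by
    rw [← Finset.prod_pow]; exact_mod_cast h3
  refine le_of_sq_le_sq ?_ (by positivity)
  calc _ ≤ _ := h4
    _ ≤ l ^ 4 := h1.le
    _ = _ := by ring

end BCF

namespace IsReg

open BCF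

variable {ε : ℤ} {R RC : ℝ → ℝ → ℝ → ℝ → Prop} {k α μ κ κ' : ℝ}

theorem exists_card_irr_nonMax_le (h : IsReg ε R RC k α μ κ κ') : ∃ C : ℝ, 0 ≤ C ∧
    ∀ (X : ℝ) (s : Finset ℕ) (G : Finset BCF), 0 < X → (∀ p ∈ s, p.Prime) →
      (∀ f ∈ G, f ∈ regForms ε R X ∧ f.Irr ∧ ∀ p ∈ s, NonMax p f) →
      (G.card : ℝ) ≤ C * X * ∏ p ∈ s, (5 / (p : ℝ) ^ 2) := by
  obtain ⟨C, hC⟩ := h.exists_ncard_cls_fam_le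
  have hC0 : 0 ≤ C := by
    have := (hC 1 one_pos).2
    have h1 : (0 : ℝ) ≤ (cls '' Fam ε ∅ 1).ncard := Nat.cast_nonneg _
    linarith
  refine ⟨4 * C, by positivity, fun X s G hX hs hG => ?_⟩
  have h1 := h.card_le_four_mul (W := G) fun f hf => ⟨(hG f hf).1, (hG f hf).2.1⟩
  have hsub : cls '' (G : Set BCF) ⊆ cls '' Fam ε s X := Set.image_mono fun f hf =>
    ⟨(hG f hf).2.1, (hG f hf).1.2.2.1, (hG f hf).1.2.2.2, (hG f hf).2.2⟩
  have hfin : (cls '' Fam ε s X).Finite := (hC X hX).1.subset <| Set.image_mono fun f hf =>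
    ⟨hf.1, hf.2.1, hf.2.2.1, by simp⟩
  have h2 := Set.ncard_le_ncard hsub hfin
  have h3 := ncard_cls_fam_le hC s hs X hX
  have h4 : (G.card : ℝ) ≤ 4 * (cls '' Fam ε s X).ncard := by
    exact_mod_cast h1.trans (Nat.mul_le_mul_left 4 h2)
  linarith

theorem exists_sum_reducible_le (h : IsReg ε R RC k α μ κ κ') {δ : ℝ} (hδ : 0 < δ) :
    ∃ C : ℝ, 0 ≤ C ∧ ∀ (l : ℝ) (F : Finset BCF) (P : Finset ℕ)
      [∀ (p : ℕ) (f : BCF), Decidable (NonMax p f)], 1 ≤ l → (∀ p ∈ P, p.Prime) →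
      (∀ f ∈ F, f ∈ regForms ε R (l ^ 4) ∧ ¬ f.Irr) →
      ∑ s ∈ P.powerset, ((F.filter fun f => ∀ p ∈ s, NonMax p f).card : ℝ)
        ≤ C * l ^ (7 / 2 + 2 * δ) := by
  classical
  obtain ⟨C, hC1, hC⟩ := exists_pow_card_le_mul_rpow (A := 2) (by norm_num) hδ
  refine ⟨20000000 * C, by positivity, fun l F P _ hl hP hF => ?_⟩
  have hl0 : 0 < l := by linarith
  have h1 := sum_powerset_mul_card_filter F P (fun p f => NonMax p f) fun _ => 1
  simp only [one_mul] at h1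
  have h2 : ∀ f ∈ F, ∑ s ∈ (P.filter fun p => NonMax p f).powerset, (1 : ℝ) ≤ C * (l ^ 2) ^ δ := by
    intro f hf
    rw [Finset.sum_const, Finset.card_powerset, nsmul_eq_mul, mul_one]
    push_cast
    have hs : ∀ p ∈ P.filter fun p => NonMax p f, p.Prime ∧ NonMax p f := fun p hp =>
      ⟨hP p (Finset.mem_filter.1 hp).1, (Finset.mem_filter.1 hp).2⟩
    have h4 := prod_le_sq_of_nonMax (hF f hf).1.2.2.1 (hF f hf).1.2.2.2 hs
    refine (hC _ fun p hp => (hs p hp).1).trans ?_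
    gcongr
  have h3 : (F.card : ℝ) ≤ 20000000 * (l ^ 3 * √l) :=
    h.card_reducible_le hl fun f hf => ⟨h.regForms_subset _ (hF f hf).1, (hF f hf).2⟩
  rw [h1]
  calc _ ≤ F.card • (C * (l ^ 2) ^ δ) := Finset.sum_le_card_nsmul _ _ _ h2
    _ ≤ 20000000 * (l ^ 3 * √l) * (C * (l ^ 2) ^ δ) := by rw [nsmul_eq_mul]; gcongr
    _ = 20000000 * C * (l ^ 3 * √l * (l ^ 2) ^ δ) := by ring
    _ = _ := by
        rw [Real.sqrt_eq_rpow, ← Real.rpow_natCast l 3, ← Real.rpow_natCast l 2,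
          ← Real.rpow_mul hl0.le, ← Real.rpow_add hl0, ← Real.rpow_add hl0]
        norm_num

theorem exists_abs_sub_density_le (h : IsReg ε R RC k α μ κ κ') {δ : ℝ} (hδ : 0 < δ)
    (hδ' : δ ≤ 1 / 2) : ∃ C : ℝ, 0 ≤ C ∧
    ∀ (l : ℝ) (s : Finset ℕ) (F G : Finset BCF), 1 ≤ l → (∀ p ∈ s, p.Prime) →
      (∀ f, f ∈ F ↔ f ∈ regForms ε R (l ^ 4) ∧ f.Irr ∧ ∀ p ∈ s, NonMax p f) →
      (∀ f, f ∈ G ↔ f ∈ regForms ε R (l ^ 4) ∧ ¬ f.Irr ∧ ∀ p ∈ s, NonMax p f) →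
      |(F.card : ℝ) - κ * Real.pi ^ 2 / (6 * κ') * l ^ 4
          * ∏ p ∈ s, (1 - (1 - 1 / (p : ℝ) ^ 2) * (1 - 1 / (p : ℝ) ^ 3))|
        ≤ C * l ^ (7 / 2 + 2 * δ) * (∏ p ∈ s, (p : ℝ)) ^ (-1 - δ) + G.card := by
  classical
  obtain ⟨K, hK0, hK⟩ := h.exists_abs_card_nonMax_sub_le
  obtain ⟨A, hA0, hA⟩ := h.exists_card_irr_nonMax_le
  obtain ⟨C, hC1, hC⟩ := exists_pow_card_le_mul_rpow (A := 5) (by norm_num) hδ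
  set v := κ * Real.pi ^ 2 / (6 * κ') with hv
  have hC0 : 0 ≤ C := by linarith
  refine ⟨K * (C * (9 + 2 / δ)) + (A + |v|) * C, by positivity, fun l s F G hl hs hF hG => ?_⟩
  have hl0 : 0 < l := by linarith
  have ha := hC s hs
  set m := ∏ p ∈ s, (p : ℝ) with hm
  have hm1 : 1 ≤ m := by
    have : ((1 : ℕ) : ℝ) ≤ ((∏ p ∈ s, p : ℕ) : ℝ) :=
      Nat.cast_le.2 (Finset.prod_pos fun p hp => (hs p hp).pos)
    rwa [Nat.cast_one, Nat.cast_prod] at this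
  set D := ∏ p ∈ s, (1 - (1 - 1 / (p : ℝ) ^ 2) * (1 - 1 / (p : ℝ) ^ 3)) with hD
  have hL : 0 ≤ l ^ (7 / 2 + 2 * δ) * m ^ (-1 - δ) := by positivity
  rcases le_total m √l with hml | hml
  · have hfin : (regForms ε R (l ^ 4)).Finite :=
      (h.finite_regForms hl).subset (h.regForms_subset _)
    have h1 := hK l hfin.toFinset (F ∪ G) s hl (fun f => by simp) hs (fun f => by
      rw [Finset.mem_union, hF, hG, Set.Finite.mem_toFinset]; tauto)
    rw [Finset.card_union_of_disjoint (Finset.disjoint_left.2 fun f h1 h2 =>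
      ((hG f).1 h2).2.1 ((hF f).1 h1).2.1), Finset.prod_const, Finset.prod_mul_distrib,
      Finset.prod_div_distrib, Finset.prod_const, ← hm] at h1
    push_cast at h1
    have h2 := mul_le_mul_of_nonneg_left (sieve_error_le_of_le hl hm1 hC0 hδ ha hml) hK0
    have hG0 : (0 : ℝ) ≤ G.card := Nat.cast_nonneg _
    have h3 : 0 ≤ (A + |v|) * C * (l ^ (7 / 2 + 2 * δ) * m ^ (-1 - δ)) := by positivity
    rw [abs_le] at h1 ⊢
    constructor <;> linarith [h1.1, h1.2]
  · have h1 := hA (l ^ 4) s F (by positivity) hs fun f hf => (hF f).1 hf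
    rw [Finset.prod_div_distrib, Finset.prod_const, Finset.prod_pow, ← hm] at h1
    have hD0 : 0 ≤ D := Finset.prod_nonneg fun p hp => (density_nonneg_and_le (hs p hp)).1
    have hD1 : D ≤ 5 ^ s.card / m ^ 2 := by
      rw [hm, ← Finset.prod_pow, ← Finset.prod_const, ← Finset.prod_div_distrib]
      refine Finset.prod_le_prod (fun p hp => (density_nonneg_and_le (hs p hp)).1) fun p hp =>
        (density_nonneg_and_le (hs p hp)).2
    have h2 := mul_le_mul_of_nonneg_left (sieve_error_le_of_ge hl hC0 hδ hδ' ha hml)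
      (show 0 ≤ A + |v| by positivity)
    have h3 : 0 ≤ K * (C * (9 + 2 / δ)) * (l ^ (7 / 2 + 2 * δ) * m ^ (-1 - δ)) := by positivity
    have hG0 : (0 : ℝ) ≤ G.card := Nat.cast_nonneg _
    have hF0 : (0 : ℝ) ≤ F.card := Nat.cast_nonneg _
    have h4 : |v * l ^ 4 * D| ≤ |v| * l ^ 4 * (5 ^ s.card / m ^ 2) := by
      rw [abs_mul, abs_mul, abs_of_nonneg hD0, abs_of_nonneg (by positivity : 0 ≤ l ^ 4)]
      gcongr
    have h5 := abs_sub (F.card : ℝ) (v * l ^ 4 * D)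
    rw [abs_of_nonneg hF0] at h5
    linarith

end IsReg

namespace IsReg

open BCF

variable {ε : ℤ} {R RC : ℝ → ℝ → ℝ → ℝ → Prop} {k α μ κ κ' : ℝ}

theorem exists_abs_card_maximal_sub_le (h : IsReg ε R RC k α μ κ κ') {δ : ℝ} (hδ : 0 < δ)
    (hδ' : δ ≤ 1 / 2) : ∃ C : ℝ, 0 ≤ C ∧ ∀ (l : ℝ) (W : Finset BCF) (Y : ℕ), 1 ≤ l →
      (∀ f, f ∈ W ↔ f ∈ regForms ε R (l ^ 4) ∧ f.Irr ∧ ∀ p : ℕ, p.Prime → ¬ NonMax p f) →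
      l ^ 2 < Y → |(W.card : ℝ) - κ * Real.pi ^ 2 / (6 * κ') * l ^ 4
        * ∏ p ∈ Nat.primesBelow Y, ((1 - 1 / (p : ℝ) ^ 2) * (1 - 1 / (p : ℝ) ^ 3))|
        ≤ C * l ^ (7 / 2 + 2 * δ) := by
  classical
  obtain ⟨A, hA0, hA⟩ := h.exists_abs_sub_density_le hδ hδ'
  obtain ⟨B, hB0, hB⟩ := h.exists_sum_reducible_le hδ
  obtain ⟨Z, hZ0, hZ⟩ := exists_sum_prod_rpow_le hδ
  refine ⟨A * Z + B, by positivity, fun l W Y hl hW hY => ?_⟩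
  have hl0 : 0 < l := by linarith
  set v := κ * Real.pi ^ 2 / (6 * κ') with hv
  have hfin : (regForms ε R (l ^ 4)).Finite :=
    (h.finite_regForms hl).subset (h.regForms_subset _)
  set F := hfin.toFinset.filter fun f => f.Irr with hF
  set G := hfin.toFinset.filter fun f => ¬ f.Irr with hG
  set P := Nat.primesBelow Y with hP
  have hPp : ∀ p ∈ P, p.Prime := fun p hp => Nat.prime_of_mem_primesBelow hp
  have hsp : ∀ s ∈ P.powerset, ∀ p ∈ s, p.Prime := fun s hs p hp =>
    hPp p (Finset.mem_powerset.1 hs hp)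
  have hWF : W = F.filter fun f => ∀ p ∈ P, ¬ NonMax p f := by
    ext f
    simp only [hW, hF, Finset.mem_filter, Set.Finite.mem_toFinset, and_assoc]
    refine and_congr_right fun h1 => and_congr_right fun _ =>
      ⟨fun h2 p hp => h2 p (hPp p hp), fun h2 p hp hn => h2 p ?_ hn⟩
    have h3 := prod_le_sq_of_nonMax h1.2.2.1 h1.2.2.2 (s := {p}) (by simpa using ⟨hp, hn⟩)
    rw [Finset.prod_singleton] at h3
    exact Nat.mem_primesBelow.2 ⟨by exact_mod_cast h3.trans_lt hY, hp⟩
  have e1 := sum_powerset_neg_one_pow_mul_card_filter F P fun p f => NonMax p f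
  rw [← hWF] at e1
  have e2 : ∏ p ∈ P, ((1 - 1 / (p : ℝ) ^ 2) * (1 - 1 / (p : ℝ) ^ 3)) =
      ∑ s ∈ P.powerset, (-1 : ℝ) ^ s.card *
        ∏ p ∈ s, (1 - (1 - 1 / (p : ℝ) ^ 2) * (1 - 1 / (p : ℝ) ^ 3)) := by
    rw [← Finset.sum_congr rfl fun s _ => Finset.prod_neg _, ← Finset.prod_one_add]
    refine Finset.prod_congr rfl fun p _ => by ring
  rw [← e1, e2, Finset.mul_sum, ← Finset.sum_sub_distrib]
  have e3 : ∀ s ∈ P.powerset,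
      |(-1 : ℝ) ^ s.card * ((F.filter fun f => ∀ p ∈ s, NonMax p f).card : ℝ) -
        v * l ^ 4 * ((-1 : ℝ) ^ s.card *
          ∏ p ∈ s, (1 - (1 - 1 / (p : ℝ) ^ 2) * (1 - 1 / (p : ℝ) ^ 3)))| ≤
      A * l ^ (7 / 2 + 2 * δ) * (∏ p ∈ s, (p : ℝ)) ^ (-1 - δ) +
        ((G.filter fun f => ∀ p ∈ s, NonMax p f).card : ℝ) := fun s hs => by
    have h1 := hA l s (F.filter fun f => ∀ p ∈ s, NonMax p f)
      (G.filter fun f => ∀ p ∈ s, NonMax p f) hl (hsp s hs)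
      (fun f => by simp only [hF, Finset.mem_filter, Set.Finite.mem_toFinset, and_assoc])
      (fun f => by simp only [hG, Finset.mem_filter, Set.Finite.mem_toFinset, and_assoc])
    refine le_trans (le_of_eq ?_) h1
    rw [mul_left_comm, ← mul_sub, abs_mul, abs_pow, abs_neg, abs_one, one_pow, one_mul]
  refine (Finset.abs_sum_le_sum_abs _ _).trans ((Finset.sum_le_sum e3).trans ?_)
  rw [Finset.sum_add_distrib, ← Finset.mul_sum, add_mul]
  have h1 := hZ P.powerset hsp
  have h2 := hB l G P hl hPp fun f hf => by
    simpa only [hG, Finset.mem_filter, Set.Finite.mem_toFinset] using hf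
  refine add_le_add ?_ h2
  calc _ ≤ A * l ^ (7 / 2 + 2 * δ) * Z := by gcongr
    _ = _ := by ring

end IsReg

theorem tendsto_prod_primesBelow_zeta {n : ℕ} (hn : 1 < n) :
    Filter.Tendsto (fun Y : ℕ => ∏ p ∈ Nat.primesBelow Y, (1 - 1 / (p : ℝ) ^ n)) Filter.atTop
      (nhds (riemannZeta n).re⁻¹) := by
  have hn' : 1 < (n : ℂ).re := by simpa using hn
  have h1 := riemannZeta_eulerProduct hn'
  have h2 := (h1.inv₀ (riemannZeta_ne_zero_of_one_lt_re hn'))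
  have h3 : (fun Y : ℕ => (∏ p ∈ Nat.primesBelow Y, (1 - (p : ℂ) ^ (-(n : ℂ)))⁻¹)⁻¹) =
      fun Y : ℕ => ((∏ p ∈ Nat.primesBelow Y, (1 - 1 / (p : ℝ) ^ n) : ℝ) : ℂ) := by
    funext Y
    rw [Finset.prod_inv_distrib, inv_inv]
    push_cast
    refine Finset.prod_congr rfl fun p _ => ?_
    rw [Complex.cpow_neg, Complex.cpow_natCast, one_div]
  rw [h3] at h2
  have h4 := (Complex.continuous_re.tendsto _).comp h2
  have h5 : (riemannZeta n)⁻¹.re = (riemannZeta n).re⁻¹ := by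
    have h6 : (riemannZeta n).im = 0 := by
      rw [zeta_nat_eq_tsum_of_gt_one hn]
      have : (∑' m : ℕ, 1 / (m : ℂ) ^ n) = ((∑' m : ℕ, 1 / (m : ℝ) ^ n : ℝ) : ℂ) := by
        push_cast; rfl
      rw [this, Complex.ofReal_im]
    have h7 : riemannZeta n = ((riemannZeta n).re : ℂ) := Complex.ext rfl (by simp [h6])
    rw [h7, ← Complex.ofReal_inv, Complex.ofReal_re, Complex.ofReal_re]
  rw [← h5]
  exact h4

theorem tendsto_prod_primesBelow :
    Filter.Tendsto (fun Y : ℕ => ∏ p ∈ Nat.primesBelow Y,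
      ((1 - 1 / (p : ℝ) ^ 2) * (1 - 1 / (p : ℝ) ^ 3))) Filter.atTop
      (nhds (6 / Real.pi ^ 2 * (riemannZeta 3).re⁻¹)) := by
  simp_rw [Finset.prod_mul_distrib]
  have h2 := tendsto_prod_primesBelow_zeta (n := 2) (by norm_num)
  have h3 := tendsto_prod_primesBelow_zeta (n := 3) (by norm_num)
  have h4 : (riemannZeta 2).re = Real.pi ^ 2 / 6 := by
    rw [riemannZeta_two, show (Real.pi : ℂ) ^ 2 / 6 = ((Real.pi ^ 2 / 6 : ℝ) : ℂ) by push_cast; rfl,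
      Complex.ofReal_re]
  push_cast at h2 h3
  rw [h4, inv_div] at h2
  exact h2.mul h3

namespace IsReg

open BCF

variable {ε : ℤ} {R RC : ℝ → ℝ → ℝ → ℝ → Prop} {k α μ κ κ' : ℝ}

theorem exists_abs_countCubic_sub_le (h : IsReg ε R RC k α μ κ κ') {η : ℝ} (hη : 0 < η) :
    ∃ C : ℝ, 0 ≤ C ∧ ∀ X : ℝ, 1 ≤ X →
      |(countCubic (fun d => 0 < ε * d ∧ ((ε * d : ℤ) : ℝ) < X) : ℝ) -
        κ / κ' * X / (4 * (riemannZeta 3).re)| ≤ C * X ^ ((7 : ℝ) / 8 + η) := by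
  classical
  set δ := min η (1 / 2) with hδdef
  have hδ : 0 < δ := lt_min hη (by norm_num)
  obtain ⟨C, hC0, hC⟩ := h.exists_abs_card_maximal_sub_le hδ (min_le_right _ _)
  refine ⟨15000 + C / 4, by positivity, fun X hX => ?_⟩
  have hX0 : 0 < X := by linarith
  set l := X ^ (1 / 4 : ℝ) with hl
  have hl1 : 1 ≤ l := Real.one_le_rpow hX (by norm_num)
  have hl4 : l ^ 4 = X := by
    rw [hl, ← Real.rpow_natCast, ← Real.rpow_mul hX0.le]; norm_num
  have hfin : (regForms ε R (l ^ 4)).Finite :=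
    (h.finite_regForms hl1).subset (h.regForms_subset _)
  set W := hfin.toFinset.filter fun f => f.Irr ∧ ∀ p : ℕ, p.Prime → ¬ NonMax p f with hWdef
  have hW : ∀ f, f ∈ W ↔ f ∈ regForms ε R (l ^ 4) ∧ f.Irr ∧
      ∀ p : ℕ, p.Prime → ¬ NonMax p f := fun f => by
    simp only [hWdef, Finset.mem_filter, Set.Finite.mem_toFinset]
  have h1 := h.abs_ncard_maxFam_sub_le hl1 hW
  have h2 : |(W.card : ℝ) - κ * Real.pi ^ 2 / (6 * κ') * l ^ 4 *
      (6 / Real.pi ^ 2 * (riemannZeta 3).re⁻¹)| ≤ C * l ^ (7 / 2 + 2 * δ) := by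
    refine le_of_tendsto ((tendsto_prod_primesBelow.const_mul _).const_sub _).abs ?_
    filter_upwards [Filter.tendsto_atTop.1 tendsto_natCast_atTop_atTop (l ^ 2 + 1)] with Y hY
    exact hC l W Y hl1 hW (by linarith)
  have h3 : κ * Real.pi ^ 2 / (6 * κ') * l ^ 4 * (6 / Real.pi ^ 2 * (riemannZeta 3).re⁻¹) =
      4 * (κ / κ' * X / (4 * (riemannZeta 3).re)) := by
    rw [hl4]
    have := Real.pi_ne_zero
    rcases h.const with ⟨-, -, -, rfl, rfl⟩ | ⟨-, -, -, rfl, rfl⟩ <;> field_simp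
  have h4 : l ^ 3 ≤ X ^ ((7 : ℝ) / 8 + η) := by
    rw [hl, ← Real.rpow_natCast, ← Real.rpow_mul hX0.le]
    exact Real.rpow_le_rpow_of_exponent_le hX (by norm_num; linarith)
  have h5 : l ^ (7 / 2 + 2 * δ) ≤ X ^ ((7 : ℝ) / 8 + η) := by
    rw [hl, ← Real.rpow_mul hX0.le]
    refine Real.rpow_le_rpow_of_exponent_le hX ?_
    have := min_le_left η (1 / 2 : ℝ)
    linarith
  have h6 := mul_le_mul_of_nonneg_left h5 hC0
  rw [countCubic_eq]
  rw [h3] at h2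
  rw [hl4] at h1
  rw [abs_le] at h1 h2 ⊢
  constructor <;> linarith [h1.1, h1.2, h2.1, h2.2]

end IsReg

/-- The Davenport-Heilbronn theorem with the Belabas-Bhargava-Pomerance error term
`O(X^{7/8 + ε})` (main term only), for both signs of the discriminant. -/
theorem cubic_count_main_error_seven_eighths :
    ∀ ε : ℝ, 0 < ε → ∃ Cε : ℝ, ∀ X : ℝ, 1 ≤ X →
      (|(countCubic (fun d => 0 < (d : ℝ) ∧ (d : ℝ) < X) : ℝ)
          - 1 * X / (12 * (riemannZeta 3).re)| ≤ Cε * X ^ ((7 : ℝ)/8 + ε)) ∧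
      (|(countCubic (fun d => -X < (d : ℝ) ∧ (d : ℝ) < 0) : ℝ)
          - 3 * X / (12 * (riemannZeta 3).re)| ≤ Cε * X ^ ((7 : ℝ)/8 + ε)) := by
  intro ε hε
  obtain ⟨A, hA0, hA⟩ := isReg_pos.exists_abs_countCubic_sub_le hε
  obtain ⟨B, hB0, hB⟩ := isReg_neg.exists_abs_countCubic_sub_le hε
  refine ⟨A + B, fun X hX => ?_⟩
  have hX0 : 0 ≤ X ^ ((7 : ℝ) / 8 + ε) := by positivity
  have e1 : (fun d : ℤ => 0 < 1 * d ∧ ((1 * d : ℤ) : ℝ) < X) =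
      fun d : ℤ => 0 < (d : ℝ) ∧ (d : ℝ) < X := by
    funext d; simp
  have e2 : (fun d : ℤ => 0 < -1 * d ∧ ((-1 * d : ℤ) : ℝ) < X) =
      fun d : ℤ => -X < (d : ℝ) ∧ (d : ℝ) < 0 := by
    funext d
    simp only [eq_iff_iff, neg_mul, one_mul, Int.neg_pos, Int.cast_neg, Int.cast_lt_zero]
    exact ⟨fun h => ⟨by linarith, h.1⟩, fun h => ⟨h.2, by linarith⟩⟩
  have hA' := hA X hX
  have hB' := hB X hX
  rw [e1, show (36 : ℝ) / 108 * X / (4 * (riemannZeta 3).re) =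
    1 * X / (12 * (riemannZeta 3).re) by ring] at hA'
  rw [e2, show (4 : ℝ) / 4 * X / (4 * (riemannZeta 3).re) =
    3 * X / (12 * (riemannZeta 3).re) by ring] at hB'
  have hA1 := mul_nonneg hA0 hX0
  have hB1 := mul_nonneg hB0 hX0
  exact ⟨by linarith, by linarith⟩
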